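/- Let 𝒜 be a homogeneous constant-coefficient differential operator of order k ≥ n on ℝ^n. Then the following are equivalent: (i) for every u ∈ BV^𝒜_loc(ℝ^n), D^{k−n}u ∈ t^{n,∞}(x) for ℒ^n-almost every x ∈ ℝ^n; (ii) 𝒜 is elliptic and satisfies condition (WC). -/

import Mathlib

open MeasureTheory Metric Filter
open scoped ENNReal RealInnerProductSpace Topology

noncomputable section

/-- Euclidean space `ℝ^n`. -/
abbrev Euc (n : ℕ) : Type := EuclideanSpace ℝ (Fin n)

/-- The `i`-th standard basis vector of `ℝ^n`. -/
def stdVec (n : ℕ) (i : Fin n) : Euc n := EuclideanSpace.single i (1 : ℝ)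

/-- Coefficients `A_I : V →ₗ W` (indexed by `I : Fin k → Fin n`) of a homogeneous linear
constant-coefficient differential operator `𝒜 u = ∑_I A_I ∂_I u` of order `k` on `ℝ^n`. -/
abbrev CoeffOp (n k : ℕ) (V W : Type*) [NormedAddCommGroup V] [InnerProductSpace ℝ V]
    [NormedAddCommGroup W] [InnerProductSpace ℝ W] : Type _ :=
  (Fin k → Fin n) → (V →ₗ[ℝ] W)

variable {V W F : Type*}
  [NormedAddCommGroup V] [InnerProductSpace ℝ V] [FiniteDimensional ℝ V]
  [NormedAddCommGroup W] [InnerProductSpace ℝ W] [FiniteDimensional ℝ W]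

/-- The coefficients represent a linear map on symmetric tensors `V ⊙^k ℝ^n`. -/
def IsSymmetricOp (n k : ℕ) (A : CoeffOp n k V W) : Prop :=
  ∀ (I : Fin k → Fin n) (σ : Equiv.Perm (Fin k)), A (I ∘ σ) = A I

/-- The symbol `𝒜[ξ] v = A (v ⊗^k ξ) = ∑_I (∏ i, ξ_{I i}) A_I v`. -/
def symbolMap (n k : ℕ) (A : CoeffOp n k V W) (ξ : Euc n) : V →ₗ[ℝ] W :=
  ∑ I : Fin k → Fin n, (∏ i, ξ (I i)) • A I

/-- Ellipticity: the symbol is injective for all `ξ ≠ 0`. -/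
def IsElliptic (n k : ℕ) (A : CoeffOp n k V W) : Prop :=
  ∀ ξ : Euc n, ξ ≠ 0 → Function.Injective (symbolMap n k A ξ)

/-- Van Schaftingen's cancellation condition: `⋂_{ξ ∈ 𝕊^{n-1}} im 𝒜[ξ] = {0}`. -/
def IsCanceling (n k : ℕ) (A : CoeffOp n k V W) : Prop :=
  (⋂ ξ ∈ sphere (0 : Euc n) 1, (LinearMap.range (symbolMap n k A ξ) : Set W)) = {0}

/-- Inverse of an endomorphism (junk value when not invertible), via matrix inversion. -/
def linInv (f : V →ₗ[ℝ] V) : V →ₗ[ℝ] V :=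
  letI b := Module.finBasis ℝ V
  Matrix.toLin b b ((LinearMap.toMatrix b b f)⁻¹)

/-- `𝒜†[ξ] = (𝒜*[ξ] 𝒜[ξ])⁻¹ 𝒜*[ξ]`. -/
def Adagger (n k : ℕ) (A : CoeffOp n k V W) (ξ : Euc n) : W →ₗ[ℝ] V :=
  linInv (LinearMap.adjoint (symbolMap n k A ξ) ∘ₗ symbolMap n k A ξ) ∘ₗ
    LinearMap.adjoint (symbolMap n k A ξ)

/-- Condition (WC): for every `w ∈ ⋂_{ξ ∈ 𝕊^{n-1}} im 𝒜[ξ]`,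
`∫_{𝕊^{n-1}} 𝒜†[ξ] w ⊗^{k-n} ξ dℋ^{n-1}(ξ) = 0`, written componentwise in the
tensor coordinates indexed by `J : Fin (k-n) → Fin n`. -/
def IsWeaklyCanceling (n k : ℕ) (A : CoeffOp n k V W) : Prop :=
  ∀ w : W, (∀ ξ ∈ sphere (0 : Euc n) 1, w ∈ LinearMap.range (symbolMap n k A ξ)) →
    ∀ J : Fin (k - n) → Fin n,
      (∫ ξ in sphere (0 : Euc n) 1,
        (∏ i, ξ (J i)) • (Adagger n k A ξ w) ∂(μH[(n : ℝ) - 1])) = 0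

section TestFun

variable [NormedAddCommGroup F] [NormedSpace ℝ F]

/-- Compactly supported smooth test function. -/
def IsTestFun (n : ℕ) (φ : Euc n → F) : Prop :=
  ContDiff ℝ (⊤ : ℕ∞) φ ∧ HasCompactSupport φ

/-- Iterated directional derivative `∂_{I 0} ⋯ ∂_{I (m-1)} φ (x)`. -/
def dirDeriv (n m : ℕ) (I : Fin m → Fin n) (φ : Euc n → F) (x : Euc n) : F :=
  iteratedFDeriv ℝ m φ x (fun i => stdVec n (I i))

/-- Smooth functions of degree-`≤ j` polynomial type. -/
def IsPolyDeg (n : ℕ) (j : ℕ) (P : Euc n → F) : Prop :=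
  ContDiff ℝ (⊤ : ℕ∞) P ∧ ∀ x, iteratedFDeriv ℝ (j + 1) P x = 0

end TestFun

/-- Pointwise application of the operator `𝒜` to a smooth map. -/
def Aapply (n k : ℕ) (A : CoeffOp n k V W) (u : Euc n → V) (x : Euc n) : W :=
  ∑ I : Fin k → Fin n, A I (dirDeriv n k I u x)

/-- `𝒜 u = f σ` (a `W`-valued measure with total-variation measure `σ` and polar density `f`)
in the sense of distributions. -/
def HasDistribA (n k : ℕ) (A : CoeffOp n k V W) (u : Euc n → V) (σ : Measure (Euc n))
    (f : Euc n → W) : Prop :=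
  ∀ φ : Euc n → W, IsTestFun n φ →
    ((-1 : ℝ) ^ k) * (∑ I : Fin k → Fin n,
        ∫ x, ⟪u x, LinearMap.adjoint (A I) (dirDeriv n k I φ x)⟫) =
      ∫ x, ⟪f x, φ x⟫ ∂σ

/-- `u ∈ BV^𝒜_loc(ℝ^n)`: `u` is locally integrable and `𝒜 u` is a `W`-valued Radon measure,
given by its polar decomposition `f σ` with `σ` locally finite and `‖f‖ = 1` σ-a.e. -/
def MemBVAloc (n k : ℕ) (A : CoeffOp n k V W) (u : Euc n → V) : Prop :=
  LocallyIntegrable u volume ∧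
    ∃ (σ : Measure (Euc n)) (f : Euc n → W), IsLocallyFiniteMeasure σ ∧
      LocallyIntegrable f σ ∧ (∀ᵐ x ∂σ, ‖f x‖ = 1) ∧ HasDistribA n k A u σ f

/-- `v` is the family of weak derivatives of order `m` of `u` (componentwise, indexed by
`I : Fin m → Fin n`). -/
def IsWeakDerivFamily (n m : ℕ) (u : Euc n → V) (v : (Fin m → Fin n) → Euc n → V) : Prop :=
  (∀ I, LocallyIntegrable (v I) volume) ∧
    ∀ (I : Fin m → Fin n) (φ : Euc n → ℝ), IsTestFun n φ →
      ∫ x, (dirDeriv n m I φ x) • u x = ((-1 : ℝ) ^ m) • ∫ x, φ x • v I x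

/-- `Q r = o(r^a)` as `r ↓ 0`. -/
def SmallO (Q : ℝ → ℝ≥0∞) (a : ℝ) : Prop :=
  Tendsto (fun r => Q r / ENNReal.ofReal (r ^ a)) (𝓝[>] (0 : ℝ)) (𝓝 0)

section Spaces

variable [NormedAddCommGroup F] [NormedSpace ℝ F]

/-- `f ∈ t^{j,p}(x)`: there is a polynomial `P` of degree at most `j` with
`(⨍_{B_r(x)} |f - P|^p)^{1/p} = o(r^j)` as `r ↓ 0`. -/
def MemT (n : ℕ) (j : ℕ) (p : ℝ) (f : Euc n → F) (x : Euc n) : Prop :=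
  ∃ P : Euc n → F, IsPolyDeg n j P ∧
    SmallO (fun r => ((volume (ball x r))⁻¹ *
      ∫⁻ y in ball x r, (‖f y - P y‖₊ : ℝ≥0∞) ^ p) ^ (1 / p)) (j : ℝ)

/-- `f ∈ t^{j,∞}(x)`: there is a polynomial `P` of degree at most `j` with
`‖f - P‖_{L^∞(B_r(x))} = o(r^j)` as `r ↓ 0`. -/
def MemTInf (n : ℕ) (j : ℕ) (f : Euc n → F) (x : Euc n) : Prop :=
  ∃ P : Euc n → F, IsPolyDeg n j P ∧
    SmallO (fun r => essSup (fun y => (‖f y - P y‖₊ : ℝ≥0∞))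
      (volume.restrict (ball x r))) (j : ℝ)

/-- The Lorentz `L^{p,q}` quasi-norm (for `p, q < ∞`). -/
def lorentzNorm {α : Type*} [MeasurableSpace α] (p q : ℝ) (μ : Measure α) (f : α → F) : ℝ≥0∞ :=
  ENNReal.ofReal p ^ (1 / q) *
    (∫⁻ t in Set.Ioi (0 : ℝ),
      (ENNReal.ofReal t * (μ {x | t < ‖f x‖}) ^ (1 / p)) ^ q * (ENNReal.ofReal t)⁻¹) ^ (1 / q)

/-- `f` is `L^{p,q}`-differentiable of order `j` at `x`:
`‖f - P‖_{L^{p,q}(B_r(x))} = o(r^{j + n/p})` for a polynomial `P` of degree at most `j`. -/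
def MemTLorentz (n : ℕ) (j : ℕ) (p q : ℝ) (f : Euc n → F) (x : Euc n) : Prop :=
  ∃ P : Euc n → F, IsPolyDeg n j P ∧
    SmallO (fun r => lorentzNorm p q (volume.restrict (ball x r)) (fun y => f y - P y))
      ((j : ℝ) + n / p)

/-- `f ∈ L^p_loc`. -/
def LocLp (n : ℕ) (p : ℝ) (f : Euc n → F) : Prop :=
  ∀ K : Set (Euc n), IsCompact K → ∫⁻ x in K, (‖f x‖₊ : ℝ≥0∞) ^ p < ⊤

end Spaces

end

section Calculus

variable {n m : ℕ} {F G H : Type*} [NormedAddCommGroup F] [NormedSpace ℝ F]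
  [NormedAddCommGroup G] [NormedSpace ℝ G] [NormedAddCommGroup H] [NormedSpace ℝ H]

lemma norm_stdVec (i : Fin n) : ‖stdVec n i‖ = 1 := by
  simp [stdVec]

lemma dirDeriv_zero (I : Fin 0 → Fin n) (φ : Euc n → F) (x : Euc n) :
    dirDeriv n 0 I φ x = φ x := by
  simp [dirDeriv]

lemma smooth_iteratedFDeriv {φ : Euc n → F} (hφ : ContDiff ℝ (⊤ : ℕ∞) φ) (m : ℕ) :
    ContDiff ℝ (⊤ : ℕ∞) (iteratedFDeriv ℝ m φ) :=
  hφ.iteratedFDeriv_right (m := (⊤ : ℕ∞)) (i := m) (by exact_mod_cast le_top)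

lemma smooth_dirDeriv {φ : Euc n → F} (hφ : ContDiff ℝ (⊤ : ℕ∞) φ) (I : Fin m → Fin n) :
    ContDiff ℝ (⊤ : ℕ∞) (dirDeriv n m I φ) :=
  (ContinuousMultilinearMap.apply ℝ (fun _ : Fin m => Euc n) F
    (fun i => stdVec n (I i))).contDiff.comp (smooth_iteratedFDeriv hφ m)

lemma smooth_fderiv_apply {φ : Euc n → F} (hφ : ContDiff ℝ (⊤ : ℕ∞) φ) (v : Euc n) :
    ContDiff ℝ (⊤ : ℕ∞) (fun x => fderiv ℝ φ x v) :=
  ((contDiff_infty_iff_fderiv.1 hφ).2).clm_apply contDiff_const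

lemma smooth_differentiable {φ : Euc n → F} (hφ : ContDiff ℝ (⊤ : ℕ∞) φ) : Differentiable ℝ φ :=
  hφ.differentiable (by simp)

lemma dirDeriv_succ {φ : Euc n → F} (hφ : ContDiff ℝ (⊤ : ℕ∞) φ) (I : Fin (m + 1) → Fin n)
    (x : Euc n) :
    dirDeriv n (m + 1) I φ x = fderiv ℝ (dirDeriv n m (Fin.tail I) φ) x (stdVec n (I 0)) := by
  have h : DifferentiableAt ℝ (iteratedFDeriv ℝ m φ) x :=
    smooth_differentiable (smooth_iteratedFDeriv hφ m) x
  unfold dirDeriv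
  rw [iteratedFDeriv_succ_apply_left, fderiv_continuousMultilinear_apply_const h]
  rfl

lemma dirDeriv_clm (L : F →L[ℝ] G) {φ : Euc n → F} (hφ : ContDiff ℝ (⊤ : ℕ∞) φ)
    (I : Fin m → Fin n) (x : Euc n) :
    dirDeriv n m I (fun y => L (φ y)) x = L (dirDeriv n m I φ x) := by
  have := L.iteratedFDeriv_comp_left (x := x) (hφ.contDiffAt) (i := m) (by exact_mod_cast le_top)
  unfold dirDeriv
  change iteratedFDeriv ℝ m (L ∘ φ) x _ = _
  rw [this]; rfl

lemma dirDeriv_add {φ ψ : Euc n → F} (hφ : ContDiff ℝ (⊤ : ℕ∞) φ) (hψ : ContDiff ℝ (⊤ : ℕ∞) ψ)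
    (I : Fin m → Fin n) (x : Euc n) :
    dirDeriv n m I (fun y => φ y + ψ y) x = dirDeriv n m I φ x + dirDeriv n m I ψ x := by
  unfold dirDeriv
  have : iteratedFDeriv ℝ m (fun y => φ y + ψ y) x = _ :=
    iteratedFDeriv_add_apply (hφ.contDiffAt.of_le (by exact_mod_cast le_top))
      (hψ.contDiffAt.of_le (by exact_mod_cast le_top))
  rw [this]; rfl

lemma dirDeriv_neg {φ : Euc n → F} (hφ : ContDiff ℝ (⊤ : ℕ∞) φ) (I : Fin m → Fin n) (x : Euc n) :
    dirDeriv n m I (fun y => -φ y) x = - dirDeriv n m I φ x := by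
  simpa using dirDeriv_clm (-(ContinuousLinearMap.id ℝ F)) hφ I x

lemma dirDeriv_sub {φ ψ : Euc n → F} (hφ : ContDiff ℝ (⊤ : ℕ∞) φ) (hψ : ContDiff ℝ (⊤ : ℕ∞) ψ)
    (I : Fin m → Fin n) (x : Euc n) :
    dirDeriv n m I (fun y => φ y - ψ y) x = dirDeriv n m I φ x - dirDeriv n m I ψ x := by
  simp only [sub_eq_add_neg]
  rw [dirDeriv_add hφ hψ.neg, dirDeriv_neg hψ]

lemma dirDeriv_const_smul (c : ℝ) {φ : Euc n → F} (hφ : ContDiff ℝ (⊤ : ℕ∞) φ)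
    (I : Fin m → Fin n) (x : Euc n) :
    dirDeriv n m I (fun y => c • φ y) x = c • dirDeriv n m I φ x := by
  simpa using dirDeriv_clm (c • ContinuousLinearMap.id ℝ F) hφ I x

lemma dirDeriv_smul_const (e : F) {φ : Euc n → ℝ} (hφ : ContDiff ℝ (⊤ : ℕ∞) φ)
    (I : Fin m → Fin n) (x : Euc n) :
    dirDeriv n m I (fun y => φ y • e) x = dirDeriv n m I φ x • e := by
  simpa using dirDeriv_clm ((ContinuousLinearMap.id ℝ ℝ).smulRight e) hφ I x

lemma dirDeriv_sum {ι : Type*} (s : Finset ι) {φ : ι → Euc n → F}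
    (hφ : ∀ i ∈ s, ContDiff ℝ (⊤ : ℕ∞) (φ i)) (I : Fin m → Fin n) (x : Euc n) :
    dirDeriv n m I (fun y => ∑ i ∈ s, φ i y) x = ∑ i ∈ s, dirDeriv n m I (φ i) x := by
  classical
  induction s using Finset.induction_on with
  | empty =>
    have := dirDeriv_const_smul (0 : ℝ) (contDiff_const (c := (0 : F))) I x
    simpa using this
  | insert a s ha ih =>
    simp only [Finset.sum_insert ha]
    rw [dirDeriv_add (hφ a (by simp)) (ContDiff.sum fun i hi => hφ i (by simp [hi])),
      ih fun i hi => hφ i (by simp [hi])]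

lemma dirDeriv_zero_fun (I : Fin m → Fin n) (x : Euc n) :
    dirDeriv n m I (fun _ => (0 : F)) x = 0 := by
  simpa using dirDeriv_const_smul (0 : ℝ) (contDiff_const (c := (0 : F))) I x

lemma dirDeriv_comp_sub (φ : Euc n → F) (a : Euc n) (I : Fin m → Fin n) (x : Euc n) :
    dirDeriv n m I (fun y => φ (y - a)) x = dirDeriv n m I φ (x - a) := by
  unfold dirDeriv; rw [iteratedFDeriv_comp_sub]

lemma dirDeriv_comp_smul (c : ℝ) {φ : Euc n → F} (hφ : ContDiff ℝ (⊤ : ℕ∞) φ) (I : Fin m → Fin n)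
    (x : Euc n) :
    dirDeriv n m I (fun y => φ (c • y)) x = c ^ m • dirDeriv n m I φ (c • x) := by
  unfold dirDeriv
  rw [iteratedFDeriv_comp_const_smul (i := m) c (hφ.of_le (by exact_mod_cast le_top))]
  rfl

lemma dirDeriv_comp_sub_left {φ : Euc n → F} (hφ : ContDiff ℝ (⊤ : ℕ∞) φ) (a : Euc n)
    (I : Fin m → Fin n) (x : Euc n) :
    dirDeriv n m I (fun y => φ (a - y)) x = (-1 : ℝ) ^ m • dirDeriv n m I φ (a - x) := by
  have h1 := dirDeriv_comp_sub (fun z => φ ((-1 : ℝ) • z)) a I x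
  rw [dirDeriv_comp_smul (-1) hφ] at h1
  simpa using h1

lemma dirDeriv_congr_nhds {φ ψ : Euc n → F} {x : Euc n} (h : φ =ᶠ[𝓝 x] ψ) (I : Fin m → Fin n) :
    dirDeriv n m I φ x = dirDeriv n m I ψ x := by
  unfold dirDeriv; rw [(h.iteratedFDeriv ℝ m).eq_of_nhds]

lemma norm_dirDeriv_le (φ : Euc n → F) (I : Fin m → Fin n) (x : Euc n) :
    ‖dirDeriv n m I φ x‖ ≤ ‖iteratedFDeriv ℝ m φ x‖ := by
  refine ((iteratedFDeriv ℝ m φ x).le_opNorm _).trans ?_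
  simp [norm_stdVec]

lemma fderiv_fderiv_comm {φ : Euc n → F} (hφ : ContDiff ℝ (⊤ : ℕ∞) φ) (v w x : Euc n) :
    fderiv ℝ (fun y => fderiv ℝ φ y v) x w = fderiv ℝ (fun y => fderiv ℝ φ y w) x v := by
  have hd : DifferentiableAt ℝ (fderiv ℝ φ) x :=
    smooth_differentiable (contDiff_infty_iff_fderiv.1 hφ).2 x
  have hs : IsSymmSndFDerivAt ℝ φ x :=
    hφ.contDiffAt.isSymmSndFDerivAt (by simp only [minSmoothness_of_isRCLikeNormedField]; exact WithTop.coe_le_coe.2 le_top)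
  rw [fderiv_clm_apply hd (by fun_prop), fderiv_clm_apply hd (by fun_prop)]
  simpa using hs w v

lemma fderiv_dirDeriv {φ : Euc n → F} (hφ : ContDiff ℝ (⊤ : ℕ∞) φ) (I : Fin m → Fin n)
    (v x : Euc n) :
    fderiv ℝ (dirDeriv n m I φ) x v = dirDeriv n m I (fun y => fderiv ℝ φ y v) x := by
  induction m generalizing x with
  | zero =>
    have : dirDeriv n 0 I φ = φ := funext fun x => dirDeriv_zero I φ x
    rw [dirDeriv_zero, this]
  | succ m ih =>
    have h1 : dirDeriv n (m + 1) I φ =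
        fun y => fderiv ℝ (dirDeriv n m (Fin.tail I) φ) y (stdVec n (I 0)) :=
      funext fun y => dirDeriv_succ hφ I y
    rw [h1, dirDeriv_succ (smooth_fderiv_apply hφ v),
      fderiv_fderiv_comm (smooth_dirDeriv hφ _)]
    have h2 : (dirDeriv n m (Fin.tail I) fun y => fderiv ℝ φ y v) =
      fun y => fderiv ℝ (dirDeriv n m (Fin.tail I) φ) y v := funext fun y => (ih _ y).symm
    rw [h2]

lemma dirDeriv_comm {l : ℕ} {φ : Euc n → F} (hφ : ContDiff ℝ (⊤ : ℕ∞) φ) (I : Fin m → Fin n)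
    (J : Fin l → Fin n) (x : Euc n) :
    dirDeriv n l J (dirDeriv n m I φ) x = dirDeriv n m I (dirDeriv n l J φ) x := by
  induction l generalizing x with
  | zero =>
    have : dirDeriv n 0 J φ = φ := funext fun x => dirDeriv_zero J φ x
    rw [dirDeriv_zero, this]
  | succ l ih =>
    have h1 : dirDeriv n (l + 1) J φ =
        fun y => fderiv ℝ (dirDeriv n l (Fin.tail J) φ) y (stdVec n (J 0)) :=
      funext fun y => dirDeriv_succ hφ J y
    rw [h1, dirDeriv_succ (smooth_dirDeriv hφ I), ← fderiv_dirDeriv (smooth_dirDeriv hφ _)]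
    congr 2
    exact funext fun y => ih (Fin.tail J) y

lemma IsTestFun.dirDeriv {φ : Euc n → F} (hφ : IsTestFun n φ) (I : Fin m → Fin n) :
    IsTestFun n (dirDeriv n m I φ) := by
  refine ⟨smooth_dirDeriv hφ.1 I, ?_⟩
  have := hφ.2.iteratedFDeriv (𝕜 := ℝ) m
  exact this.comp_left (g := fun T : (Euc n)[×m]→L[ℝ] F => T fun i => stdVec n (I i)) rfl

lemma tsupport_dirDeriv_subset {φ : Euc n → F} (I : Fin m → Fin n) :
    tsupport (dirDeriv n m I φ) ⊆ tsupport φ := by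
  refine (closure_minimal ?_ (isClosed_tsupport _))
  intro x hx
  have h1 : x ∈ Function.support (iteratedFDeriv ℝ m φ) := by
    intro h; apply hx; simp [_root_.dirDeriv, h]
  exact support_iteratedFDeriv_subset m h1

lemma IsTestFun.fderiv_apply {φ : Euc n → F} (hφ : IsTestFun n φ) (v : Euc n) :
    IsTestFun n (fun x => fderiv ℝ φ x v) :=
  ⟨smooth_fderiv_apply hφ.1 v, hφ.2.fderiv_apply (𝕜 := ℝ) v⟩

lemma IsTestFun.integrable {φ : Euc n → F} (hφ : IsTestFun n φ) (σ : Measure (Euc n))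
    [IsFiniteMeasureOnCompacts σ] : Integrable φ σ :=
  hφ.1.continuous.integrable_of_hasCompactSupport hφ.2

lemma IsTestFun.clm {φ : Euc n → F} (hφ : IsTestFun n φ) (L : F →L[ℝ] G) :
    IsTestFun n (fun x => L (φ x)) :=
  ⟨L.contDiff.comp hφ.1, hφ.2.comp_left (map_zero L)⟩

lemma IsTestFun.smul_const {φ : Euc n → ℝ} (hφ : IsTestFun n φ) (e : F) :
    IsTestFun n (fun x => φ x • e) := by
  simpa using hφ.clm ((ContinuousLinearMap.id ℝ ℝ).smulRight e)

lemma IsTestFun.add {φ ψ : Euc n → F} (hφ : IsTestFun n φ) (hψ : IsTestFun n ψ) :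
    IsTestFun n (fun x => φ x + ψ x) := ⟨hφ.1.add hψ.1, hφ.2.add hψ.2⟩

lemma IsTestFun.const_smul {φ : Euc n → F} (hφ : IsTestFun n φ) (c : ℝ) :
    IsTestFun n (fun x => c • φ x) := by
  simpa using hφ.clm (c • ContinuousLinearMap.id ℝ F)

lemma IsTestFun.sub {φ ψ : Euc n → F} (hφ : IsTestFun n φ) (hψ : IsTestFun n ψ) :
    IsTestFun n (fun x => φ x - ψ x) := by
  simpa [sub_eq_add_neg] using hφ.add (hψ.const_smul (-1))

lemma IsTestFun.sum {ι : Type*} (s : Finset ι) {φ : ι → Euc n → F}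
    (hφ : ∀ i ∈ s, IsTestFun n (φ i)) : IsTestFun n (fun x => ∑ i ∈ s, φ i x) := by
  classical
  induction s using Finset.induction_on with
  | empty => simpa using! (⟨contDiff_const, HasCompactSupport.zero⟩ : IsTestFun n (fun _ => (0 : F)))
  | insert a s ha ih =>
    simp only [Finset.sum_insert ha]
    exact (hφ a (by simp)).add (ih fun i hi => hφ i (by simp [hi]))

lemma IsTestFun.smul {φ : Euc n → ℝ} {ψ : Euc n → F} (hφ : IsTestFun n φ)
    (hψ : ContDiff ℝ (⊤ : ℕ∞) ψ) : IsTestFun n (fun x => φ x • ψ x) :=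
  ⟨hφ.1.smul hψ, hφ.2.smul_right⟩

lemma IsTestFun.comp_sub_left {φ : Euc n → F} (hφ : IsTestFun n φ) (a : Euc n) :
    IsTestFun n (fun x => φ (a - x)) :=
  ⟨hφ.1.comp (contDiff_const.sub contDiff_id),
    hφ.2.comp_homeomorph (Homeomorph.subLeft a)⟩

lemma IsTestFun.comp_smul {φ : Euc n → F} (hφ : IsTestFun n φ) {c : ℝ} (hc : c ≠ 0) :
    IsTestFun n (fun x => φ (c • x)) :=
  ⟨hφ.1.comp (contDiff_id.const_smul c),
    hφ.2.comp_homeomorph (Homeomorph.smulOfNeZero c hc)⟩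

/-- Integration by parts for smooth functions, one of them compactly supported. -/
lemma integral_dirDeriv_right (B : F →L[ℝ] G →L[ℝ] H) {g : Euc n → F} {φ : Euc n → G}
    (hg : ContDiff ℝ (⊤ : ℕ∞) g) (hφ : ContDiff ℝ (⊤ : ℕ∞) φ)
    (hc : HasCompactSupport g ∨ HasCompactSupport φ) (I : Fin m → Fin n) :
    ∫ x, B (g x) (dirDeriv n m I φ x) = (-1 : ℝ) ^ m • ∫ x, B (dirDeriv n m I g x) (φ x) := by
  have hint : ∀ {g : Euc n → F} {φ : Euc n → G}, ContDiff ℝ (⊤ : ℕ∞) g → ContDiff ℝ (⊤ : ℕ∞) φ →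
      (HasCompactSupport g ∨ HasCompactSupport φ) → Integrable (fun x => B (g x) (φ x)) := by
    intro g φ hg hφ hc
    refine Continuous.integrable_of_hasCompactSupport
      ((B.continuous.comp hg.continuous).clm_apply hφ.continuous) ?_
    rcases hc with h | h
    · exact h.mono (fun x hx h0 => hx (by simp [h0]))
    · exact h.mono (fun x hx h0 => hx (by simp [h0]))
  induction m generalizing g with
  | zero => simp [dirDeriv_zero]
  | succ m ih =>
    have e1 : ∀ x, dirDeriv n (m + 1) I φ x =
        fderiv ℝ (dirDeriv n m (Fin.tail I) φ) x (stdVec n (I 0)) := fun x => dirDeriv_succ hφ I x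
    have hT := smooth_dirDeriv hφ (Fin.tail I)
    have hcT : HasCompactSupport g ∨ HasCompactSupport (dirDeriv n m (Fin.tail I) φ) :=
      hc.imp id fun h => (IsTestFun.dirDeriv ⟨hφ, h⟩ _).2
    have hg' := smooth_fderiv_apply hg (stdVec n (I 0))
    have hcg' : HasCompactSupport (fun x => fderiv ℝ g x (stdVec n (I 0))) ∨
        HasCompactSupport φ := hc.imp (fun h => h.fderiv_apply (𝕜 := ℝ) _) id
    have hcg'' : HasCompactSupport (fun x => fderiv ℝ g x (stdVec n (I 0))) ∨
        HasCompactSupport (dirDeriv n m (Fin.tail I) φ) :=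
      hcg'.imp id fun h => (IsTestFun.dirDeriv ⟨hφ, h⟩ _).2
    simp only [e1]
    rw [integral_bilinear_fderiv_right_eq_neg_left_of_integrable (hint hg' hT hcg'')
      (hint hg (smooth_fderiv_apply hT _)
        (hcT.imp id fun h => h.fderiv_apply (𝕜 := ℝ) _))
      (hint hg hT hcT) (fun x _ => smooth_differentiable hg x)
      (fun x _ => smooth_differentiable hT x), ih hg' hcg' (Fin.tail I), pow_succ]
    have e2 : ∀ x, dirDeriv n m (Fin.tail I) (fun x => fderiv ℝ g x (stdVec n (I 0))) x =
        dirDeriv n (m + 1) I g x := fun x => by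
      rw [dirDeriv_succ hg, fderiv_dirDeriv hg]
    simp only [e2]
    module

/-- The convolution of the density `u` with respect to `σ` with the kernel `κ`. -/
noncomputable def cv (σ : Measure (Euc n)) (B : F →L[ℝ] G →L[ℝ] H) (u : Euc n → F)
    (κ : Euc n → G) (x : Euc n) : H :=
  ∫ y, B (u y) (κ (x - y)) ∂σ

variable {σ : Measure (Euc n)} (B : F →L[ℝ] G →L[ℝ] H) {u : Euc n → F} {κ : Euc n → G}

lemma integrable_cv (hu : LocallyIntegrable u σ) (hκ : IsTestFun n κ) (x : Euc n) :
    Integrable (fun y => B (u y) (κ (x - y))) σ :=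
  hκ.2.convolutionExists_right B hu hκ.1.continuous x

lemma integrable_norm_cv (hu : LocallyIntegrable u σ) (hκ : IsTestFun n κ) (x : Euc n) :
    Integrable (fun y => ‖u y‖ * ‖κ (x - y)‖) σ := by
  have h1 : HasCompactSupport (fun y => ‖κ (x - y)‖) := (hκ.comp_sub_left x).2.norm
  have h2 : Continuous (fun y => ‖κ (x - y)‖) := (hκ.comp_sub_left x).1.continuous.norm
  simpa [norm_smul, mul_comm] using (hu.integrable_smul_left_of_hasCompactSupport h2 h1).norm

lemma norm_cv_le (hu : LocallyIntegrable u σ) (hκ : IsTestFun n κ) (x : Euc n) :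
    ‖cv σ B u κ x‖ ≤ ‖B‖ * ∫ y, ‖u y‖ * ‖κ (x - y)‖ ∂σ := by
  rw [← integral_const_mul]
  refine norm_integral_le_of_norm_le ((integrable_norm_cv hu hκ x).const_mul _) ?_
  filter_upwards with y
  rw [← mul_assoc]
  exact B.le_opNorm₂ _ _

lemma smooth_cv (hu : LocallyIntegrable u σ) (hκ : IsTestFun n κ) :
    ContDiff ℝ (⊤ : ℕ∞) (cv σ B u κ) :=
  hκ.2.contDiff_convolution_right B hu hκ.1

set_option maxSynthPendingDepth 3 in
open scoped Pointwise in
lemma fderiv_cv (hu : LocallyIntegrable u σ) (hκ : IsTestFun n κ) (v x₀ : Euc n) :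
    fderiv ℝ (cv σ B u κ) x₀ v = cv σ B u (fun y => fderiv ℝ κ y v) x₀ := by
  have hg : ContDiff ℝ 1 κ := hκ.1.of_le (by exact_mod_cast le_top)
  have hcg := hκ.2
  set L' := B.precompR (Euc n)
  have h1 : ∀ᶠ x in 𝓝 x₀, AEStronglyMeasurable (fun t => B (u t) (κ (x - t))) σ :=
    Eventually.of_forall fun x => (integrable_cv B hu hκ x).aestronglyMeasurable
  have h2 : AEStronglyMeasurable (fun t => L' (u t) (fderiv ℝ κ (x₀ - t))) σ :=
    L'.aestronglyMeasurable_comp₂ hu.aestronglyMeasurable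
      ((hg.continuous_fderiv one_ne_zero).comp
        (continuous_const.sub continuous_id)).aestronglyMeasurable
  have h3 : ∀ x t, HasFDerivAt (fun x => κ (x - t)) (fderiv ℝ κ (x - t)) x := fun x t ↦ by
    simpa using!
      (hg.differentiable one_ne_zero).differentiableAt.hasFDerivAt.comp x
        ((hasFDerivAt_id x).sub (hasFDerivAt_const t x))
  let K' := -tsupport (fderiv ℝ κ) + closedBall x₀ 1
  have hK' : IsCompact K' := (hcg.fderiv ℝ).isCompact.neg.add (isCompact_closedBall x₀ 1)
  have hint : Integrable (K'.indicator fun t => ‖L'‖ * ‖u t‖ * ⨆ i, ‖fderiv ℝ κ i‖) σ := by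
    rw [integrable_indicator_iff hK'.measurableSet]
    exact ((hu.integrableOn_isCompact hK').norm.const_mul _).mul_const _
  have hbd : ∀ᵐ t ∂σ, ∀ x ∈ ball x₀ 1, ‖L' (u t) (fderiv ℝ κ (x - t))‖ ≤
      K'.indicator (fun t => ‖L'‖ * ‖u t‖ * ⨆ i, ‖fderiv ℝ κ i‖) t := by
    filter_upwards with t x hx using
      (hcg.fderiv ℝ).convolution_integrand_bound_right L' (hg.continuous_fderiv one_ne_zero)
        (ball_subset_closedBall hx)
  have key : HasFDerivAt (cv σ B u κ) (∫ t, L' (u t) (fderiv ℝ κ (x₀ - t)) ∂σ) x₀ :=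
    hasFDerivAt_integral_of_dominated_of_fderiv_le (ball_mem_nhds _ zero_lt_one) h1
      (integrable_cv B hu hκ x₀) h2 hbd hint
      (Eventually.of_forall fun t x _ => (B _).hasFDerivAt.comp x (h3 x t))
  rw [key.fderiv, ContinuousLinearMap.integral_apply]
  · rfl
  · exact hint.mono' h2 (by
      filter_upwards [hbd] with t ht using ht x₀ (mem_ball_self one_pos))

lemma dirDeriv_cv (hu : LocallyIntegrable u σ) (hκ : IsTestFun n κ) (I : Fin m → Fin n)
    (x : Euc n) : dirDeriv n m I (cv σ B u κ) x = cv σ B u (dirDeriv n m I κ) x := by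
  induction m generalizing x with
  | zero =>
    have : dirDeriv n 0 I κ = κ := funext fun x => dirDeriv_zero I κ x
    rw [dirDeriv_zero, this]
  | succ m ih =>
    have h1 : dirDeriv n (m + 1) I κ =
        fun y => fderiv ℝ (dirDeriv n m (Fin.tail I) κ) y (stdVec n (I 0)) :=
      funext fun y => dirDeriv_succ hκ.1 I y
    rw [h1, dirDeriv_succ (smooth_cv B hu hκ), ← fderiv_cv B hu (hκ.dirDeriv _)]
    congr 2
    exact funext fun y => ih (Fin.tail I) y

lemma cv_sub (hu : LocallyIntegrable u σ) (hκ : IsTestFun n κ) {κ' : Euc n → G}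
    (hκ' : IsTestFun n κ') (x : Euc n) :
    cv σ B u (fun y => κ y - κ' y) x = cv σ B u κ x - cv σ B u κ' x := by
  simp only [cv, map_sub]
  exact integral_sub (integrable_cv B hu hκ x) (integrable_cv B hu hκ' x)

end Calculus

section Adjoint

variable {n k : ℕ} {V W : Type*}
  [NormedAddCommGroup V] [InnerProductSpace ℝ V] [FiniteDimensional ℝ V]
  [NormedAddCommGroup W] [InnerProductSpace ℝ W] [FiniteDimensional ℝ W]

/-- The real inner product as a continuous bilinear map. -/
noncomputable def innerB (V : Type*) [NormedAddCommGroup V] [InnerProductSpace ℝ V] :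
    V →L[ℝ] V →L[ℝ] ℝ :=
  (innerₗ V).mkContinuous₂ 1 fun x y => by simpa using norm_inner_le_norm (𝕜 := ℝ) x y

omit [FiniteDimensional ℝ V] in
@[simp] lemma innerB_apply (v w : V) : innerB V v w = ⟪v, w⟫ := rfl

omit [FiniteDimensional ℝ V] in
lemma norm_innerB_le : ‖innerB V‖ ≤ 1 :=
  (innerₗ V).mkContinuous₂_norm_le zero_le_one fun x y => by
    simpa using norm_inner_le_norm (𝕜 := ℝ) x y

/-- The formal adjoint of the operator, without the sign `(-1)^k`. -/
noncomputable def Astar (n k : ℕ) (A : CoeffOp n k V W) (g : Euc n → W) (x : Euc n) : V :=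
  ∑ I : Fin k → Fin n, LinearMap.adjoint (A I) (dirDeriv n k I g x)

lemma Astar_eq_sum_clm (A : CoeffOp n k V W) (g : Euc n → W) (x : Euc n) :
    Astar n k A g x =
      ∑ I : Fin k → Fin n, (LinearMap.adjoint (A I)).toContinuousLinearMap (dirDeriv n k I g x) :=
  rfl

lemma IsTestFun.Astar {A : CoeffOp n k V W} {g : Euc n → W} (hg : IsTestFun n g) :
    IsTestFun n (Astar n k A g) :=
  IsTestFun.sum _ fun I _ => (hg.dirDeriv I).clm (LinearMap.adjoint (A I)).toContinuousLinearMap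

lemma Astar_dirDeriv {A : CoeffOp n k V W} {m : ℕ} (J : Fin m → Fin n) {g : Euc n → W}
    (hg : ContDiff ℝ (⊤ : ℕ∞) g) (x : Euc n) :
    Astar n k A (dirDeriv n m J g) x = dirDeriv n m J (Astar n k A g) x := by
  have h1 : Astar n k A g = fun x => ∑ I : Fin k → Fin n,
    (LinearMap.adjoint (A I)).toContinuousLinearMap (dirDeriv n k I g x) := rfl
  rw [h1, dirDeriv_sum]
  · rw [Astar_eq_sum_clm]
    refine Finset.sum_congr rfl fun I _ => ?_
    rw [dirDeriv_clm _ (smooth_dirDeriv hg I), dirDeriv_comm hg]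
  · exact fun I _ => (ContinuousLinearMap.contDiff _).comp (smooth_dirDeriv hg I)

lemma Astar_comp_smul {A : CoeffOp n k V W} (c : ℝ) {g : Euc n → W}
    (hg : ContDiff ℝ (⊤ : ℕ∞) g) (x : Euc n) :
    Astar n k A (fun y => g (c • y)) x = c ^ k • Astar n k A g (c • x) := by
  simp only [Astar, dirDeriv_comp_smul c hg, map_smul, Finset.smul_sum]

lemma Astar_const_smul {A : CoeffOp n k V W} (c : ℝ) {g : Euc n → W}
    (hg : ContDiff ℝ (⊤ : ℕ∞) g) (x : Euc n) :
    Astar n k A (fun y => c • g y) x = c • Astar n k A g x := by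
  simp only [Astar, dirDeriv_const_smul c hg, map_smul, Finset.smul_sum]

lemma HasDistribA.cv_eq {A : CoeffOp n k V W} {u : Euc n → V} {σ : Measure (Euc n)}
    {f : Euc n → W} (h : HasDistribA n k A u σ f) (hu : LocallyIntegrable u volume)
    {g : Euc n → W} (hg : IsTestFun n g) (x : Euc n) :
    cv volume (innerB V) u (Astar n k A g) x = cv σ (innerB W) f g x := by
  have h1 := h _ (hg.comp_sub_left x)
  have h2 : ∀ I : Fin k → Fin n, ∀ y, LinearMap.adjoint (A I)
      (dirDeriv n k I (fun y => g (x - y)) y) =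
      (-1 : ℝ) ^ k • LinearMap.adjoint (A I) (dirDeriv n k I g (x - y)) := by
    intro I y; rw [dirDeriv_comp_sub_left hg.1, map_smul]
  simp only [h2, inner_smul_right, integral_const_mul, ← Finset.mul_sum] at h1
  rw [← mul_assoc, ← mul_pow] at h1
  simp only [mul_neg, mul_one, neg_neg, one_pow, one_mul] at h1
  simp only [cv, innerB_apply, ← h1, Astar, inner_sum]
  refine integral_finsetSum _ fun I _ => ?_
  exact integrable_cv (innerB V) hu
    ((hg.dirDeriv I).clm (LinearMap.adjoint (A I)).toContinuousLinearMap) x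

end Adjoint

section Osc

variable {n m : ℕ} {F G : Type*} [NormedAddCommGroup F] [NormedSpace ℝ F]
  [NormedAddCommGroup G] [NormedSpace ℝ G]

lemma euc_eq_sum (v : Euc n) : v = ∑ j, v j • stdVec n j := by
  ext i
  simp [stdVec, Finset.sum_apply, Pi.single_apply]

lemma inner_stdVec (v : Euc n) (j : Fin n) : ⟪v, stdVec n j⟫ = v j := by
  simp [stdVec, EuclideanSpace.inner_single_right]

lemma norm_le_sum_coord (v : Euc n) : ‖v‖ ≤ ∑ j, |v j| := by
  calc ‖v‖ = ‖∑ j, v j • stdVec n j‖ := by rw [← euc_eq_sum]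
    _ ≤ ∑ j, |v j| := (norm_sum_le _ _).trans (by simp [norm_smul, norm_stdVec])

lemma abs_coord_le (v : Euc n) (j : Fin n) : |v j| ≤ ‖v‖ := by
  simpa using PiLp.norm_apply_le v j

lemma norm_iteratedFDeriv_le_sum (φ : Euc n → F) (x : Euc n) :
    ‖iteratedFDeriv ℝ m φ x‖ ≤ ∑ I : Fin m → Fin n, ‖dirDeriv n m I φ x‖ := by
  refine ContinuousMultilinearMap.opNorm_le_bound (by positivity) fun v => ?_
  have h1 : iteratedFDeriv ℝ m φ x v = ∑ I : Fin m → Fin n,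
      (∏ i, v i (I i)) • dirDeriv n m I φ x := by
    have : v = fun i => ∑ j, v i j • stdVec n j := funext fun i => euc_eq_sum (v i)
    conv_lhs => rw [this]
    rw [ContinuousMultilinearMap.map_sum]
    refine Finset.sum_congr rfl fun I _ => ?_
    exact ContinuousMultilinearMap.map_smul_univ _ _ _
  rw [h1, Finset.sum_mul]
  refine (norm_sum_le _ _).trans (Finset.sum_le_sum fun I _ => ?_)
  rw [norm_smul, mul_comm, norm_prod]
  refine mul_le_mul_of_nonneg_left ?_ (norm_nonneg _)
  exact Finset.prod_le_prod (fun _ _ => norm_nonneg _) fun i _ => abs_coord_le _ _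

/-- Oscillatory integral `∫ cos (2π⟪x, ξ⟫ + φ) β(ξ) dξ`. -/
noncomputable def osc (φ : ℝ) (β : Euc n → F) (x : Euc n) : F :=
  ∫ ξ, Real.cos (2 * Real.pi * ⟪x, ξ⟫ + φ) • β ξ

lemma integrable_osc (φ : ℝ) {β : Euc n → F} (hβ : IsTestFun n β) (x : Euc n) :
    Integrable (fun ξ => Real.cos (2 * Real.pi * ⟪x, ξ⟫ + φ) • β ξ) := by
  refine Continuous.integrable_of_hasCompactSupport ?_ hβ.2.smul_left
  exact (by fun_prop : Continuous fun ξ : Euc n => Real.cos (2 * Real.pi * ⟪x, ξ⟫ + φ)).smul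
    hβ.1.continuous

lemma norm_osc_le (φ : ℝ) (β : Euc n → F) (hβ : IsTestFun n β) (x : Euc n) :
    ‖osc φ β x‖ ≤ ∫ ξ, ‖β ξ‖ := by
  refine norm_integral_le_of_norm_le (hβ.integrable volume).norm ?_
  filter_upwards with ξ
  rw [norm_smul]
  exact mul_le_of_le_one_left (norm_nonneg _) (Real.abs_cos_le_one _)

lemma smooth_inner_left (v : Euc n) : ContDiff ℝ (⊤ : ℕ∞) (fun ξ : Euc n => ⟪v, ξ⟫) :=
  contDiff_const.inner ℝ contDiff_id

lemma IsTestFun.smul_left {β : Euc n → F} (hβ : IsTestFun n β) {a : Euc n → ℝ}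
    (ha : ContDiff ℝ (⊤ : ℕ∞) a) : IsTestFun n (fun ξ => a ξ • β ξ) :=
  ⟨ha.smul hβ.1, hβ.2.smul_left⟩

lemma hasFDerivAt_osc (φ : ℝ) {β : Euc n → F} (hβ : IsTestFun n β) (x : Euc n) :
    HasFDerivAt (osc φ β) (∫ ξ, ((2 * Real.pi * -Real.sin (2 * Real.pi * ⟪x, ξ⟫ + φ)) •
      (innerB (Euc n) ξ)).smulRight (β ξ)) x := by
  have hc : Continuous fun ξ : Euc n => ((2 * Real.pi * -Real.sin (2 * Real.pi * ⟪x, ξ⟫ + φ)) •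
      (innerB (Euc n) ξ)).smulRight (β ξ) := by
    have := hβ.1.continuous
    have h2 : Continuous fun ξ : Euc n =>
      (2 * Real.pi * -Real.sin (2 * Real.pi * ⟪x, ξ⟫ + φ)) • (innerB (Euc n) ξ) := by fun_prop
    exact (ContinuousLinearMap.smulRightL ℝ (Euc n) F).continuous₂.comp (h2.prodMk this)
  refine hasFDerivAt_integral_of_dominated_of_fderiv_le
    (F' := fun x ξ => ((2 * Real.pi * -Real.sin (2 * Real.pi * ⟪x, ξ⟫ + φ)) •
      (innerB (Euc n) ξ)).smulRight (β ξ))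
    (bound := fun ξ => 2 * Real.pi * ‖ξ‖ * ‖β ξ‖) (ball_mem_nhds x one_pos)
    (Eventually.of_forall fun y => (integrable_osc φ hβ y).aestronglyMeasurable)
    (integrable_osc φ hβ x) hc.aestronglyMeasurable ?_ ?_ ?_
  · refine Eventually.of_forall fun ξ y _ => ?_
    rw [ContinuousLinearMap.norm_smulRight_apply, norm_smul]
    refine mul_le_mul_of_nonneg_right ?_ (norm_nonneg _)
    have h1 : ‖innerB (Euc n) ξ‖ ≤ ‖ξ‖ := by
      simpa using (innerB (Euc n)).le_of_opNorm_le norm_innerB_le ξ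
    have h2 : ‖2 * Real.pi * -Real.sin (2 * Real.pi * ⟪y, ξ⟫ + φ)‖ ≤ 2 * Real.pi := by
      rw [norm_mul, norm_neg, Real.norm_of_nonneg (by positivity)]
      exact mul_le_of_le_one_right (by positivity) (Real.abs_sin_le_one _)
    exact mul_le_mul h2 h1 (norm_nonneg _) (by positivity)
  · refine Continuous.integrable_of_hasCompactSupport (by have := hβ.1.continuous; fun_prop) ?_
    exact hβ.2.norm.mul_left
  · refine Eventually.of_forall fun ξ y _ => ?_
    have h1 : HasFDerivAt (fun y : Euc n => ⟪y, ξ⟫) (innerB (Euc n) ξ) y := by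
      have := (innerB (Euc n) ξ).hasFDerivAt (x := y)
      refine this.congr_of_eventuallyEq (Eventually.of_forall fun z => ?_)
      simp [real_inner_comm]
    have h2 := (((h1.const_mul (2 * Real.pi)).add_const φ).cos).smul_const (β ξ)
    refine h2.congr_fderiv (congrArg (fun L : Euc n →L[ℝ] ℝ => L.smulRight (β ξ)) ?_)
    rw [smul_smul]; congr 1; ring

lemma fderiv_osc [CompleteSpace F] (φ : ℝ) {β : Euc n → F} (hβ : IsTestFun n β) (x v : Euc n) :
    fderiv ℝ (osc φ β) x v =
      (2 * Real.pi) • osc (φ + Real.pi / 2) (fun ξ => ⟪v, ξ⟫ • β ξ) x := by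
  have h := hasFDerivAt_osc φ hβ x
  rw [h.fderiv]
  rw [ContinuousLinearMap.integral_apply, osc, ← integral_smul]
  · refine integral_congr_ae (Eventually.of_forall fun ξ => ?_)
    have : Real.cos (2 * Real.pi * ⟪x, ξ⟫ + (φ + Real.pi / 2)) =
      - Real.sin (2 * Real.pi * ⟪x, ξ⟫ + φ) := by rw [← add_assoc, Real.cos_add_pi_div_two]
    simp only [ContinuousLinearMap.smulRight_apply, FunLike.coe_smul, Pi.smul_apply,
      innerB_apply, smul_eq_mul, this, smul_smul]
    rw [real_inner_comm v ξ]
    congr 1; ring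
  · have hc : Continuous fun ξ : Euc n => ((2 * Real.pi * -Real.sin (2 * Real.pi * ⟪x, ξ⟫ + φ)) •
      (innerB (Euc n) ξ)).smulRight (β ξ) := by
      have := hβ.1.continuous
      have h2 : Continuous fun ξ : Euc n =>
        (2 * Real.pi * -Real.sin (2 * Real.pi * ⟪x, ξ⟫ + φ)) • (innerB (Euc n) ξ) := by fun_prop
      exact (ContinuousLinearMap.smulRightL ℝ (Euc n) F).continuous₂.comp (h2.prodMk this)
    refine hc.integrable_of_hasCompactSupport ?_
    exact hβ.2.mono fun ξ hξ h0 => hξ (by simp [h0])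

lemma IsTestFun.inner_smul {β : Euc n → F} (hβ : IsTestFun n β) (v : Euc n) :
    IsTestFun n (fun ξ => ⟪v, ξ⟫ • β ξ) := hβ.smul_left (smooth_inner_left v)

lemma smooth_osc [CompleteSpace F] (φ : ℝ) {β : Euc n → F} (hβ : IsTestFun n β) :
    ContDiff ℝ (⊤ : ℕ∞) (osc φ β) := by
  rw [contDiff_infty]
  intro m
  induction m generalizing φ β with
  | zero =>
    exact contDiff_zero.2 (continuous_iff_continuousAt.2 fun x =>
      (hasFDerivAt_osc φ hβ x).continuousAt)
  | succ m ih =>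
    have : ((m + 1 : ℕ) : WithTop ℕ∞) = (m : WithTop ℕ∞) + 1 := by push_cast; rfl
    rw [this, contDiff_succ_iff_fderiv_apply]
    refine ⟨fun x => (hasFDerivAt_osc φ hβ x).differentiableAt, by simp, fun v => ?_⟩
    have : (fun x => fderiv ℝ (osc φ β) x v) = fun x =>
      (2 * Real.pi) • osc (φ + Real.pi / 2) (fun ξ => ⟪v, ξ⟫ • β ξ) x :=
      funext fun x => fderiv_osc φ hβ x v
    rw [this]
    exact (ih _ (hβ.inner_smul v)).const_smul _

lemma smooth_prod_coord (I : Fin m → Fin n) :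
    ContDiff ℝ (⊤ : ℕ∞) (fun ξ : Euc n => ∏ i, ξ (I i)) := by
  refine contDiff_prod fun i _ => ?_
  exact (EuclideanSpace.proj (𝕜 := ℝ) (I i)).contDiff

lemma dirDeriv_osc [CompleteSpace F] (φ : ℝ) {β : Euc n → F} (hβ : IsTestFun n β) (I : Fin m → Fin n) (x : Euc n) :
    dirDeriv n m I (osc φ β) x =
      (2 * Real.pi) ^ m • osc (φ + m * (Real.pi / 2)) (fun ξ => (∏ i, ξ (I i)) • β ξ) x := by
  induction m generalizing x with
  | zero => simp [dirDeriv_zero]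
  | succ m ih =>
    have hT : IsTestFun n (fun ξ => (∏ i, ξ (Fin.tail I i)) • β ξ) :=
      hβ.smul_left (smooth_prod_coord _)
    rw [dirDeriv_succ (smooth_osc φ hβ), funext (ih (Fin.tail I))]
    rw [fderiv_fun_const_smul ((hasFDerivAt_osc _ hT x).differentiableAt)]
    simp only [FunLike.coe_smul, Pi.smul_apply]
    rw [fderiv_osc _ hT, smul_smul, ← pow_succ]
    have h1 : φ + m * (Real.pi / 2) + Real.pi / 2 = φ + (m + 1 : ℕ) * (Real.pi / 2) := by
      push_cast; ring
    have h2 : (fun ξ : Euc n => ⟪stdVec n (I 0), ξ⟫ • (∏ i, ξ (Fin.tail I i)) • β ξ) =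
        fun ξ : Euc n => (∏ i, ξ (I i)) • β ξ := by
      funext ξ
      rw [smul_smul, Fin.prod_univ_succ, real_inner_comm, inner_stdVec]
      rfl
    rw [h1, h2]

lemma osc_fderiv (φ : ℝ) {β : Euc n → F} (hβ : IsTestFun n β) (x v : Euc n) :
    osc φ (fun ξ => fderiv ℝ β ξ v) x =
      (2 * Real.pi * ⟪x, v⟫) • osc (φ - Real.pi / 2) β x := by
  have hd : ∀ ξ, HasFDerivAt (fun ξ : Euc n => Real.cos (2 * Real.pi * ⟪x, ξ⟫ + φ))
      (-Real.sin (2 * Real.pi * ⟪x, ξ⟫ + φ) • (2 * Real.pi) • innerB (Euc n) x) ξ := by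
    intro ξ
    have h1 : HasFDerivAt (fun y : Euc n => ⟪x, y⟫) (innerB (Euc n) x) ξ :=
      (innerB (Euc n) x).hasFDerivAt (x := ξ)
    exact ((h1.const_mul (2 * Real.pi)).add_const φ).cos
  have hc : ContDiff ℝ (⊤ : ℕ∞) (fun ξ : Euc n => Real.cos (2 * Real.pi * ⟪x, ξ⟫ + φ)) :=
    ((contDiff_const.mul (smooth_inner_left x)).add contDiff_const).cos
  unfold osc
  rw [integral_smul_fderiv_eq_neg_fderiv_smul_of_integrable
    ((hβ.smul_left (smooth_fderiv_apply hc v)).integrable _)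
    (integrable_osc φ (hβ.fderiv_apply v) x) (integrable_osc φ hβ x)
    (fun ξ _ => (hd ξ).differentiableAt) (fun ξ _ => smooth_differentiable hβ.1 ξ),
    ← integral_neg, ← integral_smul]
  refine integral_congr_ae (Eventually.of_forall fun ξ => ?_)
  have : Real.cos (2 * Real.pi * ⟪x, ξ⟫ + (φ - Real.pi / 2)) =
      Real.sin (2 * Real.pi * ⟪x, ξ⟫ + φ) := by rw [← add_sub_assoc, Real.cos_sub_pi_div_two]
  simp only [(hd ξ).fderiv, this, FunLike.coe_smul, Pi.smul_apply, innerB_apply, smul_eq_mul,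
    smul_smul, ← neg_smul]
  congr 1; ring

lemma osc_dirDeriv (φ : ℝ) {β : Euc n → F} (hβ : IsTestFun n β) (I : Fin m → Fin n) (x : Euc n) :
    osc φ (dirDeriv n m I β) x =
      ((2 * Real.pi) ^ m * ∏ i, x (I i)) • osc (φ - m * (Real.pi / 2)) β x := by
  induction m generalizing φ with
  | zero =>
    have : dirDeriv n 0 I β = β := funext fun x => dirDeriv_zero I β x
    simp [this]
  | succ m ih =>
    rw [funext (dirDeriv_succ hβ.1 I), osc_fderiv _ (hβ.dirDeriv _), ih, smul_smul, inner_stdVec,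
      Fin.prod_univ_succ]
    congr 1
    · simp only [Fin.tail]; ring
    · congr 1; push_cast; ring

lemma osc_add (φ : ℝ) {β β' : Euc n → F} (hβ : IsTestFun n β) (hβ' : IsTestFun n β') (x : Euc n) :
    osc φ (fun ξ => β ξ + β' ξ) x = osc φ β x + osc φ β' x := by
  simp only [osc, smul_add]
  exact integral_add (integrable_osc φ hβ x) (integrable_osc φ hβ' x)

lemma osc_sum {ι : Type*} (s : Finset ι) (φ : ℝ) {β : ι → Euc n → F}
    (hβ : ∀ i ∈ s, IsTestFun n (β i)) (x : Euc n) :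
    osc φ (fun ξ => ∑ i ∈ s, β i ξ) x = ∑ i ∈ s, osc φ (β i) x := by
  simp only [osc, Finset.smul_sum]
  exact integral_finsetSum _ fun i hi => integrable_osc φ (hβ i hi) x

lemma osc_clm [CompleteSpace F] [CompleteSpace G] (L : F →L[ℝ] G) (φ : ℝ) {β : Euc n → F}
    (hβ : IsTestFun n β) (x : Euc n) :
    osc φ (fun ξ => L (β ξ)) x = L (osc φ β x) := by
  unfold osc
  rw [← L.integral_comp_comm (integrable_osc φ hβ x)]
  simp

lemma osc_smul_const [CompleteSpace F] (φ : ℝ) {β : Euc n → ℝ} (hβ : IsTestFun n β) (e : F)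
    (x : Euc n) : osc φ (fun ξ => β ξ • e) x = osc φ β x • e := by
  simpa using osc_clm ((ContinuousLinearMap.id ℝ ℝ).smulRight e) φ hβ x

lemma osc_decay_pow (p : ℕ) (φ : ℝ) {β : Euc n → F} (hβ : IsTestFun n β) :
    ∃ C, ∀ x : Euc n, ‖x‖ ^ p * ‖osc φ β x‖ ≤ C := by
  induction p generalizing φ β with
  | zero => exact ⟨_, fun x => by simpa using norm_osc_le φ β hβ x⟩
  | succ p ih =>
    choose C hC using fun j : Fin n =>
      ih (φ + Real.pi / 2) (hβ.fderiv_apply (stdVec n j))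
    refine ⟨∑ j, C j / (2 * Real.pi), fun x => ?_⟩
    have h1 : ∀ j, ‖x‖ ^ p * (|x j| * ‖osc φ β x‖) ≤ C j / (2 * Real.pi) := by
      intro j
      have h2 := hC j x
      rw [osc_fderiv _ hβ, inner_stdVec, norm_smul, norm_mul, add_sub_cancel_right,
        Real.norm_of_nonneg (by positivity : 0 ≤ 2 * Real.pi), Real.norm_eq_abs] at h2
      rw [le_div_iff₀ (by positivity)]
      calc _ = _ := by ring
        _ ≤ _ := h2
    calc ‖x‖ ^ (p + 1) * ‖osc φ β x‖ = ‖x‖ ^ p * ‖osc φ β x‖ * ‖x‖ := by ring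
      _ ≤ ‖x‖ ^ p * ‖osc φ β x‖ * ∑ j, |x j| := by gcongr; exact norm_le_sum_coord x
      _ = ∑ j, ‖x‖ ^ p * (|x j| * ‖osc φ β x‖) := by
        rw [Finset.mul_sum]; exact Finset.sum_congr rfl fun j _ => by ring
      _ ≤ _ := Finset.sum_le_sum fun j _ => h1 j

/-- A smooth function all of whose derivatives are rapidly decaying. -/
def IsRapid (g : Euc n → F) : Prop :=
  ContDiff ℝ (⊤ : ℕ∞) g ∧ ∀ p m : ℕ, ∃ C, 0 ≤ C ∧ ∀ x : Euc n,
    (1 + ‖x‖) ^ p * ‖iteratedFDeriv ℝ m g x‖ ≤ C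

lemma osc_decay (p : ℕ) (φ : ℝ) {β : Euc n → F} (hβ : IsTestFun n β) :
    ∃ C, ∀ x : Euc n, (1 + ‖x‖) ^ p * ‖osc φ β x‖ ≤ C := by
  obtain ⟨C0, h0⟩ := osc_decay_pow 0 φ hβ
  obtain ⟨C1, h1⟩ := osc_decay_pow p φ hβ
  refine ⟨2 ^ (p - 1) * (C0 + C1), fun x => ?_⟩
  have := add_pow_le (zero_le_one) (norm_nonneg x) p
  calc (1 + ‖x‖) ^ p * ‖osc φ β x‖ ≤ 2 ^ (p - 1) * (1 ^ p + ‖x‖ ^ p) * ‖osc φ β x‖ := by gcongr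
    _ = 2 ^ (p - 1) * (‖x‖ ^ 0 * ‖osc φ β x‖ + ‖x‖ ^ p * ‖osc φ β x‖) := by simp; ring
    _ ≤ _ := by gcongr; exacts [h0 x, h1 x]

lemma isRapid_osc [CompleteSpace F] (φ : ℝ) {β : Euc n → F} (hβ : IsTestFun n β) : IsRapid (osc φ β) := by
  refine ⟨smooth_osc φ hβ, fun p m => ?_⟩
  choose C hC using fun I : Fin m → Fin n =>
    osc_decay p (φ + m * (Real.pi / 2)) (hβ.smul_left (smooth_prod_coord I))
  refine ⟨∑ I, (2 * Real.pi) ^ m * C I, Finset.sum_nonneg fun I _ => ?_, fun x => ?_⟩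
  · exact mul_nonneg (by positivity) (le_trans (by positivity) (hC I 0))
  · calc (1 + ‖x‖) ^ p * ‖iteratedFDeriv ℝ m (osc φ β) x‖
        ≤ (1 + ‖x‖) ^ p * ∑ I : Fin m → Fin n, ‖dirDeriv n m I (osc φ β) x‖ := by
          gcongr; exact norm_iteratedFDeriv_le_sum _ _
      _ = ∑ I : Fin m → Fin n, (2 * Real.pi) ^ m * ((1 + ‖x‖) ^ p *
          ‖osc (φ + m * (Real.pi / 2)) (fun ξ => (∏ i, ξ (I i)) • β ξ) x‖) := by
          rw [Finset.mul_sum]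
          refine Finset.sum_congr rfl fun I _ => ?_
          rw [dirDeriv_osc φ hβ, norm_smul, Real.norm_of_nonneg (by positivity)]; ring
      _ ≤ _ := by gcongr with I; exact hC I x

omit [NormedSpace ℝ F] in
lemma integrable_of_decay {g : Euc n → F} (hg : AEStronglyMeasurable g) {C : ℝ}
    (hC : ∀ x, (1 + ‖x‖) ^ (n + 1) * ‖g x‖ ≤ C) : Integrable g := by
  have h1 : Integrable (fun x : Euc n => (1 + ‖x‖) ^ (-((n : ℝ) + 1))) :=
    integrable_one_add_norm (by simp)
  refine (h1.mul_const C).mono' hg (Eventually.of_forall fun x => ?_)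
  have h2 : 0 < (1 + ‖x‖) := by positivity
  rw [Real.rpow_neg h2.le, inv_mul_eq_div, le_div_iff₀ (by positivity), mul_comm]
  have h3 := hC x
  rwa [← Real.rpow_natCast, Nat.cast_add, Nat.cast_one] at h3

lemma integrable_osc_osc [CompleteSpace F] (φ : ℝ) {β : Euc n → F} (hβ : IsTestFun n β) :
    Integrable (osc φ β) := by
  obtain ⟨C, hC⟩ := osc_decay (n + 1) φ hβ
  exact integrable_of_decay (smooth_osc φ hβ).continuous.aestronglyMeasurable hC

open FourierTransform in
lemma fourier_eq_osc {β : Euc n → ℝ} (hβ : IsTestFun n β) (x : Euc n) :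
    𝓕 (fun ξ => (β ξ : ℂ)) x =
      ((osc 0 β x : ℝ) : ℂ) + ((osc (Real.pi / 2) β x : ℝ) : ℂ) * Complex.I := by
  rw [Real.fourier_eq', osc, osc, ← integral_complex_ofReal, ← integral_complex_ofReal,
    ← integral_mul_const, ← integral_add]
  · refine integral_congr_ae (Eventually.of_forall fun ξ => ?_)
    simp only [smul_eq_mul, add_zero, Real.cos_add_pi_div_two]
    rw [Complex.exp_mul_I, real_inner_comm]
    push_cast
    rw [neg_mul, neg_mul, Complex.cos_neg, Complex.sin_neg]
    ring
  · exact (integrable_osc 0 hβ x).ofReal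
  · exact ((integrable_osc _ hβ x).ofReal (𝕜 := ℂ)).mul_const _

open FourierTransform in
lemma integral_osc_zero {β : Euc n → ℝ} (hβ : IsTestFun n β) : ∫ x, osc 0 β x = β 0 := by
  have hF : 𝓕 (fun ξ => (β ξ : ℂ)) = fun x => ((osc 0 β x : ℝ) : ℂ) +
      ((osc (Real.pi / 2) β x : ℝ) : ℂ) * Complex.I := funext fun x => fourier_eq_osc hβ x
  have hi1 : Integrable (fun x => ((osc 0 β x : ℝ) : ℂ)) := (integrable_osc_osc 0 hβ).ofReal
  have hi2 : Integrable (fun x => ((osc (Real.pi / 2) β x : ℝ) : ℂ) * Complex.I) :=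
    ((integrable_osc_osc _ hβ).ofReal (𝕜 := ℂ)).mul_const _
  have hc : Continuous (fun ξ => (β ξ : ℂ)) := Complex.continuous_ofReal.comp hβ.1.continuous
  have h := congrFun (hc.fourierInv_fourier_eq (hβ.integrable volume).ofReal
    (by rw [hF]; exact hi1.add hi2)) 0
  rw [Real.fourierInv_eq', hF] at h
  simp only [inner_zero_right, mul_zero, Complex.ofReal_zero, zero_mul, Complex.exp_zero,
    one_smul] at h
  rw [integral_add hi1 hi2, integral_mul_const, integral_complex_ofReal,
    integral_complex_ofReal] at h
  simpa using congrArg Complex.re h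

lemma integrable_osc_sq [CompleteSpace F] (φ : ℝ) {β : Euc n → F} (hβ : IsTestFun n β) :
    Integrable (fun x => ‖osc φ β x‖ ^ 2) := by
  obtain ⟨C, hC⟩ := osc_decay (n + 1) φ hβ
  obtain ⟨D, hD⟩ := osc_decay 0 φ hβ
  refine integrable_of_decay (C := C * D)
    ((smooth_osc φ hβ).continuous.norm.pow 2).aestronglyMeasurable fun x => ?_
  rw [Real.norm_of_nonneg (by positivity), pow_two, ← mul_assoc]
  have h1 := hC x
  have h2 := hD x
  rw [pow_zero, one_mul] at h2
  exact mul_le_mul h1 h2 (norm_nonneg _) (le_trans (by positivity) h1)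

open FourierTransform in
lemma plancherel_real {β : Euc n → ℝ} (hβ : IsTestFun n β) :
    (∫ x, osc 0 β x ^ 2) + ∫ x, osc (Real.pi / 2) β x ^ 2 = ∫ x, β x ^ 2 := by
  have hs : ContDiff ℝ (⊤ : ℕ∞) (fun ξ => (β ξ : ℂ)) := Complex.ofRealCLM.contDiff.comp hβ.1
  have hc : HasCompactSupport (fun ξ => (β ξ : ℂ)) := hβ.2.comp_left Complex.ofReal_zero
  have h := SchwartzMap.integral_norm_sq_fourier (hc.toSchwartzMap hs)
  have h1 : ∀ x, ‖𝓕 (hc.toSchwartzMap hs) x‖ ^ 2 =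
      osc 0 β x ^ 2 + osc (Real.pi / 2) β x ^ 2 := by
    intro x
    have : 𝓕 (hc.toSchwartzMap hs) x = 𝓕 (fun ξ => (β ξ : ℂ)) x := by
      rw [SchwartzMap.fourier_coe]; rfl
    rw [this, fourier_eq_osc hβ, Complex.sq_norm, Complex.normSq_add_mul_I]
  have h2 : ∀ x, ‖(hc.toSchwartzMap hs) x‖ ^ 2 = β x ^ 2 := by
    intro x
    change ‖(β x : ℂ)‖ ^ 2 = _
    simp
  simp only [h1, h2] at h
  rw [← h, integral_add]
  · simpa using integrable_osc_sq 0 hβ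
  · simpa using integrable_osc_sq (Real.pi / 2) hβ

lemma plancherel {V : Type*} [NormedAddCommGroup V] [InnerProductSpace ℝ V]
    [FiniteDimensional ℝ V] {β : Euc n → V} (hβ : IsTestFun n β) :
    (∫ x, ‖osc 0 β x‖ ^ 2) + ∫ x, ‖osc (Real.pi / 2) β x‖ ^ 2 = ∫ x, ‖β x‖ ^ 2 := by
  let b := stdOrthonormalBasis ℝ V
  have hn : ∀ v : V, ‖v‖ ^ 2 = ∑ i, (innerB V (b i) v) ^ 2 := by
    intro v
    simpa using (b.sum_sq_norm_inner_right v).symm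
  have ht : ∀ i, IsTestFun n (fun ξ => innerB V (b i) (β ξ)) := fun i => hβ.clm _
  have h1 : ∀ φ, ∫ x, ‖osc φ β x‖ ^ 2 =
      ∑ i, ∫ x, osc φ (fun ξ => innerB V (b i) (β ξ)) x ^ 2 := by
    intro φ
    rw [← integral_finsetSum]
    · refine integral_congr_ae (Eventually.of_forall fun x => ?_)
      simp only [hn]
      exact Finset.sum_congr rfl fun i _ => by rw [osc_clm _ _ hβ]
    · intro i _
      simpa using integrable_osc_sq φ (ht i)
  rw [h1, h1, ← Finset.sum_add_distrib]
  simp only [hn]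
  rw [integral_finsetSum]
  · exact Finset.sum_congr rfl fun i _ => plancherel_real (ht i)
  · intro i _
    refine Continuous.integrable_of_hasCompactSupport ((ht i).1.continuous.pow 2) ?_
    have := (ht i).2.comp_left (g := fun t : ℝ => t ^ 2) (by simp)
    exact this

end Osc

section Symbol

variable {n k m : ℕ} {V W : Type*}
  [NormedAddCommGroup V] [InnerProductSpace ℝ V] [FiniteDimensional ℝ V]
  [NormedAddCommGroup W] [InnerProductSpace ℝ W] [FiniteDimensional ℝ W]

/-- The symbol as a continuous linear map. -/
noncomputable def symC (A : CoeffOp n k V W) (ξ : Euc n) : V →L[ℝ] W :=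
  ∑ I : Fin k → Fin n, (∏ i, ξ (I i)) • (A I).toContinuousLinearMap

/-- The adjoint symbol as a continuous linear map. -/
noncomputable def symA (A : CoeffOp n k V W) (ξ : Euc n) : W →L[ℝ] V :=
  ∑ I : Fin k → Fin n, (∏ i, ξ (I i)) • (LinearMap.adjoint (A I)).toContinuousLinearMap

lemma symC_apply (A : CoeffOp n k V W) (ξ : Euc n) (v : V) :
    symC A ξ v = symbolMap n k A ξ v := by
  simp [symC, symbolMap, Finset.sum_apply]

lemma symA_apply (A : CoeffOp n k V W) (ξ : Euc n) (w : W) :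
    symA A ξ w = ∑ I : Fin k → Fin n, (∏ i, ξ (I i)) • LinearMap.adjoint (A I) w := by
  simp [symA, FunLike.coe_sum]

lemma inner_symA (A : CoeffOp n k V W) (ξ : Euc n) (w : W) (v : V) :
    ⟪symA A ξ w, v⟫ = ⟪w, symC A ξ v⟫ := by
  rw [symA_apply, symC_apply]
  simp [symbolMap, sum_inner, inner_sum, inner_smul_left, inner_smul_right,
    LinearMap.adjoint_inner_left, Finset.sum_apply]

lemma inner_symA_right (A : CoeffOp n k V W) (ξ : Euc n) (w : W) (v : V) :
    ⟪v, symA A ξ w⟫ = ⟪symC A ξ v, w⟫ := by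
  rw [real_inner_comm, inner_symA, real_inner_comm]

lemma adjoint_symbolMap (A : CoeffOp n k V W) (ξ : Euc n) :
    LinearMap.adjoint (symbolMap n k A ξ) = (symA A ξ : W →ₗ[ℝ] V) := by
  symm
  rw [LinearMap.eq_adjoint_iff]
  intro w v
  rw [← symC_apply]
  exact inner_symA A ξ w v

lemma smooth_symC (A : CoeffOp n k V W) : ContDiff ℝ (⊤ : ℕ∞) (symC A) :=
  ContDiff.sum fun I _ => (smooth_prod_coord I).smul contDiff_const

lemma smooth_symA (A : CoeffOp n k V W) : ContDiff ℝ (⊤ : ℕ∞) (symA A) :=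
  ContDiff.sum fun I _ => (smooth_prod_coord I).smul contDiff_const

lemma prod_coord_smul (J : Fin m → Fin n) (t : ℝ) (ξ : Euc n) :
    ∏ i, (t • ξ) (J i) = t ^ m * ∏ i, ξ (J i) := by
  simp [Finset.prod_mul_distrib]

lemma symC_smul (A : CoeffOp n k V W) (t : ℝ) (ξ : Euc n) :
    symC A (t • ξ) = t ^ k • symC A ξ := by
  simp only [symC, prod_coord_smul, Finset.smul_sum, smul_smul]

lemma symA_smul (A : CoeffOp n k V W) (t : ℝ) (ξ : Euc n) :
    symA A (t • ξ) = t ^ k • symA A ξ := by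
  simp only [symA, prod_coord_smul, Finset.smul_sum, smul_smul]

/-- The Gram operator `𝒜*[ξ] 𝒜[ξ]`. -/
noncomputable def gram (A : CoeffOp n k V W) (ξ : Euc n) : V →L[ℝ] V := symA A ξ ∘L symC A ξ

/-- The inverse of the Gram operator. -/
noncomputable def ginv (A : CoeffOp n k V W) (ξ : Euc n) : V →L[ℝ] V := Ring.inverse (gram A ξ)

lemma smooth_gram (A : CoeffOp n k V W) : ContDiff ℝ (⊤ : ℕ∞) (gram A) :=
  (smooth_symA A).clm_comp (smooth_symC A)

lemma IsElliptic.injective_gram {A : CoeffOp n k V W} (hE : IsElliptic n k A) {ξ : Euc n}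
    (hξ : ξ ≠ 0) : Function.Injective (gram A ξ) := by
  rw [injective_iff_map_eq_zero]
  intro v hv
  have h1 : ⟪symC A ξ v, symC A ξ v⟫ = 0 := by
    rw [← inner_symA]
    change ⟪gram A ξ v, v⟫ = 0
    rw [hv, inner_zero_left]
  rw [inner_self_eq_zero, symC_apply] at h1
  exact hE ξ hξ (by rw [h1, map_zero])

lemma IsElliptic.isUnit_gram {A : CoeffOp n k V W} (hE : IsElliptic n k A) {ξ : Euc n}
    (hξ : ξ ≠ 0) : IsUnit (gram A ξ) := by
  have hi := hE.injective_gram hξ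
  let e := (LinearEquiv.ofInjectiveEndo (gram A ξ : V →ₗ[ℝ] V) hi).toContinuousLinearEquiv
  have : gram A ξ = (e : V →L[ℝ] V) := by ext v; rfl
  rw [this]
  exact ⟨ContinuousLinearEquiv.toUnit e, rfl⟩

lemma IsElliptic.gram_ginv {A : CoeffOp n k V W} (hE : IsElliptic n k A) {ξ : Euc n}
    (hξ : ξ ≠ 0) (v : V) : gram A ξ (ginv A ξ v) = v := by
  have := Ring.mul_inverse_cancel _ (hE.isUnit_gram hξ)
  exact congrArg (fun L : V →L[ℝ] V => L v) this

lemma IsElliptic.ginv_gram {A : CoeffOp n k V W} (hE : IsElliptic n k A) {ξ : Euc n}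
    (hξ : ξ ≠ 0) (v : V) : ginv A ξ (gram A ξ v) = v := by
  have := Ring.inverse_mul_cancel _ (hE.isUnit_gram hξ)
  exact congrArg (fun L : V →L[ℝ] V => L v) this

lemma IsElliptic.inner_ginv {A : CoeffOp n k V W} (hE : IsElliptic n k A) {ξ : Euc n}
    (hξ : ξ ≠ 0) (v w : V) : ⟪ginv A ξ v, w⟫ = ⟪v, ginv A ξ w⟫ := by
  conv_lhs => rw [← hE.gram_ginv hξ w]
  conv_rhs => rw [← hE.gram_ginv hξ v]
  simp only [gram, ContinuousLinearMap.comp_apply]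
  rw [inner_symA_right, inner_symA]

lemma IsElliptic.contDiffAt_ginv {A : CoeffOp n k V W} (hE : IsElliptic n k A) {ξ : Euc n}
    (hξ : ξ ≠ 0) : ContDiffAt ℝ (⊤ : ℕ∞) (ginv A) ξ := by
  have h := contDiffAt_ringInverse (n := ((⊤ : ℕ∞) : WithTop ℕ∞)) ℝ (hE.isUnit_gram hξ).unit
  exact ContDiffAt.comp ξ h (smooth_gram A).contDiffAt

/-- The dual kernel `𝒜[ξ] (𝒜*[ξ] 𝒜[ξ])⁻¹ e`. -/
noncomputable def dualK (A : CoeffOp n k V W) (e : V) (ξ : Euc n) : W := symC A ξ (ginv A ξ e)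

/-- The left inverse `(𝒜*[ξ] 𝒜[ξ])⁻¹ 𝒜*[ξ] w`. -/
noncomputable def dagK (A : CoeffOp n k V W) (w : W) (ξ : Euc n) : V := ginv A ξ (symA A ξ w)

/-- The projection of `w` onto the kernel of `𝒜*[ξ]`. -/
noncomputable def projK (A : CoeffOp n k V W) (w : W) (ξ : Euc n) : W :=
  w - symC A ξ (dagK A w ξ)

variable {A : CoeffOp n k V W}

lemma IsElliptic.symA_dualK (hE : IsElliptic n k A) (e : V) {ξ : Euc n} (hξ : ξ ≠ 0) :
    symA A ξ (dualK A e ξ) = e := hE.gram_ginv hξ e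

lemma IsElliptic.symA_projK (hE : IsElliptic n k A) (w : W) {ξ : Euc n} (hξ : ξ ≠ 0) :
    symA A ξ (projK A w ξ) = 0 := by
  rw [projK, map_sub, sub_eq_zero]
  exact (hE.gram_ginv hξ _).symm

lemma IsElliptic.inner_dualK (hE : IsElliptic n k A) (e : V) (w : W) {ξ : Euc n} (hξ : ξ ≠ 0) :
    ⟪dualK A e ξ, w⟫ = ⟪e, dagK A w ξ⟫ := by
  rw [dualK, dagK, ← inner_symA_right, hE.inner_ginv hξ]

lemma IsElliptic.inner_projK (hE : IsElliptic n k A) (w w' : W) {ξ : Euc n} (hξ : ξ ≠ 0) :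
    ⟪projK A w ξ, w'⟫ = ⟪w, projK A w' ξ⟫ := by
  simp only [projK, inner_sub_left, inner_sub_right, dagK]
  rw [← inner_symA_right, ← inner_symA, hE.inner_ginv hξ]

lemma IsElliptic.projK_projK (hE : IsElliptic n k A) (w : W) {ξ : Euc n} (hξ : ξ ≠ 0) :
    projK A (projK A w ξ) ξ = projK A w ξ := by
  conv_lhs => rw [projK, dagK, hE.symA_projK w hξ]
  simp

lemma IsElliptic.contDiffAt_dualK (hE : IsElliptic n k A) (e : V) {ξ : Euc n} (hξ : ξ ≠ 0) :
    ContDiffAt ℝ (⊤ : ℕ∞) (dualK A e) ξ :=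
  (smooth_symC A).contDiffAt.clm_apply ((hE.contDiffAt_ginv hξ).clm_apply contDiffAt_const)

lemma IsElliptic.contDiffAt_dagK (hE : IsElliptic n k A) (w : W) {ξ : Euc n} (hξ : ξ ≠ 0) :
    ContDiffAt ℝ (⊤ : ℕ∞) (dagK A w) ξ :=
  (hE.contDiffAt_ginv hξ).clm_apply ((smooth_symA A).contDiffAt.clm_apply contDiffAt_const)

lemma IsElliptic.contDiffAt_projK (hE : IsElliptic n k A) (w : W) {ξ : Euc n} (hξ : ξ ≠ 0) :
    ContDiffAt ℝ (⊤ : ℕ∞) (projK A w) ξ :=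
  contDiffAt_const.sub ((smooth_symC A).contDiffAt.clm_apply (hE.contDiffAt_dagK w hξ))

lemma IsElliptic.dagK_smul (hE : IsElliptic n k A) (w : W) {ξ : Euc n} (hξ : ξ ≠ 0) {t : ℝ}
    (ht : t ≠ 0) : dagK A w (t • ξ) = (t ^ k)⁻¹ • dagK A w ξ := by
  have hξ' : t • ξ ≠ 0 := smul_ne_zero ht hξ
  apply hE.injective_gram hξ'
  rw [dagK, hE.gram_ginv hξ', map_smul, gram, ContinuousLinearMap.comp_apply, symA_smul,
    symC_smul]
  simp only [FunLike.coe_smul, Pi.smul_apply, map_smul]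
  have : symA A ξ (symC A ξ (dagK A w ξ)) = symA A ξ w := hE.gram_ginv hξ _
  rw [this, smul_smul, smul_smul, inv_mul_cancel₀ (pow_ne_zero _ ht), one_mul]

lemma IsElliptic.dagK_symC (hE : IsElliptic n k A) (v : V) {ξ : Euc n} (hξ : ξ ≠ 0) :
    dagK A (symC A ξ v) ξ = v := hE.ginv_gram hξ v

lemma IsElliptic.mem_range_iff (hE : IsElliptic n k A) (w : W) {ξ : Euc n} (hξ : ξ ≠ 0) :
    w ∈ LinearMap.range (symbolMap n k A ξ) ↔ projK A w ξ = 0 := by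
  constructor
  · rintro ⟨v, rfl⟩
    rw [projK, ← symC_apply, hE.dagK_symC v hξ, sub_self]
  · intro h
    exact ⟨dagK A w ξ, by rw [← symC_apply]; exact (sub_eq_zero.1 h).symm⟩

lemma linInv_apply_apply {f : V →ₗ[ℝ] V} (hf : Function.Injective f) (v : V) :
    linInv f (f v) = v := by
  let b := Module.finBasis ℝ V
  have hu : IsUnit (LinearMap.toMatrix b b f).det := by
    rw [LinearMap.det_toMatrix]
    have := LinearMap.isUnit_iff_isUnit_det f
    rw [← this, Module.End.isUnit_iff]
    exact ⟨hf, LinearMap.injective_iff_surjective.1 hf⟩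
  have h1 : linInv f ∘ₗ f = LinearMap.id := by
    unfold linInv
    have h2 : f = Matrix.toLin b b (LinearMap.toMatrix b b f) := (Matrix.toLin_toMatrix b b f).symm
    conv_lhs => enter [2]; rw [h2]
    rw [← Matrix.toLin_mul, Matrix.nonsing_inv_mul _ hu, Matrix.toLin_one]
  exact LinearMap.congr_fun h1 v

lemma IsElliptic.adagger_eq (hE : IsElliptic n k A) (w : W) {ξ : Euc n} (hξ : ξ ≠ 0) :
    Adagger n k A ξ w = dagK A w ξ := by
  unfold Adagger
  rw [LinearMap.comp_apply]
  have h1 : LinearMap.adjoint (symbolMap n k A ξ) ∘ₗ symbolMap n k A ξ =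
      (gram A ξ : V →ₗ[ℝ] V) := by
    rw [adjoint_symbolMap]
    ext v
    simp [gram, symC_apply]
  rw [h1, adjoint_symbolMap]
  have h2 : (symA A ξ : W →ₗ[ℝ] V) w = (gram A ξ : V →ₗ[ℝ] V) (dagK A w ξ) :=
    (hE.gram_ginv hξ _).symm
  rw [h2]
  exact linInv_apply_apply (hE.injective_gram hξ) _

lemma IsElliptic.exists_lower_bound (hk : 1 ≤ k) (hE : IsElliptic n k A) :
    ∃ c : ℝ, 0 < c ∧ ∀ ξ v, c * ‖ξ‖ ^ k * ‖v‖ ≤ ‖symC A ξ v‖ := by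
  have hne : ∀ ξ ∈ sphere (0 : Euc n) 1, ξ ≠ 0 := fun ξ hξ => ne_zero_of_mem_unit_sphere ⟨ξ, hξ⟩
  have hc : ContinuousOn (fun ξ : Euc n => ginv A ξ ∘L symA A ξ) (sphere (0 : Euc n) 1) :=
    fun ξ hξ => ((hE.contDiffAt_ginv (hne ξ hξ)).clm_comp
      (smooth_symA A).contDiffAt).continuousAt.continuousWithinAt
  obtain ⟨M, hM⟩ := (isCompact_sphere (0 : Euc n) 1).exists_bound_of_continuousOn hc
  have hM' : 0 < max M 1 := lt_max_of_lt_right one_pos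
  refine ⟨(max M 1)⁻¹, by positivity, fun ξ v => ?_⟩
  rcases eq_or_ne ξ 0 with rfl | hξ
  · simp [show k ≠ 0 by omega]
  have hξ' : 0 < ‖ξ‖ := norm_pos_iff.2 hξ
  set ω : Euc n := ‖ξ‖⁻¹ • ξ with hω
  have hωs : ω ∈ sphere (0 : Euc n) 1 := by
    simp [hω, norm_smul, hξ'.ne']
  have h1 : ξ = ‖ξ‖ • ω := by rw [hω, smul_smul, mul_inv_cancel₀ hξ'.ne', one_smul]
  have h2 : ‖v‖ ≤ max M 1 * ‖symC A ω v‖ := by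
    calc ‖v‖ = ‖(ginv A ω ∘L symA A ω) (symC A ω v)‖ :=
          congrArg norm (hE.ginv_gram (hne ω hωs) v).symm
      _ ≤ ‖ginv A ω ∘L symA A ω‖ * ‖symC A ω v‖ := ContinuousLinearMap.le_opNorm _ _
      _ ≤ _ := by gcongr; exact (hM ω hωs).trans (le_max_left _ _)
  have h3 : ‖symC A ξ v‖ = ‖ξ‖ ^ k * ‖symC A ω v‖ := by
    conv_lhs => rw [h1, symC_smul]
    simp [norm_smul]
  rw [h3, mul_assoc, inv_mul_le_iff₀ hM']
  calc ‖ξ‖ ^ k * ‖v‖ ≤ ‖ξ‖ ^ k * (max M 1 * ‖symC A ω v‖) := by gcongr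
    _ = _ := by ring

end Symbol

section Cutoff

variable {n k m : ℕ} {F : Type*} [NormedAddCommGroup F] [NormedSpace ℝ F]

/-- A radial cutoff equal to one on the unit ball. -/
noncomputable def chi (n : ℕ) (ξ : Euc n) : ℝ := Real.smoothTransition (2 - ‖ξ‖ ^ 2)

/-- A radial annular cutoff. -/
noncomputable def psi (n : ℕ) (ξ : Euc n) : ℝ := chi n ((2 : ℝ)⁻¹ • ξ) - chi n ξ

lemma chi_of_norm_le {ξ : Euc n} (h : ‖ξ‖ ≤ 1) : chi n ξ = 1 :=
  Real.smoothTransition.one_of_one_le (by nlinarith [norm_nonneg ξ])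

lemma chi_of_le_norm {ξ : Euc n} (h : 3 / 2 ≤ ‖ξ‖) : chi n ξ = 0 :=
  Real.smoothTransition.zero_of_nonpos (by nlinarith)

lemma chi_nonneg (ξ : Euc n) : 0 ≤ chi n ξ := Real.smoothTransition.nonneg _

lemma chi_le_one (ξ : Euc n) : chi n ξ ≤ 1 := Real.smoothTransition.le_one _

lemma norm_half_smul (ξ : Euc n) : ‖(2 : ℝ)⁻¹ • ξ‖ = ‖ξ‖ / 2 := by
  rw [norm_smul, norm_inv, Real.norm_ofNat]; ring

lemma psi_of_norm_le {ξ : Euc n} (h : ‖ξ‖ ≤ 1) : psi n ξ = 0 := by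
  rw [psi, chi_of_norm_le h, chi_of_norm_le, sub_self]
  rw [norm_half_smul]; linarith

lemma psi_of_le_norm {ξ : Euc n} (h : 3 ≤ ‖ξ‖) : psi n ξ = 0 := by
  rw [psi, chi_of_le_norm (ξ := ξ) (by linarith), chi_of_le_norm, sub_self]
  rw [norm_half_smul]; linarith

lemma psi_of_norm_eq {ξ : Euc n} (h : ‖ξ‖ = 2) : psi n ξ = 1 := by
  rw [psi, chi_of_norm_le, chi_of_le_norm (by linarith), sub_zero]
  rw [norm_half_smul]; linarith

lemma psi_nonneg (ξ : Euc n) : 0 ≤ psi n ξ := by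
  rcases le_total ‖ξ‖ (3 / 2) with h | h
  · have : chi n ((2 : ℝ)⁻¹ • ξ) = 1 := chi_of_norm_le (by rw [norm_half_smul]; linarith)
    rw [psi, this]; linarith [chi_le_one ξ]
  · rw [psi, chi_of_le_norm h, sub_zero]; exact chi_nonneg _

lemma psi_congr {ξ ξ' : Euc n} (h : ‖ξ‖ = ‖ξ'‖) : psi n ξ = psi n ξ' := by
  simp only [psi, chi, norm_half_smul, h]

lemma smooth_chi : ContDiff ℝ (⊤ : ℕ∞) (chi n) :=
  Real.smoothTransition.contDiff.comp (contDiff_const.sub (contDiff_norm_sq ℝ))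

lemma smooth_psi : ContDiff ℝ (⊤ : ℕ∞) (psi n) :=
  (smooth_chi.comp (contDiff_const_smul _)).sub smooth_chi

lemma hasCompactSupport_of_norm {f : Euc n → F} {R : ℝ} (h : ∀ x, R ≤ ‖x‖ → f x = 0) :
    HasCompactSupport f := by
  refine HasCompactSupport.intro (isCompact_closedBall (0 : Euc n) R) fun x hx => h x ?_
  simp only [mem_closedBall, dist_zero_right, not_le] at hx
  exact hx.le

lemma isTestFun_chi : IsTestFun n (chi n) :=
  ⟨smooth_chi, hasCompactSupport_of_norm fun _ => chi_of_le_norm⟩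

lemma isTestFun_psi : IsTestFun n (psi n) :=
  ⟨smooth_psi, hasCompactSupport_of_norm fun _ => psi_of_le_norm⟩

lemma isTestFun_psi_smul {b : Euc n → F} (hb : ∀ ξ ≠ 0, ContDiffAt ℝ (⊤ : ℕ∞) b ξ) :
    IsTestFun n (fun ξ => psi n ξ • b ξ) := by
  refine ⟨contDiff_iff_contDiffAt.2 fun ξ => ?_, isTestFun_psi.2.smul_right⟩
  rcases eq_or_ne ξ 0 with rfl | hξ
  · refine (contDiffAt_const (c := (0 : F))).congr_of_eventuallyEq ?_
    filter_upwards [ball_mem_nhds (0 : Euc n) one_pos] with ξ hξ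
    rw [psi_of_norm_le (by simpa using (mem_ball_zero_iff.1 hξ).le), zero_smul]
  · exact smooth_psi.contDiffAt.smul (hb ξ hξ)

/-- The low-pass kernel. -/
noncomputable def rho (n : ℕ) : Euc n → ℝ := osc 0 (chi n)

lemma isRapid_rho : IsRapid (rho n) := isRapid_osc _ isTestFun_chi

lemma integral_rho : ∫ x, rho n x = 1 := by
  rw [rho, integral_osc_zero isTestFun_chi, chi_of_norm_le (by simp)]

lemma osc_psi (x : Euc n) : osc 0 (psi n) x = 2 ^ n * rho n ((2 : ℝ) • x) - rho n x := by
  have h1 : osc 0 (fun ξ => chi n ((2 : ℝ)⁻¹ • ξ)) x = 2 ^ n * rho n ((2 : ℝ) • x) := by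
    have h := Measure.integral_comp_smul (volume : Measure (Euc n))
      (fun ξ => Real.cos (2 * Real.pi * ⟪(2 : ℝ) • x, ξ⟫ + 0) • chi n ξ) (2 : ℝ)⁻¹
    have h2 : ∀ ξ : Euc n, ⟪(2 : ℝ) • x, (2 : ℝ)⁻¹ • ξ⟫ = ⟪x, ξ⟫ := fun ξ => by
      rw [inner_smul_left, inner_smul_right]; simp
    simp only [h2] at h
    rw [osc, h, rho, osc]
    simp
  have h2 : IsTestFun n (fun ξ => chi n ((2 : ℝ)⁻¹ • ξ)) := isTestFun_chi.comp_smul (by norm_num)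
  rw [← h1, rho]
  have : psi n = fun ξ => chi n ((2 : ℝ)⁻¹ • ξ) + (-1 : ℝ) • chi n ξ := by
    funext ξ; rw [psi]; simp [sub_eq_add_neg]
  rw [this, osc_add 0 h2 (isTestFun_chi.const_smul _)]
  have h3 : osc 0 (fun ξ => (-1 : ℝ) • chi n ξ) x = - osc 0 (chi n) x := by
    simp [osc, integral_neg]
  rw [h3, sub_eq_add_neg]

/-- The band-limited kernel with symbol `psi • b / (2πi)^k`. -/
noncomputable def bandK (k : ℕ) (b : Euc n → F) (x : Euc n) : F :=
  ((2 * Real.pi) ^ k)⁻¹ • osc (-(k * (Real.pi / 2))) (fun ξ => psi n ξ • b ξ) x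

lemma IsRapid.const_smul {g : Euc n → F} (hg : IsRapid g) (c : ℝ) :
    IsRapid (fun x => c • g x) := by
  refine ⟨hg.1.const_smul c, fun p m => ?_⟩
  obtain ⟨C, hC, h⟩ := hg.2 p m
  refine ⟨‖c‖ * C, by positivity, fun x => ?_⟩
  rw [iteratedFDeriv_const_smul_apply' (hg.1.contDiffAt.of_le (by exact_mod_cast le_top)),
    norm_smul]
  calc _ = ‖c‖ * ((1 + ‖x‖) ^ p * ‖iteratedFDeriv ℝ m g x‖) := by ring
    _ ≤ _ := by gcongr; exact h x

variable [CompleteSpace F] {b : Euc n → F} (hb : ∀ ξ ≠ 0, ContDiffAt ℝ (⊤ : ℕ∞) b ξ)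

include hb in
lemma isRapid_bandK : IsRapid (bandK k b) := (isRapid_osc _ (isTestFun_psi_smul hb)).const_smul _

include hb in
lemma dirDeriv_bandK (I : Fin m → Fin n) (x : Euc n) :
    dirDeriv n m I (bandK k b) x = ((2 * Real.pi) ^ k)⁻¹ • (2 * Real.pi) ^ m •
      osc (-(k * (Real.pi / 2)) + m * (Real.pi / 2))
        (fun ξ => (∏ i, ξ (I i)) • psi n ξ • b ξ) x := by
  have hT := isTestFun_psi_smul hb
  unfold bandK
  rw [dirDeriv_const_smul _ (smooth_osc _ hT), dirDeriv_osc _ hT]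

include hb in
lemma dirDeriv_bandK_top (I : Fin k → Fin n) (x : Euc n) :
    dirDeriv n k I (bandK k b) x = osc 0 (fun ξ => (∏ i, ξ (I i)) • psi n ξ • b ξ) x := by
  rw [dirDeriv_bandK hb, smul_smul, inv_mul_cancel₀ (by positivity), one_smul, neg_add_cancel]

include hb in
lemma dirDeriv_bandK_zero (I : Fin m → Fin n) :
    dirDeriv n m I (bandK k b) 0 = ((2 * Real.pi) ^ k)⁻¹ • (2 * Real.pi) ^ m •
      Real.cos (-(k * (Real.pi / 2)) + m * (Real.pi / 2)) •
        ∫ ξ, (∏ i, ξ (I i)) • psi n ξ • b ξ := by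
  rw [dirDeriv_bandK hb, osc]
  simp only [inner_zero_left, mul_zero, zero_add]
  rw [integral_smul]

variable {G : Type*} [NormedAddCommGroup G] [NormedSpace ℝ G] [CompleteSpace G]

include hb in
lemma sum_dirDeriv_bandK (L : (Fin k → Fin n) → F →L[ℝ] G) {e : G}
    (he : ∀ ξ ≠ 0, ∑ I, (∏ i, ξ (I i)) • L I (b ξ) = e) (x : Euc n) :
    ∑ I, L I (dirDeriv n k I (bandK k b) x) = osc 0 (psi n) x • e := by
  have hT := isTestFun_psi_smul hb
  have hT2 : ∀ I : Fin k → Fin n, IsTestFun n (fun ξ => (∏ i, ξ (I i)) • psi n ξ • b ξ) :=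
    fun I => hT.smul_left (smooth_prod_coord I)
  simp only [dirDeriv_bandK_top hb, ← osc_clm (L _) 0 (hT2 _)]
  rw [← osc_sum _ _ fun I _ => (hT2 I).clm (L I), ← osc_smul_const _ isTestFun_psi]
  congr 1
  funext ξ
  rcases eq_or_ne ξ 0 with rfl | hξ
  · simp [psi_of_norm_le (n := n) (ξ := 0) (by simp)]
  · rw [← he ξ hξ, Finset.smul_sum]
    refine Finset.sum_congr rfl fun I _ => ?_
    rw [map_smul, map_smul, smul_comm]

end Cutoff

section BandKernel

variable {n k m : ℕ} {V W : Type*}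
  [NormedAddCommGroup V] [InnerProductSpace ℝ V] [FiniteDimensional ℝ V]
  [NormedAddCommGroup W] [InnerProductSpace ℝ W] [FiniteDimensional ℝ W] {A : CoeffOp n k V W}

lemma Astar_bandK {b : Euc n → W} (hb : ∀ ξ ≠ 0, ContDiffAt ℝ (⊤ : ℕ∞) b ξ) {e : V}
    (he : ∀ ξ ≠ 0, symA A ξ (b ξ) = e) (x : Euc n) :
    Astar n k A (bandK k b) x = osc 0 (psi n) x • e := by
  rw [Astar_eq_sum_clm]
  refine sum_dirDeriv_bandK hb _ (fun ξ hξ => ?_) x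
  rw [← he ξ hξ, symA_apply]
  rfl

lemma Aapply_bandK {b : Euc n → V} (hb : ∀ ξ ≠ 0, ContDiffAt ℝ (⊤ : ℕ∞) b ξ) {w : W}
    (he : ∀ ξ ≠ 0, symC A ξ (b ξ) = w) (x : Euc n) :
    Aapply n k A (bandK k b) x = osc 0 (psi n) x • w := by
  refine sum_dirDeriv_bandK hb (fun I => (A I).toContinuousLinearMap) (fun ξ hξ => ?_) x
  rw [← he ξ hξ, symC, FunLike.coe_sum, Finset.sum_apply]
  rfl

lemma projK_add (w w' : W) (ξ : Euc n) : projK A (w + w') ξ = projK A w ξ + projK A w' ξ := by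
  simp only [projK, dagK, map_add]; abel

lemma projK_smul (c : ℝ) (w : W) (ξ : Euc n) : projK A (c • w) ξ = c • projK A w ξ := by
  simp only [projK, dagK, map_smul, smul_sub]

lemma IsElliptic.projK_comp_smul (hE : IsElliptic n k A) (w : W) {ξ : Euc n} (hξ : ξ ≠ 0) {t : ℝ}
    (ht : t ≠ 0) : projK A w (t • ξ) = projK A w ξ := by
  rw [projK, hE.dagK_smul w hξ ht, symC_smul, projK]
  simp only [FunLike.coe_smul, Pi.smul_apply, map_smul, smul_smul]
  rw [inv_mul_cancel₀ (pow_ne_zero _ ht), one_smul]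

lemma exists_nonzero_prod_tendsto (ξ : Euc n) (J : Fin m → Fin n) :
    ∃ η : ℕ → Euc n, Tendsto η atTop (𝓝 ξ) ∧ ∀ᶠ i in atTop, ∏ j, η i (J j) ≠ 0 := by
  let o : Euc n := WithLp.toLp 2 fun _ => 1
  refine ⟨fun i => ξ + (1 / ((i : ℝ) + 1)) • o, ?_, ?_⟩
  · have := (tendsto_one_div_add_atTop_nhds_zero_nat (𝕜 := ℝ)).smul_const o
    simpa using this.const_add ξ
  · have h : ∀ j, ∀ᶠ i : ℕ in atTop, (ξ + (1 / ((i : ℝ) + 1)) • o) (J j) ≠ 0 := by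
      intro j
      by_cases h0 : ξ (J j) = 0
      · refine Eventually.of_forall fun i => ?_
        simp only [PiLp.add_apply, h0, PiLp.smul_apply, o, smul_eq_mul, mul_one, zero_add]
        positivity
      · have h1 : Tendsto (fun i : ℕ => ξ (J j) + 1 / ((i : ℝ) + 1)) atTop (𝓝 (ξ (J j) + 0)) :=
          tendsto_one_div_add_atTop_nhds_zero_nat.const_add _
        rw [add_zero] at h1
        simpa [o] using h1.eventually_ne h0
    filter_upwards [eventually_all.2 h] with i hi
    exact Finset.prod_ne_zero_iff.2 fun j _ => hi j

lemma IsElliptic.exists_kernel_symbol (hE : IsElliptic n k A) (J : Fin m → Fin n)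
    (hWC : ∀ w : W, (∀ ξ ≠ 0, projK A w ξ = 0) →
      ∫ ξ, (∏ i, ξ (J i)) • psi n ξ • dagK A w ξ = 0) (e : V) :
    ∃ b : Euc n → W, (∀ ξ ≠ 0, ContDiffAt ℝ (⊤ : ℕ∞) b ξ) ∧ (∀ ξ ≠ 0, symA A ξ (b ξ) = e) ∧
      ∫ ξ, (∏ i, ξ (J i)) • psi n ξ • b ξ = 0 := by
  have hT0 : IsTestFun n (fun ξ => (∏ i, ξ (J i)) • psi n ξ • dualK A e ξ) :=
    (isTestFun_psi_smul fun ξ hξ => hE.contDiffAt_dualK e hξ).smul_left (smooth_prod_coord J)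
  have hT1 : ∀ w, IsTestFun n
      (fun ξ => (∏ i, ξ (J i)) • psi n ξ • (∏ i, ξ (J i)) • projK A w ξ) := fun w =>
    (isTestFun_psi_smul fun ξ hξ => (smooth_prod_coord J).contDiffAt.smul
      (hE.contDiffAt_projK w hξ)).smul_left (smooth_prod_coord J)
  let L : W →ₗ[ℝ] W :=
    { toFun := fun w => ∫ ξ, (∏ i, ξ (J i)) • psi n ξ • (∏ i, ξ (J i)) • projK A w ξ
      map_add' := fun w w' => by
        simp only [projK_add, smul_add]
        exact integral_add ((hT1 w).integrable _) ((hT1 w').integrable _)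
      map_smul' := fun c w => by
        rw [RingHom.id_apply, ← integral_smul]
        refine integral_congr_ae (Eventually.of_forall fun ξ => ?_)
        simp only [projK_smul, smul_comm _ c] }
  have hL : ∀ w, L w = ∫ ξ, (∏ i, ξ (J i)) • psi n ξ • (∏ i, ξ (J i)) • projK A w ξ :=
    fun w => rfl
  have hzero : psi n (0 : Euc n) = 0 := psi_of_norm_le (by simp)
  have hsymm : L.IsSymmetric := by
    intro w w'
    rw [real_inner_comm, hL, hL, ← integral_inner ((hT1 w).integrable _),
      ← integral_inner ((hT1 w').integrable _)]
    refine integral_congr_ae (Eventually.of_forall fun ξ => ?_)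
    rcases eq_or_ne ξ 0 with rfl | hξ
    · simp [hzero]
    · simp only [inner_smul_right]
      rw [real_inner_comm, hE.inner_projK w w' hξ]
  have hmem : (∫ ξ, (∏ i, ξ (J i)) • psi n ξ • dualK A e ξ) ∈ LinearMap.range L := by
    rw [← Submodule.orthogonal_orthogonal (LinearMap.range L), hsymm.orthogonal_range,
      Submodule.mem_orthogonal]
    intro w hw
    rw [LinearMap.mem_ker, hL] at hw
    have h1 : ∫ ξ, psi n ξ * ((∏ i, ξ (J i)) ^ 2 * ‖projK A w ξ‖ ^ 2) = 0 := by
      have := congrArg (fun v => ⟪w, v⟫) hw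
      simp only [inner_zero_right] at this
      rw [← integral_inner ((hT1 w).integrable _)] at this
      rw [← this]
      refine integral_congr_ae (Eventually.of_forall fun ξ => ?_)
      rcases eq_or_ne ξ 0 with rfl | hξ
      · simp [hzero]
      · simp only [inner_smul_right]
        rw [← hE.projK_projK w hξ, ← hE.inner_projK w _ hξ, hE.projK_projK w hξ,
          real_inner_self_eq_norm_sq]
        ring
    have hT2 : IsTestFun n (fun ξ => psi n ξ • ((∏ i, ξ (J i)) ^ 2 * ‖projK A w ξ‖ ^ 2)) :=
      isTestFun_psi_smul fun ξ hξ => ((smooth_prod_coord J).contDiffAt.pow 2).mul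
        ((hE.contDiffAt_projK w hξ).norm_sq ℝ)
    have h2 : ∀ ξ, psi n ξ * ((∏ i, ξ (J i)) ^ 2 * ‖projK A w ξ‖ ^ 2) = 0 := by
      have h3 := (integral_eq_zero_iff_of_nonneg (fun ξ =>
        mul_nonneg (psi_nonneg ξ) (by positivity)) (hT2.integrable volume)).1 h1
      have h4 := (Continuous.ae_eq_iff_eq volume hT2.1.continuous continuous_const).1 h3
      exact fun ξ => congrFun h4 ξ
    have h5 : ∀ ξ ≠ 0, (∏ i, ξ (J i)) ≠ 0 → projK A w ξ = 0 := by
      intro ξ hξ hJ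
      have hξ' : 0 < ‖ξ‖ := norm_pos_iff.2 hξ
      have h6 := h2 ((2 / ‖ξ‖) • ξ)
      rw [psi_of_norm_eq (by rw [norm_smul]; simp [hξ'.ne']), prod_coord_smul,
        hE.projK_comp_smul w hξ (by positivity), one_mul, mul_eq_zero] at h6
      rcases h6 with h6 | h6
      · rw [pow_eq_zero_iff two_ne_zero, mul_eq_zero] at h6
        exact absurd h6 (not_or.2 ⟨by positivity, hJ⟩)
      · simpa using h6
    have h7 : ∀ ξ ≠ 0, projK A w ξ = 0 := by
      intro ξ hξ
      obtain ⟨η, hη, hη'⟩ := exists_nonzero_prod_tendsto ξ J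
      have h8 := (hE.contDiffAt_projK w hξ).continuousAt.tendsto.comp hη
      refine tendsto_nhds_unique h8 (tendsto_const_nhds.congr' ?_)
      filter_upwards [hη', hη.eventually_ne hξ] with i hi hi'
      exact (h5 _ hi' hi).symm
    have h9 := hWC w h7
    rw [← integral_inner (hT0.integrable _)]
    have hT3 : IsTestFun n (fun ξ => (∏ i, ξ (J i)) • psi n ξ • dagK A w ξ) :=
      (isTestFun_psi_smul fun ξ hξ => hE.contDiffAt_dagK w hξ).smul_left (smooth_prod_coord J)
    have h10 := integral_inner (𝕜 := ℝ) (hT3.integrable volume) e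
    rw [h9, inner_zero_right] at h10
    rw [← h10]
    refine integral_congr_ae (Eventually.of_forall fun ξ => ?_)
    rcases eq_or_ne ξ 0 with rfl | hξ
    · simp [hzero]
    · simp only [inner_smul_right]
      rw [real_inner_comm, hE.inner_dualK e w hξ]
  obtain ⟨w₁, hw₁⟩ := hmem
  refine ⟨fun ξ => dualK A e ξ - (∏ i, ξ (J i)) • projK A w₁ ξ, fun ξ hξ =>
    (hE.contDiffAt_dualK e hξ).sub ((smooth_prod_coord J).contDiffAt.smul
      (hE.contDiffAt_projK w₁ hξ)), fun ξ hξ => ?_, ?_⟩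
  · rw [map_sub, map_smul, hE.symA_dualK e hξ, hE.symA_projK w₁ hξ, smul_zero, sub_zero]
  · simp only [smul_sub]
    rw [integral_sub (hT0.integrable _) ((hT1 w₁).integrable _), ← hw₁, ← hL, sub_self]

end BandKernel

section ScaledRapid

variable {n k m : ℕ} {F : Type*} [NormedAddCommGroup F] [NormedSpace ℝ F]

lemma dirDeriv_dirDeriv {φ : Euc n → F} (hφ : ContDiff ℝ (⊤ : ℕ∞) φ) (I : Fin k → Fin n) (l : ℕ)
    (J : Fin l → Fin n) : ∃ N : ℕ, ∃ K : Fin N → Fin n, N = l + k ∧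
      dirDeriv n l J (dirDeriv n k I φ) = dirDeriv n N K φ := by
  induction l with
  | zero => exact ⟨k, I, by simp, funext fun x => dirDeriv_zero _ _ _⟩
  | succ l ih =>
    obtain ⟨N, K, hN, h⟩ := ih (Fin.tail J)
    refine ⟨N + 1, Fin.cons (J 0) K, by omega, funext fun x => ?_⟩
    rw [dirDeriv_succ (smooth_dirDeriv hφ I), h, dirDeriv_succ hφ, Fin.tail_cons, Fin.cons_zero]

lemma norm_dirDeriv_dirDeriv_le {φ : Euc n → F} (hφ : ContDiff ℝ (⊤ : ℕ∞) φ) (I : Fin k → Fin n)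
    {l : ℕ} (J : Fin l → Fin n) (x : Euc n) :
    ‖dirDeriv n l J (dirDeriv n k I φ) x‖ ≤ ‖iteratedFDeriv ℝ (l + k) φ x‖ := by
  obtain ⟨N, K, hN, h⟩ := dirDeriv_dirDeriv hφ I l J
  rw [h, ← hN]
  exact norm_dirDeriv_le _ _ _

lemma IsTestFun.exists_bound {φ : Euc n → F} (hφ : IsTestFun n φ) (m : ℕ) :
    ∃ C, 0 ≤ C ∧ ∀ x, ‖iteratedFDeriv ℝ m φ x‖ ≤ C := by
  obtain ⟨C, hC⟩ := (smooth_iteratedFDeriv (m := m) hφ.1).continuous.bounded_above_of_compact_support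
    (hφ.2.iteratedFDeriv m)
  exact ⟨C, (norm_nonneg _).trans (hC 0), hC⟩

lemma IsRapid.exists_scaled_bound {g : Euc n → F} (hg : IsRapid g) {ζ : Euc n → ℝ}
    (hζ : IsTestFun n ζ) (l p : ℕ) : ∃ C, 0 ≤ C ∧ ∀ s : ℝ, 1 ≤ s → ∀ x,
      (1 + s * ‖x‖) ^ p * ‖iteratedFDeriv ℝ l (fun y => ζ y • g (s • y)) x‖ ≤ C * s ^ l := by
  choose M hM0 hM using fun j => hζ.exists_bound j
  choose R hR0 hR using fun j => hg.2 p j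
  refine ⟨∑ i ∈ Finset.range (l + 1), (l.choose i : ℝ) * M i * R (l - i),
    Finset.sum_nonneg fun i _ => by have := hM0 i; have := hR0 (l - i); positivity,
    fun s hs x => ?_⟩
  have hgs : ContDiff ℝ (⊤ : ℕ∞) (fun y => g (s • y)) := hg.1.comp (contDiff_const_smul s)
  have h0 : 0 ≤ s := zero_le_one.trans hs
  calc _ ≤ (1 + s * ‖x‖) ^ p * ∑ i ∈ Finset.range (l + 1), (l.choose i : ℝ) *
        ‖iteratedFDeriv ℝ i ζ x‖ * ‖iteratedFDeriv ℝ (l - i) (fun y => g (s • y)) x‖ := by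
        gcongr
        exact norm_iteratedFDeriv_smul_le (N := (⊤ : ℕ∞)) hζ.1 hgs x (by exact_mod_cast le_top)
    _ = ∑ i ∈ Finset.range (l + 1), (l.choose i : ℝ) * ‖iteratedFDeriv ℝ i ζ x‖ *
        ((1 + s * ‖x‖) ^ p * ‖iteratedFDeriv ℝ (l - i) (fun y => g (s • y)) x‖) := by
        rw [Finset.mul_sum]; refine Finset.sum_congr rfl fun i _ => by ring
    _ ≤ ∑ i ∈ Finset.range (l + 1), (l.choose i : ℝ) * M i * (R (l - i) * s ^ l) := by
        refine Finset.sum_le_sum fun i _ => ?_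
        have h1 : (1 + s * ‖x‖) ^ p * ‖iteratedFDeriv ℝ (l - i) (fun y => g (s • y)) x‖ ≤
            R (l - i) * s ^ l := by
          rw [iteratedFDeriv_comp_const_smul (i := l - i) s
            (contDiff_infty.1 hg.1 _),
            norm_smul, norm_pow, Real.norm_of_nonneg h0]
          have h2 := hR (l - i) (s • x)
          rw [norm_smul, Real.norm_of_nonneg h0] at h2
          calc _ = ((1 + s * ‖x‖) ^ p * ‖iteratedFDeriv ℝ (l - i) g (s • x)‖) * s ^ (l - i) := by
                ring
            _ ≤ R (l - i) * s ^ l := by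
                gcongr
                · exact hR0 _
                · omega
        have := hM0 i
        have := hM i x
        gcongr
    _ = _ := by rw [Finset.sum_mul]; refine Finset.sum_congr rfl fun i _ => by ring

/-- The localization cutoff. -/
noncomputable def eta (n : ℕ) (x : Euc n) : ℝ := chi n ((4 : ℝ) • x)

lemma norm_four_smul (x : Euc n) : ‖(4 : ℝ) • x‖ = 4 * ‖x‖ := by
  rw [norm_smul, Real.norm_ofNat]

lemma isTestFun_eta : IsTestFun n (eta n) := isTestFun_chi.comp_smul (by norm_num)

lemma eta_of_lt {x : Euc n} (h : ‖x‖ < 1 / 4) : eta n =ᶠ[𝓝 x] fun _ => 1 := by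
  have : {y : Euc n | ‖y‖ < 1 / 4} ∈ 𝓝 x := (isOpen_lt continuous_norm continuous_const).mem_nhds h
  filter_upwards [this] with y hy
  exact chi_of_norm_le (by rw [norm_four_smul]; linarith)

lemma eta_of_le {x : Euc n} (h : 1 / 2 ≤ ‖x‖) : eta n =ᶠ[𝓝 x] fun _ => 0 := by
  have : {y : Euc n | 3 / 8 < ‖y‖} ∈ 𝓝 x :=
    (isOpen_lt continuous_const continuous_norm).mem_nhds (by rw [Set.mem_ofPred_eq]; linarith)
  filter_upwards [this] with y hy
  exact chi_of_le_norm (by rw [norm_four_smul]; linarith)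

/-- Localized low-pass kernels. -/
noncomputable def kap (n : ℕ) (s : ℝ) (x : Euc n) : ℝ := s ^ n * (eta n x * rho n (s • x))

lemma isTestFun_kap (s : ℝ) : IsTestFun n (kap n s) := by
  have h : IsTestFun n (fun x => eta n x • rho n (s • x)) :=
    isTestFun_eta.smul (isRapid_rho.1.comp (contDiff_const_smul s))
  exact h.const_smul (s ^ n)

lemma kap_of_le {x : Euc n} (s : ℝ) (h : 1 / 2 ≤ ‖x‖) : kap n s =ᶠ[𝓝 x] fun _ => 0 := by
  filter_upwards [eta_of_le h] with y hy
  rw [kap, hy]; simp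

lemma exists_kap_bound (l p : ℕ) : ∃ C, 0 ≤ C ∧ ∀ s : ℝ, 1 ≤ s → ∀ x : Euc n,
    (1 + s * ‖x‖) ^ p * ‖iteratedFDeriv ℝ l (kap n s) x‖ ≤ C * s ^ (n + l) := by
  obtain ⟨C, hC, h⟩ := (isRapid_rho (n := n)).exists_scaled_bound isTestFun_eta l p
  refine ⟨C, hC, fun s hs x => ?_⟩
  have h1 : kap n s = fun y => s ^ n • (fun y => eta n y • rho n (s • y)) y := rfl
  have h2 : ContDiff ℝ (⊤ : ℕ∞) (fun y : Euc n => eta n y • rho n (s • y)) :=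
    isTestFun_eta.1.smul (isRapid_rho.1.comp (contDiff_const_smul s))
  rw [h1, iteratedFDeriv_const_smul_apply' (h2.contDiffAt.of_le (by exact_mod_cast le_top)),
    norm_smul, Real.norm_of_nonneg (by positivity)]
  calc _ = s ^ n * ((1 + s * ‖x‖) ^ p *
        ‖iteratedFDeriv ℝ l (fun y : Euc n => eta n y • rho n (s • y)) x‖) := by ring
    _ ≤ s ^ n * (C * s ^ l) := by exact mul_le_mul_of_nonneg_left (h s hs x) (by positivity)
    _ = _ := by ring

end ScaledRapid

section DyadicSum

lemma sum_two_pow_ratio_le (N : ℕ) {t : ℝ} (ht : 0 ≤ t) :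
    ∑ i ∈ Finset.range N, (2 ^ i * t) / (1 + 2 ^ i * t) ^ 2 ≤ 2 := by
  have key : ∀ N : ℕ, ∑ i ∈ Finset.range N, (2 ^ i * t) / (1 + 2 ^ i * t) ^ 2 ≤
      2 * ((2 ^ N * t) / (1 + 2 ^ N * t) - t / (1 + t)) := by
    intro N
    induction N with
    | zero => simp
    | succ N ih =>
      rw [Finset.sum_range_succ]
      set s := 2 ^ N * t with hs
      have hs0 : 0 ≤ s := by positivity
      have h1 : (2 : ℝ) ^ (N + 1) * t = 2 * s := by rw [hs]; ring
      have h2 : s / (1 + s) ^ 2 ≤ 2 * (2 * s / (1 + 2 * s) - s / (1 + s)) := by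
        rw [div_sub_div _ _ (by positivity) (by positivity), ← mul_div_assoc,
          div_le_div_iff₀ (by positivity) (by positivity)]
        have : 0 ≤ s ^ 2 := by positivity
        have : 0 ≤ s ^ 3 := by positivity
        nlinarith
      rw [h1]; linarith
  refine (key N).trans ?_
  have h1 : (2 ^ N * t) / (1 + 2 ^ N * t) ≤ 1 := by
    rw [div_le_one (by positivity)]; linarith
  have h2 : 0 ≤ t / (1 + t) := by positivity
  linarith

lemma sum_half_pow_le (N : ℕ) : ∑ i ∈ Finset.range N, ((2 : ℝ) ^ i)⁻¹ ≤ 2 := by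
  have h : ∀ N : ℕ, ∑ i ∈ Finset.range N, ((2 : ℝ) ^ i)⁻¹ = 2 - 2 * (2 ^ N)⁻¹ := by
    intro N
    induction N with
    | zero => simp
    | succ N ih => rw [Finset.sum_range_succ, ih, pow_succ]; field_simp; ring
  rw [h]
  have : (0 : ℝ) ≤ (2 ^ N)⁻¹ := by positivity
  linarith

end DyadicSum

section Kernel

variable {n k m : ℕ} {V W : Type*}
  [NormedAddCommGroup V] [InnerProductSpace ℝ V] [FiniteDimensional ℝ V]
  [NormedAddCommGroup W] [InnerProductSpace ℝ W] [FiniteDimensional ℝ W]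

/-- A localized dyadic decomposition of the adjoint fundamental solution with error. -/
structure KernelSys (A : CoeffOp n k V W) (J : Fin m → Fin n) (e : V) where
  /-- main kernels -/
  g : ℕ → Euc n → W
  /-- error kernels -/
  E : ℕ → Euc n → V
  /-- common bound -/
  C : ℝ
  C_nonneg : 0 ≤ C
  test_g : ∀ i, IsTestFun n (g i)
  test_E : ∀ i, IsTestFun n (E i)
  g_zero : ∀ i x, 1 / 2 ≤ ‖x‖ → g i =ᶠ[𝓝 x] fun _ => 0
  E_zero : ∀ i x, 1 / 2 ≤ ‖x‖ → E i =ᶠ[𝓝 x] fun _ => 0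
  Astar_g : ∀ i x, Astar n k A (g i) x = (kap n (2 ^ (i + 1)) x - kap n (2 ^ i) x) • e + E i x
  bound_g : ∀ i l, l ≤ k → ∀ x, (1 + 2 ^ i * ‖x‖) ^ (n + 1) * ‖iteratedFDeriv ℝ l (g i) x‖ ≤
    C * ((2 ^ i) ^ n * (2 ^ i) ^ l / (2 ^ i) ^ k)
  bound_E : ∀ i l, l ≤ k → ∀ I x, ‖dirDeriv n l I (E i) x‖ ≤ C / (2 ^ i) ^ (k + 1)
  sum_g : ∀ N x, ∑ i ∈ Finset.range N, ‖dirDeriv n m J (g i) x‖ ≤ C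

lemma IsRapid.dirDeriv_bound_of_zero {Ψ : Euc n → W} (hΨ : IsRapid Ψ) (J : Fin m → Fin n)
    (h0 : dirDeriv n m J Ψ 0 = 0) :
    ∃ C, 0 ≤ C ∧ ∀ y, ‖dirDeriv n m J Ψ y‖ ≤ C * (‖y‖ / (1 + ‖y‖) ^ 2) := by
  obtain ⟨C1, hC1, h1⟩ := hΨ.2 0 (m + 1)
  obtain ⟨C2, hC2, h2⟩ := hΨ.2 2 m
  refine ⟨4 * C1 + C2, by positivity, fun y => ?_⟩
  rcases le_total ‖y‖ 1 with hy | hy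
  · have h3 : ‖dirDeriv n m J Ψ y - dirDeriv n m J Ψ 0‖ ≤ C1 * ‖y - 0‖ := by
      refine Convex.norm_image_sub_le_of_norm_fderiv_le (𝕜 := ℝ) (s := Set.univ)
        (fun x _ => (smooth_differentiable (smooth_dirDeriv hΨ.1 J)) x) (fun x _ => ?_)
        convex_univ (Set.mem_univ _) (Set.mem_univ _)
      have h4 : HasFDerivAt (dirDeriv n m J Ψ)
          ((ContinuousMultilinearMap.apply ℝ (fun _ : Fin m => Euc n) W
            (fun i => stdVec n (J i))).comp (fderiv ℝ (iteratedFDeriv ℝ m Ψ) x)) x :=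
        (ContinuousMultilinearMap.apply ℝ (fun _ : Fin m => Euc n) W
            (fun i => stdVec n (J i))).hasFDerivAt.comp x
          ((smooth_differentiable (smooth_iteratedFDeriv hΨ.1 m)) x).hasFDerivAt
      rw [h4.fderiv]
      refine ContinuousLinearMap.opNorm_le_bound _ hC1 fun v => ?_
      have h5 := h1 x
      rw [pow_zero, one_mul, ← norm_fderiv_iteratedFDeriv] at h5
      rw [ContinuousLinearMap.comp_apply, ContinuousMultilinearMap.apply_apply]
      calc _ ≤ ‖fderiv ℝ (iteratedFDeriv ℝ m Ψ) x v‖ * ∏ i, ‖stdVec n (J i)‖ :=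
            ContinuousMultilinearMap.le_opNorm _ _
        _ = ‖fderiv ℝ (iteratedFDeriv ℝ m Ψ) x v‖ := by simp [norm_stdVec]
        _ ≤ ‖fderiv ℝ (iteratedFDeriv ℝ m Ψ) x‖ * ‖v‖ := ContinuousLinearMap.le_opNorm _ _
        _ ≤ _ := by gcongr
    rw [h0, sub_zero, sub_zero] at h3
    have h6 : ‖y‖ ≤ 4 * (‖y‖ / (1 + ‖y‖) ^ 2) := by
      rw [← mul_div_assoc, le_div_iff₀ (by positivity)]
      nlinarith [norm_nonneg y, mul_nonneg (norm_nonneg y) (norm_nonneg y)]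
    have h7 : 0 ≤ ‖y‖ / (1 + ‖y‖) ^ 2 := by positivity
    nlinarith
  · have h3 := h2 y
    have h4 := norm_dirDeriv_le Ψ J y
    have h5 : ‖dirDeriv n m J Ψ y‖ ≤ C2 / (1 + ‖y‖) ^ 2 := by
      rw [le_div_iff₀ (by positivity), mul_comm]
      exact (mul_le_mul_of_nonneg_left h4 (by positivity)).trans h3
    refine h5.trans ?_
    rw [← mul_div_assoc]
    gcongr
    nlinarith

lemma far_bound {p n k l : ℕ} (hp : n + 2 * k + 1 = p) (hl : l ≤ k) {s t X C : ℝ} (hs : 1 ≤ s)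
    (ht : 1 / 4 ≤ t) (hX : 0 ≤ X) (hC : 0 ≤ C) (h : (1 + s * t) ^ p * X ≤ C * s ^ (n + l)) :
    X ≤ 4 ^ p * C / s ^ (k + 1) := by
  have hs0 : 0 < s := by linarith
  have h1 : (s / 4) ^ p * X ≤ C * s ^ (n + l) :=
    (mul_le_mul_of_nonneg_right (pow_le_pow_left₀ (by positivity) (by nlinarith) _) hX).trans h
  rw [div_pow, div_mul_eq_mul_div, div_le_iff₀ (by positivity)] at h1
  rw [le_div_iff₀ (by positivity)]
  have h2 : s ^ (n + l) * s ^ (k + 1) ≤ s ^ p := by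
    rw [← pow_add]; exact pow_le_pow_right₀ hs (by omega)
  have h3 : s ^ p * (X * s ^ (k + 1)) ≤ s ^ p * (4 ^ p * C) := by
    calc s ^ p * (X * s ^ (k + 1)) = (s ^ p * X) * s ^ (k + 1) := by ring
      _ ≤ (C * s ^ (n + l) * 4 ^ p) * s ^ (k + 1) := by gcongr
      _ = (C * 4 ^ p) * (s ^ (n + l) * s ^ (k + 1)) := by ring
      _ ≤ (C * 4 ^ p) * s ^ p := by gcongr
      _ = _ := by ring
  exact le_of_mul_le_mul_left h3 (by positivity)

lemma Astar_congr_nhds {A : CoeffOp n k V W} {g g' : Euc n → W} {x : Euc n} (h : g =ᶠ[𝓝 x] g') :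
    Astar n k A g x = Astar n k A g' x := by
  simp only [Astar, dirDeriv_congr_nhds h]

lemma exists_norm_Astar_dirDeriv_le (A : CoeffOp n k V W) : ∃ a, 0 ≤ a ∧ ∀ (g : Euc n → W),
    ContDiff ℝ (⊤ : ℕ∞) g → ∀ (l : ℕ) (I : Fin l → Fin n) (x : Euc n),
      ‖dirDeriv n l I (Astar n k A g) x‖ ≤ a * ‖iteratedFDeriv ℝ (l + k) g x‖ := by
  refine ⟨∑ I : Fin k → Fin n, ‖(LinearMap.adjoint (A I)).toContinuousLinearMap‖,
    Finset.sum_nonneg fun _ _ => norm_nonneg _, fun g hg l I x => ?_⟩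
  rw [← Astar_dirDeriv I hg, Astar_eq_sum_clm, Finset.sum_mul]
  refine norm_sum_le_of_le _ fun K _ => ?_
  refine (ContinuousLinearMap.le_opNorm _ _).trans ?_
  gcongr
  rw [← dirDeriv_comm hg]
  exact norm_dirDeriv_dirDeriv_le hg K I x

theorem IsElliptic.exists_kernel {A : CoeffOp n k V W} (hE : IsElliptic n k A)
    (J : Fin m → Fin n) (hm : m + n ≤ k)
    (hWC : m + n = k → ∀ w : W, (∀ ξ ≠ 0, projK A w ξ = 0) →
      ∫ ξ, (∏ i, ξ (J i)) • psi n ξ • dagK A w ξ = 0) (e : V) :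
    Nonempty (KernelSys A J e) := by
  obtain ⟨b, hb, hbe, hb0⟩ : ∃ b : Euc n → W, (∀ ξ ≠ 0, ContDiffAt ℝ (⊤ : ℕ∞) b ξ) ∧
      (∀ ξ ≠ 0, symA A ξ (b ξ) = e) ∧
      (m + n = k → ∫ ξ, (∏ i, ξ (J i)) • psi n ξ • b ξ = 0) := by
    by_cases h : m + n = k
    · obtain ⟨b, h1, h2, h3⟩ := hE.exists_kernel_symbol J (hWC h) e
      exact ⟨b, h1, h2, fun _ => h3⟩
    · exact ⟨dualK A e, fun ξ hξ => hE.contDiffAt_dualK e hξ, fun ξ hξ => hE.symA_dualK e hξ,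
        fun h' => absurd h' h⟩
  set Ψ : Euc n → W := bandK k b with hΨdef
  have hΨ : IsRapid Ψ := isRapid_bandK hb
  have hAΨ : ∀ x, Astar n k A Ψ x = osc 0 (psi n) x • e := Astar_bandK hb hbe
  let G : ℝ → Euc n → W := fun s y => eta n y • Ψ (s • y)
  have hΨs : ∀ s : ℝ, ContDiff ℝ (⊤ : ℕ∞) (fun y => Ψ (s • y)) := fun s =>
    hΨ.1.comp (contDiff_const_smul s)
  have hG : ∀ s, IsTestFun n (G s) := fun s => isTestFun_eta.smul (hΨs s)
  let g : ℝ → Euc n → W := fun s y => (s ^ n / s ^ k) • G s y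
  have hg : ∀ s, IsTestFun n (g s) := fun s => (hG s).const_smul _
  choose R hR0 hR using fun l p => hΨ.exists_scaled_bound (isTestFun_eta (n := n)) l p
  have hgR : ∀ l p (s : ℝ), 1 ≤ s → ∀ x, (1 + s * ‖x‖) ^ p * ‖iteratedFDeriv ℝ l (g s) x‖ ≤
      R l p * (s ^ n * s ^ l / s ^ k) := by
    intro l p s hs x
    rw [iteratedFDeriv_const_smul_apply' (contDiff_infty.1 (hG s).1 _).contDiffAt,
      norm_smul, Real.norm_of_nonneg (by positivity)]
    calc _ = s ^ n / s ^ k * ((1 + s * ‖x‖) ^ p * ‖iteratedFDeriv ℝ l (G s) x‖) := by ring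
      _ ≤ s ^ n / s ^ k * (R l p * s ^ l) :=
        mul_le_mul_of_nonneg_left (hR l p s hs x) (by positivity)
      _ = _ := by ring
  have hgz : ∀ s x, 1 / 2 ≤ ‖x‖ → g s =ᶠ[𝓝 x] fun _ => 0 := by
    intro s x hx
    filter_upwards [eta_of_le hx] with y hy
    simp [g, G, hy]
  have hgn : ∀ s x, ‖x‖ < 1 / 4 → g s =ᶠ[𝓝 x] fun y => (s ^ n / s ^ k) • Ψ (s • y) := by
    intro s x hx
    filter_upwards [eta_of_lt hx] with y hy
    simp [g, G, hy]
  let E : ℝ → Euc n → V := fun s x => Astar n k A (g s) x - (kap n (2 * s) x - kap n s x) • e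
  have hke : ∀ s : ℝ, IsTestFun n (fun x => kap n s x • e) := fun s => (isTestFun_kap s).smul_const e
  have hE' : E = fun s x => Astar n k A (g s) x - ((kap n (2 * s) x) • e - kap n s x • e) := by
    funext s x; simp only [E, sub_smul]
  have hET : ∀ s, IsTestFun n (E s) := fun s => by
    rw [hE']; exact (hg s).Astar.sub ((hke _).sub (hke _))
  have hEz : ∀ s x, 1 / 2 ≤ ‖x‖ → E s =ᶠ[𝓝 x] fun _ => 0 := by
    intro s x hx
    filter_upwards [(hgz s x hx).eventually_nhds, kap_of_le s hx, kap_of_le (2 * s) hx] with y h1 h2 h3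
    simp only [E, h2, h3, Astar_congr_nhds h1, sub_self, zero_smul, sub_zero]
    simp [Astar, dirDeriv_zero_fun]
  have hEn : ∀ s : ℝ, 1 ≤ s → ∀ x : Euc n, ‖x‖ < 1 / 4 → E s =ᶠ[𝓝 x] fun _ => 0 := by
    intro s hs x hx
    have hs0 : s ≠ 0 := by positivity
    filter_upwards [(hgn s x hx).eventually_nhds, eta_of_lt hx] with y h1 h2
    simp only [E, Astar_congr_nhds h1, kap, h2, Astar_const_smul _ (hΨs s), Astar_comp_smul s hΨ.1,
      hAΨ, osc_psi, smul_smul]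
    rw [← sub_smul, mul_comm (2 : ℝ) s, smul_eq_zero]
    left
    field_simp
    ring
  obtain ⟨a, ha, hAb⟩ := exists_norm_Astar_dirDeriv_le A
  choose Q hQ0 hQ using fun l p => exists_kap_bound (n := n) l p
  set p := n + 2 * k + 1 with hp
  have hEb : ∀ l ≤ k, ∀ s : ℝ, 1 ≤ s → ∀ (I : Fin l → Fin n) x, ‖dirDeriv n l I (E s) x‖ ≤
      (4 ^ p * (a * R (l + k) p) + 4 ^ p * (Q l p * ‖e‖) + 4 ^ p * (Q l p * ‖e‖)) / s ^ (k + 1) := by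
    intro l hl s hs I x
    have := hR0 (l + k) p
    have := hQ0 l p
    have hs0 : 0 < s := by positivity
    rcases lt_or_ge ‖x‖ (1 / 4) with hx | hx
    · rw [dirDeriv_congr_nhds (hEn s hs x hx), dirDeriv_zero_fun, norm_zero]; positivity
    · rw [hE', dirDeriv_sub (hg s).Astar.1 ((hke _).sub (hke _)).1, dirDeriv_sub (hke _).1 (hke _).1,
        add_div, add_div, add_assoc]
      have hkb : ∀ s : ℝ, 1 ≤ s → ‖dirDeriv n l I (fun x => kap n s x • e) x‖ ≤
          4 ^ p * (Q l p * ‖e‖) / s ^ (k + 1) := by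
        intro s hs
        refine far_bound hp.symm hl hs hx (norm_nonneg _) (by positivity) ?_
        rw [dirDeriv_smul_const _ (isTestFun_kap s).1, norm_smul]
        calc _ ≤ (1 + s * ‖x‖) ^ p * (‖iteratedFDeriv ℝ l (kap n s) x‖ * ‖e‖) := by
              gcongr; exact norm_dirDeriv_le _ _ _
          _ = ((1 + s * ‖x‖) ^ p * ‖iteratedFDeriv ℝ l (kap n s) x‖) * ‖e‖ := by ring
          _ ≤ (Q l p * s ^ (n + l)) * ‖e‖ := by exact mul_le_mul_of_nonneg_right (hQ l p s hs x) (norm_nonneg _)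
          _ = _ := by ring
      refine (norm_sub_le _ _).trans (add_le_add ?_ ((norm_sub_le _ _).trans (add_le_add ?_ ?_)))
      · refine far_bound hp.symm hl hs hx (norm_nonneg _) (by positivity) ?_
        calc _ ≤ (1 + s * ‖x‖) ^ p * (a * ‖iteratedFDeriv ℝ (l + k) (g s) x‖) := by
              gcongr; exact hAb _ (hg s).1 _ _ _
          _ = a * ((1 + s * ‖x‖) ^ p * ‖iteratedFDeriv ℝ (l + k) (g s) x‖) := by ring
          _ ≤ a * (R (l + k) p * (s ^ n * s ^ (l + k) / s ^ k)) := by exact mul_le_mul_of_nonneg_left (hgR _ _ s hs x) ha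
          _ = _ := by rw [pow_add s l k, pow_add]; field_simp
      · refine (hkb (2 * s) (by linarith)).trans ?_
        gcongr
        linarith
      · exact hkb s hs
  obtain ⟨D, hD0, hD⟩ : ∃ D, 0 ≤ D ∧ ∀ N x, ∑ i ∈ Finset.range N, ‖dirDeriv n m J (g (2 ^ i)) x‖ ≤ D := by
    have hgm : ∀ p i x, (1 + 2 ^ i * ‖x‖) ^ p * ‖dirDeriv n m J (g (2 ^ i)) x‖ ≤
        R m p * (((2 : ℝ) ^ i) ^ n * (2 ^ i) ^ m / (2 ^ i) ^ k) := fun p i x =>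
      (mul_le_mul_of_nonneg_left (norm_dirDeriv_le _ _ _) (by positivity)).trans
        (hgR m p (2 ^ i) (one_le_pow₀ one_le_two) x)
    rcases hm.lt_or_eq with hm' | hm'
    · refine ⟨R m 0 * 2, mul_nonneg (hR0 _ _) zero_le_two, fun N x => ?_⟩
      refine le_trans ?_ (mul_le_mul_of_nonneg_left (sum_half_pow_le N) (hR0 m 0))
      rw [Finset.mul_sum]
      refine Finset.sum_le_sum fun i _ => ?_
      have h1 := hgm 0 i x
      rw [pow_zero, one_mul] at h1
      refine h1.trans (mul_le_mul_of_nonneg_left ?_ (hR0 _ _))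
      rw [div_le_iff₀ (by positivity), inv_mul_eq_div, le_div_iff₀ (by positivity), ← pow_add,
        ← pow_succ]
      exact pow_le_pow_right₀ (one_le_pow₀ one_le_two) (by omega)
    · have hΨ0 : dirDeriv n m J Ψ 0 = 0 := by
        rw [hΨdef, dirDeriv_bandK_zero hb, hb0 hm']; simp
      obtain ⟨L, hL0, hL⟩ := hΨ.dirDeriv_bound_of_zero J hΨ0
      have hc : ∀ i : ℕ, ((2 : ℝ) ^ i) ^ n * (2 ^ i) ^ m / (2 ^ i) ^ k = 1 := fun i => by
        rw [← pow_add, add_comm n m, hm', div_self (by positivity)]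
      refine ⟨(L + 5 * R m 1) * 2, by have := hR0 m 1; positivity, fun N x => ?_⟩
      refine le_trans ?_ (mul_le_mul_of_nonneg_left (sum_two_pow_ratio_le N (norm_nonneg x))
        (by have := hR0 m 1; positivity))
      rw [Finset.mul_sum]
      refine Finset.sum_le_sum fun i _ => ?_
      have := hR0 m 1
      have hr : 0 ≤ 2 ^ i * ‖x‖ / (1 + 2 ^ i * ‖x‖) ^ 2 := by positivity
      rcases lt_or_ge ‖x‖ (1 / 4) with hx | hx
      · rw [dirDeriv_congr_nhds (hgn _ x hx), dirDeriv_const_smul _ (hΨs _),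
          dirDeriv_comp_smul _ hΨ.1, smul_smul, norm_smul]
        have h1 := hL ((2 : ℝ) ^ i • x)
        have h2 : ((2 : ℝ) ^ i) ^ n / (2 ^ i) ^ k * (2 ^ i) ^ m = 1 := by rw [← hc i]; ring
        rw [h2, norm_one, one_mul]
        rw [norm_smul, Real.norm_of_nonneg (by positivity)] at h1
        refine h1.trans ?_
        gcongr
        linarith
      · have h1 := hgm 1 i x
        rw [hc, mul_one, pow_one] at h1
        have ht : 1 / 4 ≤ 2 ^ i * ‖x‖ := by
          have : (1 : ℝ) ≤ 2 ^ i := one_le_pow₀ one_le_two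
          nlinarith
        set t := 2 ^ i * ‖x‖
        have h2 : ‖dirDeriv n m J (g (2 ^ i)) x‖ ≤ 5 * R m 1 * (t / (1 + t) ^ 2) := by
          rw [← mul_div_assoc, le_div_iff₀ (by positivity)]
          calc _ = (1 + t) * ((1 + t) * ‖dirDeriv n m J (g (2 ^ i)) x‖) := by ring
            _ ≤ (5 * t) * R m 1 := mul_le_mul (by linarith) h1 (by positivity) (by positivity)
            _ = _ := by ring
        refine h2.trans ?_
        gcongr
        linarith
  set C1 := ∑ l ∈ Finset.range (k + 1), R l (n + 1) with hC1
  set C2 := ∑ l ∈ Finset.range (k + 1),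
    (4 ^ p * (a * R (l + k) p) + 4 ^ p * (Q l p * ‖e‖) + 4 ^ p * (Q l p * ‖e‖)) with hC2
  have hC2' : ∀ l, 0 ≤ 4 ^ p * (a * R (l + k) p) + 4 ^ p * (Q l p * ‖e‖) + 4 ^ p * (Q l p * ‖e‖) := by
    intro l
    have := hR0 (l + k) p
    have := hQ0 l p
    positivity
  have h1 : 0 ≤ C1 := Finset.sum_nonneg fun l _ => hR0 _ _
  have h2 : 0 ≤ C2 := Finset.sum_nonneg fun l _ => hC2' l
  have two : ∀ i : ℕ, (1 : ℝ) ≤ 2 ^ i := fun i => one_le_pow₀ one_le_two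
  refine ⟨⟨fun i => g (2 ^ i), fun i => E (2 ^ i), C1 + C2 + D, by positivity, fun i => hg _,
    fun i => hET _, fun i => hgz _, fun i => hEz _, fun i x => ?_, fun i l hl x => ?_,
    fun i l hl I x => ?_, fun N x => (hD N x).trans (by linarith)⟩⟩
  · simp only [E]
    rw [pow_succ, mul_comm ((2 : ℝ) ^ i) 2, add_sub_cancel]
  · refine (hgR l (n + 1) _ (two i) x).trans ?_
    gcongr
    have : R l (n + 1) ≤ C1 := Finset.single_le_sum (f := fun l => R l (n + 1))
      (fun l _ => hR0 _ _) (Finset.mem_range.2 (by omega))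
    linarith
  · refine (hEb l hl _ (two i) I x).trans ?_
    refine div_le_div_of_nonneg_right ?_ (by positivity)
    have : (4 ^ p * (a * R (l + k) p) + 4 ^ p * (Q l p * ‖e‖) + 4 ^ p * (Q l p * ‖e‖)) ≤ C2 :=
      Finset.single_le_sum (f := fun l => 4 ^ p * (a * R (l + k) p) + 4 ^ p * (Q l p * ‖e‖) +
      4 ^ p * (Q l p * ‖e‖)) (fun l _ => hC2' l) (Finset.mem_range.2 (by omega : l < k + 1))
    linarith

end Kernel

section BallBounds

variable {n : ℕ} {F : Type*} [NormedAddCommGroup F] [InnerProductSpace ℝ F]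

lemma locInt_ball {σ : Measure (Euc n)} {f : Euc n → F} (hf : LocallyIntegrable f σ) (x : Euc n)
    (r : ℝ) : IntegrableOn f (ball x r) σ :=
  (hf.integrableOn_isCompact (isCompact_closedBall x r)).mono_set ball_subset_closedBall

lemma sum_norm_cv_le {σ : Measure (Euc n)} {f : Euc n → F} (hf : LocallyIntegrable f σ)
    {κ : ℕ → Euc n → F} (hκ : ∀ i, IsTestFun n (κ i)) {r c : ℝ} {N : ℕ}
    (h0 : ∀ i z, r ≤ ‖z‖ → κ i z = 0) (hc : ∀ z, ∑ i ∈ Finset.range N, ‖κ i z‖ ≤ c) (x : Euc n) :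
    ∑ i ∈ Finset.range N, ‖cv σ (innerB F) f (κ i) x‖ ≤ c * ∫ y in ball x r, ‖f y‖ ∂σ := by
  calc _ ≤ ∑ i ∈ Finset.range N, ∫ y, ‖f y‖ * ‖κ i (x - y)‖ ∂σ := by
        refine Finset.sum_le_sum fun i _ => (norm_cv_le _ hf (hκ i) x).trans ?_
        refine mul_le_of_le_one_left (integral_nonneg fun y => by positivity) norm_innerB_le
    _ = ∫ y, ∑ i ∈ Finset.range N, ‖f y‖ * ‖κ i (x - y)‖ ∂σ :=
        (integral_finsetSum _ fun i _ => integrable_norm_cv hf (hκ i) x).symm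
    _ = ∫ y in ball x r, ∑ i ∈ Finset.range N, ‖f y‖ * ‖κ i (x - y)‖ ∂σ := by
        refine (setIntegral_eq_integral_of_forall_compl_eq_zero fun y hy => ?_).symm
        refine Finset.sum_eq_zero fun i _ => ?_
        rw [mem_ball, not_lt, dist_comm, dist_eq_norm] at hy
        rw [h0 i _ hy, norm_zero, mul_zero]
    _ ≤ ∫ y in ball x r, c * ‖f y‖ ∂σ := by
        refine setIntegral_mono_on ?_ ((locInt_ball hf x r).norm.const_mul c) measurableSet_ball
          fun y _ => ?_
        · exact integrable_finsetSum _ fun i _ => (integrable_norm_cv hf (hκ i) x).integrableOn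
        · rw [← Finset.mul_sum, mul_comm]
          exact mul_le_mul_of_nonneg_right (hc _) (norm_nonneg _)
    _ = _ := integral_const_mul _ _

lemma norm_cv_le_ball {σ : Measure (Euc n)} {f : Euc n → F} (hf : LocallyIntegrable f σ)
    {κ : Euc n → F} (hκ : IsTestFun n κ) {r c : ℝ}
    (h0 : ∀ z, r ≤ ‖z‖ → κ z = 0) (hc : ∀ z, ‖κ z‖ ≤ c) (x : Euc n) :
    ‖cv σ (innerB F) f κ x‖ ≤ c * ∫ y in ball x r, ‖f y‖ ∂σ := by
  simpa using sum_norm_cv_le (N := 1) hf (κ := fun _ => κ) (fun _ => hκ) (fun _ => h0)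
    (by simpa using hc) x

end BallBounds

section Rep

variable {n k m : ℕ} {V W : Type*}
  [NormedAddCommGroup V] [InnerProductSpace ℝ V] [FiniteDimensional ℝ V]
  [NormedAddCommGroup W] [InnerProductSpace ℝ W] [FiniteDimensional ℝ W]

/-- The localized low-pass kernels at scale `r`. -/
noncomputable def kapr (n : ℕ) (r : ℝ) (N : ℕ) (z : Euc n) : ℝ :=
  (r⁻¹) ^ n * kap n (2 ^ N) (r⁻¹ • z)

lemma isTestFun_kapr {r : ℝ} (hr : 0 < r) (N : ℕ) : IsTestFun n (kapr n r N) :=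
  ((isTestFun_kap _).comp_smul (inv_pos.2 hr).ne').const_smul ((r⁻¹) ^ n)

/-- Derivatives of the low-pass regularizations of `⟪u, e⟫`. -/
noncomputable def lowpass (u : Euc n → V) (e : V) (J : Fin m → Fin n) (r : ℝ) (N : ℕ)
    (x : Euc n) : ℝ :=
  cv volume (innerB V) u (fun z => dirDeriv n m J (kapr n r N) z • e) x

lemma half_le_norm_inv_smul {r : ℝ} (hr : 0 < r) {z : Euc n} (hz : r ≤ ‖z‖) :
    1 / 2 ≤ ‖r⁻¹ • z‖ := by
  rw [norm_smul, Real.norm_of_nonneg (inv_pos.2 hr).le, inv_mul_eq_div, le_div_iff₀ hr]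
  linarith

lemma dirDeriv_kapr (r : ℝ) (N : ℕ) (J : Fin m → Fin n) (z : Euc n) :
    dirDeriv n m J (kapr n r N) z = (r⁻¹) ^ (n + m) * dirDeriv n m J (kap n (2 ^ N)) (r⁻¹ • z) := by
  have h : kapr n r N = fun z => (r⁻¹) ^ n • (fun z => kap n (2 ^ N) (r⁻¹ • z)) z := rfl
  have h1 : ContDiff ℝ (⊤ : ℕ∞) (fun z : Euc n => kap n (2 ^ N) (r⁻¹ • z)) :=
    (isTestFun_kap _).1.comp (contDiff_const_smul _)
  rw [h, dirDeriv_const_smul _ h1,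
    dirDeriv_comp_smul _ (isTestFun_kap _).1, smul_smul, ← pow_add, smul_eq_mul]

lemma dirDeriv_of_eventually_zero {F : Type*} [NormedAddCommGroup F] [NormedSpace ℝ F]
    {φ : Euc n → F} {x : Euc n} (h : φ =ᶠ[𝓝 x] fun _ => 0)
    (J : Fin m → Fin n) : dirDeriv n m J φ x = 0 := by
  rw [dirDeriv_congr_nhds h, dirDeriv_zero_fun]

theorem KernelSys.lowpass_bound {A : CoeffOp n k V W} {J : Fin m → Fin n} {e : V}
    (K : KernelSys A J e) (hm : m ≤ k) : ∃ C, 0 ≤ C ∧ ∀ (u : Euc n → V) (σ : Measure (Euc n))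
      (f : Euc n → W), LocallyIntegrable u volume → LocallyIntegrable f σ →
      HasDistribA n k A u σ f → ∀ r, 0 < r → ∀ x, (∃ a, Tendsto (fun N => lowpass u e J r N x)
        atTop (𝓝 a)) ∧ ∀ N, ‖lowpass u e J r N x‖ ≤ C * ((r⁻¹) ^ (n + m) * ((∫ y in ball x r, ‖u y‖) +
          r ^ k * ∫ y in ball x r, ‖f y‖ ∂σ)) := by
  obtain ⟨Q, hQ0, hQ⟩ := (isTestFun_kap (n := n) 1).exists_bound m
  have hKC := K.C_nonneg
  refine ⟨2 * K.C + Q * ‖e‖, by positivity, fun u σ f hu hf h r hr x => ?_⟩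
  set s := r⁻¹ with hs
  have hs0 : 0 < s := inv_pos.2 hr
  set Iu := ∫ y in ball x r, ‖u y‖
  set If := ∫ y in ball x r, ‖f y‖ ∂σ
  have hIu : 0 ≤ Iu := integral_nonneg fun _ => norm_nonneg _
  have hIf : 0 ≤ If := integral_nonneg fun _ => norm_nonneg _
  let gs : ℕ → Euc n → W := fun i z => (s ^ (n + m) * r ^ k) • dirDeriv n m J (K.g i) (s • z)
  let Es : ℕ → Euc n → V := fun i z => s ^ (n + m) • dirDeriv n m J (K.E i) (s • z)
  have hgs : ∀ i, IsTestFun n (gs i) := fun i =>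
    (((K.test_g i).dirDeriv J).comp_smul hs0.ne').const_smul _
  have hEs : ∀ i, IsTestFun n (Es i) := fun i =>
    (((K.test_E i).dirDeriv J).comp_smul hs0.ne').const_smul _
  have hκT : ∀ N, IsTestFun n (fun z => dirDeriv n m J (kapr n r N) z • e) := fun N =>
    ((isTestFun_kapr hr N).dirDeriv J).smul_const e
  have hkey : ∀ i z, dirDeriv n m J (kapr n r (i + 1)) z • e - dirDeriv n m J (kapr n r i) z • e =
      Astar n k A (gs i) z - Es i z := by
    intro i z
    have hT := (K.test_g i).dirDeriv J
    have h1 : Astar n k A (gs i) z = s ^ (n + m) • Astar n k A (dirDeriv n m J (K.g i)) (s • z) := by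
      have hT1 : ContDiff ℝ (⊤ : ℕ∞) (fun z => dirDeriv n m J (K.g i) (s • z)) :=
        hT.1.comp (contDiff_const_smul _)
      simp only [gs]
      rw [Astar_const_smul _ hT1, Astar_comp_smul _ hT.1, smul_smul,
        mul_assoc, ← mul_pow, hs, mul_inv_cancel₀ hr.ne', one_pow, mul_one]
    have h2 : Astar n k A (K.g i) = fun x =>
        (kap n (2 ^ (i + 1)) x • e - kap n (2 ^ i) x • e) + K.E i x := by
      funext x; rw [K.Astar_g, sub_smul]
    rw [h1, Astar_dirDeriv J (K.test_g i).1, h2, dirDeriv_add (((isTestFun_kap _).smul_const e).sub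
      ((isTestFun_kap _).smul_const e)).1 (K.test_E i).1, dirDeriv_sub
      ((isTestFun_kap _).smul_const e).1 ((isTestFun_kap _).smul_const e).1,
      dirDeriv_smul_const _ (isTestFun_kap _).1, dirDeriv_smul_const _ (isTestFun_kap _).1,
      dirDeriv_kapr, dirDeriv_kapr, ← hs]
    simp only [Es, smul_add, smul_sub, mul_smul, add_sub_cancel_right]
  have hinc : ∀ i, lowpass u e J r (i + 1) x - lowpass u e J r i x =
      cv σ (innerB W) f (gs i) x - cv volume (innerB V) u (Es i) x := by
    intro i
    unfold lowpass
    rw [← cv_sub _ hu (hκT _) (hκT _), funext (hkey i), cv_sub _ hu (hgs i).Astar (hEs i),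
      h.cv_eq hu (hgs i)]
  have hsum : ∀ N, ∑ i ∈ Finset.range N, ‖lowpass u e J r (i + 1) x - lowpass u e J r i x‖ ≤
      2 * K.C * (s ^ (n + m) * (Iu + r ^ k * If)) := by
    intro N
    have h1 : ∑ i ∈ Finset.range N, ‖cv σ (innerB W) f (gs i) x‖ ≤ s ^ (n + m) * r ^ k * K.C * If := by
      refine sum_norm_cv_le hf hgs (fun i z hz => ?_) (fun z => ?_) x
      · simp only [gs]
        rw [dirDeriv_of_eventually_zero (K.g_zero i _ (half_le_norm_inv_smul hr hz)), smul_zero]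
      · simp only [gs, norm_smul]
        rw [← Finset.mul_sum, Real.norm_of_nonneg (by positivity)]
        exact mul_le_mul_of_nonneg_left (K.sum_g N _) (by positivity)
    have h2 : ∑ i ∈ Finset.range N, ‖cv volume (innerB V) u (Es i) x‖ ≤ s ^ (n + m) * (K.C * 2) * Iu := by
      refine sum_norm_cv_le hu hEs (fun i z hz => ?_) (fun z => ?_) x
      · simp only [Es]
        rw [dirDeriv_of_eventually_zero (K.E_zero i _ (half_le_norm_inv_smul hr hz)), smul_zero]
      · simp only [Es, norm_smul]
        rw [← Finset.mul_sum, Real.norm_of_nonneg (by positivity)]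
        refine mul_le_mul_of_nonneg_left ?_ (by positivity)
        refine le_trans ?_ (mul_le_mul_of_nonneg_left (sum_half_pow_le N) hKC)
        rw [Finset.mul_sum]
        refine Finset.sum_le_sum fun i _ => (K.bound_E i m hm J _).trans ?_
        rw [div_eq_mul_inv]
        gcongr
        exact le_self_pow₀ (one_le_pow₀ one_le_two) (by omega)
    calc _ ≤ ∑ i ∈ Finset.range N, (‖cv σ (innerB W) f (gs i) x‖ +
          ‖cv volume (innerB V) u (Es i) x‖) := by
          refine Finset.sum_le_sum fun i _ => ?_
          rw [hinc]; exact norm_sub_le _ _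
      _ ≤ s ^ (n + m) * r ^ k * K.C * If + s ^ (n + m) * (K.C * 2) * Iu := by
          rw [Finset.sum_add_distrib]; exact add_le_add h1 h2
      _ ≤ _ := by
          have : 0 ≤ s ^ (n + m) * r ^ k * K.C * If := by positivity
          nlinarith
  have h0 : ‖lowpass u e J r 0 x‖ ≤ Q * ‖e‖ * (s ^ (n + m) * (Iu + r ^ k * If)) := by
    have h1 : ‖lowpass u e J r 0 x‖ ≤ s ^ (n + m) * Q * ‖e‖ * Iu := by
      refine norm_cv_le_ball hu (hκT 0) (fun z hz => ?_) (fun z => ?_) x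
      · rw [dirDeriv_kapr, dirDeriv_of_eventually_zero (kap_of_le _ (half_le_norm_inv_smul hr hz)),
          mul_zero, zero_smul]
      · rw [dirDeriv_kapr, norm_smul, norm_mul, Real.norm_of_nonneg (by positivity), pow_zero]
        gcongr
        exact (norm_dirDeriv_le _ _ _).trans (hQ _)
    refine h1.trans ?_
    have : 0 ≤ s ^ (n + m) * r ^ k * Q * ‖e‖ * If := by positivity
    nlinarith
  constructor
  · have h1 : Summable fun i => lowpass u e J r (i + 1) x - lowpass u e J r i x :=
      .of_norm (summable_of_sum_range_le (fun _ => norm_nonneg _) hsum)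
    refine ⟨_, ((h1.hasSum.tendsto_sum_nat).const_add (lowpass u e J r 0 x)).congr fun N => ?_⟩
    rw [Finset.sum_range_sub (fun i => lowpass u e J r i x)]; ring
  · intro N
    have h1 : lowpass u e J r N x = lowpass u e J r 0 x +
        ∑ i ∈ Finset.range N, (lowpass u e J r (i + 1) x - lowpass u e J r i x) := by
      rw [Finset.sum_range_sub (fun i => lowpass u e J r i x)]; ring
    rw [h1, add_comm (2 * K.C), add_mul]
    exact (norm_add_le _ _).trans (add_le_add h0 ((norm_sum_le _ _).trans (hsum N)))

end Rep

section ApproxIdentity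

variable {n m : ℕ}

lemma integrable_rho : Integrable (rho n) := by
  obtain ⟨C, hC, h⟩ := (isRapid_rho (n := n)).2 (n + 1) 0
  refine integrable_of_decay isRapid_rho.1.continuous.aestronglyMeasurable (C := C) fun x => ?_
  simpa using h x

lemma eta_nonneg (x : Euc n) : 0 ≤ eta n x := chi_nonneg _

lemma eta_le_one (x : Euc n) : eta n x ≤ 1 := chi_le_one _

lemma integral_kapr_mul {r : ℝ} (hr : 0 < r) (N : ℕ) (φ : Euc n → ℝ) (y : Euc n) :
    ∫ x, kapr n r N (x - y) * φ x =
      ∫ ζ, (eta n (((2 : ℝ) ^ N)⁻¹ • ζ) * rho n ζ) * φ ((r * ((2 : ℝ) ^ N)⁻¹) • ζ + y) := by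
  have h1 := integral_add_right_eq_self (μ := (volume : Measure (Euc n)))
    (fun x => kapr n r N (x - y) * φ x) y
  simp only [add_sub_cancel_right] at h1
  have h2 := Measure.integral_comp_smul (volume : Measure (Euc n))
    (fun z => kapr n r N z * φ (z + y)) (r * ((2 : ℝ) ^ N)⁻¹)
  rw [← h1]
  set R := r * ((2 : ℝ) ^ N)⁻¹ with hR
  have hR0 : 0 < R := by positivity
  rw [finrank_euclideanSpace_fin, abs_of_pos (by positivity), smul_eq_mul] at h2
  have h3 : ∫ x, kapr n r N x * φ (x + y) =
      R ^ n * ∫ x, kapr n r N (R • x) * φ (R • x + y) := by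
    rw [h2, mul_inv_cancel_left₀ (by positivity)]
  rw [h3, ← integral_const_mul]
  refine integral_congr_ae (Eventually.of_forall fun ζ => ?_)
  simp only [kapr, kap, smul_smul]
  have e1 : r⁻¹ * R = ((2 : ℝ) ^ N)⁻¹ := by rw [hR]; field_simp
  have e2 : (2 : ℝ) ^ N * ((2 : ℝ) ^ N)⁻¹ = 1 := by field_simp
  rw [e1, e2, one_smul]
  have e3 : R ^ n * (r⁻¹ ^ n * (2 ^ N) ^ n) = 1 := by
    rw [← mul_pow, ← mul_pow, hR]; field_simp; simp
  calc _ = (R ^ n * (r⁻¹ ^ n * (2 ^ N) ^ n)) * ((eta n (((2 : ℝ) ^ N)⁻¹ • ζ) * rho n ζ) *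
        φ (R • ζ + y)) := by ring
    _ = _ := by rw [e3, one_mul]

lemma tendsto_integral_kapr_mul {r : ℝ} (hr : 0 < r) {φ : Euc n → ℝ} (hφ : Continuous φ) {M : ℝ}
    (hM : ∀ x, |φ x| ≤ M) (y : Euc n) :
    Tendsto (fun N => ∫ x, kapr n r N (x - y) * φ x) atTop (𝓝 (φ y)) := by
  simp only [integral_kapr_mul hr]
  have h0 : Tendsto (fun N : ℕ => ((2 : ℝ) ^ N)⁻¹) atTop (𝓝 0) :=
    (tendsto_pow_atTop_atTop_of_one_lt one_lt_two).inv_tendsto_atTop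
  have h1 : φ y = ∫ ζ, (1 * rho n ζ) * φ y := by
    simp only [one_mul]
    rw [integral_mul_const, integral_rho, one_mul]
  rw [h1]
  refine tendsto_integral_of_dominated_convergence (fun ζ => |rho n ζ| * M) (fun N => ?_)
    (integrable_rho.abs.mul_const M) (fun N => ?_) (Eventually.of_forall fun ζ => ?_)
  · refine Continuous.aestronglyMeasurable ?_
    have := isRapid_rho (n := n) |>.1.continuous
    have := isTestFun_eta (n := n) |>.1.continuous
    fun_prop
  · refine Eventually.of_forall fun ζ => ?_
    rw [Real.norm_eq_abs, abs_mul, abs_mul, abs_of_nonneg (eta_nonneg _)]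
    have := eta_le_one (((2 : ℝ) ^ N)⁻¹ • ζ)
    refine mul_le_mul ?_ (hM _) (abs_nonneg _) (abs_nonneg _)
    exact mul_le_of_le_one_left (abs_nonneg _) this
  · refine Tendsto.mul (Tendsto.mul ?_ tendsto_const_nhds) ?_
    · have h2 : Tendsto (fun N : ℕ => ((2 : ℝ) ^ N)⁻¹ • ζ) atTop (𝓝 0) := by
        simpa using h0.smul_const ζ
      refine tendsto_const_nhds.congr' ?_
      filter_upwards [h2.eventually (eta_of_lt (x := (0 : Euc n)) (by simp))] with N hN
      exact hN.symm
    · have h2 : Tendsto (fun N : ℕ => (r * ((2 : ℝ) ^ N)⁻¹) • ζ + y) atTop (𝓝 y) := by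
        simpa using ((h0.const_mul r).smul_const ζ).add_const y
      exact (hφ.tendsto y).comp h2

lemma abs_integral_kapr_mul_le {r : ℝ} (hr : 0 < r) (N : ℕ) {φ : Euc n → ℝ} {M : ℝ}
    (hM : ∀ x, |φ x| ≤ M) (y : Euc n) :
    |∫ x, kapr n r N (x - y) * φ x| ≤ (∫ ζ, |rho n ζ|) * M := by
  rw [integral_kapr_mul hr, ← integral_mul_const, ← Real.norm_eq_abs]
  refine norm_integral_le_of_norm_le (integrable_rho.abs.mul_const M)
    (Eventually.of_forall fun ζ => ?_)
  rw [Real.norm_eq_abs, abs_mul, abs_mul, abs_of_nonneg (eta_nonneg _)]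
  refine mul_le_mul ?_ (hM _) (abs_nonneg _) (abs_nonneg _)
  exact mul_le_of_le_one_left (abs_nonneg _) (eta_le_one _)

end ApproxIdentity

section Fubini

variable {n m : ℕ} {V : Type*}
  [NormedAddCommGroup V] [InnerProductSpace ℝ V] [FiniteDimensional ℝ V]

lemma integrable_prod_cv {g φ κ : Euc n → ℝ} (hg : LocallyIntegrable g volume)
    (hφ : Continuous φ) (hφc : HasCompactSupport φ) (hκ : Continuous κ)
    (hκc : HasCompactSupport κ) :
    Integrable (fun z : Euc n × Euc n => φ z.1 * (g z.2 * κ (z.1 - z.2))) (volume.prod volume) := by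
  obtain ⟨M, hM⟩ := hκ.bounded_above_of_compact_support hκc
  set K : Set (Euc n) := (fun z : Euc n × Euc n => z.1 - z.2) '' (tsupport φ ×ˢ tsupport κ) with hK
  have hKc : IsCompact K := (hφc.isCompact.prod hκc.isCompact).image (by fun_prop)
  have h1 : Integrable (fun z : Euc n × Euc n => φ z.1 * K.indicator g z.2)
      (volume.prod volume) :=
    (hφ.integrable_of_hasCompactSupport hφc).mul_prod
      ((hg.integrableOn_isCompact hKc).integrable_indicator hKc.measurableSet)
  have h2 := h1.mul_bdd (g := fun z : Euc n × Euc n => κ (z.1 - z.2)) (c := M)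
    (by apply Continuous.aestronglyMeasurable; fun_prop) (Eventually.of_forall fun z => hM _)
  refine h2.congr (Eventually.of_forall fun z => ?_)
  simp only
  by_cases hz : z.2 ∈ K
  · rw [Set.indicator_of_mem hz]; ring
  · rw [Set.indicator_of_notMem hz]
    have : φ z.1 = 0 ∨ κ (z.1 - z.2) = 0 := by
      by_contra! h
      exact hz ⟨(z.1, z.1 - z.2), ⟨subset_tsupport _ h.1, subset_tsupport _ h.2⟩, by simp⟩
    rcases this with h | h <;> simp [h]

lemma integral_mul_cv {g φ κ : Euc n → ℝ} (hg : LocallyIntegrable g volume)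
    (hφ : Continuous φ) (hφc : HasCompactSupport φ) (hκ : Continuous κ)
    (hκc : HasCompactSupport κ) :
    ∫ x, φ x * ∫ y, g y * κ (x - y) = ∫ y, g y * ∫ x, κ (x - y) * φ x := by
  simp only [← integral_const_mul]
  rw [integral_integral_swap (integrable_prod_cv hg hφ hφc hκ hκc)]
  refine integral_congr_ae (Eventually.of_forall fun y => integral_congr_ae
    (Eventually.of_forall fun x => ?_))
  simp only; ring

lemma locInt_inner {σ : Measure (Euc n)} {u : Euc n → V} (hu : LocallyIntegrable u σ) (e : V) :
    LocallyIntegrable (fun y => ⟪u y, e⟫) σ := by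
  intro x
  obtain ⟨s, hs, h⟩ := hu x
  exact ⟨s, hs, h.inner_const e⟩

lemma tendsto_integral_lowpass {u : Euc n → V} (hu : LocallyIntegrable u volume) (e : V)
    (J : Fin m → Fin n) {r : ℝ} (hr : 0 < r) {φ : Euc n → ℝ} (hφ : IsTestFun n φ) :
    Tendsto (fun N => ∫ x, φ x * lowpass u e J r N x) atTop
      (𝓝 ((-1 : ℝ) ^ m * ∫ y, ⟪u y, e⟫ * dirDeriv n m J φ y)) := by
  have hg := locInt_inner hu e
  have hφ' := hφ.dirDeriv J
  have h1 : ∀ N, ∫ x, φ x * lowpass u e J r N x =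
      (-1 : ℝ) ^ m * ∫ y, ⟪u y, e⟫ * ∫ x, kapr n r N (x - y) * dirDeriv n m J φ x := by
    intro N
    have hκ := (isTestFun_kapr (n := n) hr N).dirDeriv J
    have e1 : ∀ x, lowpass u e J r N x =
        ∫ y, ⟪u y, e⟫ * dirDeriv n m J (kapr n r N) (x - y) := by
      intro x
      refine integral_congr_ae (Eventually.of_forall fun y => ?_)
      simp [mul_comm]
    simp only [e1]
    rw [integral_mul_cv hg hφ.1.continuous hφ.2 hκ.1.continuous hκ.2, ← integral_const_mul]
    refine integral_congr_ae (Eventually.of_forall fun y => ?_)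
    have h3 : ContDiff ℝ (⊤ : ℕ∞) fun x => kapr n r N (x - y) :=
      (isTestFun_kapr hr N).1.comp (contDiff_id.sub contDiff_const)
    have h2 := integral_dirDeriv_right (ContinuousLinearMap.mul ℝ ℝ) h3 hφ.1 (Or.inr hφ.2) J
    simp only [ContinuousLinearMap.mul_apply', dirDeriv_comp_sub, smul_eq_mul] at h2
    simp only
    rw [h2, mul_left_comm, ← mul_assoc ((-1 : ℝ) ^ m), ← mul_pow]
    norm_num
  simp only [h1]
  refine Tendsto.const_mul _ ?_
  obtain ⟨M, hM⟩ := hφ'.1.continuous.bounded_above_of_compact_support hφ'.2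
  set K := cthickening r (tsupport φ) with hK
  have hKc : IsCompact K := hφ.2.isCompact.cthickening
  refine tendsto_integral_of_dominated_convergence
    (fun y => K.indicator (fun y => |⟪u y, e⟫| * ((∫ ζ, |rho n ζ|) * M)) y) (fun N => ?_)
    (IntegrableOn.integrable_indicator ((hg.integrableOn_isCompact hKc).abs.mul_const _)
      hKc.measurableSet)
    (fun N => Eventually.of_forall fun y => ?_) (Eventually.of_forall fun y => ?_)
  · refine hg.aestronglyMeasurable.mul (Continuous.aestronglyMeasurable ?_)
    have h3 := smooth_cv (σ := volume) (ContinuousLinearMap.mul ℝ ℝ)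
      (hφ'.1.continuous.locallyIntegrable) ((isTestFun_kapr (n := n) hr N).comp_smul
        (c := -1) (by norm_num))
    refine h3.continuous.congr fun y => integral_congr_ae (Eventually.of_forall fun x => ?_)
    simp [mul_comm]
  · by_cases hy : y ∈ K
    · rw [Set.indicator_of_mem hy, norm_mul, Real.norm_eq_abs]
      exact mul_le_mul_of_nonneg_left (abs_integral_kapr_mul_le hr N hM y) (abs_nonneg _)
    · rw [Set.indicator_of_notMem hy]
      have h4 : ∫ x, kapr n r N (x - y) * dirDeriv n m J φ x = 0 := by
        refine integral_eq_zero_of_ae (Eventually.of_forall fun x => ?_)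
        simp only [Pi.zero_apply]
        by_cases hx : x ∈ tsupport φ
        · have h5 : r ≤ ‖x - y‖ := by
            by_contra! h
            exact hy (mem_cthickening_of_dist_le y x r _ hx (by
              rw [dist_comm, dist_eq_norm]; exact h.le))
          rw [kapr, (kap_of_le _ (half_le_norm_inv_smul hr h5)).eq_of_nhds]; simp
        · rw [image_eq_zero_of_notMem_tsupport (f := dirDeriv n m J φ)
            fun h => hx (tsupport_dirDeriv_subset J h), mul_zero]
      rw [h4]; simp
  · exact (tendsto_integral_kapr_mul hr hφ'.1.continuous hM y).const_mul _

end Fubini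

section Representation

variable {n k m : ℕ} {V W : Type*}
  [NormedAddCommGroup V] [InnerProductSpace ℝ V] [FiniteDimensional ℝ V]
  [NormedAddCommGroup W] [InnerProductSpace ℝ W] [FiniteDimensional ℝ W]

lemma smooth_lowpass {u : Euc n → V} (hu : LocallyIntegrable u volume) (e : V) (J : Fin m → Fin n)
    {r : ℝ} (hr : 0 < r) (N : ℕ) : ContDiff ℝ (⊤ : ℕ∞) (lowpass u e J r N) :=
  smooth_cv _ hu (((isTestFun_kapr hr N).dirDeriv J).smul_const e)

lemma setIntegral_norm_ball_le {F : Type*} [NormedAddCommGroup F] {σ : Measure (Euc n)}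
    {f : Euc n → F} (hf : LocallyIntegrable f σ) {x : Euc n} {R r : ℝ} (hx : ‖x‖ ≤ R) :
    ∫ y in ball x r, ‖f y‖ ∂σ ≤ ∫ y in closedBall 0 (R + r), ‖f y‖ ∂σ := by
  refine setIntegral_mono_set (hf.integrableOn_isCompact (isCompact_closedBall _ _)).norm
    (Eventually.of_forall fun _ => norm_nonneg _) (LE.le.eventuallyLE ?_)
  intro y hy
  rw [mem_closedBall, dist_zero_right]
  have h1 := mem_ball_iff_norm.1 hy
  have := norm_add_le (y - x) x
  rw [sub_add_cancel] at this
  linarith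

theorem KernelSys.exists_limit {A : CoeffOp n k V W} {J : Fin m → Fin n} {e : V}
    (K : KernelSys A J e) (hm : m ≤ k) {u : Euc n → V} {σ : Measure (Euc n)}
    {f : Euc n → W} (hu : LocallyIntegrable u volume) (hf : LocallyIntegrable f σ)
    (h : HasDistribA n k A u σ f) {r : ℝ} (hr : 0 < r) :
    ∃ w : Euc n → ℝ, (∀ x, Tendsto (fun N => lowpass u e J r N x) atTop (𝓝 (w x))) ∧
      LocallyIntegrable w volume ∧ ∀ φ : Euc n → ℝ, IsTestFun n φ →
        ∫ x, φ x * w x = (-1 : ℝ) ^ m * ∫ y, ⟪u y, e⟫ * dirDeriv n m J φ y := by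
  obtain ⟨C, hC0, hC⟩ := K.lowpass_bound hm
  choose w hw using fun x => (hC u σ f hu hf h r hr x).1
  let B : ℝ → ℝ := fun R => C * ((r⁻¹) ^ (n + m) * ((∫ y in closedBall 0 (R + r), ‖u y‖) +
          r ^ k * ∫ y in closedBall 0 (R + r), ‖f y‖ ∂σ))
  have hB : ∀ R x, ‖x‖ ≤ R → ∀ N, ‖lowpass u e J r N x‖ ≤ B R := by
    intro R x hx N
    refine ((hC u σ f hu hf h r hr x).2 N).trans ?_
    have h1 := setIntegral_norm_ball_le hu (r := r) hx
    have h2 := setIntegral_norm_ball_le hf (r := r) hx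
    simp only [B]
    gcongr
  have hB' : ∀ R x, ‖x‖ ≤ R → ‖w x‖ ≤ B R := fun R x hx =>
    le_of_tendsto (hw x).norm (Eventually.of_forall (hB R x hx))
  have hmeas : AEStronglyMeasurable w volume :=
    aestronglyMeasurable_of_tendsto_ae atTop
      (fun N => (smooth_lowpass hu e J hr N).continuous.aestronglyMeasurable)
      (Eventually.of_forall hw)
  refine ⟨w, hw, ?_, fun φ hφ => ?_⟩
  · rw [locallyIntegrable_iff]
    intro K hK
    obtain ⟨R, hR⟩ := hK.isBounded.subset_closedBall (0 : Euc n)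
    refine IntegrableOn.of_bound hK.measure_lt_top hmeas.restrict (B R) ?_
    filter_upwards [ae_restrict_mem hK.measurableSet] with x hx
    exact hB' R x (by simpa using hR hx)
  · refine tendsto_nhds_unique ?_ (tendsto_integral_lowpass hu e J hr hφ)
    obtain ⟨R, hR⟩ := hφ.2.isCompact.isBounded.subset_closedBall (0 : Euc n)
    refine tendsto_integral_of_dominated_convergence (fun x => ‖φ x‖ * B R) (fun N => ?_)
      (((hφ.1.continuous.integrable_of_hasCompactSupport hφ.2).norm).mul_const _)
      (fun N => Eventually.of_forall fun x => ?_)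
      (Eventually.of_forall fun x => (hw x).const_mul _)
    · exact (hφ.1.continuous.mul (smooth_lowpass hu e J hr N).continuous).aestronglyMeasurable
    · rw [norm_mul]
      by_cases hx : x ∈ tsupport φ
      · exact mul_le_mul_of_nonneg_left (hB R x (by simpa using hR hx) N) (norm_nonneg _)
      · simp [image_eq_zero_of_notMem_tsupport hx]

lemma ae_eq_of_test {v w : Euc n → ℝ} (hv : LocallyIntegrable v volume)
    (hw : LocallyIntegrable w volume)
    (h : ∀ φ : Euc n → ℝ, IsTestFun n φ → ∫ x, φ x * v x = ∫ x, φ x * w x) :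
    v =ᵐ[volume] w :=
  ae_eq_of_integral_contDiff_smul_eq hv hw fun φ h1 h2 => h φ ⟨h1, h2⟩

theorem KernelSys.tendsto_lowpass {A : CoeffOp n k V W} {J : Fin m → Fin n} {e : V}
    (K : KernelSys A J e) (hm : m ≤ k) {u : Euc n → V} {σ : Measure (Euc n)}
    {f : Euc n → W} (hu : LocallyIntegrable u volume) (hf : LocallyIntegrable f σ)
    (h : HasDistribA n k A u σ f) {w : Euc n → ℝ} (hw : LocallyIntegrable w volume)
    (hwt : ∀ φ : Euc n → ℝ, IsTestFun n φ →
      ∫ x, φ x * w x = (-1 : ℝ) ^ m * ∫ y, ⟪u y, e⟫ * dirDeriv n m J φ y)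
    {r : ℝ} (hr : 0 < r) :
    ∀ᵐ x, Tendsto (fun N => lowpass u e J r N x) atTop (𝓝 (w x)) := by
  obtain ⟨w', h1, h2, h3⟩ := K.exists_limit hm hu hf h hr
  filter_upwards [ae_eq_of_test hw h2 fun φ hφ => (hwt φ hφ).trans (h3 φ hφ).symm] with x hx
  rw [hx]; exact h1 x

/-- A local bound of the `m`-th order weak derivatives by the mass of `u` and of `𝒜 u`. -/
theorem KernelSys.exists_ae_bound {A : CoeffOp n k V W} {J : Fin m → Fin n} {e : V}
    (K : KernelSys A J e) (hm : m ≤ k) : ∃ C, 0 ≤ C ∧ ∀ (u : Euc n → V) (σ : Measure (Euc n))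
      (f : Euc n → W) (w : Euc n → ℝ), LocallyIntegrable u volume → LocallyIntegrable f σ →
      HasDistribA n k A u σ f → LocallyIntegrable w volume →
      (∀ φ : Euc n → ℝ, IsTestFun n φ →
        ∫ x, φ x * w x = (-1 : ℝ) ^ m * ∫ y, ⟪u y, e⟫ * dirDeriv n m J φ y) →
      ∀ r, 0 < r → ∀ᵐ x, |w x| ≤ C * ((r⁻¹) ^ (n + m) * ((∫ y in ball x r, ‖u y‖) +
          r ^ k * ∫ y in ball x r, ‖f y‖ ∂σ)) := by
  obtain ⟨C, hC0, hC⟩ := K.lowpass_bound hm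
  refine ⟨C, hC0, fun u σ f w hu hf h hw hwt r hr => ?_⟩
  filter_upwards [K.tendsto_lowpass hm hu hf h hw hwt hr] with x hx
  exact le_of_tendsto hx.norm (Eventually.of_forall (hC u σ f hu hf h r hr x).2)

end Representation

section Coercive

variable {n k : ℕ} {V W : Type*}
  [NormedAddCommGroup V] [InnerProductSpace ℝ V] [FiniteDimensional ℝ V]
  [NormedAddCommGroup W] [InnerProductSpace ℝ W] [FiniteDimensional ℝ W]

lemma Aapply_eq_sum_clm (A : CoeffOp n k V W) (w : Euc n → V) : Aapply n k A w = fun x =>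
    ∑ I, LinearMap.toContinuousLinearMap (A I) (dirDeriv n k I w x) := rfl

lemma IsTestFun.Aapply {A : CoeffOp n k V W} {w : Euc n → V} (hw : IsTestFun n w) :
    IsTestFun n (Aapply n k A w) := by
  rw [Aapply_eq_sum_clm]
  exact IsTestFun.sum _ fun I _ => (hw.dirDeriv I).clm _

lemma osc_Aapply (A : CoeffOp n k V W) (φ : ℝ) {w : Euc n → V} (hw : IsTestFun n w) (x : Euc n) :
    osc φ (Aapply n k A w) x =
      (2 * Real.pi) ^ k • symC A x (osc (φ - k * (Real.pi / 2)) w x) := by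
  rw [Aapply_eq_sum_clm, osc_sum _ _ fun I _ => (hw.dirDeriv I).clm _, symC_apply, symbolMap,
    LinearMap.sum_apply, Finset.smul_sum]
  refine Finset.sum_congr rfl fun I _ => ?_
  rw [osc_clm _ _ (hw.dirDeriv I), osc_dirDeriv _ hw]
  simp [smul_smul]

theorem IsElliptic.exists_coercive {A : CoeffOp n k V W} (hk : 1 ≤ k) (hE : IsElliptic n k A) :
    ∃ C, 0 ≤ C ∧ ∀ w : Euc n → V, IsTestFun n w → ∀ I : Fin k → Fin n,
      ∫ x, ‖dirDeriv n k I w x‖ ^ 2 ≤ C * ∫ x, ‖Aapply n k A w x‖ ^ 2 := by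
  obtain ⟨c, hc, h⟩ := hE.exists_lower_bound hk
  refine ⟨(c⁻¹) ^ 2, by positivity, fun w hw I => ?_⟩
  have key : ∀ φ x, ‖osc φ (dirDeriv n k I w) x‖ ^ 2 ≤
      (c⁻¹) ^ 2 * ‖osc φ (_root_.Aapply n k A w) x‖ ^ 2 := by
    intro φ x
    rw [← mul_pow]
    refine pow_le_pow_left₀ (norm_nonneg _) ?_ 2
    rw [osc_dirDeriv _ hw, osc_Aapply A φ hw, norm_smul, norm_smul, norm_mul]
    set v := osc (φ - k * (Real.pi / 2)) w x
    have h1 : ‖∏ i, x (I i)‖ ≤ ‖x‖ ^ k := by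
      rw [Real.norm_eq_abs, Finset.abs_prod]
      refine (Finset.prod_le_prod (fun _ _ => abs_nonneg _) fun i _ => abs_coord_le x (I i)).trans ?_
      simp
    have h2 : ‖x‖ ^ k * ‖v‖ ≤ c⁻¹ * ‖symC A x v‖ := by
      rw [inv_mul_eq_div, le_div_iff₀ hc]
      linarith [h x v]
    calc _ ≤ ‖(2 * Real.pi) ^ k‖ * (‖x‖ ^ k * ‖v‖) := by
          rw [mul_assoc]; gcongr
      _ ≤ ‖(2 * Real.pi) ^ k‖ * (c⁻¹ * ‖symC A x v‖) := mul_le_mul_of_nonneg_left h2 (norm_nonneg _)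
      _ = _ := by ring
  rw [← plancherel (hw.dirDeriv I), ← plancherel (hw.Aapply (A := A)), mul_add,
    ← integral_const_mul, ← integral_const_mul]
  exact add_le_add
    (integral_mono (integrable_osc_sq _ (hw.dirDeriv I))
      ((integrable_osc_sq _ hw.Aapply).const_mul _) (key 0))
    (integral_mono (integrable_osc_sq _ (hw.dirDeriv I))
      ((integrable_osc_sq _ hw.Aapply).const_mul _) (key _))

end Coercive

section WeakLimit

lemma exists_weak_limit {H : Type*} [NormedAddCommGroup H] [InnerProductSpace ℝ H]
    [CompleteSpace H] {x : ℕ → H} {C : ℝ} (hx : ∀ N, ‖x N‖ ≤ C) :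
    ∃ g : H, ∀ h : H, Tendsto (fun N => ⟪x N, h⟫) (hyperfilter ℕ : Filter ℕ) (𝓝 ⟪g, h⟫) := by
  have hK := WeakDual.isCompact_closedBall (𝕜 := ℝ) (E := H) 0 C
  let y : ℕ → WeakDual ℝ H := fun N => StrongDual.toWeakDual (InnerProductSpace.toDual ℝ H (x N))
  have hy : ((hyperfilter ℕ).map y : Filter (WeakDual ℝ H)) ≤
      𝓟 (WeakDual.toStrongDual ⁻¹' closedBall (0 : StrongDual ℝ H) C) := by
    rw [Ultrafilter.coe_map, le_principal_iff, mem_map]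
    refine Filter.univ_mem' fun N => ?_
    simp only [Set.mem_preimage, mem_closedBall, dist_zero_right, y]
    exact ((InnerProductSpace.toDual ℝ H).norm_map (x N)).trans_le (hx N)
  obtain ⟨L, -, hL⟩ := hK.ultrafilter_le_nhds _ hy
  refine ⟨(InnerProductSpace.toDual ℝ H).symm (WeakDual.toStrongDual L), fun h => ?_⟩
  rw [InnerProductSpace.toDual_symm_apply]
  have h1 : Tendsto y (hyperfilter ℕ : Filter ℕ) (𝓝 L) := hL
  exact ((WeakDual.eval_continuous h).tendsto L).comp h1

end WeakLimit

section Cutoff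

variable {n : ℕ}

/-- A smooth bump function of unit mass supported in the half unit ball. -/
noncomputable def bmp (n : ℕ) (x : Euc n) : ℝ := (∫ y, eta n y)⁻¹ * eta n x

lemma isTestFun_bmp : IsTestFun n (bmp n) := isTestFun_eta.const_smul (∫ y, eta n y)⁻¹

lemma integral_eta_pos : 0 < ∫ y, eta n y := by
  have hc := (isTestFun_eta (n := n)).1.continuous
  rw [integral_pos_iff_support_of_nonneg (fun x => eta_nonneg x) (isTestFun_eta.integrable _)]
  refine (hc.isOpen_support).measure_pos _ ⟨0, ?_⟩
  have := (eta_of_lt (x := (0 : Euc n)) (by simp)).eq_of_nhds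
  simp [this]

lemma bmp_nonneg (x : Euc n) : 0 ≤ bmp n x :=
  mul_nonneg (inv_nonneg.2 integral_eta_pos.le) (eta_nonneg x)

lemma integral_bmp : ∫ x, bmp n x = 1 := by
  simp only [bmp]
  rw [integral_const_mul, inv_mul_cancel₀ integral_eta_pos.ne']

lemma bmp_of_le {x : Euc n} (hx : 1 / 2 ≤ ‖x‖) : bmp n x = 0 := by
  rw [bmp, (eta_of_le hx).eq_of_nhds, mul_zero]

/-- The rescaled bump function. -/
noncomputable def bmps (n : ℕ) (s : ℝ) (x : Euc n) : ℝ := s ^ n * bmp n (s • x)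

lemma isTestFun_bmps {s : ℝ} (hs : 0 < s) : IsTestFun n (bmps n s) :=
  (isTestFun_bmp.comp_smul hs.ne').const_smul (s ^ n)

lemma bmps_nonneg {s : ℝ} (hs : 0 < s) (x : Euc n) : 0 ≤ bmps n s x :=
  mul_nonneg (by positivity) (bmp_nonneg _)

lemma bmps_of_le {s : ℝ} (hs : 0 < s) {x : Euc n} (hx : s⁻¹ / 2 ≤ ‖x‖) : bmps n s x = 0 := by
  rw [bmps, bmp_of_le, mul_zero]
  rw [norm_smul, Real.norm_of_nonneg hs.le]
  calc (1 : ℝ) / 2 = s * (s⁻¹ / 2) := by field_simp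
    _ ≤ _ := by gcongr

lemma integral_pow_mul_comp_smul {s : ℝ} (hs : 0 < s) (g : Euc n → ℝ) :
    ∫ x, s ^ n * g (s • x) = ∫ x, g x := by
  rw [integral_const_mul, Measure.integral_comp_smul, finrank_euclideanSpace_fin,
    abs_of_pos (by positivity), smul_eq_mul, mul_inv_cancel_left₀ (by positivity)]

lemma integral_bmps {s : ℝ} (hs : 0 < s) : ∫ x, bmps n s x = 1 :=
  (integral_pow_mul_comp_smul hs _).trans integral_bmp

lemma dirDeriv_bmps {m : ℕ} (s : ℝ) (I : Fin m → Fin n) (x : Euc n) :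
    dirDeriv n m I (bmps n s) x = s ^ m * (s ^ n * dirDeriv n m I (bmp n) (s • x)) := by
  have h : bmps n s = fun z => s ^ n • (fun z => bmp n (s • z)) z := rfl
  have h1 : ContDiff ℝ (⊤ : ℕ∞) (fun z : Euc n => bmp n (s • z)) :=
    isTestFun_bmp.1.comp (contDiff_const_smul _)
  rw [h, dirDeriv_const_smul _ h1, dirDeriv_comp_smul _ isTestFun_bmp.1]
  simp only [smul_eq_mul]; ring

lemma integral_abs_dirDeriv_bmps {m : ℕ} {s : ℝ} (hs : 0 < s) (I : Fin m → Fin n) :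
    ∫ x, |dirDeriv n m I (bmps n s) x| = s ^ m * ∫ x, |dirDeriv n m I (bmp n) x| := by
  rw [← integral_pow_mul_comp_smul hs fun x => |dirDeriv n m I (bmp n) x|, ← integral_const_mul]
  refine integral_congr_ae (Eventually.of_forall fun x => ?_)
  simp only [dirDeriv_bmps]
  rw [abs_mul, abs_mul, abs_of_pos (pow_pos hs m), abs_of_pos (pow_pos hs n)]

open Classical in
theorem exists_cutoffs {F : Set (Euc n)} (hF : IsCompact F) :
    ∃ Z : ℕ → Euc n → ℝ, (∀ i, IsTestFun n (Z i)) ∧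
      (∀ i x, infDist x F < ((2 : ℝ) ^ i)⁻¹ / 2 → F.Nonempty → Z i =ᶠ[𝓝 x] fun _ => 1) ∧
      (∀ i x, 2 * ((2 : ℝ) ^ i)⁻¹ < infDist x F → Z i =ᶠ[𝓝 x] fun _ => 0) ∧
      ∀ l, ∃ C, 0 ≤ C ∧ ∀ i x, ‖iteratedFDeriv ℝ l (Z i) x‖ ≤ C * ((2 : ℝ) ^ i) ^ l := by
  let Fs : ℕ → Set (Euc n) := fun i => cthickening ((2 : ℝ) ^ i)⁻¹ F
  have hFs : ∀ i, IsCompact (Fs i) := fun i => hF.cthickening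
  let g : ℕ → Euc n → ℝ := fun i => (Fs i).indicator fun _ => 1
  have hgi : ∀ i, Integrable (g i) := fun i =>
    (integrable_indicator_iff (hFs i).measurableSet).2 (integrableOn_const (hFs i).measure_lt_top.ne)
  have hg : ∀ i, LocallyIntegrable (g i) volume := fun i => (hgi i).locallyIntegrable
  have hs : ∀ i : ℕ, (0 : ℝ) < 2 ^ i := fun i => by positivity
  let Z : ℕ → Euc n → ℝ := fun i => cv volume (ContinuousLinearMap.mul ℝ ℝ) (g i) (bmps n (2 ^ i))
  have hZ0 : ∀ i x, (∀ y ∈ Fs i, ((2 : ℝ) ^ i)⁻¹ / 2 ≤ dist x y) → Z i x = 0 := by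
    intro i x h
    refine integral_eq_zero_of_ae (Eventually.of_forall fun y => ?_)
    simp only [ContinuousLinearMap.mul_apply', Pi.zero_apply, g]
    by_cases hy : y ∈ Fs i
    · rw [bmps_of_le (hs i) (by rw [← dist_eq_norm]; exact h y hy), mul_zero]
    · rw [Set.indicator_of_notMem hy, zero_mul]
  have hZ1 : ∀ i x, (∀ y, dist x y < ((2 : ℝ) ^ i)⁻¹ / 2 → y ∈ Fs i) → Z i x = 1 := by
    intro i x h
    rw [← integral_bmps (n := n) (hs i), ← integral_sub_left_eq_self (bmps n (2 ^ i)) volume x]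
    refine integral_congr_ae (Eventually.of_forall fun y => ?_)
    simp only [ContinuousLinearMap.mul_apply', g]
    by_cases hy : y ∈ Fs i
    · rw [Set.indicator_of_mem hy, one_mul]
    · rw [bmps_of_le (hs i), mul_zero]
      rw [← dist_eq_norm]
      by_contra! h'
      exact hy (h y h')
  have hsm : ∀ i, ContDiff ℝ (⊤ : ℕ∞) (Z i) := fun i => smooth_cv _ (hg i) (isTestFun_bmps (hs i))
  have hinf : ∀ i x y, y ∈ Fs i → infDist x F ≤ ((2 : ℝ) ^ i)⁻¹ + dist x y := by
    intro i x y hy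
    have h1 : infDist y F ≤ ((2 : ℝ) ^ i)⁻¹ :=
      ENNReal.toReal_le_of_le_ofReal (by positivity) hy
    rcases F.eq_empty_or_nonempty with rfl | hne
    · simp; positivity
    · linarith [infDist_le_infDist_add_dist (s := F) (x := x) (y := y)]
  have hout : ∀ i x, 2 * ((2 : ℝ) ^ i)⁻¹ < infDist x F → Z i =ᶠ[𝓝 x] fun _ => 0 := by
    intro i x hx
    filter_upwards [(continuous_infDist_pt F).tendsto x |>.eventually (lt_mem_nhds hx)] with z hz
    refine hZ0 i z fun y hy => ?_
    have := hinf i z y hy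
    have := inv_pos.2 (hs i)
    linarith
  refine ⟨Z, fun i => ⟨hsm i, ?_⟩, fun i x hx hne => ?_, hout, fun l => ?_⟩
  · refine HasCompactSupport.intro (hF.cthickening (r := 2 * ((2 : ℝ) ^ i)⁻¹)) fun x hx => ?_
    refine hZ0 i x fun y hy => ?_
    by_contra! hlt
    apply hx
    have h2 := cthickening_cthickening_subset (ε := ((2 : ℝ) ^ i)⁻¹ / 2) (δ := ((2 : ℝ) ^ i)⁻¹)
      (by positivity) (by positivity) F (mem_cthickening_of_dist_le x y _ _ hy hlt.le)
    refine cthickening_mono ?_ _ h2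
    have := inv_pos.2 (hs i)
    linarith
  · filter_upwards [(continuous_infDist_pt F).tendsto x |>.eventually (gt_mem_nhds hx)] with z hz
    refine hZ1 i z fun y hy => ?_
    have h3 := infDist_le_infDist_add_dist (s := F) (x := y) (y := z)
    rw [dist_comm] at h3
    change infEDist y F ≤ _
    refine (ENNReal.le_ofReal_iff_toReal_le (infEDist_ne_top hne) (by positivity)).2 ?_
    change infDist y F ≤ _
    linarith
  · refine ⟨∑ I : Fin l → Fin n, ∫ x, |dirDeriv n l I (bmp n) x|,
      Finset.sum_nonneg fun I _ => integral_nonneg fun x => abs_nonneg _, fun i x => ?_⟩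
    refine (norm_iteratedFDeriv_le_sum _ _).trans ?_
    rw [Finset.sum_mul]
    refine Finset.sum_le_sum fun I _ => ?_
    have hb := (isTestFun_bmps (n := n) (hs i)).dirDeriv I
    rw [dirDeriv_cv _ (hg i) (isTestFun_bmps (hs i)), mul_comm,
      ← integral_abs_dirDeriv_bmps (hs i)]
    refine (norm_cv_le _ (hg i) hb x).trans ?_
    refine (mul_le_of_le_one_left (integral_nonneg fun y => by positivity)
      (ContinuousLinearMap.opNorm_mul_le ℝ ℝ)).trans ?_
    rw [← integral_sub_left_eq_self (fun x => |dirDeriv n l I (bmps n (2 ^ i)) x|) volume x]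
    refine integral_mono (integrable_norm_cv (hg i) hb x)
      ((hb.comp_sub_left x).integrable _).abs fun y => ?_
    refine mul_le_of_le_one_left (norm_nonneg _) ?_
    simp only [g, Set.indicator]
    split_ifs <;> simp

end Cutoff

section Dyadic

variable {n : ℕ} {F G : Type*} [NormedAddCommGroup F] [NormedSpace ℝ F]
  [NormedAddCommGroup G] [NormedSpace ℝ G]

lemma exists_dyadic_le (p i : ℕ) {t : ℝ} (h0 : 0 ≤ t) (hi : t < 2 ^ i) :
    ∃ j ≤ i, t < 2 ^ j ∧ 1 ≤ 2 ^ p * ((2 : ℝ) ^ j)⁻¹ ^ p * (1 + t) ^ p := by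
  classical
  have hex : ∃ j : ℕ, t < 2 ^ j := ⟨i, hi⟩
  refine ⟨Nat.find hex, Nat.find_min' hex hi, Nat.find_spec hex, ?_⟩
  rw [← mul_pow, ← mul_pow]
  refine one_le_pow₀ ?_
  rcases Nat.eq_zero_or_eq_succ_pred (Nat.find hex) with h | h
  · rw [h]; simp; linarith
  · have h1 : ¬ t < 2 ^ (Nat.find hex - 1) := Nat.find_min hex (by omega)
    rw [h]
    simp only [Nat.pred_eq_sub_one, Nat.succ_eq_add_one] at *
    rw [not_lt] at h1
    rw [pow_succ, mul_inv, mul_comm ((2 : ℝ) ^ _)⁻¹, mul_inv_cancel_left₀ two_ne_zero,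
      inv_mul_eq_div, le_div_iff₀ (by positivity)]
    linarith

/-- Convolution with a kernel concentrated at scale `2^{-i}` of a density whose mass on balls
centered at nearby points is controlled. -/
lemma integral_norm_mul_kernel_le {σ : Measure (Euc n)} {f : Euc n → F}
    (hf : LocallyIntegrable f σ) {κ : Euc n → G} (hκ : IsTestFun n κ) {i : ℕ} {B Λ : ℝ}
    (hB0 : 0 ≤ B) (hΛ : 0 ≤ Λ) {x x' : Euc n} (hxx : dist x x' ≤ 2 * ((2 : ℝ) ^ i)⁻¹)
    (hx' : ∀ r, 0 < r → r ≤ 4 → ∫ y in ball x' r, ‖f y‖ ∂σ ≤ Λ * r ^ n)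
    (h0 : ∀ z, 1 / 2 ≤ ‖z‖ → κ z = 0)
    (hB : ∀ z, (1 + (2 : ℝ) ^ i * ‖z‖) ^ (n + 1) * ‖κ z‖ ≤ B) :
    ∫ y, ‖f y‖ * ‖κ (x - y)‖ ∂σ ≤ (2 ^ (n + 2) * 3 ^ n) * B * Λ * (((2 : ℝ) ^ i)⁻¹) ^ n := by
  have hs : (0 : ℝ) < 2 ^ i := by positivity
  set a : ℕ → ℝ := fun j => 2 ^ (n + 1) * (((2 : ℝ) ^ j)⁻¹) ^ (n + 1)
  have ha : ∀ j, 0 ≤ a j := fun j => by positivity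
  set S : ℕ → Set (Euc n) := fun j => ball x (2 ^ j * ((2 : ℝ) ^ i)⁻¹)
  have hint : ∀ j, Integrable (fun y => a j * B * (S j).indicator (fun y => ‖f y‖) y) σ := fun j =>
    (IntegrableOn.integrable_indicator (f := fun y => ‖f y‖)
      ((hf.integrableOn_isCompact (isCompact_closedBall x _)).mono_set
      ball_subset_closedBall).norm measurableSet_ball).const_mul _
  have hpt : ∀ y, ‖f y‖ * ‖κ (x - y)‖ ≤
      ∑ j ∈ Finset.range (i + 1), a j * B * (S j).indicator (fun y => ‖f y‖) y := by
    intro y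
    have hnn : ∀ j ∈ Finset.range (i + 1), 0 ≤ a j * B * (S j).indicator (fun y => ‖f y‖) y :=
      fun j _ => mul_nonneg (mul_nonneg (ha j) hB0) (Set.indicator_nonneg (fun _ _ => norm_nonneg _) _)
    by_cases hy : 1 / 2 ≤ ‖x - y‖
    · rw [h0 _ hy, norm_zero, mul_zero]
      exact Finset.sum_nonneg hnn
    push Not at hy
    obtain ⟨j, hj, htj, hjB⟩ := exists_dyadic_le (n + 1) i (t := 2 ^ i * ‖x - y‖) (by positivity)
      (by nlinarith)
    have hyS : y ∈ S j := by
      simp only [S, mem_ball]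
      rw [dist_comm, dist_eq_norm, ← div_eq_mul_inv, lt_div_iff₀ hs]
      linarith
    refine le_trans ?_ (Finset.single_le_sum hnn (Finset.mem_range.2 (Nat.lt_succ_of_le hj)))
    rw [Set.indicator_of_mem hyS, mul_comm]
    refine mul_le_mul_of_nonneg_right ?_ (norm_nonneg _)
    calc ‖κ (x - y)‖ ≤ a j * (1 + 2 ^ i * ‖x - y‖) ^ (n + 1) * ‖κ (x - y)‖ :=
          le_mul_of_one_le_left (norm_nonneg _) hjB
      _ = a j * ((1 + 2 ^ i * ‖x - y‖) ^ (n + 1) * ‖κ (x - y)‖) := by ring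
      _ ≤ a j * B := mul_le_mul_of_nonneg_left (hB _) (ha j)
  have hball : ∀ j ≤ i, ∫ y in S j, ‖f y‖ ∂σ ≤ Λ * (3 * (2 ^ j * ((2 : ℝ) ^ i)⁻¹)) ^ n := by
    intro j hj
    have h1 : ((2 : ℝ) ^ i)⁻¹ ≤ 2 ^ j * ((2 : ℝ) ^ i)⁻¹ :=
      le_mul_of_one_le_left (by positivity) (one_le_pow₀ one_le_two)
    have h2 : (2 : ℝ) ^ j * ((2 : ℝ) ^ i)⁻¹ ≤ 1 := by
      rw [← div_eq_mul_inv, div_le_one hs]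
      exact pow_le_pow_right₀ one_le_two hj
    refine le_trans ?_ (hx' (3 * (2 ^ j * ((2 : ℝ) ^ i)⁻¹)) (by positivity) (by linarith))
    refine setIntegral_mono_set ((hf.integrableOn_isCompact (isCompact_closedBall x' _)).mono_set
      ball_subset_closedBall).norm
      (Eventually.of_forall fun _ => norm_nonneg _) (LE.le.eventuallyLE ?_)
    exact ball_subset_ball' (by linarith)
  calc _ ≤ ∫ y, ∑ j ∈ Finset.range (i + 1), a j * B * (S j).indicator (fun y => ‖f y‖) y ∂σ :=
        integral_mono (integrable_norm_cv hf hκ x) (integrable_finsetSum _ fun j _ => hint j) hpt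
    _ = ∑ j ∈ Finset.range (i + 1), a j * B * ∫ y in S j, ‖f y‖ ∂σ := by
        rw [integral_finsetSum _ fun j _ => hint j]
        refine Finset.sum_congr rfl fun j _ => ?_
        rw [integral_const_mul, integral_indicator measurableSet_ball]
    _ ≤ ∑ j ∈ Finset.range (i + 1), (2 ^ (n + 1) * 3 ^ n) * B * Λ * (((2 : ℝ) ^ i)⁻¹) ^ n *
          (1 / 2) ^ j := by
        refine Finset.sum_le_sum fun j hj => ?_
        refine (mul_le_mul_of_nonneg_left (hball j (Nat.lt_succ_iff.1 (Finset.mem_range.1 hj)))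
          (mul_nonneg (ha j) hB0)).trans (le_of_eq ?_)
        simp only [a, mul_pow, one_div, inv_pow, pow_succ (_⁻¹)]
        have : ((2 : ℝ) ^ j) ^ n ≠ 0 := by positivity
        field_simp
    _ ≤ (2 ^ (n + 1) * 3 ^ n) * B * Λ * (((2 : ℝ) ^ i)⁻¹) ^ n * 2 := by
        rw [← Finset.mul_sum]
        refine mul_le_mul_of_nonneg_left ?_ (by positivity)
        have := sum_half_pow_le (i + 1)
        simpa using this
    _ = _ := by ring

end Dyadic

section Increments

variable {n k m : ℕ} {V W : Type*}
  [NormedAddCommGroup V] [InnerProductSpace ℝ V] [FiniteDimensional ℝ V]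
  [NormedAddCommGroup W] [InnerProductSpace ℝ W] [FiniteDimensional ℝ W]

/-- The low-pass regularization of `⟪u, e⟫` at scale `2^{-i}`. -/
noncomputable def lpf (u : Euc n → V) (e : V) (i : ℕ) (x : Euc n) : ℝ :=
  cv volume (innerB V) u (fun z => kap n (2 ^ i) z • e) x

lemma isTestFun_kap_smul (i : ℕ) (e : V) : IsTestFun n (fun z => kap n (2 ^ i) z • e) :=
  (isTestFun_kap _).smul_const e

lemma smooth_lpf {u : Euc n → V} (hu : LocallyIntegrable u volume) (e : V) (i : ℕ) :
    ContDiff ℝ (⊤ : ℕ∞) (lpf u e i) :=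
  smooth_cv _ hu (isTestFun_kap_smul i e)

lemma lpf_eq_lowpass (u : Euc n → V) (e : V) (J : Fin 0 → Fin n) (i : ℕ) (x : Euc n) :
    lpf u e i x = lowpass u e J 1 i x := by
  simp [lpf, lowpass, dirDeriv_zero, kapr]

/-- Control of the masses of `u` and `f` at balls centered at `x'`. -/
structure MassBound (u : Euc n → V) (σ : Measure (Euc n)) (f : Euc n → W) (Λ : ℝ) (x' : Euc n) :
    Prop where
  nonneg : 0 ≤ Λ
  mass : ∀ r, 0 < r → r ≤ 4 → ∫ y in ball x' r, ‖f y‖ ∂σ ≤ Λ * r ^ n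
  massU : ∫ y in ball x' 4, ‖u y‖ ≤ Λ

lemma MassBound.norm_cv_le {u : Euc n → V} {σ : Measure (Euc n)} {f : Euc n → W} {Λ : ℝ}
    {x x' : Euc n} (hm : MassBound u σ f Λ x') (hu : LocallyIntegrable u volume)
    {κ : Euc n → V} (hκ : IsTestFun n κ) {c : ℝ} (hc0 : 0 ≤ c) (hxx : dist x x' ≤ 2)
    (h0 : ∀ z, 1 / 2 ≤ ‖z‖ → κ z = 0) (hc : ∀ z, ‖κ z‖ ≤ c) :
    ‖cv volume (innerB V) u κ x‖ ≤ c * Λ := by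
  refine (norm_cv_le_ball hu hκ h0 hc x).trans (mul_le_mul_of_nonneg_left ?_ hc0)
  refine le_trans ?_ hm.massU
  refine setIntegral_mono_set (locInt_ball hu x' _).norm
    (Eventually.of_forall fun _ => norm_nonneg _) (LE.le.eventuallyLE ?_)
  exact ball_subset_ball' (by linarith)

theorem KernelSys.exists_incr_bound {A : CoeffOp n k V W} {J : Fin m → Fin n} {e : V}
    (K : KernelSys A J e) : ∃ C, 0 ≤ C ∧ ∀ (u : Euc n → V) (σ : Measure (Euc n))
      (f : Euc n → W), LocallyIntegrable u volume → LocallyIntegrable f σ →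
      HasDistribA n k A u σ f → ∀ Λ x x' i, MassBound u σ f Λ x' →
      dist x x' ≤ 2 * ((2 : ℝ) ^ i)⁻¹ → ∀ l ≤ k, ∀ I : Fin l → Fin n,
      ‖dirDeriv n l I (lpf u e (i + 1)) x - dirDeriv n l I (lpf u e i) x‖ ≤
        C * Λ * ((2 ^ i) ^ l / (2 ^ i) ^ k) := by
  have hKC := K.C_nonneg
  refine ⟨(2 ^ (n + 2) * 3 ^ n) * K.C + K.C, by positivity,
    fun u σ f hu hf h Λ x x' i hm hxx l hl I => ?_⟩
  have hΛ := hm.nonneg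
  have hs : (1 : ℝ) ≤ 2 ^ i := one_le_pow₀ one_le_two
  have hs0 : (0 : ℝ) < 2 ^ i := by positivity
  have hg := K.test_g i
  have hE := K.test_E i
  have h1 : dirDeriv n l I (lpf u e (i + 1)) x - dirDeriv n l I (lpf u e i) x =
      cv σ (innerB W) f (dirDeriv n l I (K.g i)) x -
        cv volume (innerB V) u (dirDeriv n l I (K.E i)) x := by
    unfold lpf
    rw [dirDeriv_cv _ hu (isTestFun_kap_smul _ _), dirDeriv_cv _ hu (isTestFun_kap_smul _ _),
      ← cv_sub _ hu ((isTestFun_kap_smul _ _).dirDeriv I) ((isTestFun_kap_smul _ _).dirDeriv I),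
      ← h.cv_eq hu (hg.dirDeriv I), ← cv_sub _ hu (hg.dirDeriv I).Astar (hE.dirDeriv I)]
    congr 1
    funext z
    have h2 : Astar n k A (K.g i) = fun x =>
        (kap n (2 ^ (i + 1)) x • e - kap n (2 ^ i) x • e) + K.E i x := by
      funext x; rw [K.Astar_g, sub_smul]
    rw [Astar_dirDeriv I hg.1, h2, dirDeriv_add ((isTestFun_kap_smul _ e).sub
      (isTestFun_kap_smul _ e)).1 hE.1, dirDeriv_sub (isTestFun_kap_smul _ e).1
      (isTestFun_kap_smul _ e).1, add_sub_cancel_right]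
  have hxx2 : dist x x' ≤ 2 := hxx.trans (by
    have := inv_le_one_of_one_le₀ hs; linarith)
  have h2 : ‖cv volume (innerB V) u (dirDeriv n l I (K.E i)) x‖ ≤
      K.C * ((2 ^ i) ^ l / (2 ^ i) ^ k) * Λ := by
    refine hm.norm_cv_le hu (hE.dirDeriv I) (by positivity) hxx2 (fun z hz => ?_) fun z => ?_
    · exact dirDeriv_of_eventually_zero (K.E_zero i z hz) I
    · refine (K.bound_E i l hl I z).trans ?_
      rw [div_eq_mul_inv]
      refine mul_le_mul_of_nonneg_left ?_ hKC
      rw [inv_eq_one_div]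
      refine div_le_div₀ (by positivity) (one_le_pow₀ hs) (by positivity) ?_
      exact pow_le_pow_right₀ hs (by omega)
  have h3 : ‖cv σ (innerB W) f (dirDeriv n l I (K.g i)) x‖ ≤
      (2 ^ (n + 2) * 3 ^ n) * (K.C * ((2 ^ i) ^ n * (2 ^ i) ^ l / (2 ^ i) ^ k)) * Λ *
        (((2 : ℝ) ^ i)⁻¹) ^ n := by
    refine (norm_cv_le _ hf (hg.dirDeriv I) x).trans ?_
    refine (mul_le_of_le_one_left (integral_nonneg fun y => by positivity) norm_innerB_le).trans ?_
    refine integral_norm_mul_kernel_le hf (hg.dirDeriv I) (by positivity) hΛ hxx hm.mass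
      (fun z hz => dirDeriv_of_eventually_zero (K.g_zero i z hz) I) fun z => ?_
    exact (mul_le_mul_of_nonneg_left (norm_dirDeriv_le _ _ _) (by positivity)).trans
      (K.bound_g i l hl z)
  rw [h1]
  refine (norm_sub_le _ _).trans ((add_le_add h3 h2).trans (le_of_eq ?_))
  rw [inv_pow]
  field_simp

lemma exists_lpf_zero_bound (n l : ℕ) : ∃ C, 0 ≤ C ∧ ∀ (u : Euc n → V) (e : V)
      (σ : Measure (Euc n)) (f : Euc n → W), LocallyIntegrable u volume →
      ∀ Λ x x', MassBound u σ f Λ x' → dist x x' ≤ 2 → ∀ I : Fin l → Fin n,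
      ‖dirDeriv n l I (lpf u e 0) x‖ ≤ C * ‖e‖ * Λ := by
  obtain ⟨Q, hQ0, hQ⟩ := (isTestFun_kap (n := n) (2 ^ 0)).exists_bound l
  refine ⟨Q, hQ0, fun u e σ f hu Λ x x' hm hxx I => ?_⟩
  unfold lpf
  rw [dirDeriv_cv _ hu (isTestFun_kap_smul _ _)]
  refine hm.norm_cv_le hu ((isTestFun_kap_smul _ _).dirDeriv I) (by positivity) hxx
    (fun z hz => ?_) fun z => ?_
  · rw [dirDeriv_smul_const _ (isTestFun_kap _).1, dirDeriv_of_eventually_zero (kap_of_le _ hz),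
      zero_smul]
  · rw [dirDeriv_smul_const _ (isTestFun_kap _).1, norm_smul]
    gcongr
    exact (norm_dirDeriv_le _ _ _).trans (hQ _)

/-- The vector-valued low-pass regularization of `u`. -/
noncomputable def lpv (u : Euc n → V) (i : ℕ) (x : Euc n) : V :=
  ∑ a, lpf u (stdOrthonormalBasis ℝ V a) i x • stdOrthonormalBasis ℝ V a

lemma smooth_lpv {u : Euc n → V} (hu : LocallyIntegrable u volume) (i : ℕ) :
    ContDiff ℝ (⊤ : ℕ∞) (lpv u i) :=
  ContDiff.sum fun _ _ => (smooth_lpf hu _ i).smul contDiff_const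

lemma dirDeriv_lpv {l : ℕ} {u : Euc n → V} (hu : LocallyIntegrable u volume) (i : ℕ)
    (I : Fin l → Fin n) (x : Euc n) : dirDeriv n l I (lpv u i) x =
      ∑ a, dirDeriv n l I (lpf u (stdOrthonormalBasis ℝ V a) i) x • stdOrthonormalBasis ℝ V a := by
  have hs : ∀ a, ContDiff ℝ (⊤ : ℕ∞) (fun x =>
      lpf u (stdOrthonormalBasis ℝ V a) i x • stdOrthonormalBasis ℝ V a) :=
    fun a => (smooth_lpf hu _ i).smul contDiff_const
  unfold lpv
  rw [dirDeriv_sum _ fun a _ => hs a]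
  exact Finset.sum_congr rfl fun a _ => dirDeriv_smul_const _ (smooth_lpf hu _ i) _ _

lemma inner_Aapply_lpv {A : CoeffOp n k V W} {u : Euc n → V} {σ : Measure (Euc n)} {f : Euc n → W}
    (hu : LocallyIntegrable u volume) (h : HasDistribA n k A u σ f) (i : ℕ) (x : Euc n) (w : W) :
    ⟪Aapply n k A (lpv u i) x, w⟫ = cv σ (innerB W) f (fun z => kap n (2 ^ i) z • w) x := by
  rw [← h.cv_eq hu (isTestFun_kap_smul i w)]
  have hκ := isTestFun_kap (n := n) (2 ^ i)
  have h1 : Aapply n k A (lpv u i) x = ∑ I, ∑ a,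
      cv volume (innerB V) u (fun z => dirDeriv n k I (kap n (2 ^ i)) z •
        stdOrthonormalBasis ℝ V a) x • A I (stdOrthonormalBasis ℝ V a) := by
    unfold Aapply
    refine Finset.sum_congr rfl fun I _ => ?_
    rw [dirDeriv_lpv hu, map_sum]
    refine Finset.sum_congr rfl fun a _ => ?_
    have h2 : dirDeriv n k I (lpf u (stdOrthonormalBasis ℝ V a) i) x = cv volume (innerB V) u
        (dirDeriv n k I (fun z => kap n (2 ^ i) z • stdOrthonormalBasis ℝ V a)) x :=
      dirDeriv_cv _ hu (isTestFun_kap_smul _ _) I x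
    rw [map_smul, h2]
    congr 2
    funext z
    exact dirDeriv_smul_const _ hκ.1 _ _
  rw [h1, sum_inner]
  simp only [sum_inner, inner_smul_left, cv, innerB_apply]
  simp only [inner_smul_right, conj_trivial, ← integral_mul_const]
  have hint : ∀ I : Fin k → Fin n, ∀ v : V, Integrable (fun y =>
      dirDeriv n k I (kap n (2 ^ i)) (x - y) * ⟪u y, v⟫) := fun I v => by
    simpa [inner_smul_right] using integrable_cv (innerB V) hu ((hκ.dirDeriv I).smul_const v) x
  have h2 : ∀ y, ⟪u y, Astar n k A (fun z => kap n (2 ^ i) z • w) (x - y)⟫ =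
      ∑ I, ∑ a, dirDeriv n k I (kap n (2 ^ i)) (x - y) * ⟪u y, stdOrthonormalBasis ℝ V a⟫ *
        ⟪A I (stdOrthonormalBasis ℝ V a), w⟫ := by
    intro y
    unfold Astar
    rw [inner_sum]
    refine Finset.sum_congr rfl fun I _ => ?_
    rw [dirDeriv_smul_const _ hκ.1, map_smul, inner_smul_right, LinearMap.adjoint_inner_right]
    conv_lhs => rw [← (stdOrthonormalBasis ℝ V).sum_repr' (u y)]
    rw [map_sum, sum_inner, Finset.mul_sum]
    refine Finset.sum_congr rfl fun a _ => ?_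
    rw [map_smul, inner_smul_left, real_inner_comm (u y)]
    simp only [conj_trivial]; ring
  simp only [h2]
  rw [integral_finsetSum _ fun I _ => integrable_finsetSum _ fun a _ => (hint I _).mul_const _]
  refine Finset.sum_congr rfl fun I _ => ?_
  rw [integral_finsetSum _ fun a _ => (hint I _).mul_const _]

theorem exists_Aapply_lpv_bound (n : ℕ) : ∃ C, 0 ≤ C ∧ ∀ {k : ℕ} (A : CoeffOp n k V W)
      (u : Euc n → V) (σ : Measure (Euc n)) (f : Euc n → W), LocallyIntegrable u volume →
      LocallyIntegrable f σ → HasDistribA n k A u σ f → ∀ Λ x x' i, MassBound u σ f Λ x' →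
      dist x x' ≤ 2 * ((2 : ℝ) ^ i)⁻¹ → ‖Aapply n k A (lpv u i) x‖ ≤ C * Λ := by
  obtain ⟨Q, hQ0, hQ⟩ := exists_kap_bound (n := n) 0 (n + 1)
  refine ⟨2 ^ (n + 2) * 3 ^ n * Q, by positivity, fun A u σ f hu hf h Λ x x' i hm hxx => ?_⟩
  have hs : (1 : ℝ) ≤ 2 ^ i := one_le_pow₀ one_le_two
  set w := Aapply n _ A (lpv u i) x with hw
  have hΛ := hm.nonneg
  have h1 : ‖cv σ (innerB W) f (fun z => kap n (2 ^ i) z • w) x‖ ≤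
      (2 ^ (n + 2) * 3 ^ n) * (Q * (2 ^ i) ^ n * ‖w‖) * Λ * (((2 : ℝ) ^ i)⁻¹) ^ n := by
    refine (norm_cv_le _ hf (isTestFun_kap_smul i w) x).trans ?_
    refine (mul_le_of_le_one_left (integral_nonneg fun y => by positivity) norm_innerB_le).trans ?_
    refine integral_norm_mul_kernel_le hf (isTestFun_kap_smul i w) (by positivity) hΛ hxx hm.mass
      (fun z hz => by simp [(kap_of_le _ hz).eq_of_nhds]) fun z => ?_
    rw [norm_smul, ← mul_assoc]
    refine mul_le_mul_of_nonneg_right ?_ (norm_nonneg _)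
    simpa using hQ _ hs z
  rw [← inner_Aapply_lpv hu h, ← hw, real_inner_self_eq_norm_sq, Real.norm_of_nonneg (sq_nonneg _)]
    at h1
  have h2 : ‖w‖ ^ 2 ≤ (2 ^ (n + 2) * 3 ^ n * Q * Λ) * ‖w‖ := by
    refine h1.trans (le_of_eq ?_)
    rw [inv_pow]
    field_simp
  rcases (norm_nonneg w).eq_or_lt with h0 | h0
  · rw [← h0]; positivity
  · rw [pow_two] at h2
    exact le_of_mul_le_mul_right h2 h0

end Increments

section Extension

variable {n k : ℕ} {V W : Type*}
  [NormedAddCommGroup V] [InnerProductSpace ℝ V] [FiniteDimensional ℝ V]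
  [NormedAddCommGroup W] [InnerProductSpace ℝ W] [FiniteDimensional ℝ W]

/-- The dyadic pieces of `u`. -/
noncomputable def incr (u : Euc n → V) : ℕ → Euc n → V
  | 0 => lpv u 0
  | i + 1 => fun x => lpv u (i + 1) x - lpv u i x

lemma smooth_incr {u : Euc n → V} (hu : LocallyIntegrable u volume) (i : ℕ) :
    ContDiff ℝ (⊤ : ℕ∞) (incr u i) := by
  cases i with
  | zero => exact smooth_lpv hu 0
  | succ i => exact (smooth_lpv hu _).sub (smooth_lpv hu _)

lemma sum_incr (u : Euc n → V) (N : ℕ) (x : Euc n) :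
    ∑ i ∈ Finset.range (N + 1), incr u i x = lpv u N x := by
  induction N with
  | zero => simp [incr]
  | succ N ih => rw [Finset.sum_range_succ, ih]; simp [incr]

lemma sum_Aapply_incr (A : CoeffOp n k V W) {u : Euc n → V} (hu : LocallyIntegrable u volume)
    (N : ℕ) (x : Euc n) :
    ∑ i ∈ Finset.range (N + 1), Aapply n k A (incr u i) x = Aapply n k A (lpv u N) x := by
  induction N with
  | zero => simp [incr]
  | succ N ih =>
    rw [Finset.sum_range_succ, ih]
    simp only [Aapply, incr]
    rw [← Finset.sum_add_distrib]
    refine Finset.sum_congr rfl fun I _ => ?_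
    rw [dirDeriv_sub (smooth_lpv hu _) (smooth_lpv hu _), map_sub, add_sub_cancel]

theorem exists_incr_bound (hn : 1 ≤ n) {A : CoeffOp n k V W} {J : Fin 0 → Fin n}
    (K : ∀ e : V, KernelSys A J e) {u : Euc n → V} {σ : Measure (Euc n)}
    {f : Euc n → W} (hu : LocallyIntegrable u volume) (hf : LocallyIntegrable f σ)
    (h : HasDistribA n k A u σ f) (Λ : ℝ) : ∃ C, 0 ≤ C ∧ ∀ x x' i, MassBound u σ f Λ x' →
      dist x x' ≤ 2 * ((2 : ℝ) ^ i)⁻¹ → ∀ l ≤ k,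
      ‖iteratedFDeriv ℝ l (incr u i) x‖ ≤ C * ((2 ^ i) ^ l / (2 ^ i) ^ k) := by
  set b := stdOrthonormalBasis ℝ V
  choose C1 hC1 h1 using fun a => (K (b a)).exists_incr_bound
  choose C2 hC2 h2 using exists_lpf_zero_bound (V := V) (W := W) n
  set D1 := ∑ a, C1 a * |Λ| * 2 ^ k
  set D2 := ∑ l ∈ Finset.range (k + 1), ∑ _a : Fin (Module.finrank ℝ V), C2 l * |Λ|
  have hD1 : 0 ≤ D1 := Finset.sum_nonneg fun a _ => by have := hC1 a; positivity
  have hD2 : 0 ≤ D2 := Finset.sum_nonneg fun l _ => Finset.sum_nonneg fun a _ => by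
    have := hC2 l; positivity
  have key : ∀ x x' i, MassBound u σ f Λ x' → dist x x' ≤ 2 * ((2 : ℝ) ^ i)⁻¹ → ∀ l ≤ k,
      ∀ I : Fin l → Fin n,
      ‖dirDeriv n l I (incr u i) x‖ ≤ (D1 + D2) * ((2 ^ i) ^ l / (2 ^ i) ^ k) := by
    intro x x' i hm hxx l hl I
    have hΛ : |Λ| = Λ := abs_of_nonneg hm.nonneg
    cases i with
    | zero =>
      simp only [incr, pow_zero, one_pow, div_one, mul_one] at hxx ⊢
      rw [dirDeriv_lpv hu]
      refine le_trans ?_ (le_add_of_nonneg_left hD1)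
      refine (norm_sum_le _ _).trans ?_
      refine le_trans ?_ (Finset.single_le_sum (f := fun l => ∑ _a : Fin (Module.finrank ℝ V),
        C2 l * |Λ|) (fun l _ => Finset.sum_nonneg fun a _ => by
        have := hC2 l; positivity) (Finset.mem_range.2 (Nat.lt_succ_of_le hl)))
      refine Finset.sum_le_sum fun a _ => ?_
      rw [norm_smul, b.norm_eq_one, mul_one, hΛ]
      simpa using h2 l u (b a) σ f hu Λ x x' hm (by simpa using hxx) I
    | succ i =>
      simp only [incr]
      rw [dirDeriv_sub (smooth_lpv hu _) (smooth_lpv hu _), dirDeriv_lpv hu, dirDeriv_lpv hu,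
        ← Finset.sum_sub_distrib]
      refine (norm_sum_le _ _).trans ?_
      refine le_trans ?_ (mul_le_mul_of_nonneg_right (le_add_of_nonneg_right hD2) (by positivity))
      rw [Finset.sum_mul]
      refine Finset.sum_le_sum fun a _ => ?_
      rw [← sub_smul, norm_smul, b.norm_eq_one, mul_one, hΛ]
      have hxx' : dist x x' ≤ 2 * ((2 : ℝ) ^ i)⁻¹ := by
        refine hxx.trans (mul_le_mul_of_nonneg_left ?_ zero_le_two)
        exact inv_anti₀ (by positivity) (pow_le_pow_right₀ one_le_two (by omega))
      refine (h1 a u σ f hu hf h Λ x x' i hm hxx' l hl I).trans ?_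
      rw [mul_assoc (C1 a * Λ)]
      refine mul_le_mul_of_nonneg_left ?_ (mul_nonneg (hC1 a) hm.nonneg)
      rw [pow_succ (2 : ℝ) i, mul_pow, mul_pow, ← mul_div_assoc, mul_comm ((2 ^ i : ℝ) ^ k),
        mul_div_mul_left _ _ (by positivity)]
      refine div_le_div_of_nonneg_right ?_ (by positivity)
      exact le_mul_of_one_le_right (by positivity) (one_le_pow₀ one_le_two)
  refine ⟨n ^ k * (D1 + D2), by positivity, fun x x' i hm hxx l hl => ?_⟩
  refine (norm_iteratedFDeriv_le_sum _ _).trans ?_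
  refine (Finset.sum_le_sum fun I _ => key x x' i hm hxx l hl I).trans ?_
  rw [Finset.sum_const, nsmul_eq_mul, mul_assoc]
  refine mul_le_mul_of_nonneg_right ?_ (by positivity)
  simp only [Finset.card_univ, Fintype.card_fun, Fintype.card_fin, Nat.cast_pow]
  exact pow_le_pow_right₀ (by exact_mod_cast hn) hl

/-- Dyadic decomposition data localized near a compact set `F`: the pieces `P i` are bounded in
`C^k`, summable in `C^{k-1}`, and their sums have bounded image under `𝒜`. -/
structure DyadicData (A : CoeffOp n k V W) (u : Euc n → V) (F : Set (Euc n)) where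
  /-- the pieces -/
  P : ℕ → Euc n → V
  /-- common bound -/
  C : ℝ
  C_nonneg : 0 ≤ C
  test : ∀ i, IsTestFun n (P i)
  sum_eq : ∀ N, ∀ x ∈ F, ∑ i ∈ Finset.range (N + 1), P i x = lpv u N x
  zero : ∀ i x, 2 < infDist x F → P i x = 0
  bound : ∀ i x, ∀ l < k, ∀ I : Fin l → Fin n, ‖dirDeriv n l I (P i) x‖ ≤ C * ((2 : ℝ) ^ i)⁻¹
  boundA : ∀ N x, ‖∑ i ∈ Finset.range N, Aapply n k A (P i) x‖ ≤ C

lemma norm_Aapply_le (A : CoeffOp n k V W) : ∃ C, 0 ≤ C ∧ ∀ (w : Euc n → V) (x : Euc n),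
    ‖Aapply n k A w x‖ ≤ C * ‖iteratedFDeriv ℝ k w x‖ := by
  refine ⟨∑ I, ‖LinearMap.toContinuousLinearMap (A I)‖, by positivity, fun w x => ?_⟩
  rw [Finset.sum_mul]
  refine (norm_sum_le _ _).trans (Finset.sum_le_sum fun I _ => ?_)
  refine ((LinearMap.toContinuousLinearMap (A I)).le_opNorm _).trans ?_
  gcongr
  exact norm_dirDeriv_le _ _ _

lemma Aapply_congr_nhds (A : CoeffOp n k V W) {w w' : Euc n → V} {x : Euc n}
    (h : w =ᶠ[𝓝 x] w') : Aapply n k A w x = Aapply n k A w' x :=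
  Finset.sum_congr rfl fun I _ => by rw [dirDeriv_congr_nhds h I]

theorem exists_dyadicData (hn : 1 ≤ n) {A : CoeffOp n k V W} {J : Fin 0 → Fin n}
    (K : ∀ e : V, KernelSys A J e) {u : Euc n → V} {σ : Measure (Euc n)}
    {f : Euc n → W} (hu : LocallyIntegrable u volume) (hf : LocallyIntegrable f σ)
    (h : HasDistribA n k A u σ f) {Λ : ℝ} {F : Set (Euc n)} (hF : IsCompact F)
    (hFne : F.Nonempty) (hm : ∀ x ∈ F, MassBound u σ f Λ x) : Nonempty (DyadicData A u F) := by
  obtain ⟨C, hC0, hC⟩ := exists_incr_bound hn K hu hf h Λ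
  obtain ⟨CA, hCA0, hCA⟩ := exists_Aapply_lpv_bound (V := V) (W := W) n
  obtain ⟨Z, hZt, hZ1, hZ0, hZb⟩ := exists_cutoffs hF
  choose Q hQ0 hQ using hZb
  obtain ⟨N0, hN0, hNA⟩ := norm_Aapply_le A
  have hΛ : 0 ≤ Λ := (hm _ hFne.some_mem).nonneg
  have hsm := smooth_incr hu
  set P : ℕ → Euc n → V := fun i x => Z i x • incr u i x
  set S : ℕ → ℝ := fun l => ∑ j ∈ Finset.range (l + 1), (l.choose j : ℝ) * Q j * C
  have hS0 : ∀ l, 0 ≤ S l := fun l => Finset.sum_nonneg fun j _ => by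
    have := hQ0 j; positivity
  have hPz : ∀ i x, 2 * ((2 : ℝ) ^ i)⁻¹ < infDist x F → P i =ᶠ[𝓝 x] fun _ => 0 := by
    intro i x hx
    filter_upwards [hZ0 i x hx] with y hy
    simp [P, hy]
  have hPb : ∀ i x, ∀ l ≤ k, ‖iteratedFDeriv ℝ l (P i) x‖ ≤ S l * ((2 ^ i) ^ l / (2 ^ i) ^ k) := by
    intro i x l hl
    by_cases hx : 2 * ((2 : ℝ) ^ i)⁻¹ < infDist x F
    · rw [((hPz i x hx).iteratedFDeriv ℝ l).eq_of_nhds]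
      have : iteratedFDeriv ℝ l (fun _ : Euc n => (0 : V)) x = 0 := by
        rw [iteratedFDeriv_fun_zero]; rfl
      rw [this, norm_zero]
      exact mul_nonneg (hS0 l) (by positivity)
    push Not at hx
    obtain ⟨x', hx', hd⟩ := hF.exists_infDist_eq_dist hFne x
    rw [hd] at hx
    refine (norm_iteratedFDeriv_smul_le (hZt i).1 (hsm i) x (by exact_mod_cast le_top)).trans ?_
    rw [Finset.sum_mul]
    refine Finset.sum_le_sum fun j hj => ?_
    have hj' : j ≤ l := Nat.lt_succ_iff.1 (Finset.mem_range.1 hj)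
    have h1 := hQ j i x
    have h2 := hC x x' i (hm x' hx') hx (l - j) (by omega)
    calc (l.choose j : ℝ) * ‖iteratedFDeriv ℝ j (Z i) x‖ * ‖iteratedFDeriv ℝ (l - j) (incr u i) x‖
        ≤ (l.choose j : ℝ) * (Q j * (2 ^ i) ^ j) * (C * ((2 ^ i) ^ (l - j) / (2 ^ i) ^ k)) := by
          gcongr
          have := hQ0 j
          positivity
      _ = (l.choose j : ℝ) * Q j * C * ((2 ^ i) ^ l / (2 ^ i) ^ k) := by
          have h3 : ((2 : ℝ) ^ i) ^ l = (2 ^ i) ^ j * (2 ^ i) ^ (l - j) := by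
            rw [← pow_add, Nat.add_sub_cancel' hj']
          rw [h3]; ring
  set T := ∑ l ∈ Finset.range k, S l
  have hT : 0 ≤ T := Finset.sum_nonneg fun l _ => hS0 l
  refine ⟨⟨P, T + (CA * Λ + 3 * (N0 * S k)), by have := hS0 k; positivity,
    fun i => (hZt i).smul (hsm i), fun N x hx => ?_, fun i x hx => ?_, fun i x l hl I => ?_,
    fun N x => ?_⟩⟩
  · rw [← sum_incr]
    refine Finset.sum_congr rfl fun i _ => ?_
    have := (hZ1 i x (by rw [infDist_zero_of_mem hx]; positivity) hFne).eq_of_nhds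
    simp [P, this]
  · refine (hPz i x (lt_of_le_of_lt ?_ hx)).eq_of_nhds
    have := inv_le_one_of_one_le₀ (one_le_pow₀ one_le_two : (1 : ℝ) ≤ 2 ^ i)
    linarith
  · refine (norm_dirDeriv_le _ _ _).trans ((hPb i x l hl.le).trans ?_)
    have h1 : S l ≤ T := Finset.single_le_sum (fun l _ => hS0 l) (Finset.mem_range.2 hl)
    have h2 : ((2 : ℝ) ^ i) ^ l / (2 ^ i) ^ k ≤ ((2 : ℝ) ^ i)⁻¹ := by
      rw [div_le_iff₀ (by positivity), inv_mul_eq_div, le_div_iff₀ (by positivity), ← pow_succ]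
      exact pow_le_pow_right₀ (one_le_pow₀ one_le_two) hl
    have h3 : 0 ≤ CA * Λ + 3 * (N0 * S k) := by have := hS0 k; positivity
    exact mul_le_mul (h1.trans (le_add_of_nonneg_right h3)) h2 (by positivity)
      (add_nonneg hT h3)
  · classical
    have hPA : ∀ i, ‖Aapply n k A (P i) x‖ ≤ N0 * S k := fun i => by
      refine (hNA _ _).trans (mul_le_mul_of_nonneg_left ?_ hN0)
      have := hPb i x k le_rfl
      rwa [div_self (by positivity), mul_one] at this
    have hex : ∃ p, N ≤ p ∨ ((2 : ℝ) ^ p)⁻¹ / 2 ≤ infDist x F := ⟨N, Or.inl le_rfl⟩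
    set p := Nat.find hex with hp
    have hpN : p ≤ N := Nat.find_min' hex (Or.inl le_rfl)
    have hmin : ∀ i < p, infDist x F < ((2 : ℝ) ^ i)⁻¹ / 2 := fun i hi => by
      have := Nat.find_min hex hi
      push Not at this
      exact this.2
    rw [← Finset.sum_range_add_sum_Ico _ hpN]
    refine (norm_add_le _ _).trans (le_add_of_nonneg_of_le hT (add_le_add ?_ ?_))
    · have h1 : ∀ i ∈ Finset.range p, Aapply n k A (P i) x = Aapply n k A (incr u i) x := by
        intro i hi
        refine Aapply_congr_nhds A ?_
        filter_upwards [hZ1 i x (hmin i (Finset.mem_range.1 hi)) hFne] with y hy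
        simp [P, hy]
      rw [Finset.sum_congr rfl h1]
      rcases Nat.eq_zero_or_eq_succ_pred p with h0 | h0
      · rw [h0]; simp; positivity
      · rw [h0, Nat.succ_eq_add_one, sum_Aapply_incr A hu]
        obtain ⟨x', hx', hd⟩ := hF.exists_infDist_eq_dist hFne x
        refine hCA A u σ f hu hf h Λ x x' _ (hm x' hx') ?_
        have := hmin p.pred (by omega)
        have h4 : (0 : ℝ) < (2 ^ p.pred)⁻¹ := by positivity
        rw [← hd]
        linarith
    · refine (norm_sum_le _ _).trans ?_
      have h1 : ∀ i ∈ Finset.Ico p N, ‖Aapply n k A (P i) x‖ ≤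
          if i ∈ Finset.Ico p (p + 3) then N0 * S k else 0 := by
        intro i hi
        rw [Finset.mem_Ico] at hi
        split_ifs with hi3
        · exact hPA i
        · have hi4 : p + 3 ≤ i := by
            rw [Finset.mem_Ico] at hi3; omega
          have hps : ((2 : ℝ) ^ p)⁻¹ / 2 ≤ infDist x F :=
            (Nat.find_spec hex).resolve_left (by omega)
          have h5 : ((2 : ℝ) ^ i)⁻¹ ≤ (2 ^ (p + 3))⁻¹ :=
            inv_anti₀ (by positivity) (pow_le_pow_right₀ one_le_two hi4)
          have h6 : (0 : ℝ) < (2 ^ p)⁻¹ := by positivity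
          rw [pow_add, mul_inv] at h5
          have h7 := Aapply_congr_nhds A (hPz i x (by linarith))
          rw [h7]
          have h8 : Aapply n k A (fun _ : Euc n => (0 : V)) x = 0 := by
            simp [Aapply, dirDeriv_zero_fun]
          rw [h8, norm_zero]
      refine (Finset.sum_le_sum h1).trans ?_
      rw [← Finset.sum_filter, Finset.sum_const, nsmul_eq_mul]
      refine mul_le_mul_of_nonneg_right ?_ (mul_nonneg hN0 (hS0 k))
      have h9 : (Finset.filter (fun i => i ∈ Finset.Ico p (p + 3)) (Finset.Ico p N)).card ≤
          (Finset.Ico p (p + 3)).card := Finset.card_le_card fun i hi => (Finset.mem_filter.1 hi).2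
      rw [Nat.card_Ico] at h9
      exact_mod_cast h9.trans (by omega)

lemma integral_norm_sq_le_of_zero {G : Type*} [NormedAddCommGroup G] {g : Euc n → G}
    {B : Set (Euc n)} (hB : IsCompact B) {M : ℝ}
    (h0 : ∀ x ∉ B, g x = 0) (hM : ∀ x, ‖g x‖ ≤ M) :
    ∫ x, ‖g x‖ ^ 2 ≤ M ^ 2 * volume.real B := by
  have hi : Integrable (B.indicator fun _ => M ^ 2 : Euc n → ℝ) volume :=
    (integrable_indicator_iff hB.measurableSet).2 (integrableOn_const hB.measure_lt_top.ne)
  refine (integral_mono_of_nonneg (Eventually.of_forall fun x => sq_nonneg _) hi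
    (Eventually.of_forall fun x => ?_)).trans (le_of_eq ?_)
  · by_cases hx : x ∈ B
    · simp only [Set.indicator_of_mem hx]
      exact pow_le_pow_left₀ (norm_nonneg _) (hM x) 2
    · simp [h0 x hx, Set.indicator_of_notMem hx]
  · rw [integral_indicator hB.measurableSet, setIntegral_const, smul_eq_mul, mul_comm]

/-- Bounded sequences of test functions have weak limits. -/
lemma exists_weak_limit_test {g : ℕ → Euc n → ℝ} (hg : ∀ N, IsTestFun n (g N)) {M : ℝ}
    (hM : ∀ N, ∫ x, g N x ^ 2 ≤ M) :
    ∃ G : Euc n → ℝ, LocallyIntegrable G volume ∧ ∀ φ : Euc n → ℝ, IsTestFun n φ →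
      Tendsto (fun N => ∫ x, φ x * g N x) (hyperfilter ℕ : Filter ℕ) (𝓝 (∫ x, φ x * G x)) := by
  have hL : ∀ {φ : Euc n → ℝ}, IsTestFun n φ → MemLp φ 2 volume :=
    fun h => h.1.continuous.memLp_of_hasCompactSupport h.2
  have hin : ∀ {φ : Euc n → ℝ} (h : IsTestFun n φ) (G : Lp ℝ 2 (volume : Measure (Euc n))),
      ⟪G, (hL h).toLp φ⟫ = ∫ x, φ x * G x := by
    intro φ h G
    rw [L2.inner_def]
    refine integral_congr_ae ?_
    filter_upwards [(hL h).coeFn_toLp] with x hx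
    simp [hx]
  have hin2 : ∀ {φ ψ : Euc n → ℝ} (h : IsTestFun n φ) (h' : IsTestFun n ψ),
      ⟪(hL h').toLp ψ, (hL h).toLp φ⟫ = ∫ x, φ x * ψ x := by
    intro φ ψ h h'
    rw [hin h]
    refine integral_congr_ae ?_
    filter_upwards [(hL h').coeFn_toLp] with x hx
    simp [hx]
  obtain ⟨G, hG⟩ := exists_weak_limit (x := fun N => (hL (hg N)).toLp (g N)) (C := √M) fun N => by
    refine Real.le_sqrt_of_sq_le ?_
    rw [← real_inner_self_eq_norm_sq, hin2 (hg N) (hg N)]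
    simpa only [← pow_two] using hM N
  refine ⟨G, (Lp.memLp G).locallyIntegrable (by norm_num), fun φ hφ => ?_⟩
  have := hG ((hL hφ).toLp φ)
  rw [hin hφ] at this
  exact this.congr fun N => hin2 hφ (hg N)

theorem DyadicData.exists_extension {A : CoeffOp n k V W} {u : Euc n → V} {F : Set (Euc n)}
    (D : DyadicData A u F) (hk : 1 ≤ k) (hE : IsElliptic n k A) (hF : IsCompact F)
    (hFne : F.Nonempty)
    (hlim : ∀ᵐ x, Tendsto (fun N => lpv u N x) atTop (𝓝 (u x))) (e : V) :
    ∃ v : Euc n → ℝ, LocallyIntegrable v volume ∧ (∀ᵐ x, x ∈ F → v x = ⟪u x, e⟫) ∧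
      ∀ l ≤ k, ∀ I : Fin l → Fin n, ∃ G : Euc n → ℝ, LocallyIntegrable G volume ∧
        ∀ φ : Euc n → ℝ, IsTestFun n φ →
          ∫ x, dirDeriv n l I φ x * v x = (-1 : ℝ) ^ l * ∫ x, φ x * G x := by
  have hC := D.C_nonneg
  set B := cthickening 2 F
  have hBc : IsCompact B := hF.cthickening
  have hPB : ∀ x ∉ B, ∀ i, D.P i =ᶠ[𝓝 x] fun _ => 0 := by
    intro x hx i
    filter_upwards [(isClosed_cthickening (δ := 2) (E := F)).isOpen_compl.mem_nhds hx] with y hy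
    refine D.zero i y ?_
    by_contra hcon
    push Not at hcon
    refine hy ?_
    rw [mem_cthickening_iff, ← ENNReal.ofReal_toReal (infEDist_ne_top hFne)]
    exact ENNReal.ofReal_le_ofReal hcon
  have hPb : ∀ i x, ‖D.P i x‖ ≤ D.C * (1 / 2) ^ i := fun i x => by
    have := D.bound i x 0 (by omega) Fin.elim0
    simpa [dirDeriv_zero] using this
  have hsum : Summable fun i : ℕ => D.C * (1 / 2 : ℝ) ^ i := summable_geometric_two.mul_left _
  set v : Euc n → ℝ := fun x => ∑' i, ⟪D.P i x, e⟫
  have hvb : ∀ i x, ‖⟪D.P i x, e⟫‖ ≤ D.C * (1 / 2) ^ i * ‖e‖ := fun i x =>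
    (norm_inner_le_norm (𝕜 := ℝ) _ _).trans (mul_le_mul_of_nonneg_right (hPb i x) (norm_nonneg _))
  have hsum2 : Summable fun i : ℕ => D.C * (1 / 2 : ℝ) ^ i * ‖e‖ := hsum.mul_right _
  have hvc : Continuous v := continuous_tsum
    (fun i => (D.test i).1.continuous.inner continuous_const) hsum2 hvb
  set U : ℕ → Euc n → V := fun N x => ∑ i ∈ Finset.range N, D.P i x
  have hU : ∀ N, IsTestFun n (U N) := fun N => IsTestFun.sum _ fun i _ => D.test i
  have hUv : ∀ x, Tendsto (fun N => ⟪U N x, e⟫) atTop (𝓝 (v x)) := fun x => by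
    have := (Summable.of_norm_bounded hsum2 (hvb · x)).hasSum.tendsto_sum_nat
    simpa only [U, sum_inner] using this
  have hdU : ∀ N l (I : Fin l → Fin n) x,
      dirDeriv n l I (U N) x = ∑ i ∈ Finset.range N, dirDeriv n l I (D.P i) x := fun N l I x =>
    dirDeriv_sum _ (fun i _ => (D.test i).1) I x
  have hgeo : ∀ N, ∑ i ∈ Finset.range N, D.C * ((2 : ℝ) ^ i)⁻¹ ≤ D.C * 2 := fun N => by
    rw [← Finset.mul_sum]; exact mul_le_mul_of_nonneg_left (sum_half_pow_le N) hC
  have hUB : ∀ x ∉ B, ∀ N, U N =ᶠ[𝓝 x] fun _ => 0 := by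
    intro x hx N
    have := (Finset.eventually_all (Finset.range N) (l := 𝓝 x)
      (p := fun i y => D.P i y = 0)).2 fun i _ => hPB x hx i
    filter_upwards [this] with y hy
    exact Finset.sum_eq_zero hy
  refine ⟨v, hvc.locallyIntegrable, ?_, fun l hl I => ?_⟩
  · filter_upwards [hlim] with x hx hxF
    refine tendsto_nhds_unique ((hUv x).comp (tendsto_add_atTop_nat 1)) ?_
    refine (hx.inner tendsto_const_nhds).congr fun N => ?_
    rw [← D.sum_eq N x hxF]; rfl
  · obtain ⟨M, hM⟩ : ∃ M, ∀ N, ∫ x, ‖dirDeriv n l I (U N) x‖ ^ 2 ≤ M := by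
      rcases hl.lt_or_eq with hl | rfl
      · refine ⟨(D.C * 2) ^ 2 * volume.real B, fun N => integral_norm_sq_le_of_zero hBc
          (fun x hx => dirDeriv_of_eventually_zero (hUB x hx N) I) fun x => ?_⟩
        rw [hdU]
        exact (norm_sum_le _ _).trans ((Finset.sum_le_sum fun i _ => D.bound i x l hl I).trans
          (hgeo N))
      · obtain ⟨Q, hQ0, hQ⟩ := hE.exists_coercive hk
        refine ⟨Q * (D.C ^ 2 * volume.real B), fun N => (hQ _ (hU N) I).trans
          (mul_le_mul_of_nonneg_left (integral_norm_sq_le_of_zero hBc (fun x hx => ?_)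
          fun x => ?_) hQ0)⟩
        · rw [Aapply_congr_nhds A (hUB x hx N)]
          simp [Aapply, dirDeriv_zero_fun]
        · refine le_trans (le_of_eq ?_) (D.boundA N x)
          congr 1
          simp only [Aapply, hdU, map_sum]
          exact Finset.sum_comm
    have hg : ∀ N, IsTestFun n (fun x => ⟪dirDeriv n l I (U N) x, e⟫) := fun N => by
      simpa [real_inner_comm] using ((hU N).dirDeriv I).clm (innerSL ℝ e)
    obtain ⟨G, hG, hGt⟩ := exists_weak_limit_test hg (M := M * ‖e‖ ^ 2) fun N => by
      refine le_trans ?_ (mul_le_mul_of_nonneg_right (hM N) (sq_nonneg _))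
      rw [← integral_mul_const]
      refine integral_mono_of_nonneg (Eventually.of_forall fun x => sq_nonneg _) ?_
        (Eventually.of_forall fun x => ?_)
      · have h2 := (hU N).dirDeriv I
        exact ((memLp_two_iff_integrable_sq_norm h2.1.continuous.aestronglyMeasurable).1
          (h2.1.continuous.memLp_of_hasCompactSupport h2.2)).mul_const _
      · simp only
        rw [← mul_pow, ← sq_abs]
        exact pow_le_pow_left₀ (abs_nonneg _) (abs_real_inner_le_norm _ _) 2
    refine ⟨G, hG, fun φ hφ => ?_⟩
    have h1 : Tendsto (fun N => ∫ x, dirDeriv n l I φ x * ⟪U N x, e⟫) atTop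
        (𝓝 (∫ x, dirDeriv n l I φ x * v x)) := by
      refine tendsto_integral_of_dominated_convergence
        (fun x => ‖dirDeriv n l I φ x‖ * (D.C * 2 * ‖e‖)) (fun N => ?_) ?_ (fun N => ?_) ?_
      · exact ((hφ.dirDeriv I).1.continuous.mul ((hU N).1.continuous.inner
          continuous_const)).aestronglyMeasurable
      · exact ((hφ.dirDeriv I).integrable volume).norm.mul_const _
      · refine Eventually.of_forall fun x => ?_
        rw [norm_mul]
        refine mul_le_mul_of_nonneg_left ?_ (norm_nonneg _)
        refine (norm_inner_le_norm (𝕜 := ℝ) _ _).trans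
          (mul_le_mul_of_nonneg_right ?_ (norm_nonneg _))
        refine (norm_sum_le _ _).trans ((Finset.sum_le_sum fun i _ => hPb i x).trans ?_)
        simpa using hgeo N
      · exact Eventually.of_forall fun x => (hUv x).const_mul _
    have h2 : ∀ N, ∫ x, dirDeriv n l I φ x * ⟪U N x, e⟫ =
        (-1 : ℝ) ^ l * ∫ x, φ x * ⟪dirDeriv n l I (U N) x, e⟫ := by
      intro N
      have h3 := integral_dirDeriv_right (ContinuousLinearMap.mul ℝ ℝ)
        (((hU N).1).inner ℝ (contDiff_const (c := e))) hφ.1 (Or.inr hφ.2) I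
      have h4 : ∀ x, dirDeriv n l I (fun x => ⟪U N x, e⟫) x = ⟪dirDeriv n l I (U N) x, e⟫ :=
        fun x => by simpa [real_inner_comm] using dirDeriv_clm (innerSL ℝ e) (hU N).1 I x
      simpa [h4, mul_comm] using h3
    refine tendsto_nhds_unique (h1.mono_left Nat.hyperfilter_le_atTop) ?_
    simp only [h2]
    exact (hGt φ hφ).const_mul _

end Extension

section Mollify

variable {n : ℕ} {F : Type*} [NormedAddCommGroup F]

/-- `∫_{B_s(x₀)} ‖g - c‖ ≤ η s^n` for all `s < δ`. -/
def CloseTo (g : Euc n → F) (x₀ : Euc n) (c : F) (η δ : ℝ) : Prop :=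
  ∀ s, 0 < s → s < δ → ∫ y in ball x₀ s, ‖g y - c‖ ≤ η * s ^ n

/-- `x₀` is a Lebesgue point of `g`. -/
def LebPt (g : Euc n → F) (x₀ : Euc n) : Prop := ∀ η > 0, ∃ δ > 0, CloseTo g x₀ (g x₀) η δ

lemma locInt_ball' {σ : Measure (Euc n)} {f : Euc n → F} (hf : LocallyIntegrable f σ)
    (x : Euc n) (r : ℝ) : IntegrableOn f (ball x r) σ :=
  (hf.integrableOn_isCompact (isCompact_closedBall x r)).mono_set ball_subset_closedBall

lemma volume_real_closedBall (x : Euc n) {r : ℝ} (hr : 0 ≤ r) :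
    volume.real (closedBall x r) = r ^ n * volume.real (ball (0 : Euc n) 1) := by
  rw [Measure.real, Measure.addHaar_closedBall _ _ hr, ENNReal.toReal_mul,
    ENNReal.toReal_ofReal (by positivity), finrank_euclideanSpace_fin, Measure.real]

lemma volume_real_unitBall_pos : 0 < volume.real (ball (0 : Euc n) 1) :=
  ENNReal.toReal_pos (measure_ball_pos _ _ one_pos).ne' measure_ball_lt_top.ne

lemma ae_lebPt [NormedSpace ℝ F] [CompleteSpace F] {g : Euc n → F}
    (hg : LocallyIntegrable g volume) : ∀ᵐ x, LebPt g x := by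
  filter_upwards [(Besicovitch.vitaliFamily volume).ae_tendsto_average_norm_sub hg] with x hx η hη
  have h1 := hx.comp (Besicovitch.tendsto_filterAt volume x)
  have hω := volume_real_unitBall_pos (n := n)
  have h2 := (h1.eventually (gt_mem_nhds (show (0 : ℝ) < η / volume.real (ball (0 : Euc n) 1) by
    positivity)))
  obtain ⟨δ, hδ, h3⟩ := mem_nhdsGT_iff_exists_Ioo_subset.1 h2
  refine ⟨δ, hδ, fun s hs hsδ => ?_⟩
  have h4 := h3 ⟨hs, hsδ⟩
  simp only [Function.comp, Set.mem_ofPred_eq, setAverage_eq, smul_eq_mul,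
    volume_real_closedBall x hs.le] at h4
  rw [inv_mul_lt_iff₀ (by positivity)] at h4
  have h5 : s ^ n * volume.real (ball (0 : Euc n) 1) * (η / volume.real (ball (0 : Euc n) 1)) =
      η * s ^ n := by field_simp
  rw [h5] at h4
  refine le_trans (setIntegral_mono_set ?_ (Eventually.of_forall fun _ => norm_nonneg _)
    (LE.le.eventuallyLE ball_subset_closedBall)) h4.le
  exact ((hg.integrableOn_isCompact (isCompact_closedBall x s)).sub
    (integrableOn_const (isCompact_closedBall x s).measure_lt_top.ne)).norm

/-- Mollification of `g` at scale `1 / s`. -/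
noncomputable def mol (g : Euc n → ℝ) (s : ℝ) (x : Euc n) : ℝ :=
  cv volume (ContinuousLinearMap.mul ℝ ℝ) g (bmps n s) x

lemma locInt_sub_const {g : Euc n → ℝ} (hg : LocallyIntegrable g volume) (c : ℝ) :
    LocallyIntegrable (fun y => |g y - c|) volume :=
  fun x => by
  obtain ⟨s, hs, h⟩ := (hg.sub (continuous_const (y := c)).locallyIntegrable) x
  exact ⟨s, hs, h.norm⟩

lemma smooth_mol {g : Euc n → ℝ} (hg : LocallyIntegrable g volume) {s : ℝ} (hs : 0 < s) :
    ContDiff ℝ (⊤ : ℕ∞) (mol g s) := smooth_cv _ hg (isTestFun_bmps hs)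

lemma abs_mol_sub_le {g : Euc n → ℝ} (hg : LocallyIntegrable g volume) {s : ℝ} (hs : 0 < s)
    (c : ℝ) (x : Euc n) : |mol g s x - c| ≤ ∫ y, |g y - c| * bmps n s (x - y) := by
  have hb := isTestFun_bmps (n := n) hs
  have h1 : mol g s x - c = ∫ y, (g y - c) * bmps n s (x - y) := by
    have h2 : ∫ y, bmps n s (x - y) = 1 := by
      rw [integral_sub_left_eq_self (fun z => bmps n s z), integral_bmps hs]
    have h3 := integrable_cv (ContinuousLinearMap.mul ℝ ℝ) hg hb x
    have h4 : Integrable (fun y => bmps n s (x - y)) := (hb.comp_sub_left x).integrable volume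
    simp only [ContinuousLinearMap.mul_apply'] at h3
    simp only [sub_mul]
    rw [integral_sub h3 (h4.const_mul c), integral_const_mul, h2, mul_one]
    rfl
  rw [h1, ← Real.norm_eq_abs]
  refine (norm_integral_le_integral_norm _).trans (le_of_eq ?_)
  refine integral_congr_ae (Eventually.of_forall fun y => ?_)
  simp [abs_of_nonneg (bmps_nonneg hs _)]

lemma exists_bmp_bound : ∃ B, 0 ≤ B ∧ ∀ s, 0 < s → ∀ x : Euc n, bmps n s x ≤ B * s ^ n := by
  obtain ⟨B, hB0, hB⟩ := (isTestFun_bmp (n := n)).exists_bound 0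
  refine ⟨B, hB0, fun s hs x => ?_⟩
  have := hB (s • x)
  simp only [norm_iteratedFDeriv_zero] at this
  rw [bmps, mul_comm]
  exact mul_le_mul_of_nonneg_right ((le_abs_self _).trans this) (by positivity)

lemma exists_mol_bound (n : ℕ) : ∃ C, 0 ≤ C ∧ ∀ (g : Euc n → ℝ), LocallyIntegrable g volume →
    ∀ (x₀ : Euc n) (c η δ : ℝ), CloseTo g x₀ c η δ → ∀ s, 0 < s → 2 * s⁻¹ < δ →
    ∀ x, dist x x₀ ≤ s⁻¹ → |mol g s x - c| ≤ C * η := by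
  obtain ⟨B, hB0, hB⟩ := exists_bmp_bound (n := n)
  refine ⟨B * 2 ^ n, by positivity, fun g hg x₀ c η δ hc s hs hsδ x hx => ?_⟩
  have h1 := hc (2 * s⁻¹) (by positivity) hsδ
  have hb := isTestFun_bmps (n := n) hs
  refine (abs_mol_sub_le hg hs c x).trans ?_
  calc ∫ y, |g y - c| * bmps n s (x - y)
      ≤ ∫ y, (ball x₀ (2 * s⁻¹)).indicator (fun y => |g y - c| * (B * s ^ n)) y := by
        refine integral_mono_of_nonneg (Eventually.of_forall fun y => ?_) ?_
          (Eventually.of_forall fun y => ?_)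
        · exact mul_nonneg (abs_nonneg _) (bmps_nonneg hs _)
        · exact IntegrableOn.integrable_indicator
            ((locInt_ball' (locInt_sub_const hg c) _ _).mul_const _) measurableSet_ball
        · simp only
          by_cases hy : s⁻¹ / 2 ≤ ‖x - y‖
          · rw [bmps_of_le hs hy, mul_zero]
            exact Set.indicator_nonneg (fun y _ => by positivity) _
          · rw [Set.indicator_of_mem]
            · exact mul_le_mul_of_nonneg_left (hB s hs _) (abs_nonneg _)
            · rw [mem_ball]
              push Not at hy
              rw [← dist_eq_norm, dist_comm] at hy
              have := dist_triangle y x x₀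
              have : 0 < s⁻¹ := by positivity
              linarith
    _ = (∫ y in ball x₀ (2 * s⁻¹), ‖g y - c‖) * (B * s ^ n) := by
        rw [integral_indicator measurableSet_ball, integral_mul_const]; rfl
    _ ≤ η * (2 * s⁻¹) ^ n * (B * s ^ n) := mul_le_mul_of_nonneg_right h1 (by positivity)
    _ = _ := by
        rw [mul_pow, inv_pow]; field_simp

lemma integral_mol_sub_le {g : Euc n → ℝ} (hg : LocallyIntegrable g volume) (x₀ : Euc n) (c : ℝ)
    {s t : ℝ} (hs : 0 < s) (hst : s⁻¹ ≤ t) :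
    ∫ x in closedBall x₀ t, |mol g s x - c| ≤ ∫ y in ball x₀ (3 * t), ‖g y - c‖ := by
  have hs' : 0 < s⁻¹ := by positivity
  have ht : 0 < t := hs'.trans_le hst
  have hb := isTestFun_bmps (n := n) hs
  set φ : Euc n → ℝ := fun x => max 0 (min 1 (2 - dist x x₀ / t))
  have hφ : Continuous φ := by fun_prop
  have hφ0 : ∀ x, 0 ≤ φ x := fun x => le_max_left _ _
  have hφ1 : ∀ x, φ x ≤ 1 := fun x => max_le zero_le_one (min_le_left _ _)
  have hφs : ∀ x, 2 * t ≤ dist x x₀ → φ x = 0 := fun x hx => by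
    refine max_eq_left (min_le_of_right_le ?_)
    rw [sub_nonpos, le_div_iff₀ ht]; exact hx
  have hφe : ∀ x ∈ closedBall x₀ t, φ x = 1 := fun x hx => by
    rw [mem_closedBall] at hx
    have : 1 ≤ 2 - dist x x₀ / t := by
      rw [le_sub_comm, div_le_iff₀ ht]; linarith
    simp [φ, min_eq_left this]
  have hφc : HasCompactSupport φ := HasCompactSupport.of_support_subset_isCompact
    (isCompact_closedBall x₀ (2 * t)) fun x hx => by
      by_contra hcon
      rw [mem_closedBall, not_le] at hcon
      exact hx (hφs x hcon.le)
  have hgc := locInt_sub_const hg c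
  have h0 : ∀ x, ∫ y, |g y - c| * bmps n s (x - y) =
      cv volume (ContinuousLinearMap.mul ℝ ℝ) (fun y => |g y - c|) (bmps n s) x := fun x => rfl
  have hcont : Continuous fun x => ∫ y, |g y - c| * bmps n s (x - y) := by
    simp only [h0]; exact (smooth_cv _ hgc hb).continuous
  have hin : ∀ y, ∫ x, bmps n s (x - y) * φ x ≤ 1 := fun y => by
    calc ∫ x, bmps n s (x - y) * φ x ≤ ∫ x, bmps n s (x - y) :=
          integral_mono_of_nonneg (Eventually.of_forall fun x => mul_nonneg (bmps_nonneg hs _) (hφ0 x))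
            ((hb.integrable volume).comp_sub_right y)
            (Eventually.of_forall fun x => mul_le_of_le_one_right (bmps_nonneg hs _) (hφ1 x))
      _ = 1 := by rw [integral_sub_right_eq_self (fun z => bmps n s z), integral_bmps hs]
  have hin0 : ∀ y, 3 * t ≤ dist y x₀ → ∫ x, bmps n s (x - y) * φ x = 0 := fun y hy => by
    refine integral_eq_zero_of_ae (Eventually.of_forall fun x => ?_)
    simp only [Pi.zero_apply, mul_eq_zero]
    by_contra! hcon
    have h1 : dist x x₀ < 2 * t := by
      by_contra! h; exact hcon.2 (hφs x h)
    have h2 : ‖x - y‖ < s⁻¹ / 2 := by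
      by_contra! h; exact hcon.1 (bmps_of_le hs h)
    rw [← dist_eq_norm, dist_comm] at h2
    have := dist_triangle y x x₀
    linarith
  calc ∫ x in closedBall x₀ t, |mol g s x - c|
      ≤ ∫ x, φ x * ∫ y, |g y - c| * bmps n s (x - y) := by
        rw [← integral_indicator measurableSet_closedBall]
        refine integral_mono_of_nonneg (Eventually.of_forall fun x =>
          Set.indicator_nonneg (fun _ _ => abs_nonneg _) _) ?_ (Eventually.of_forall fun x => ?_)
        · exact (hφ.mul hcont).integrable_of_hasCompactSupport hφc.mul_right
        · by_cases hx : x ∈ closedBall x₀ t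
          · simp only [Set.indicator_of_mem hx, hφe x hx, one_mul]
            exact abs_mol_sub_le hg hs c x
          · simp only [Set.indicator_of_notMem hx]
            exact mul_nonneg (hφ0 x) (integral_nonneg fun y =>
              mul_nonneg (abs_nonneg _) (bmps_nonneg hs _))
    _ = ∫ y, |g y - c| * ∫ x, bmps n s (x - y) * φ x :=
        integral_mul_cv hgc hφ hφc hb.1.continuous hb.2
    _ ≤ ∫ y, (ball x₀ (3 * t)).indicator (fun y => ‖g y - c‖) y := by
        refine integral_mono_of_nonneg (Eventually.of_forall fun y => mul_nonneg (abs_nonneg _)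
          (integral_nonneg fun x => mul_nonneg (bmps_nonneg hs _) (hφ0 x))) ?_
          (Eventually.of_forall fun y => ?_)
        · exact IntegrableOn.integrable_indicator (locInt_ball' hgc _ _) measurableSet_ball
        · by_cases hy : y ∈ ball x₀ (3 * t)
          · simp only [Set.indicator_of_mem hy]
            exact mul_le_of_le_one_right (abs_nonneg _) (hin y)
          · simp only [Set.indicator_of_notMem hy]
            rw [mem_ball, not_lt] at hy
            rw [hin0 y hy, mul_zero]
    _ = _ := integral_indicator measurableSet_ball

theorem exists_integral_mol_bound (n : ℕ) : ∃ C, 0 ≤ C ∧ ∀ (g : Euc n → ℝ),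
    LocallyIntegrable g volume → ∀ (x₀ : Euc n) (c η δ : ℝ), CloseTo g x₀ c η δ →
    ∀ s, 0 < s → 2 * s⁻¹ < δ → ∀ t, 0 < t → 3 * t < δ →
    ∫ x in closedBall x₀ t, |mol g s x - c| ≤ C * η * t ^ n := by
  obtain ⟨C, hC0, hC⟩ := exists_mol_bound n
  set ω := volume.real (ball (0 : Euc n) 1)
  have hω : 0 ≤ ω := volume_real_unitBall_pos.le
  refine ⟨C * ω + 3 ^ n, by positivity, fun g hg x₀ c η δ hc s hs hsδ t ht htδ => ?_⟩
  have hη : 0 ≤ η * (3 * t) ^ n :=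
    (integral_nonneg fun _ => norm_nonneg _).trans (hc (3 * t) (by positivity) htδ)
  have hη : 0 ≤ η := nonneg_of_mul_nonneg_left hη (by positivity)
  rcases le_total s⁻¹ t with hst | hst
  · refine (integral_mol_sub_le hg x₀ c hs hst).trans ((hc _ (by positivity) htδ).trans ?_)
    rw [mul_pow, add_mul, add_mul]
    have : 0 ≤ C * ω * η * t ^ n := by positivity
    linarith
  · calc ∫ x in closedBall x₀ t, |mol g s x - c| ≤ ∫ x in closedBall x₀ t, C * η := by
          refine integral_mono_of_nonneg (Eventually.of_forall fun _ => abs_nonneg _)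
            (integrableOn_const (isCompact_closedBall x₀ t).measure_lt_top.ne) ?_
          filter_upwards [ae_restrict_mem measurableSet_closedBall] with x hx
          exact hC g hg x₀ c η δ hc s hs hsδ x ((mem_closedBall.1 hx).trans hst)
      _ = C * ω * η * t ^ n := by
          rw [setIntegral_const, volume_real_closedBall _ ht.le, smul_eq_mul]; ring
      _ ≤ _ := by
          have : 0 ≤ 3 ^ n * η * t ^ n := by positivity
          nlinarith

lemma LebPt.tendsto_mol {g : Euc n → ℝ} (hg : LocallyIntegrable g volume) {x₀ : Euc n}
    (h : LebPt g x₀) : Tendsto (fun N : ℕ => mol g (2 ^ N) x₀) atTop (𝓝 (g x₀)) := by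
  obtain ⟨C, hC0, hC⟩ := exists_mol_bound n
  rw [Metric.tendsto_atTop]
  intro ε hε
  obtain ⟨δ, hδ, hcl⟩ := h (ε / (C + 1)) (by positivity)
  have h0 : Tendsto (fun N : ℕ => 2 * ((2 : ℝ) ^ N)⁻¹) atTop (𝓝 (2 * 0)) :=
    (tendsto_pow_atTop_atTop_of_one_lt one_lt_two).inv_tendsto_atTop.const_mul 2
  rw [mul_zero] at h0
  obtain ⟨N0, hN0⟩ := eventually_atTop.1 (h0.eventually (gt_mem_nhds hδ))
  refine ⟨N0, fun N hN => ?_⟩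
  rw [Real.dist_eq]
  refine (hC g hg x₀ _ _ δ hcl (2 ^ N) (by positivity) (hN0 N hN) x₀
    (by rw [dist_self]; positivity)).trans_lt ?_
  rw [← mul_div_assoc, div_lt_iff₀ (by positivity)]
  nlinarith

end Mollify

section Taylor

lemma abs_taylor_sub_le (k : ℕ) : ∀ (f : ℕ → ℝ → ℝ), (∀ l t, HasDerivAt (f l) (f (l + 1) t) t) →
    ∀ a : ℝ, ∀ t ∈ Set.Icc (0 : ℝ) 1,
    |f 0 t - (∑ l ∈ Finset.range (k + 1), ((l.factorial : ℝ))⁻¹ * f l 0 * t ^ l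
      + (((k + 1).factorial : ℝ))⁻¹ * a * t ^ (k + 1))| ≤ ∫ s in (0 : ℝ)..1, |f (k + 1) s - a| := by
  induction k with
  | zero =>
    intro f hf a t ht
    have hc : Continuous (f 1) := continuous_iff_continuousAt.2 fun t => (hf 1 t).continuousAt
    have h1 : ∫ s in (0 : ℝ)..t, (f 1 s - a) = f 0 t - f 0 0 - a * t := by
      rw [intervalIntegral.integral_sub (hc.intervalIntegrable _ _)
        (continuous_const.intervalIntegrable _ _),
        intervalIntegral.integral_eq_sub_of_hasDerivAt (fun x _ => hf 0 x)
          (hc.intervalIntegrable _ _)]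
      simp; ring
    have h2 : f 0 t - (∑ l ∈ Finset.range (0 + 1), ((l.factorial : ℝ))⁻¹ * f l 0 * t ^ l
      + (((0 + 1).factorial : ℝ))⁻¹ * a * t ^ (0 + 1)) = ∫ s in (0 : ℝ)..t, (f 1 s - a) := by
      rw [h1]; simp; ring
    rw [h2]
    refine (intervalIntegral.abs_integral_le_integral_abs ht.1).trans ?_
    exact intervalIntegral.integral_mono_interval le_rfl ht.1 ht.2
      (Eventually.of_forall fun _ => abs_nonneg _)
      ((hc.sub continuous_const).abs.intervalIntegrable _ _)
  | succ k ih =>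
    intro f hf a t ht
    set M := ∫ s in (0 : ℝ)..1, |f (k + 1 + 1) s - a| with hM
    have hM0 : 0 ≤ M := intervalIntegral.integral_nonneg zero_le_one fun _ _ => abs_nonneg _
    set R : ℝ → ℝ := fun t => f 0 t - (∑ l ∈ Finset.range (k + 1 + 1),
      ((l.factorial : ℝ))⁻¹ * f l 0 * t ^ l
      + (((k + 1 + 1).factorial : ℝ))⁻¹ * a * t ^ (k + 1 + 1)) with hR
    set R' : ℝ → ℝ := fun t => f 1 t - (∑ l ∈ Finset.range (k + 1),
      ((l.factorial : ℝ))⁻¹ * f (l + 1) 0 * t ^ l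
      + (((k + 1).factorial : ℝ))⁻¹ * a * t ^ (k + 1)) with hR'
    have hd : ∀ t, HasDerivAt R (R' t) t := by
      intro t
      have hpow : ∀ (m : ℕ) (c : ℝ), HasDerivAt (fun t : ℝ => (((m + 1).factorial : ℝ))⁻¹ * c * t ^ (m + 1))
          (((m.factorial : ℝ))⁻¹ * c * t ^ m) t := by
        intro m c
        have := ((hasDerivAt_pow (m + 1) t).const_mul ((((m + 1).factorial : ℝ))⁻¹ * c))
        refine this.congr_deriv ?_
        rw [Nat.factorial_succ]; push_cast
        have : (m.factorial : ℝ) ≠ 0 := by positivity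
        have : (m : ℝ) + 1 ≠ 0 := by positivity
        field_simp
      have h1 : HasDerivAt (fun t : ℝ => ∑ l ∈ Finset.range (k + 1),
          ((((l + 1).factorial : ℝ))⁻¹ * f (l + 1) 0 * t ^ (l + 1)))
          (∑ l ∈ Finset.range (k + 1), ((l.factorial : ℝ))⁻¹ * f (l + 1) 0 * t ^ l) t :=
        HasDerivAt.fun_sum fun l _ => hpow l _
      have h2 := (hf 0 t).sub ((h1.add_const (f 0 0)).add (hpow (k + 1) a))
      refine h2.congr_of_eventuallyEq (Eventually.of_forall fun s => ?_)
      simp only [hR, Finset.sum_range_succ' _ (k + 1), Pi.sub_apply, Pi.add_apply]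
      simp
    have hR0 : R 0 = 0 := by
      simp [hR, Finset.sum_range_succ' _ (k + 1)]
    have hb : ∀ s ∈ Set.Icc (0 : ℝ) 1, ‖R' s‖ ≤ M := fun s hs =>
      ih (fun l => f (l + 1)) (fun l t => hf (l + 1) t) a s hs
    have := (convex_Icc (0 : ℝ) 1).norm_image_sub_le_of_norm_hasDerivWithin_le
      (fun s _ => (hd s).hasDerivWithinAt) hb (Set.left_mem_Icc.2 zero_le_one) ht
    rw [hR0, sub_zero, sub_zero, Real.norm_eq_abs, Real.norm_eq_abs] at this
    refine this.trans ?_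
    rw [abs_of_nonneg ht.1]
    exact mul_le_of_le_one_right hM0 ht.2

variable {n : ℕ}

/-- The Taylor polynomial at `x₀` with prescribed derivatives `c`. -/
noncomputable def taylorPoly (k : ℕ) (c : (l : ℕ) → (Fin l → Fin n) → ℝ) (x₀ y : Euc n) : ℝ :=
  ∑ l ∈ Finset.range (k + 1), ((l.factorial : ℝ))⁻¹ *
    ∑ I : Fin l → Fin n, (∏ i, (y - x₀) (I i)) * c l I

lemma abs_prod_coord_le {l : ℕ} (h : Euc n) (I : Fin l → Fin n) : |∏ i, h (I i)| ≤ ‖h‖ ^ l := by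
  rw [Finset.abs_prod]
  refine (Finset.prod_le_prod (fun _ _ => abs_nonneg _) fun i _ => abs_coord_le h (I i)).trans ?_
  simp

lemma hasDerivAt_line {w : Euc n → ℝ} (hw : ContDiff ℝ (⊤ : ℕ∞) w) (x₀ h : Euc n) (l : ℕ) (t : ℝ) :
    HasDerivAt (fun t : ℝ => ∑ I : Fin l → Fin n, (∏ i, h (I i)) * dirDeriv n l I w (x₀ + t • h))
      (∑ I : Fin (l + 1) → Fin n, (∏ i, h (I i)) * dirDeriv n (l + 1) I w (x₀ + t • h)) t := by
  have h0 : HasDerivAt (fun t : ℝ => x₀ + t • h) h t := by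
    simpa using ((hasDerivAt_id t).smul_const h).const_add x₀
  have h1 : ∀ I : Fin l → Fin n, HasDerivAt (fun t : ℝ => dirDeriv n l I w (x₀ + t • h))
      (∑ j, h j * dirDeriv n (l + 1) (Fin.cons j I) w (x₀ + t • h)) t := by
    intro I
    have hd := ((smooth_differentiable (smooth_dirDeriv hw I)) (x₀ + t • h)).hasFDerivAt
    have h2 := hd.comp_hasDerivAt t h0
    refine h2.congr_deriv ?_
    have h3 : ∀ L : Euc n →L[ℝ] ℝ, L h = ∑ j, h j * L (stdVec n j) := fun L => by
      conv_lhs => rw [euc_eq_sum h]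
      simp only [map_sum, map_smul, smul_eq_mul]
    rw [h3]
    refine Finset.sum_congr rfl fun j _ => ?_
    rw [dirDeriv_succ hw]
    simp
  have h2 : HasDerivAt (fun t : ℝ => ∑ I : Fin l → Fin n, (∏ i, h (I i)) * dirDeriv n l I w (x₀ + t • h))
      (∑ I : Fin l → Fin n, (∏ i, h (I i)) *
        (∑ j, h j * dirDeriv n (l + 1) (Fin.cons j I) w (x₀ + t • h))) t :=
    HasDerivAt.fun_sum fun I _ => (h1 I).const_mul _
  refine h2.congr_deriv ?_
  symm
  rw [← (Fin.consEquiv (fun _ : Fin (l + 1) => Fin n)).sum_comp, Fintype.sum_prod_type,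
    Finset.sum_comm]
  refine Finset.sum_congr rfl fun I _ => ?_
  rw [Finset.mul_sum]
  refine Finset.sum_congr rfl fun j _ => ?_
  simp only [Fin.consEquiv_apply, Fin.prod_univ_succ, Fin.cons_zero, Fin.cons_succ]
  rw [show (Fin.consEquiv fun _ : Fin (l + 1) => Fin n) (j, I) = Fin.cons j I from rfl]
  ring

lemma abs_sub_taylorPoly_le {k : ℕ} (hk : 1 ≤ k) {w : Euc n → ℝ} (hw : ContDiff ℝ (⊤ : ℕ∞) w)
    (x₀ : Euc n) {c : (l : ℕ) → (Fin l → Fin n) → ℝ}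
    (hc : ∀ l < k, ∀ I, c l I = dirDeriv n l I w x₀) (h : Euc n) :
    |w (x₀ + h) - taylorPoly k c x₀ (x₀ + h)| ≤
      ‖h‖ ^ k * ∑ I : Fin k → Fin n, ∫ t in (0 : ℝ)..1, |dirDeriv n k I w (x₀ + t • h) - c k I| := by
  obtain ⟨k, rfl⟩ : ∃ m, k = m + 1 := ⟨k - 1, by omega⟩
  have key := abs_taylor_sub_le k _ (fun l t => hasDerivAt_line hw x₀ h l t)
    (∑ I : Fin (k + 1) → Fin n, (∏ i, h (I i)) * c (k + 1) I) 1 ⟨zero_le_one, le_rfl⟩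
  have h0 : taylorPoly (k + 1) c x₀ (x₀ + h) = ∑ l ∈ Finset.range (k + 1), ((l.factorial : ℝ))⁻¹ *
      (∑ I : Fin l → Fin n, (∏ i, h (I i)) * dirDeriv n l I w (x₀ + (0 : ℝ) • h)) * 1 ^ l +
      (((k + 1).factorial : ℝ))⁻¹ * (∑ I : Fin (k + 1) → Fin n, (∏ i, h (I i)) * c (k + 1) I) *
      1 ^ (k + 1) := by
    rw [taylorPoly, Finset.sum_range_succ]
    simp only [one_pow, mul_one, zero_smul, add_zero, add_sub_cancel_left]
    congr 1
    refine Finset.sum_congr rfl fun l hl => ?_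
    congr 1
    refine Finset.sum_congr rfl fun I _ => ?_
    rw [hc l (Finset.mem_range.1 hl)]
  have h1 : (∑ I : Fin 0 → Fin n, (∏ i, h (I i)) * dirDeriv n 0 I w (x₀ + (1 : ℝ) • h)) =
      w (x₀ + h) := by
    simp [dirDeriv_zero]
  rw [h1, ← h0] at key
  refine key.trans ?_
  have hcont : ∀ I : Fin (k + 1) → Fin n, Continuous fun t : ℝ =>
      |dirDeriv n (k + 1) I w (x₀ + t • h) - c (k + 1) I| := fun I =>
    (((smooth_dirDeriv hw I).continuous.comp (by fun_prop : Continuous fun t : ℝ => x₀ + t • h)).sub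
      continuous_const).abs
  rw [← intervalIntegral.integral_finsetSum fun I _ => (hcont I).intervalIntegrable _ _,
    ← intervalIntegral.integral_const_mul]
  refine intervalIntegral.integral_mono_on zero_le_one ?_ ?_ fun t _ => ?_
  · refine Continuous.intervalIntegrable ?_ _ _
    have : Continuous fun t : ℝ => ∑ I : Fin (k + 1) → Fin n, (∏ i, h (I i)) *
      dirDeriv n (k + 1) I w (x₀ + t • h) := continuous_iff_continuousAt.2 fun t =>
        (hasDerivAt_line hw x₀ h (k + 1) t).continuousAt
    exact (this.sub continuous_const).abs
  · exact ((continuous_finsetSum _ fun I _ => hcont I).const_mul _).intervalIntegrable _ _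
  · rw [← Finset.sum_sub_distrib, Finset.mul_sum]
    refine (Finset.abs_sum_le_sum_abs _ _).trans (Finset.sum_le_sum fun I _ => ?_)
    rw [← mul_sub, abs_mul]
    exact mul_le_mul_of_nonneg_right (abs_prod_coord_le h I) (abs_nonneg _)

section PolyDeg

variable {F : Type*} [NormedAddCommGroup F] [NormedSpace ℝ F]

lemma iteratedFDeriv_eq_zero_of_le {f : Euc n → F} {m : ℕ} (h : ∀ x, iteratedFDeriv ℝ m f x = 0)
    {p : ℕ} (hp : m ≤ p) (x : Euc n) : iteratedFDeriv ℝ p f x = 0 := by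
  induction p, hp using Nat.le_induction generalizing x with
  | base => exact h x
  | succ p _ ih =>
    have h0 : iteratedFDeriv ℝ p f = 0 := funext ih
    ext v
    rw [iteratedFDeriv_succ_apply_left, h0]
    simp

lemma IsPolyDeg.mono {f : Euc n → F} {j j' : ℕ} (h : IsPolyDeg n j f) (hj : j ≤ j') :
    IsPolyDeg n j' f :=
  ⟨h.1, fun x => iteratedFDeriv_eq_zero_of_le h.2 (by omega) x⟩

lemma IsPolyDeg.add {f g : Euc n → F} {j : ℕ} (hf : IsPolyDeg n j f) (hg : IsPolyDeg n j g) :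
    IsPolyDeg n j (fun x => f x + g x) := by
  refine ⟨hf.1.add hg.1, fun x => ?_⟩
  rw [show (fun x => f x + g x) = f + g from rfl, iteratedFDeriv_add_apply
    ((contDiff_infty.1 hf.1 _).contDiffAt) ((contDiff_infty.1 hg.1 _).contDiffAt), hf.2, hg.2,
    add_zero]

lemma isPolyDeg_const (c : F) (j : ℕ) : IsPolyDeg n j fun _ => c :=
  ⟨contDiff_const, fun x => by rw [iteratedFDeriv_const_of_ne (by omega)]; rfl⟩

lemma IsPolyDeg.sum {ι : Type*} {s : Finset ι} {f : ι → Euc n → F} {j : ℕ}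
    (h : ∀ i ∈ s, IsPolyDeg n j (f i)) : IsPolyDeg n j (fun x => ∑ i ∈ s, f i x) := by
  classical
  induction s using Finset.induction_on with
  | empty => simpa using isPolyDeg_const (0 : F) j
  | insert a s ha ih =>
    simp only [Finset.sum_insert ha]
    exact (h a (Finset.mem_insert_self _ _)).add
      (ih fun i hi => h i (Finset.mem_insert_of_mem hi))

lemma IsPolyDeg.clm {G : Type*} [NormedAddCommGroup G] [NormedSpace ℝ G] {f : Euc n → F} {j : ℕ}
    (h : IsPolyDeg n j f) (L : F →L[ℝ] G) : IsPolyDeg n j (fun x => L (f x)) := by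
  refine ⟨L.contDiff.comp h.1, fun x => ?_⟩
  have := L.iteratedFDeriv_comp_left (x := x) ((contDiff_infty.1 h.1 (j + 1)).contDiffAt) le_rfl
  rw [show (fun x => L (f x)) = L ∘ f from rfl, this, h.2]
  ext; simp

lemma IsPolyDeg.coord_mul {f : Euc n → ℝ} {j : ℕ} (h : IsPolyDeg n j f) (x₀ : Euc n) (i : Fin n) :
    IsPolyDeg n (j + 1) (fun y => (y - x₀) i * f y) := by
  have hg : IsPolyDeg n 1 (fun y : Euc n => (y - x₀) i) := by
    have hs : ContDiff ℝ (⊤ : ℕ∞) (fun y : Euc n => (y - x₀) i) := by fun_prop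
    refine ⟨hs, fun x => ?_⟩
    have h1 : fderiv ℝ (fun y : Euc n => (y - x₀) i) = fun _ => EuclideanSpace.proj i := by
      funext y
      have : HasFDerivAt (fun y : Euc n => (y - x₀) i) (EuclideanSpace.proj (𝕜 := ℝ) i) y := by
        have h2 := ((EuclideanSpace.proj (𝕜 := ℝ) i : Euc n →L[ℝ] ℝ).hasFDerivAt (x := y)).sub_const
          (x₀ i)
        refine h2.congr_of_eventuallyEq (Eventually.of_forall fun z => ?_)
        simp
      exact this.fderiv
    rw [← norm_eq_zero, ← norm_iteratedFDeriv_fderiv, h1, iteratedFDeriv_const_of_ne (by norm_num)]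
    simp
  refine ⟨hg.1.mul h.1, fun x => ?_⟩
  rw [← norm_le_zero_iff]
  refine (norm_iteratedFDeriv_mul_le (n := j + 1 + 1) (contDiff_infty.1 hg.1 (j + 1 + 1))
    (contDiff_infty.1 h.1 (j + 1 + 1)) x (by simp)).trans (le_of_eq ?_)
  refine Finset.sum_eq_zero fun m _ => ?_
  by_cases hm : 2 ≤ m
  · rw [iteratedFDeriv_eq_zero_of_le hg.2 hm]; simp
  · rw [iteratedFDeriv_eq_zero_of_le (p := j + 1 + 1 - m) h.2 (by omega)]; simp

lemma isPolyDeg_prod_coord (x₀ : Euc n) : ∀ (l : ℕ) (I : Fin l → Fin n),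
    IsPolyDeg n l (fun y => ∏ i, (y - x₀) (I i))
  | 0, I => by simpa using isPolyDeg_const (1 : ℝ) 0
  | l + 1, I => by
    simp only [Fin.prod_univ_succ]
    exact (isPolyDeg_prod_coord x₀ l (fun i => I i.succ)).coord_mul x₀ (I 0)

lemma isPolyDeg_taylorPoly (k : ℕ) (c : (l : ℕ) → (Fin l → Fin n) → ℝ) (x₀ : Euc n) :
    IsPolyDeg n k (taylorPoly k c x₀) := by
  refine IsPolyDeg.sum fun l hl => ?_
  have h1 : IsPolyDeg n k (fun y => ∑ I : Fin l → Fin n, (∏ i, (y - x₀) (I i)) * c l I) := by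
    refine IsPolyDeg.sum fun I _ => ?_
    have h2 := ((isPolyDeg_prod_coord x₀ l I).mono (Nat.le_of_lt_succ (Finset.mem_range.1 hl))).clm
      (c l I • ContinuousLinearMap.id ℝ ℝ)
    simpa [mul_comm] using h2
  exact h1.clm (((l.factorial : ℝ))⁻¹ • ContinuousLinearMap.id ℝ ℝ)

end PolyDeg

end Taylor

section WeakTaylor

lemma integral_abs_le_of_tendsto {X : Type*} [MeasurableSpace X] {μ : Measure X} {f : ℕ → X → ℝ}
    {g : X → ℝ} (hf : ∀ N, Integrable (f N) μ) (hg : Integrable g μ)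
    (h : ∀ᵐ x ∂μ, Tendsto (fun N => f N x) atTop (𝓝 (g x))) {B : ℝ}
    (hB : ∀ᶠ N in atTop, ∫ x, |f N x| ∂μ ≤ B) : ∫ x, |g x| ∂μ ≤ B := by
  have hB0 : 0 ≤ B := by
    obtain ⟨N, hN⟩ := hB.exists
    exact (integral_nonneg fun _ => abs_nonneg _).trans hN
  have key : ∀ u : X → ℝ, Integrable u μ → ENNReal.ofReal (∫ x, |u x| ∂μ) = ∫⁻ x, ‖u x‖ₑ ∂μ :=
    fun u hu => by
      rw [ofReal_integral_eq_lintegral_ofReal hu.abs (Eventually.of_forall fun _ => abs_nonneg _)]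
      refine lintegral_congr fun x => ?_
      rw [← Real.norm_eq_abs, ofReal_norm]
  rw [← ENNReal.ofReal_le_ofReal_iff hB0, key g hg]
  calc ∫⁻ x, ‖g x‖ₑ ∂μ = ∫⁻ x, liminf (fun N => ‖f N x‖ₑ) atTop ∂μ := by
        refine lintegral_congr_ae ?_
        filter_upwards [h] with x hx
        exact (hx.enorm.liminf_eq).symm
    _ ≤ liminf (fun N => ∫⁻ x, ‖f N x‖ₑ ∂μ) atTop :=
        lintegral_liminf_le' fun N => (hf N).1.enorm
    _ ≤ ENNReal.ofReal B := by
        refine (liminf_le_liminf (v := fun _ => ENNReal.ofReal B) ?_).trans_eq ?_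
        · filter_upwards [hB] with N hN
          rw [← key _ (hf N)]
          exact ENNReal.ofReal_le_ofReal hN
        · simp

variable {n : ℕ}

lemma dirDeriv_mol {v G : Euc n → ℝ} (hv : LocallyIntegrable v volume) {l : ℕ} {I : Fin l → Fin n}
    (h : ∀ φ : Euc n → ℝ, IsTestFun n φ →
      ∫ x, dirDeriv n l I φ x * v x = (-1 : ℝ) ^ l * ∫ x, φ x * G x) {s : ℝ} (hs : 0 < s) (x : Euc n) :
    dirDeriv n l I (mol v s) x = mol G s x := by
  have hb := isTestFun_bmps (n := n) hs
  have h1 : dirDeriv n l I (mol v s) x = ∫ y, v y * dirDeriv n l I (bmps n s) (x - y) :=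
    dirDeriv_cv (ContinuousLinearMap.mul ℝ ℝ) hv hb I x
  have h2 := h _ (hb.comp_sub_left x)
  rw [h1]
  have h3 : ∀ y, dirDeriv n l I (fun y => bmps n s (x - y)) y =
      (-1 : ℝ) ^ l * dirDeriv n l I (bmps n s) (x - y) := fun y => by
    rw [dirDeriv_comp_sub_left hb.1]; rfl
  simp only [h3, mul_assoc] at h2
  rw [integral_const_mul] at h2
  have h4 := mul_left_cancel₀ (pow_ne_zero l (by norm_num : (-1 : ℝ) ≠ 0)) h2
  simp only [mol, cv, ContinuousLinearMap.mul_apply']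
  calc _ = ∫ y, dirDeriv n l I (bmps n s) (x - y) * v y := by simp only [mul_comm]
    _ = _ := h4
    _ = _ := by simp only [mul_comm]

/-- Averages over segments of a function on a ball. -/
lemma integral_segment_le {g : Euc n → ℝ} (hg : Continuous g) (hg0 : ∀ x, 0 ≤ g x) (x₀ : Euc n)
    {r B : ℝ} (hr : 0 < r) (hB : ∀ t, 0 < t → t ≤ r → ∫ x in closedBall x₀ t, g x ≤ B * t ^ n) :
    ∫ h in closedBall (0 : Euc n) r, ∫ t in (0 : ℝ)..1, g (x₀ + t • h) ≤ B * r ^ n := by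
  have h1 : ∀ t ∈ Set.Ioc (0 : ℝ) 1, ∫ h in closedBall (0 : Euc n) r, g (x₀ + t • h) ≤ B * r ^ n := by
    intro t ht
    have h2 := Measure.setIntegral_comp_smul_of_pos volume (fun y => g (x₀ + y))
      (closedBall (0 : Euc n) r) ht.1
    rw [h2, finrank_euclideanSpace_fin, smul_closedBall _ _ hr.le, smul_zero,
      Real.norm_of_nonneg ht.1.le, smul_eq_mul]
    have h3 : ∫ x in closedBall (0 : Euc n) (t * r), g (x₀ + x) =
        ∫ x in closedBall x₀ (t * r), g x := by
      have := (measurePreserving_add_left volume x₀).setIntegral_preimage_emb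
        (measurableEmbedding_addLeft x₀) g (closedBall x₀ (t * r))
      rw [← this]
      congr 2
      ext z; simp
    rw [h3, inv_mul_le_iff₀ (pow_pos ht.1 _)]
    refine (hB (t * r) (mul_pos ht.1 hr) (mul_le_of_le_one_left hr.le ht.2)).trans_eq ?_
    rw [mul_pow]; ring
  simp only [intervalIntegral.integral_of_le zero_le_one]
  rw [integral_integral_swap]
  · calc ∫ t in Set.Ioc (0 : ℝ) 1, ∫ h in closedBall (0 : Euc n) r, g (x₀ + t • h)
        ≤ ∫ t in Set.Ioc (0 : ℝ) 1, B * r ^ n := by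
          refine integral_mono_of_nonneg
            (Eventually.of_forall fun t => integral_nonneg fun h => hg0 _)
            (integrableOn_const measure_Ioc_lt_top.ne) ?_
          filter_upwards [ae_restrict_mem measurableSet_Ioc] with t ht
          exact h1 t ht
      _ = B * r ^ n := by simp
  · rw [Measure.prod_restrict]
    refine IntegrableOn.mono_set (t := closedBall (0 : Euc n) r ×ˢ Set.Icc (0 : ℝ) 1) ?_
      (Set.prod_mono le_rfl Set.Ioc_subset_Icc_self)
    refine ContinuousOn.integrableOn_compact ((isCompact_closedBall _ _).prod isCompact_Icc) ?_
    exact (show Continuous fun p : Euc n × ℝ => g (x₀ + p.2 • p.1) by fun_prop).continuousOn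

lemma integral_abs_sub_taylorPoly_le {k : ℕ} (hk : 1 ≤ k) {w : Euc n → ℝ}
    (hw : ContDiff ℝ (⊤ : ℕ∞) w) (x₀ : Euc n) {c : (l : ℕ) → (Fin l → Fin n) → ℝ}
    (hc : ∀ l < k, ∀ I, c l I = dirDeriv n l I w x₀) {r B : ℝ} (hr : 0 < r)
    (hB : ∀ I t, 0 < t → t ≤ r → ∫ x in closedBall x₀ t, |dirDeriv n k I w x - c k I| ≤ B * t ^ n) :
    ∫ x in closedBall x₀ r, |w x - taylorPoly k c x₀ x| ≤ n ^ k * B * r ^ (n + k) := by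
  have hP := (isPolyDeg_taylorPoly k c x₀).1.continuous
  have hcs : ∀ I : Fin k → Fin n, Continuous fun x => |dirDeriv n k I w x - c k I| := fun I =>
    ((smooth_dirDeriv hw I).continuous.sub continuous_const).abs
  have hcI : ∀ I : Fin k → Fin n, Continuous fun h : Euc n =>
      ∫ t in (0 : ℝ)..1, |dirDeriv n k I w (x₀ + t • h) - c k I| := fun I => by
    refine intervalIntegral.continuous_parametric_intervalIntegral_of_continuous' ?_ 0 1
    exact (hcs I).comp (show Continuous fun p : Euc n × ℝ => x₀ + p.2 • p.1 by fun_prop)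
  have h3 : ∫ h in closedBall (0 : Euc n) r, |w (x₀ + h) - taylorPoly k c x₀ (x₀ + h)| =
      ∫ x in closedBall x₀ r, |w x - taylorPoly k c x₀ x| := by
    have := (measurePreserving_add_left volume x₀).setIntegral_preimage_emb
      (measurableEmbedding_addLeft x₀) (fun x => |w x - taylorPoly k c x₀ x|) (closedBall x₀ r)
    rw [← this]
    congr 2
    ext z; simp
  rw [← h3]
  calc ∫ h in closedBall (0 : Euc n) r, |w (x₀ + h) - taylorPoly k c x₀ (x₀ + h)|
      ≤ ∫ h in closedBall (0 : Euc n) r, r ^ k * ∑ I : Fin k → Fin n,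
          ∫ t in (0 : ℝ)..1, |dirDeriv n k I w (x₀ + t • h) - c k I| := by
        refine integral_mono_of_nonneg (Eventually.of_forall fun h => abs_nonneg _) ?_ ?_
        · exact ((continuous_finsetSum _ fun I _ => hcI I).const_mul _).continuousOn.integrableOn_compact
            (isCompact_closedBall _ _)
        · filter_upwards [ae_restrict_mem measurableSet_closedBall] with h hh
          refine (abs_sub_taylorPoly_le hk hw x₀ hc h).trans ?_
          refine mul_le_mul_of_nonneg_right (pow_le_pow_left₀ (norm_nonneg _)
            (by simpa using hh) _) (Finset.sum_nonneg fun I _ => ?_)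
          exact intervalIntegral.integral_nonneg zero_le_one fun _ _ => abs_nonneg _
    _ = r ^ k * ∑ I : Fin k → Fin n, ∫ h in closedBall (0 : Euc n) r,
          ∫ t in (0 : ℝ)..1, |dirDeriv n k I w (x₀ + t • h) - c k I| := by
        rw [integral_const_mul, integral_finsetSum]
        exact fun I _ => (hcI I).continuousOn.integrableOn_compact (isCompact_closedBall _ _)
    _ ≤ r ^ k * ∑ I : Fin k → Fin n, B * r ^ n := by
        refine mul_le_mul_of_nonneg_left (Finset.sum_le_sum fun I _ => ?_) (by positivity)
        exact integral_segment_le (hcs I) (fun _ => abs_nonneg _) x₀ hr (hB I)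
    _ = _ := by
        simp; ring

/-- A function all of whose weak derivatives up to order `k` are locally integrable has an
`L¹`-Taylor expansion of order `k` almost everywhere. -/
theorem ae_exists_taylor {k : ℕ} (hk : 1 ≤ k) {v : Euc n → ℝ} (hv : LocallyIntegrable v volume)
    (hG : ∀ l ≤ k, ∀ I : Fin l → Fin n, ∃ G : Euc n → ℝ, LocallyIntegrable G volume ∧
      ∀ φ : Euc n → ℝ, IsTestFun n φ →
        ∫ x, dirDeriv n l I φ x * v x = (-1 : ℝ) ^ l * ∫ x, φ x * G x) :
    ∀ᵐ x₀ : Euc n, ∃ P : Euc n → ℝ, IsPolyDeg n k P ∧ ∀ ε > 0, ∃ δ > 0, ∀ r, 0 < r → r < δ →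
      ∫ x in ball x₀ r, |v x - P x| ≤ ε * r ^ (n + k) := by
  have hG' : ∀ l : ℕ, ∀ I : Fin l → Fin n, ∃ G : Euc n → ℝ, l ≤ k → LocallyIntegrable G volume ∧
      ∀ φ : Euc n → ℝ, IsTestFun n φ →
        ∫ x, dirDeriv n l I φ x * v x = (-1 : ℝ) ^ l * ∫ x, φ x * G x := fun l I => by
    by_cases hl : l ≤ k
    · obtain ⟨G, h⟩ := hG l hl I
      exact ⟨G, fun _ => h⟩
    · exact ⟨0, fun h => absurd h hl⟩
  choose G hGp using hG'
  have hL : ∀ᵐ x₀ : Euc n, ∀ (l : ℕ) (I : Fin l → Fin n), l ≤ k → LebPt (G l I) x₀ := by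
    rw [ae_all_iff]; intro l
    rw [ae_all_iff]; intro I
    by_cases hl : l ≤ k
    · filter_upwards [ae_lebPt (hGp l I hl).1] with x hx _ using hx
    · exact Eventually.of_forall fun x h => absurd h hl
  have hvt : ∀ᵐ x : Euc n, Tendsto (fun N : ℕ => mol v (2 ^ N) x) atTop (𝓝 (v x)) := by
    filter_upwards [ae_lebPt hv] with x hx using hx.tendsto_mol hv
  filter_upwards [hL] with x₀ hx₀
  refine ⟨taylorPoly k (fun l I => G l I x₀) x₀, isPolyDeg_taylorPoly _ _ _, fun ε hε => ?_⟩
  obtain ⟨C, hC0, hC⟩ := exists_integral_mol_bound n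
  set η : ℝ := ε / (n ^ k * C + 1) with hη
  have hη0 : 0 < η := by positivity
  have hδ : ∃ δ > 0, ∀ I : Fin k → Fin n, CloseTo (G k I) x₀ (G k I x₀) η δ := by
    choose δ hδ hcl using fun I => hx₀ k I le_rfl η hη0
    rcases isEmpty_or_nonempty (Fin k → Fin n) with hem | hne
    · exact ⟨1, one_pos, fun I => hem.elim I⟩
    · obtain ⟨I0, hI0⟩ := Finite.exists_min δ
      exact ⟨δ I0, hδ I0, fun I s hs hsδ => hcl I s hs (hsδ.trans_le (hI0 I))⟩
  obtain ⟨δ, hδ0, hcl⟩ := hδ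
  refine ⟨δ / 3, by positivity, fun r hr hrδ => ?_⟩
  set cN : ℕ → (l : ℕ) → (Fin l → Fin n) → ℝ := fun N l I =>
    if l < k then dirDeriv n l I (mol v (2 ^ N)) x₀ else G l I x₀ with hcN
  have hpos : ∀ N : ℕ, (0 : ℝ) < 2 ^ N := fun N => by positivity
  have hlim : ∀ l ≤ k, ∀ I, Tendsto (fun N => cN N l I) atTop (𝓝 (G l I x₀)) := by
    intro l hl I
    simp only [hcN]
    split_ifs with hlk
    · simp only [dirDeriv_mol hv (hGp l I hl).2 (hpos _)]
      exact (hx₀ l I hl).tendsto_mol (hGp l I hl).1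
    · exact tendsto_const_nhds
  have hPlim : ∀ y, Tendsto (fun N => taylorPoly k (cN N) x₀ y) atTop
      (𝓝 (taylorPoly k (fun l I => G l I x₀) x₀ y)) := fun y => by
    refine tendsto_finsetSum _ fun l hl => Tendsto.const_mul _ (tendsto_finsetSum _ fun I _ => ?_)
    exact (hlim l (Nat.le_of_lt_succ (Finset.mem_range.1 hl)) I).const_mul _
  have hint : ∀ c : (l : ℕ) → (Fin l → Fin n) → ℝ,
      IntegrableOn (taylorPoly k c x₀) (closedBall x₀ r) := fun c =>
    (isPolyDeg_taylorPoly k c x₀).1.continuous.continuousOn.integrableOn_compact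
      (isCompact_closedBall _ _)
  have hvint := hv.integrableOn_isCompact (isCompact_closedBall x₀ r)
  have hmain : ∫ x in closedBall x₀ r, |v x - taylorPoly k (fun l I => G l I x₀) x₀ x| ≤
      n ^ k * (C * η) * r ^ (n + k) := by
    refine integral_abs_le_of_tendsto
      (f := fun N x => mol v (2 ^ N) x - taylorPoly k (cN N) x₀ x) (fun N => ?_)
      (hvint.sub (hint _)) ?_ ?_
    · exact ((smooth_mol hv (hpos N)).continuous.continuousOn.integrableOn_compact
        (isCompact_closedBall _ _)).sub (hint _)
    · filter_upwards [ae_restrict_of_ae hvt] with x hx using hx.sub (hPlim x)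
    · have h0 : Tendsto (fun N : ℕ => 2 * ((2 : ℝ) ^ N)⁻¹) atTop (𝓝 (2 * 0)) :=
        (tendsto_pow_atTop_atTop_of_one_lt one_lt_two).inv_tendsto_atTop.const_mul 2
      rw [mul_zero] at h0
      filter_upwards [h0.eventually (gt_mem_nhds hδ0)] with N hN
      refine integral_abs_sub_taylorPoly_le hk (smooth_mol hv (hpos N)) x₀ (fun l hl I => ?_) hr
        fun I t ht htr => ?_
      · simp [hcN, hl]
      · simp only [hcN, lt_irrefl, if_false, dirDeriv_mol hv (hGp k I le_rfl).2 (hpos _)]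
        exact hC _ (hGp k I le_rfl).1 x₀ _ η δ (hcl I) _ (hpos N) hN t ht (by linarith)
  refine le_trans (setIntegral_mono_set (hvint.sub (hint _)).norm
    (Eventually.of_forall fun _ => abs_nonneg _)
    (LE.le.eventuallyLE ball_subset_closedBall)) (hmain.trans ?_)
  refine mul_le_mul_of_nonneg_right ?_ (by positivity)
  rw [hη, ← mul_assoc, ← mul_div_assoc, div_le_iff₀ (by positivity)]
  nlinarith [show (0 : ℝ) ≤ n ^ k * C by positivity]

end WeakTaylor

section GoodSets

variable {n k : ℕ} {V W : Type*}
  [NormedAddCommGroup V] [InnerProductSpace ℝ V] [FiniteDimensional ℝ V]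
  [NormedAddCommGroup W] [InnerProductSpace ℝ W] [FiniteDimensional ℝ W]

lemma KernelSys.tendsto_lpv {A : CoeffOp n k V W} {J : Fin 0 → Fin n}
    (K : ∀ e : V, KernelSys A J e) {u : Euc n → V} {σ : Measure (Euc n)} {f : Euc n → W}
    (hu : LocallyIntegrable u volume) (hf : LocallyIntegrable f σ)
    (h : HasDistribA n k A u σ f) :
    ∀ᵐ x, Tendsto (fun N => lpv u N x) atTop (𝓝 (u x)) := by
  have h1 : ∀ᵐ x, ∀ a, Tendsto (fun N => lpf u (stdOrthonormalBasis ℝ V a) N x) atTop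
      (𝓝 ⟪u x, stdOrthonormalBasis ℝ V a⟫) := by
    rw [ae_all_iff]
    intro a
    have h2 := (K (stdOrthonormalBasis ℝ V a)).tendsto_lowpass (Nat.zero_le _) hu hf h
      (w := fun x => ⟪u x, stdOrthonormalBasis ℝ V a⟫) (locInt_inner hu _)
      (fun φ hφ => by simp [dirDeriv_zero, mul_comm]) one_pos
    simpa only [lpf_eq_lowpass u _ J] using h2
  filter_upwards [h1] with x hx
  have h3 : u x = ∑ a, ⟪u x, stdOrthonormalBasis ℝ V a⟫ • stdOrthonormalBasis ℝ V a := by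
    conv_lhs => rw [← (stdOrthonormalBasis ℝ V).sum_repr' (u x)]
    simp only [real_inner_comm]
  rw [h3]
  exact tendsto_finsetSum _ fun a _ => (hx a).smul_const _

/-- Points of a closed ball at which the density of `‖f‖ σ` is controlled. -/
def densSet (σ : Measure (Euc n)) (f : Euc n → W) (lam : ℕ) : Set (Euc n) :=
  {x | ‖x‖ ≤ lam ∧ ∀ r, 0 < r → r ≤ 1 → ∫ y in ball x r, ‖f y‖ ∂σ ≤ lam * r ^ n}

lemma setIntegral_norm_mono {F : Type*} [NormedAddCommGroup F] {σ : Measure (Euc n)}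
    {f : Euc n → F} (hf : LocallyIntegrable f σ)
    {s t : Set (Euc n)} (hst : s ⊆ t) (ht : ∃ R, t ⊆ closedBall 0 R) :
    ∫ y in s, ‖f y‖ ∂σ ≤ ∫ y in t, ‖f y‖ ∂σ := by
  obtain ⟨R, hR⟩ := ht
  exact setIntegral_mono_set
    (((hf.integrableOn_isCompact (isCompact_closedBall 0 R)).mono_set hR).norm)
    (Eventually.of_forall fun _ => norm_nonneg _) (LE.le.eventuallyLE hst)

lemma ball_subset_closedBall_zero {x : Euc n} {r R : ℝ} (h : ‖x‖ + r ≤ R) :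
    ball x r ⊆ closedBall 0 R := fun y hy => by
  rw [mem_closedBall, dist_zero_right]
  rw [mem_ball, dist_eq_norm] at hy
  have := norm_add_le (y - x) x
  rw [sub_add_cancel] at this
  linarith

lemma isCompact_closure_densSet (σ : Measure (Euc n)) (f : Euc n → W) (lam : ℕ) :
    IsCompact (closure (densSet σ f lam)) :=
  (isCompact_closedBall (0 : Euc n) lam).of_isClosed_subset isClosed_closure
    (closure_minimal (fun x hx => by simpa using hx.1) isClosed_closedBall)

lemma exists_massBound {u : Euc n → V} {σ : Measure (Euc n)} {f : Euc n → W}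
    (hu : LocallyIntegrable u volume) (hf : LocallyIntegrable f σ) (lam : ℕ) :
    ∃ Λ, ∀ x ∈ closure (densSet σ f lam), MassBound u σ f Λ x := by
  set M := ∫ y in closedBall (0 : Euc n) (lam + 4), ‖f y‖ ∂σ with hM
  set U := ∫ y in closedBall (0 : Euc n) (lam + 4), ‖u y‖ with hU
  have hM0 : 0 ≤ M := integral_nonneg fun _ => norm_nonneg _
  have hU0 : 0 ≤ U := integral_nonneg fun _ => norm_nonneg _
  refine ⟨lam * 2 ^ n + M * 2 ^ n + U, fun x hx => ?_⟩
  have hxn : ‖x‖ ≤ lam := by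
    have := closure_minimal (t := closedBall (0 : Euc n) lam) (fun x hx => by simpa using hx.1)
      isClosed_closedBall hx
    simpa using this
  refine ⟨by positivity, fun r hr hr4 => ?_, ?_⟩
  · rcases le_total r (1 / 2) with h | h
    · obtain ⟨x', hx', hxx⟩ := Metric.mem_closure_iff.1 hx r hr
      have h1 := hx'.2 (2 * r) (by positivity) (by linarith)
      refine (setIntegral_norm_mono hf (t := ball x' (2 * r)) (fun y hy => ?_)
        ⟨lam + 2 * r, ball_subset_closedBall_zero (by linarith [hx'.1])⟩).trans (h1.trans ?_)
      · rw [mem_ball] at hy ⊢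
        linarith [dist_triangle y x x']
      · rw [mul_pow, ← mul_assoc]
        refine mul_le_mul_of_nonneg_right ?_ (by positivity)
        have : 0 ≤ M * 2 ^ n := by positivity
        linarith
    · have h1 : ∫ y in ball x r, ‖f y‖ ∂σ ≤ M := setIntegral_norm_mono hf
        (ball_subset_closedBall_zero (by linarith)) ⟨_, le_rfl⟩
      have h2 : (1 : ℝ) ≤ 2 ^ n * r ^ n := by
        rw [← mul_pow]; exact one_le_pow₀ (by linarith)
      have h3 : M * 1 ≤ M * (2 ^ n * r ^ n) := mul_le_mul_of_nonneg_left h2 hM0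
      have h4 : 0 ≤ (lam * 2 ^ n + U) * r ^ n := by positivity
      nlinarith
  · have h1 : ∫ y in ball x 4, ‖u y‖ ≤ U := setIntegral_norm_mono hu
        (ball_subset_closedBall_zero (by linarith)) ⟨_, le_rfl⟩
    have : 0 ≤ lam * 2 ^ n + M * 2 ^ n := by positivity
    linarith

lemma integral_norm_le_measureReal {σ : Measure (Euc n)} [IsLocallyFiniteMeasure σ] {f : Euc n → W}
    (hf1 : ∀ᵐ x ∂σ, ‖f x‖ = 1) (x : Euc n) (r : ℝ) :
    ∫ y in ball x r, ‖f y‖ ∂σ ≤ σ.real (closedBall x r) := by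
  have h1 : ∫ y in ball x r, ‖f y‖ ∂σ = ∫ y in ball x r, (1 : ℝ) ∂σ :=
    integral_congr_ae (ae_restrict_of_ae hf1)
  rw [h1]
  simp only [integral_const, smul_eq_mul, mul_one, measureReal_restrict_apply_univ]
  exact measureReal_mono ball_subset_closedBall (isCompact_closedBall x r).measure_lt_top.ne

lemma exists_measureReal_closedBall_le {ρ : Measure (Euc n)} {x : Euc n} {L : ℝ≥0∞}
    (h : Tendsto (fun a => ρ a / volume a) ((Besicovitch.vitaliFamily volume).filterAt x) (𝓝 L))
    {η : ℝ} (hη : L < ENNReal.ofReal η) : ∃ δ > 0, ∀ r, 0 < r → r < δ →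
      ρ.real (closedBall x r) ≤ η * volume.real (closedBall x r) := by
  have h1 := h.comp (Besicovitch.tendsto_filterAt volume x)
  have h2 := h1.eventually (gt_mem_nhds hη)
  obtain ⟨δ, hδ, h3⟩ := mem_nhdsGT_iff_exists_Ioo_subset.1 h2
  refine ⟨δ, hδ, fun r hr hrδ => ?_⟩
  have h4 : ρ (closedBall x r) / volume (closedBall x r) < ENNReal.ofReal η := h3 ⟨hr, hrδ⟩
  have hη0 : 0 < η := ENNReal.ofReal_pos.1 (bot_le.trans_lt hη)
  have h5 := (ENNReal.div_lt_iff (Or.inl (measure_closedBall_pos volume x hr).ne')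
    (Or.inl (isCompact_closedBall x r).measure_lt_top.ne)).1 h4
  have h6 := ENNReal.toReal_mono (ENNReal.mul_ne_top ENNReal.ofReal_ne_top
    (isCompact_closedBall x r).measure_lt_top.ne) h5.le
  rwa [ENNReal.toReal_mul, ENNReal.toReal_ofReal hη0.le] at h6

lemma ae_exists_mem_densSet {σ : Measure (Euc n)} [IsLocallyFiniteMeasure σ] {f : Euc n → W}
    (hf : LocallyIntegrable f σ) (hf1 : ∀ᵐ x ∂σ, ‖f x‖ = 1) :
    ∀ᵐ x : Euc n, ∃ lam : ℕ, x ∈ densSet σ f lam := by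
  filter_upwards [(Besicovitch.vitaliFamily volume).ae_tendsto_rnDeriv σ,
    σ.rnDeriv_lt_top volume] with x hx hfin
  obtain ⟨η, hη⟩ : ∃ η : ℝ, σ.rnDeriv volume x < ENNReal.ofReal η := by
    refine ⟨(σ.rnDeriv volume x).toReal + 1, ?_⟩
    rw [ENNReal.lt_ofReal_iff_toReal_lt hfin.ne]
    linarith
  obtain ⟨δ, hδ, h1⟩ := exists_measureReal_closedBall_le hx hη
  set ω := volume.real (ball (0 : Euc n) 1)
  set M := ∫ y in closedBall (0 : Euc n) (‖x‖ + 1), ‖f y‖ ∂σ with hM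
  have hM0 : 0 ≤ M := integral_nonneg fun _ => norm_nonneg _
  obtain ⟨l1, hl1⟩ := exists_nat_ge ‖x‖
  obtain ⟨l2, hl2⟩ := exists_nat_ge (η * ω)
  obtain ⟨l3, hl3⟩ := exists_nat_ge (M / δ ^ n)
  refine ⟨l1 + l2 + l3, ?_, fun r hr hr1 => ?_⟩
  · push_cast
    have : (0 : ℝ) ≤ l2 := by positivity
    have : (0 : ℝ) ≤ l3 := by positivity
    linarith
  · push_cast
    rcases lt_or_ge r δ with h | h
    · have h2 := (integral_norm_le_measureReal hf1 x r).trans (h1 r hr h)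
      rw [volume_real_closedBall x hr.le] at h2
      refine h2.trans ?_
      have : η * (r ^ n * ω) = (η * ω) * r ^ n := by ring
      rw [show η * (r ^ n * volume.real (ball (0 : Euc n) 1)) = (η * ω) * r ^ n by
        simp only [ω]; ring]
      refine mul_le_mul_of_nonneg_right ?_ (by positivity)
      have : (0 : ℝ) ≤ l1 := by positivity
      have : (0 : ℝ) ≤ l3 := by positivity
      linarith
    · have h2 : ∫ y in ball x r, ‖f y‖ ∂σ ≤ M := setIntegral_norm_mono hf
        (ball_subset_closedBall_zero (by linarith)) ⟨_, le_rfl⟩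
      have h3 : M ≤ l3 * r ^ n := by
        rw [div_le_iff₀ (by positivity)] at hl3
        refine hl3.trans (mul_le_mul_of_nonneg_left (pow_le_pow_left₀ hδ.le h n) (by positivity))
      have : (0 : ℝ) ≤ (l1 + l2) * r ^ n := by positivity
      nlinarith

/-- Expansion of `u` to order `k` at almost every point, relative to a set of density one. -/
theorem ae_exists_poly (hn : 1 ≤ n) (hk : 1 ≤ k) {A : CoeffOp n k V W} (hE : IsElliptic n k A)
    {J : Fin 0 → Fin n}
    (K : ∀ e : V, KernelSys A J e) {u : Euc n → V} {σ : Measure (Euc n)} [IsLocallyFiniteMeasure σ]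
    {f : Euc n → W} (hu : LocallyIntegrable u volume) (hf : LocallyIntegrable f σ)
    (hf1 : ∀ᵐ x ∂σ, ‖f x‖ = 1) (h : HasDistribA n k A u σ f) :
    ∀ᵐ x₀ : Euc n, ∃ F : Set (Euc n), MeasurableSet F ∧ ∃ P : Euc n → V, IsPolyDeg n k P ∧
      ∀ ε > 0, ∃ δ > 0, ∀ r, 0 < r → r < δ → volume.real (ball x₀ r \ F) ≤ ε * r ^ n ∧
        ∫ x in ball x₀ r ∩ F, ‖u x - P x‖ ≤ ε * r ^ (n + k) := by
  set b := stdOrthonormalBasis ℝ V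
  have hlim := KernelSys.tendsto_lpv K hu hf h
  have key : ∀ lam : ℕ, ∀ᵐ x₀ : Euc n, x₀ ∈ densSet σ f lam →
      ∃ F : Set (Euc n), MeasurableSet F ∧ ∃ P : Euc n → V, IsPolyDeg n k P ∧
      ∀ ε > 0, ∃ δ > 0, ∀ r, 0 < r → r < δ → volume.real (ball x₀ r \ F) ≤ ε * r ^ n ∧
        ∫ x in ball x₀ r ∩ F, ‖u x - P x‖ ≤ ε * r ^ (n + k) := by
    intro lam
    by_cases hne : (densSet σ f lam).Nonempty
    swap
    · exact Eventually.of_forall fun x hx => absurd ⟨x, hx⟩ hne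
    set F := closure (densSet σ f lam) with hFdef
    have hF := isCompact_closure_densSet σ f lam
    have hFm : MeasurableSet F := hF.measurableSet
    obtain ⟨Λ, hΛ⟩ := exists_massBound hu hf lam
    obtain ⟨D⟩ := exists_dyadicData hn K hu hf h hF hne.closure hΛ
    choose v hv hvF hvG using fun a => D.exists_extension hk hE hF hne.closure hlim (b a)
    have h1 : ∀ᵐ x₀ : Euc n, ∀ a, ∃ P : Euc n → ℝ, IsPolyDeg n k P ∧ ∀ ε > 0, ∃ δ > 0, ∀ r, 0 < r →
        r < δ → ∫ x in ball x₀ r, |v a x - P x| ≤ ε * r ^ (n + k) :=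
      ae_all_iff.2 fun a => ae_exists_taylor hk (hv a) (hvG a)
    have hind : LocallyIntegrable (F.indicator (fun _ => (1 : ℝ))) volume :=
      (integrableOn_const hF.measure_lt_top.ne).integrable_indicator hFm |>.locallyIntegrable
    filter_upwards [h1, ae_lebPt hind] with x₀ hx₀ hleb hmem
    have hxF : x₀ ∈ F := subset_closure hmem
    choose P hP hPb using hx₀
    refine ⟨F, hFm, fun x => ∑ a, P a x • b a, ?_, fun ε hε => ?_⟩
    · exact IsPolyDeg.sum fun a _ => (hP a).clm ((ContinuousLinearMap.id ℝ ℝ).smulRight (b a))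
    obtain ⟨δ1, hδ1, hc⟩ := hleb ε hε
    set N : ℝ := ((Fintype.card (Fin (Module.finrank ℝ V)) : ℕ) : ℝ) with hN
    set η := ε / (N + 1) with hη
    have hN0 : 0 ≤ N := by positivity
    have hη0 : 0 < η := by positivity
    have hδ : ∃ δ > 0, ∀ a, ∀ r, 0 < r → r < δ → ∫ x in ball x₀ r, |v a x - P a x| ≤
        η * r ^ (n + k) := by
      choose δ hδ hcl using fun a => hPb a η hη0
      rcases isEmpty_or_nonempty (Fin (Module.finrank ℝ V)) with hem | hne
      · exact ⟨1, one_pos, fun I => hem.elim I⟩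
      · obtain ⟨I0, hI0⟩ := Finite.exists_min δ
        exact ⟨δ I0, hδ I0, fun I s hs hsδ => hcl I s hs (hsδ.trans_le (hI0 I))⟩
    obtain ⟨δ2, hδ2, hc2⟩ := hδ
    refine ⟨min δ1 δ2, lt_min hδ1 hδ2, fun r hr hrδ => ⟨?_, ?_⟩⟩
    · refine le_trans (le_of_eq ?_) (hc r hr (hrδ.trans_le (min_le_left _ _)))
      have h2 : ∀ y, ‖F.indicator (fun _ => (1 : ℝ)) y - F.indicator (fun _ => (1 : ℝ)) x₀‖ =
          Fᶜ.indicator (fun _ => (1 : ℝ)) y := fun y => by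
        rw [Set.indicator_of_mem hxF]
        by_cases hy : y ∈ F <;> simp [hy]
      simp only [h2]
      rw [setIntegral_indicator hFm.compl]
      simp [Set.sdiff_eq]
    · have hvi : ∀ a, IntegrableOn (fun x => |v a x - P a x|) (ball x₀ r) := fun a =>
        ((locInt_ball' (hv a) x₀ r).sub
          (locInt_ball' (hP a).1.continuous.locallyIntegrable x₀ r)).abs
      have hae : ∀ᵐ x, ∀ a, x ∈ F → v a x = ⟪u x, b a⟫ := ae_all_iff.2 hvF
      calc ∫ x in ball x₀ r ∩ F, ‖u x - ∑ a, P a x • b a‖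
          ≤ ∫ x in ball x₀ r ∩ F, ∑ a, |v a x - P a x| := by
            refine integral_mono_of_nonneg (Eventually.of_forall fun _ => norm_nonneg _) ?_ ?_
            · exact integrable_finsetSum _ fun a _ => (hvi a).mono_set Set.inter_subset_left
            · filter_upwards [ae_restrict_mem (measurableSet_ball.inter hFm),
                ae_restrict_of_ae hae] with x hx hx2
              have h3 : u x - ∑ a, P a x • b a = ∑ a, (v a x - P a x) • b a := by
                conv_lhs => rw [← b.sum_repr' (u x)]
                rw [← Finset.sum_sub_distrib]
                refine Finset.sum_congr rfl fun a _ => ?_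
                rw [hx2 a hx.2, sub_smul, real_inner_comm]
              rw [h3]
              refine (norm_sum_le _ _).trans (Finset.sum_le_sum fun a _ => ?_)
              rw [norm_smul, b.norm_eq_one, mul_one, Real.norm_eq_abs]
        _ = ∑ a, ∫ x in ball x₀ r ∩ F, |v a x - P a x| :=
            integral_finsetSum _ fun a _ => (hvi a).mono_set Set.inter_subset_left
        _ ≤ ∑ a : Fin (Module.finrank ℝ V), η * r ^ (n + k) := by
            refine Finset.sum_le_sum fun a _ => ?_
            refine le_trans ?_ (hc2 a r hr (hrδ.trans_le (min_le_right _ _)))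
            exact setIntegral_mono_set (hvi a) (Eventually.of_forall fun _ => abs_nonneg _)
              (LE.le.eventuallyLE Set.inter_subset_left)
        _ ≤ ε * r ^ (n + k) := by
            rw [Finset.sum_const, nsmul_eq_mul, ← mul_assoc]
            refine mul_le_mul_of_nonneg_right ?_ (by positivity)
            rw [Finset.card_univ, ← hN, hη, ← mul_div_assoc, div_le_iff₀ (by positivity)]
            nlinarith
  filter_upwards [ae_exists_mem_densSet hf hf1, ae_all_iff.2 key] with x₀ ⟨lam, hl⟩ hx
  exact hx lam hl

end GoodSets

section LebesguePoints

variable {n : ℕ} {F : Type*} [NormedAddCommGroup F]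

lemma LebPt.sub {g₁ g₂ : Euc n → F} {x₀ : Euc n} (hi₁ : LocallyIntegrable g₁ volume)
    (hi₂ : LocallyIntegrable g₂ volume) (h₁ : LebPt g₁ x₀) (h₂ : LebPt g₂ x₀) :
    LebPt (fun x => g₁ x - g₂ x) x₀ := by
  intro η hη
  obtain ⟨δ₁, hδ₁, hc₁⟩ := h₁ (η / 2) (by positivity)
  obtain ⟨δ₂, hδ₂, hc₂⟩ := h₂ (η / 2) (by positivity)
  refine ⟨min δ₁ δ₂, lt_min hδ₁ hδ₂, fun s hs hsδ => ?_⟩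
  have e₁ := hc₁ s hs (hsδ.trans_le (min_le_left _ _))
  have e₂ := hc₂ s hs (hsδ.trans_le (min_le_right _ _))
  have i₁ : IntegrableOn (fun y => ‖g₁ y - g₁ x₀‖) (ball x₀ s) :=
    ((locInt_ball' hi₁ x₀ s).sub (integrableOn_const measure_ball_lt_top.ne)).norm
  have i₂ : IntegrableOn (fun y => ‖g₂ y - g₂ x₀‖) (ball x₀ s) :=
    ((locInt_ball' hi₂ x₀ s).sub (integrableOn_const measure_ball_lt_top.ne)).norm
  calc ∫ y in ball x₀ s, ‖g₁ y - g₂ y - (g₁ x₀ - g₂ x₀)‖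
      ≤ ∫ y in ball x₀ s, (‖g₁ y - g₁ x₀‖ + ‖g₂ y - g₂ x₀‖) := by
        refine integral_mono_of_nonneg (Eventually.of_forall fun _ => norm_nonneg _) (i₁.add i₂)
          (Eventually.of_forall fun y => ?_)
        simp only
        rw [show g₁ y - g₂ y - (g₁ x₀ - g₂ x₀) = (g₁ y - g₁ x₀) - (g₂ y - g₂ x₀) by abel]
        exact norm_sub_le _ _
    _ = _ := integral_add i₁ i₂
    _ ≤ η * s ^ n := by linarith

lemma lebPt_of_continuous {g : Euc n → F} (hg : Continuous g) (x₀ : Euc n) : LebPt g x₀ := by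
  intro η hη
  have hω := volume_real_unitBall_pos (n := n)
  obtain ⟨δ, hδ, h⟩ := Metric.continuous_iff.1 hg x₀ (η / volume.real (ball (0 : Euc n) 1))
    (by positivity)
  refine ⟨δ, hδ, fun s hs hsδ => ?_⟩
  have h1 : ‖∫ y in ball x₀ s, ‖g y - g x₀‖‖ ≤
      η / volume.real (ball (0 : Euc n) 1) * volume.real (ball x₀ s) := by
    refine norm_setIntegral_le_of_norm_le_const measure_ball_lt_top fun y hy => ?_
    rw [norm_norm, ← dist_eq_norm]
    exact (h y ((mem_ball.1 hy).trans hsδ)).le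
  have h2 : volume.real (ball x₀ s) ≤ s ^ n * volume.real (ball (0 : Euc n) 1) := by
    rw [← volume_real_closedBall x₀ hs.le]
    exact measureReal_mono ball_subset_closedBall (isCompact_closedBall x₀ s).measure_lt_top.ne
  refine (le_abs_self _).trans (h1.trans ?_)
  calc _ ≤ η / volume.real (ball (0 : Euc n) 1) * (s ^ n * volume.real (ball (0 : Euc n) 1)) := by
        gcongr
    _ = η * s ^ n := by field_simp

end LebesguePoints

section Decomposition

variable {n k : ℕ} {V W : Type*}
  [NormedAddCommGroup V] [InnerProductSpace ℝ V] [FiniteDimensional ℝ V]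
  [NormedAddCommGroup W] [InnerProductSpace ℝ W] [FiniteDimensional ℝ W]

lemma integrable_inner_test {σ : Measure (Euc n)} {f φ : Euc n → W}
    (hf : LocallyIntegrable f σ) (hφ : IsTestFun n φ) : Integrable (fun x => ⟪f x, φ x⟫) σ := by
  simpa using integrable_cv (innerB W) hf (hφ.comp_sub_left 0) 0

/-- Lebesgue decomposition of the vector measure `f σ`. -/
lemma exists_lebesgue_decomposition {σ : Measure (Euc n)} [IsLocallyFiniteMeasure σ]
    {f : Euc n → W} (hf : LocallyIntegrable f σ) :
    ∃ (σs : Measure (Euc n)) (g : Euc n → W) (S : Set (Euc n)), σs ≤ σ ∧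
      LocallyIntegrable g volume ∧ MeasurableSet S ∧ σs S = 0 ∧ volume Sᶜ = 0 ∧
      ∀ φ : Euc n → W, IsTestFun n φ →
        ∫ x, ⟪f x, φ x⟫ ∂σ = ∫ x, ⟪f x, φ x⟫ ∂σs + ∫ x, ⟪g x, φ x⟫ := by
  obtain ⟨S, hS, h1, h2⟩ := Measure.mutuallySingular_singularPart σ (volume : Measure (Euc n))
  have hle : volume.withDensity (σ.rnDeriv volume) ≤ σ := Measure.withDensity_rnDeriv_le σ volume
  have hdec : σ = σ.singularPart volume + volume.withDensity (σ.rnDeriv volume) :=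
    Measure.haveLebesgueDecomposition_add σ volume
  have hfin : ∀ᵐ x : Euc n, σ.rnDeriv volume x < ∞ := σ.rnDeriv_lt_top volume
  have hf1 : LocallyIntegrable f (σ.singularPart volume) :=
    hf.mono_measure (Measure.singularPart_le σ volume)
  have hf2 : LocallyIntegrable f (volume.withDensity (σ.rnDeriv volume)) := hf.mono_measure hle
  refine ⟨σ.singularPart volume, fun x => (σ.rnDeriv volume x).toReal • f x, S,
    Measure.singularPart_le σ volume, ?_, hS, h1, h2, fun φ hφ => ?_⟩
  · refine locallyIntegrable_iff.2 fun K hK => ?_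
    have h3 := hf2.integrableOn_isCompact hK
    rw [IntegrableOn, restrict_withDensity hK.measurableSet,
      integrable_withDensity_iff_integrable_smul' (Measure.measurable_rnDeriv σ volume)
        (ae_restrict_of_ae hfin)] at h3
    exact h3
  · conv_lhs => rw [hdec]
    rw [integral_add_measure (integrable_inner_test hf1 hφ) (integrable_inner_test hf2 hφ),
      integral_withDensity_eq_integral_toReal_smul (Measure.measurable_rnDeriv σ volume) hfin]
    simp only [inner_smul_left, smul_eq_mul, RCLike.conj_to_real]

/-- The vector measure `f τ` is close to `c` times Lebesgue measure near `x₀`. -/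
def NearConst (τ : Measure (Euc n)) (f : Euc n → W) (x₀ : Euc n) (c : W) : Prop :=
  ∀ η > 0, ∃ δ > 0, ∀ r, 0 < r → r < δ →
    (∫ x in ball x₀ r, ‖f x‖ ∂τ ≤ (‖c‖ * volume.real (ball (0 : Euc n) 1) + η) * r ^ n) ∧
    ∀ (φ : Euc n → W) (M : ℝ), IsTestFun n φ → (∀ x, x ∉ ball x₀ r → φ x = 0) →
      (∀ x, ‖φ x‖ ≤ M) → |∫ x, ⟪f x, φ x⟫ ∂τ - ∫ x, ⟪c, φ x⟫| ≤ M * (η * r ^ n)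

lemma smooth_Aapply {A : CoeffOp n k V W} {P : Euc n → V} (hP : ContDiff ℝ (⊤ : ℕ∞) P) :
    ContDiff ℝ (⊤ : ℕ∞) (Aapply n k A P) := by
  rw [Aapply_eq_sum_clm]
  exact ContDiff.sum fun I _ => (ContinuousLinearMap.contDiff _).comp (smooth_dirDeriv hP I)

lemma hasDistribA_smooth (A : CoeffOp n k V W) {P : Euc n → V} (hP : ContDiff ℝ (⊤ : ℕ∞) P) :
    HasDistribA n k A P volume (Aapply n k A P) := by
  intro φ hφ
  have hi : ∀ I : Fin k → Fin n,
      Integrable (fun x => ⟪A I (dirDeriv n k I P x), φ x⟫) := fun I =>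
    integrable_inner_test (f := fun x => A I (dirDeriv n k I P x))
      ((LinearMap.toContinuousLinearMap (A I)).continuous.comp
        (smooth_dirDeriv hP I).continuous).locallyIntegrable hφ
  simp only [Aapply, sum_inner]
  rw [integral_finsetSum _ fun I _ => hi I, Finset.mul_sum]
  refine Finset.sum_congr rfl fun I _ => ?_
  have h1 := integral_dirDeriv_right (innerB W)
    (g := fun x => (LinearMap.toContinuousLinearMap (A I)) (P x))
    ((ContinuousLinearMap.contDiff _).comp hP) hφ.1 (Or.inr hφ.2) I
  have h2 : ∀ x, dirDeriv n k I (fun x => (LinearMap.toContinuousLinearMap (A I)) (P x)) x =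
      A I (dirDeriv n k I P x) := dirDeriv_clm (LinearMap.toContinuousLinearMap (A I)) hP I
  simp only [innerB_apply, h2, smul_eq_mul] at h1
  simp only [LinearMap.coe_toContinuousLinearMap'] at h1
  simp only [LinearMap.adjoint_inner_right]
  rw [h1, ← mul_assoc, ← mul_pow]
  simp

lemma HasDistribA.sub_smooth {A : CoeffOp n k V W} {u P : Euc n → V} {σ : Measure (Euc n)}
    {f : Euc n → W} (hu : LocallyIntegrable u volume) (h : HasDistribA n k A u σ f)
    (hP : ContDiff ℝ (⊤ : ℕ∞) P) {φ : Euc n → W} (hφ : IsTestFun n φ) :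
    ((-1 : ℝ) ^ k) * (∑ I : Fin k → Fin n,
        ∫ x, ⟪u x - P x, LinearMap.adjoint (A I) (dirDeriv n k I φ x)⟫) =
      ∫ x, ⟪f x, φ x⟫ ∂σ - ∫ x, ⟪Aapply n k A P x, φ x⟫ := by
  rw [← h φ hφ, ← hasDistribA_smooth A hP φ hφ, ← mul_sub, ← Finset.sum_sub_distrib]
  congr 1
  refine Finset.sum_congr rfl fun I _ => ?_
  have ht : IsTestFun n (fun x => LinearMap.adjoint (A I) (dirDeriv n k I φ x)) :=
    (hφ.dirDeriv I).clm (LinearMap.toContinuousLinearMap (LinearMap.adjoint (A I)))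
  rw [← integral_sub (integrable_inner_test hu ht)
    (integrable_inner_test hP.continuous.locallyIntegrable ht)]
  simp only [inner_sub_left]

/-- Subtracting a smooth map from `u` at almost every point. -/
theorem ae_exists_shifted {A : CoeffOp n k V W} {u : Euc n → V} {σ : Measure (Euc n)}
    [IsLocallyFiniteMeasure σ] {f : Euc n → W} (hu : LocallyIntegrable u volume)
    (hf : LocallyIntegrable f σ) (hf1 : ∀ᵐ x ∂σ, ‖f x‖ = 1) (h : HasDistribA n k A u σ f) :
    ∀ᵐ x₀ : Euc n, ∀ P : Euc n → V, ContDiff ℝ (⊤ : ℕ∞) P →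
      ∃ (τ : Measure (Euc n)) (f' : Euc n → W) (c : W), LocallyIntegrable f' τ ∧
        HasDistribA n k A (fun x => u x - P x) τ f' ∧ NearConst τ f' x₀ c := by
  classical
  obtain ⟨σs, g, S, hle, hg, hS, hsS, hvS, hdec⟩ := exists_lebesgue_decomposition hf
  have : IsLocallyFiniteMeasure σs := ⟨fun x => by
    obtain ⟨s, hs, hs'⟩ := σ.finiteAt_nhds x
    exact ⟨s, hs, (hle s).trans_lt hs'⟩⟩
  have hms : σs ⟂ₘ (volume : Measure (Euc n)) := ⟨S, hS, hsS, hvS⟩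
  filter_upwards [ae_lebPt hg, (Besicovitch.vitaliFamily volume).ae_tendsto_rnDeriv σs,
    Measure.rnDeriv_eq_zero_of_mutuallySingular hms Measure.AbsolutelyContinuous.rfl]
    with x₀ hleb hdens hzero P hP
  rw [hzero] at hdens
  set G : Euc n → W := fun x => g x - Aapply n k A P x with hG
  have hAP := (smooth_Aapply (A := A) hP).continuous
  have hGi : LocallyIntegrable G volume := hg.sub hAP.locallyIntegrable
  have hGl : LebPt G x₀ := LebPt.sub hg hAP.locallyIntegrable hleb (lebPt_of_continuous hAP x₀)
  set f' : Euc n → W := fun x => if x ∈ S then G x else f x with hf'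
  have es : f' =ᵐ[σs] f := by
    have : ∀ᵐ x ∂σs, x ∉ S := measure_eq_zero_iff_ae_notMem.1 hsS
    filter_upwards [this] with x hx
    simp [hf', hx]
  have ev : f' =ᵐ[volume] G := by
    have : ∀ᵐ x, x ∉ Sᶜ := measure_eq_zero_iff_ae_notMem.1 hvS
    filter_upwards [this] with x hx
    have hx' : x ∈ S := by simpa using hx
    simp [hf', hx']
  have hfs : LocallyIntegrable f σs := hf.mono_measure hle
  have hi : LocallyIntegrable f' (σs + volume) := by
    refine locallyIntegrable_iff.2 fun K hK => ?_
    rw [IntegrableOn, Measure.restrict_add, integrable_add_measure]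
    exact ⟨(hfs.integrableOn_isCompact hK).congr (ae_restrict_of_ae es.symm),
      (hGi.integrableOn_isCompact hK).congr (ae_restrict_of_ae ev.symm)⟩
  have hint : ∀ φ : Euc n → W, IsTestFun n φ → ∫ x, ⟪f' x, φ x⟫ ∂(σs + volume) =
      ∫ x, ⟪f x, φ x⟫ ∂σs + ∫ x, ⟪G x, φ x⟫ := fun φ hφ => by
    have e1 : (fun x => ⟪f' x, φ x⟫) =ᵐ[σs] fun x => ⟪f x, φ x⟫ := by
      filter_upwards [es] with x hx
      rw [hx]
    have e2 : (fun x => ⟪f' x, φ x⟫) =ᵐ[volume] fun x => ⟪G x, φ x⟫ := by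
      filter_upwards [ev] with x hx
      rw [hx]
    rw [integral_add_measure ((integrable_inner_test hfs hφ).congr e1.symm)
      ((integrable_inner_test hGi hφ).congr e2.symm), integral_congr_ae e1, integral_congr_ae e2]
  refine ⟨σs + volume, f', G x₀, hi, fun φ hφ => ?_, fun η hη => ?_⟩
  · rw [h.sub_smooth hu hP hφ, hint φ hφ, hdec φ hφ]
    have := integral_sub (integrable_inner_test hg hφ)
      (integrable_inner_test hAP.locallyIntegrable hφ)
    simp only [hG, inner_sub_left]
    rw [this]
    ring
  · have hω := volume_real_unitBall_pos (n := n)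
    set ω := volume.real (ball (0 : Euc n) 1)
    obtain ⟨δ₁, hδ₁, hc₁⟩ := hGl (η / 2) (by positivity)
    obtain ⟨δ₂, hδ₂, hc₂⟩ := exists_measureReal_closedBall_le hdens
      (show (0 : ℝ≥0∞) < ENNReal.ofReal (η / 2 / ω) from ENNReal.ofReal_pos.2 (by positivity))
    refine ⟨min δ₁ δ₂, lt_min hδ₁ hδ₂, fun r hr hrδ => ?_⟩
    have e₁ := hc₁ r hr (hrδ.trans_le (min_le_left _ _))
    have e₂ : ∫ x in ball x₀ r, ‖f x‖ ∂σs ≤ η / 2 * r ^ n := by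
      refine (integral_norm_le_measureReal (ae_mono hle hf1) x₀ r).trans
        ((hc₂ r hr (hrδ.trans_le (min_le_right _ _))).trans (le_of_eq ?_))
      rw [volume_real_closedBall x₀ hr.le]
      rw [div_mul_eq_mul_div, div_eq_iff hω.ne']
      ring
    have hGc : IntegrableOn (fun x => ‖G x - G x₀‖) (ball x₀ r) :=
      ((locInt_ball' hGi x₀ r).sub (integrableOn_const measure_ball_lt_top.ne)).norm
    have hvb : volume.real (ball x₀ r) ≤ r ^ n * ω := by
      rw [← volume_real_closedBall x₀ hr.le]
      exact measureReal_mono ball_subset_closedBall (isCompact_closedBall x₀ r).measure_lt_top.ne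
    constructor
    · have e1 : (fun x => ‖f' x‖) =ᵐ[σs.restrict (ball x₀ r)] fun x => ‖f x‖ :=
        ae_restrict_of_ae (es.fun_comp _)
      have e2 : (fun x => ‖f' x‖) =ᵐ[volume.restrict (ball x₀ r)] fun x => ‖G x‖ :=
        ae_restrict_of_ae (ev.fun_comp _)
      rw [Measure.restrict_add, integral_add_measure
        ((locInt_ball' hfs x₀ r).norm.congr e1.symm) ((locInt_ball' hGi x₀ r).norm.congr e2.symm),
        integral_congr_ae e1, integral_congr_ae e2]
      have e3 : ∫ x in ball x₀ r, ‖G x‖ ≤ ‖G x₀‖ * (r ^ n * ω) + η / 2 * r ^ n := by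
        calc ∫ x in ball x₀ r, ‖G x‖ ≤ ∫ x in ball x₀ r, (‖G x₀‖ + ‖G x - G x₀‖) := by
              refine integral_mono_of_nonneg (Eventually.of_forall fun _ => norm_nonneg _)
                ((integrableOn_const measure_ball_lt_top.ne).add hGc)
                (Eventually.of_forall fun x => ?_)
              have := norm_add_le (G x₀) (G x - G x₀)
              rwa [add_sub_cancel] at this
          _ = ‖G x₀‖ * volume.real (ball x₀ r) + ∫ x in ball x₀ r, ‖G x - G x₀‖ := by
              have hc : IntegrableOn (fun _ : Euc n => ‖G x₀‖) (ball x₀ r) :=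
                integrableOn_const measure_ball_lt_top.ne
              rw [integral_add hc hGc]
              simp [mul_comm]
          _ ≤ _ := add_le_add (mul_le_mul_of_nonneg_left hvb (norm_nonneg _)) e₁
      nlinarith
    · intro φ M hφ h0 hM
      have hM0 : 0 ≤ M := (norm_nonneg _).trans (hM x₀)
      rw [hint φ hφ, add_sub_assoc, ← integral_sub (integrable_inner_test hGi hφ)
        (integrable_inner_test continuous_const.locallyIntegrable hφ)]
      have b1 : |∫ x, ⟪f x, φ x⟫ ∂σs| ≤ M * (η / 2 * r ^ n) := by
        have e : ∫ x, ⟪f x, φ x⟫ ∂σs = ∫ x in ball x₀ r, ⟪f x, φ x⟫ ∂σs :=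
          (setIntegral_eq_integral_of_forall_compl_eq_zero fun x hx => by simp [h0 x hx]).symm
        rw [e, ← Real.norm_eq_abs]
        refine (norm_integral_le_integral_norm _).trans ?_
        calc _ ≤ ∫ x in ball x₀ r, M * ‖f x‖ ∂σs := by
              refine integral_mono_of_nonneg (Eventually.of_forall fun _ => norm_nonneg _)
                ((locInt_ball' hfs x₀ r).norm.const_mul M) (Eventually.of_forall fun x => ?_)
              refine (norm_inner_le_norm (𝕜 := ℝ) _ _).trans ?_
              rw [mul_comm]
              exact mul_le_mul_of_nonneg_right (hM x) (norm_nonneg _)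
          _ ≤ _ := by
              rw [integral_const_mul]
              exact mul_le_mul_of_nonneg_left e₂ hM0
      have b2 : |∫ x, (⟪G x, φ x⟫ - ⟪G x₀, φ x⟫)| ≤ M * (η / 2 * r ^ n) := by
        have e : ∫ x, (⟪G x, φ x⟫ - ⟪G x₀, φ x⟫) = ∫ x in ball x₀ r, (⟪G x, φ x⟫ - ⟪G x₀, φ x⟫) :=
          (setIntegral_eq_integral_of_forall_compl_eq_zero fun x hx => by simp [h0 x hx]).symm
        rw [e, ← Real.norm_eq_abs]
        refine (norm_integral_le_integral_norm _).trans ?_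
        calc _ ≤ ∫ x in ball x₀ r, M * ‖G x - G x₀‖ := by
              refine integral_mono_of_nonneg (Eventually.of_forall fun _ => norm_nonneg _)
                (hGc.const_mul M) (Eventually.of_forall fun x => ?_)
              simp only [← inner_sub_left]
              refine (norm_inner_le_norm (𝕜 := ℝ) _ _).trans ?_
              rw [mul_comm]
              exact mul_le_mul_of_nonneg_right (hM x) (norm_nonneg _)
          _ ≤ _ := by
              rw [integral_const_mul]
              exact mul_le_mul_of_nonneg_left e₁ hM0
      refine (abs_add_le _ _).trans ((add_le_add b1 b2).trans (le_of_eq ?_))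
      ring

end Decomposition

section Iteration

lemma tendsto_zero_of_doubling {a : ℝ → ℝ} (ha : ∀ ε > 0, ∃ δ > 0, ∀ r, 0 < r → r < δ →
    a r ≤ ε * (1 + a (2 * r))) (hb : ∀ δ > 0, ∃ M, ∀ r, δ ≤ r → r < 2 * δ → a r ≤ M) :
    ∀ ε > 0, ∃ δ > 0, ∀ r, 0 < r → r < δ → a r ≤ ε := by
  obtain ⟨δ, hδ, h1⟩ := ha (1 / 2) (by norm_num)
  obtain ⟨M, hM⟩ := hb δ hδ
  set M' := max M 1
  have hM1 : 1 ≤ M' := le_max_right _ _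
  have key : ∀ j : ℕ, ∀ r, 0 < r → r < 2 * δ → δ ≤ 2 ^ j * r → a r ≤ M' := by
    intro j
    induction j with
    | zero =>
      intro r _ hr2 hr3
      exact (hM r (by simpa using hr3) hr2).trans (le_max_left _ _)
    | succ j ih =>
      intro r hr hr2 hr3
      rcases le_or_gt δ r with h | h
      · exact (hM r h hr2).trans (le_max_left _ _)
      · have h2 := ih (2 * r) (by positivity) (by linarith) (by rw [pow_succ] at hr3; linarith)
        have h3 := h1 r hr h
        linarith
  intro ε hε
  obtain ⟨δ', hδ', h2⟩ := ha (ε / (1 + M')) (by positivity)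
  refine ⟨min δ δ', lt_min hδ hδ', fun r hr hrδ => ?_⟩
  have hr1 : r < δ := hrδ.trans_le (min_le_left _ _)
  obtain ⟨j, hj⟩ := pow_unbounded_of_one_lt (δ / (2 * r)) (one_lt_two (α := ℝ))
  have h3 := key j (2 * r) (by positivity) (by linarith) (by
    rw [div_lt_iff₀ (by positivity)] at hj
    exact hj.le)
  refine (h2 r hr (hrδ.trans_le (min_le_right _ _))).trans ?_
  rw [div_mul_eq_mul_div, div_le_iff₀ (by positivity)]
  exact mul_le_mul_of_nonneg_left (by linarith) hε.le

variable {n k : ℕ} {V W : Type*}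
  [NormedAddCommGroup V] [InnerProductSpace ℝ V] [FiniteDimensional ℝ V]
  [NormedAddCommGroup W] [InnerProductSpace ℝ W] [FiniteDimensional ℝ W]

lemma KernelSys.exists_norm_bound {A : CoeffOp n k V W} {J : Fin 0 → Fin n}
    (K : ∀ e : V, KernelSys A J e) : ∃ C, 0 ≤ C ∧ ∀ (u : Euc n → V) (σ : Measure (Euc n))
      (f : Euc n → W), LocallyIntegrable u volume → LocallyIntegrable f σ →
      HasDistribA n k A u σ f → ∀ r, 0 < r → ∀ᵐ x, ‖u x‖ ≤
        C * ((r⁻¹) ^ n * ((∫ y in ball x r, ‖u y‖) + r ^ k * ∫ y in ball x r, ‖f y‖ ∂σ)) := by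
  set b := stdOrthonormalBasis ℝ V
  choose C hC0 hC using fun a => (K (b a)).exists_ae_bound (Nat.zero_le _)
  refine ⟨∑ a, C a, Finset.sum_nonneg fun a _ => hC0 a, fun u σ f hu hf h r hr => ?_⟩
  have h1 : ∀ᵐ x, ∀ a, |⟪u x, b a⟫| ≤
      C a * ((r⁻¹) ^ n * ((∫ y in ball x r, ‖u y‖) + r ^ k * ∫ y in ball x r, ‖f y‖ ∂σ)) :=
    ae_all_iff.2 fun a => hC a u σ f _ hu hf h (locInt_inner hu (b a))
      (fun φ hφ => by simp [dirDeriv_zero, mul_comm]) r hr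
  filter_upwards [h1] with x hx
  rw [Finset.sum_mul]
  calc ‖u x‖ = ‖∑ a, ⟪b a, u x⟫ • b a‖ := by rw [b.sum_repr']
    _ ≤ ∑ a, ‖⟪b a, u x⟫ • b a‖ := norm_sum_le _ _
    _ ≤ _ := Finset.sum_le_sum fun a _ => by
      rw [norm_smul, b.norm_eq_one, mul_one, real_inner_comm, Real.norm_eq_abs]
      exact hx a

lemma ball_subset_ball_two {x₀ x : Euc n} {r : ℝ} (hx : x ∈ ball x₀ r) :
    ball x r ⊆ ball x₀ (2 * r) := fun y hy => by
  rw [mem_ball] at *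
  linarith [dist_triangle y x x₀]

lemma exists_subset_closedBall_zero (x : Euc n) (r : ℝ) : ∃ R, ball x r ⊆ closedBall 0 R :=
  ⟨_, ball_subset_closedBall_zero le_rfl⟩

lemma integral_norm_small {A : CoeffOp n k V W} {J : Fin 0 → Fin n}
    (K : ∀ e : V, KernelSys A J e) {u : Euc n → V} {τ : Measure (Euc n)} {f : Euc n → W}
    (hu : LocallyIntegrable u volume) (hf : LocallyIntegrable f τ) (h : HasDistribA n k A u τ f)
    {x₀ : Euc n} {c : W} (hc : NearConst τ f x₀ c) {F : Set (Euc n)} (hF : MeasurableSet F)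
    (hFu : ∀ ε > 0, ∃ δ > 0, ∀ r, 0 < r → r < δ → volume.real (ball x₀ r \ F) ≤ ε * r ^ n ∧
        ∫ x in ball x₀ r ∩ F, ‖u x‖ ≤ ε * r ^ (n + k)) :
    ∀ ε > 0, ∃ δ > 0, ∀ r, 0 < r → r < δ → ∫ x in ball x₀ r, ‖u x‖ ≤ ε * r ^ (n + k) := by
  set X : ℝ → ℝ := fun r => ∫ x in ball x₀ r, ‖u x‖ with hX
  have hX0 : ∀ r, 0 ≤ X r := fun r => integral_nonneg fun _ => norm_nonneg _
  obtain ⟨C, hC0, hC⟩ := KernelSys.exists_norm_bound K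
  obtain ⟨δ₀, hδ₀, hY⟩ := hc 1 one_pos
  set B := ‖c‖ * volume.real (ball (0 : Euc n) 1) + 1 with hB
  have hB0 : 0 ≤ B := by positivity
  set D := 1 + C * B * 2 ^ n + C * 2 ^ (n + k) with hD
  have hD0 : 0 < D := by positivity
  have main := tendsto_zero_of_doubling (a := fun r => X r / r ^ (n + k)) (fun ε hε => ?_)
    (fun δ hδ => ⟨X (2 * δ) / δ ^ (n + k), fun r hr1 hr2 => ?_⟩)
  · intro ε hε
    obtain ⟨δ, hδ, h1⟩ := main ε hε
    refine ⟨δ, hδ, fun r hr hrδ => ?_⟩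
    have h2 := h1 r hr hrδ
    rwa [div_le_iff₀ (by positivity)] at h2
  · obtain ⟨δ, hδ, h1⟩ := hFu (ε / D) (by positivity)
    refine ⟨min δ (δ₀ / 2), lt_min hδ (by positivity), fun r hr hrδ => ?_⟩
    obtain ⟨h2, h3⟩ := h1 r hr (hrδ.trans_le (min_le_left _ _))
    have h4 := (hY (2 * r) (by positivity)
      (by linarith [hrδ.trans_le (min_le_right δ (δ₀ / 2))])).1
    set Q := C * ((r⁻¹) ^ n * (X (2 * r) + r ^ k * (B * (2 * r) ^ n))) with hQ
    have hQ0 : 0 ≤ Q := by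
      have := hX0 (2 * r)
      positivity
    have h5 : ∀ᵐ x ∂volume.restrict (ball x₀ r \ F), ‖u x‖ ≤ Q := by
      filter_upwards [ae_restrict_of_ae (hC u τ f hu hf h r hr),
        ae_restrict_mem (measurableSet_ball.diff hF)] with x hx hxb
      refine hx.trans ?_
      have hsub := ball_subset_ball_two hxb.1
      have e1 : ∫ y in ball x r, ‖u y‖ ≤ X (2 * r) :=
        setIntegral_norm_mono hu hsub (exists_subset_closedBall_zero _ _)
      have e2 : ∫ y in ball x r, ‖f y‖ ∂τ ≤ B * (2 * r) ^ n :=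
        (setIntegral_norm_mono hf hsub (exists_subset_closedBall_zero _ _)).trans h4
      rw [hQ]
      gcongr
    have hui : IntegrableOn (fun x => ‖u x‖) (ball x₀ r) := (locInt_ball' hu x₀ r).norm
    have hfin : volume (ball x₀ r \ F) ≠ ∞ :=
      (measure_mono Set.sdiff_subset).trans_lt measure_ball_lt_top |>.ne
    have h6 : ∫ x in ball x₀ r \ F, ‖u x‖ ≤ Q * (ε / D * r ^ n) := by
      calc ∫ x in ball x₀ r \ F, ‖u x‖ ≤ ∫ x in ball x₀ r \ F, Q :=
            integral_mono_of_nonneg (Eventually.of_forall fun _ => norm_nonneg _)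
              (integrableOn_const hfin) h5
        _ = Q * volume.real (ball x₀ r \ F) := by simp [mul_comm]
        _ ≤ _ := mul_le_mul_of_nonneg_left h2 hQ0
    have h7 : X r ≤ ε / D * r ^ (n + k) + Q * (ε / D * r ^ n) := by
      have := integral_inter_add_sdiff hF hui
      simp only [hX]
      linarith
    have h8 : Q * r ^ n = C * X (2 * r) + C * B * 2 ^ n * r ^ (n + k) := by
      rw [hQ, mul_pow, pow_add, inv_pow]
      field_simp
    rw [div_le_iff₀ (by positivity)]
    refine h7.trans ?_
    rw [show Q * (ε / D * r ^ n) = ε / D * (Q * r ^ n) by ring, h8, ← mul_add]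
    rw [show ε * (1 + X (2 * r) / (2 * r) ^ (n + k)) * r ^ (n + k) =
      ε / D * (D * (r ^ (n + k) + X (2 * r) / 2 ^ (n + k))) by
        rw [mul_pow]; field_simp]
    refine mul_le_mul_of_nonneg_left ?_ (by positivity)
    have e3 : C * X (2 * r) = C * 2 ^ (n + k) * (X (2 * r) / 2 ^ (n + k)) := by field_simp
    have e4 : 0 ≤ X (2 * r) / 2 ^ (n + k) := div_nonneg (hX0 _) (by positivity)
    have e5 : 0 ≤ C * B * 2 ^ n := by positivity
    have e6 : 0 ≤ C * 2 ^ (n + k) * r ^ (n + k) := by positivity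
    have e7 : 0 ≤ C * B * 2 ^ n * (X (2 * r) / 2 ^ (n + k)) := mul_nonneg e5 e4
    rw [e3, hD]
    nlinarith
  · have h1 : X r ≤ X (2 * δ) :=
      setIntegral_norm_mono hu (ball_subset_ball hr2.le) (exists_subset_closedBall_zero _ _)
    exact div_le_div₀ (hX0 _) h1 (by positivity) (by gcongr)

lemma NearConst.eq_zero {A : CoeffOp n k V W} {u : Euc n → V} {τ : Measure (Euc n)}
    {f : Euc n → W} (hu : LocallyIntegrable u volume) (h : HasDistribA n k A u τ f)
    {x₀ : Euc n} {c : W} (hc : NearConst τ f x₀ c)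
    (hX : ∀ ε > 0, ∃ δ > 0, ∀ r, 0 < r → r < δ → ∫ x in ball x₀ r, ‖u x‖ ≤ ε * r ^ (n + k)) :
    c = 0 := by
  obtain ⟨B, hB0, hB⟩ := exists_bmp_bound (n := n)
  have ht : IsTestFun n (fun x => bmp n x • c) := isTestFun_bmp.smul_const c
  obtain ⟨C, hC0, hC⟩ := (IsTestFun.Astar (A := A) ht).exists_bound 0
  simp only [norm_iteratedFDeriv_zero] at hC
  set D := C + B * ‖c‖ + 1 with hD
  have hD0 : 0 < D := by positivity
  have key : ∀ ε > 0, ‖c‖ ^ 2 ≤ 0 + ε := by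
    intro ε hε
    obtain ⟨δ₁, hδ₁, h1⟩ := hX (ε / D) (by positivity)
    obtain ⟨δ₂, hδ₂, h2⟩ := hc (ε / D) (by positivity)
    obtain ⟨r, hr, hrδ⟩ := exists_between (lt_min hδ₁ hδ₂)
    have h1 := h1 r hr (hrδ.trans_le (min_le_left _ _))
    have h2 := (h2 r hr (hrδ.trans_le (min_le_right _ _))).2
    have hs : 0 < r⁻¹ := inv_pos.2 hr
    set g : Euc n → W := fun x => bmps n r⁻¹ x • c with hg
    have hgt : IsTestFun n g := (isTestFun_bmps hs).smul_const c
    have hg0 : ∀ z, r ≤ ‖z‖ → g z = 0 := fun z hz => by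
      simp only [hg]
      rw [bmps_of_le hs (by rw [inv_inv]; linarith), zero_smul]
    have e1 := h.cv_eq hu hgt x₀
    have e2 : |cv τ (innerB W) f g x₀ - ‖c‖ ^ 2| ≤ B * r⁻¹ ^ n * ‖c‖ * (ε / D * r ^ n) := by
      have e3 := h2 (fun y => g (x₀ - y)) (B * r⁻¹ ^ n * ‖c‖) (hgt.comp_sub_left x₀)
        (fun y hy => hg0 _ (by
          rw [mem_ball, dist_comm, dist_eq_norm] at hy
          linarith))
        (fun y => by
          simp only [hg, norm_smul, Real.norm_of_nonneg (bmps_nonneg hs _)]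
          exact mul_le_mul_of_nonneg_right (hB _ hs _) (norm_nonneg _))
      have e4 : ∫ y, ⟪c, g (x₀ - y)⟫ = ‖c‖ ^ 2 := by
        simp only [hg, inner_smul_right, real_inner_self_eq_norm_sq]
        rw [integral_mul_const, integral_sub_left_eq_self (fun y => bmps n r⁻¹ y) volume x₀,
          integral_bmps hs, one_mul]
      rwa [e4] at e3
    have hga : ∀ z, Astar n k A g z =
        r⁻¹ ^ n • r⁻¹ ^ k • Astar n k A (fun x => bmp n x • c) (r⁻¹ • z) := fun z => by
      have : g = fun y => r⁻¹ ^ n • (fun y => (fun x => bmp n x • c) (r⁻¹ • y)) y := by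
        funext y
        simp only [hg, bmps, mul_smul]
      rw [this, Astar_const_smul _ (ht.comp_smul hs.ne').1, Astar_comp_smul _ ht.1]
    have e5 : ‖cv volume (innerB V) u (Astar n k A g) x₀‖ ≤
        r⁻¹ ^ n * (r⁻¹ ^ k * C) * ∫ y in ball x₀ r, ‖u y‖ := by
      refine norm_cv_le_ball hu hgt.Astar (fun z hz => ?_) (fun z => ?_) x₀
      · have hz' : z ∉ tsupport (bmps n r⁻¹) := by
          intro hmem
          have h6 : tsupport (bmps n r⁻¹) ⊆ closedBall 0 (r / 2) := by
            refine closure_minimal (fun y hy => ?_) isClosed_closedBall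
            rw [mem_closedBall, dist_zero_right]
            by_contra hcon
            exact hy (bmps_of_le hs (by rw [inv_inv]; push Not at hcon; exact hcon.le))
          have := h6 hmem
          rw [mem_closedBall, dist_zero_right] at this
          linarith
        have h7 : ∀ I : Fin k → Fin n, dirDeriv n k I g z = 0 := fun I => by
          have : g =ᶠ[𝓝 z] fun _ => 0 := by
            have := notMem_tsupport_iff_eventuallyEq.1 hz'
            filter_upwards [this] with y hy
            simp [hg, hy]
          rw [dirDeriv_congr_nhds this I, dirDeriv_zero_fun]
        simp [Astar, h7]
      · rw [hga, norm_smul, norm_smul, Real.norm_of_nonneg (by positivity),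
          Real.norm_of_nonneg (by positivity)]
        have := hC (r⁻¹ • z)
        gcongr
    have e6 : r⁻¹ ^ n * (r⁻¹ ^ k * C) * ∫ y in ball x₀ r, ‖u y‖ ≤ C * (ε / D) := by
      calc _ ≤ r⁻¹ ^ n * (r⁻¹ ^ k * C) * (ε / D * r ^ (n + k)) := by gcongr
        _ = _ := by rw [pow_add, inv_pow, inv_pow]; field_simp
    have e7 : B * r⁻¹ ^ n * ‖c‖ * (ε / D * r ^ n) = B * ‖c‖ * (ε / D) := by
      rw [inv_pow]; field_simp
    rw [e1] at e5
    rw [e7] at e2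
    have e8 := (abs_le.1 e2).1
    have e9 := (le_abs_self (cv τ (innerB W) f g x₀)).trans (e5.trans e6)
    have e10 : (C + B * ‖c‖ + 1) * (ε / D) = ε := by
      rw [← hD]; field_simp
    have e11 : 0 < ε / D := by positivity
    linarith
  have h3 := le_of_forall_pos_le_add key
  have h4 : ‖c‖ = 0 := by nlinarith [norm_nonneg c]
  exact norm_eq_zero.1 h4

end Iteration

section Sufficiency

variable {n k : ℕ} {V W : Type*}
  [NormedAddCommGroup V] [InnerProductSpace ℝ V] [FiniteDimensional ℝ V]
  [NormedAddCommGroup W] [InnerProductSpace ℝ W] [FiniteDimensional ℝ W]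

lemma IsPolyDeg.dirDeriv {P : Euc n → V} {m j : ℕ} (hP : IsPolyDeg n (m + j) P)
    (J : Fin m → Fin n) : IsPolyDeg n j (dirDeriv n m J P) := by
  refine ⟨smooth_dirDeriv hP.1 J, fun x => ?_⟩
  rw [← norm_le_zero_iff]
  refine (norm_iteratedFDeriv_le_sum _ x).trans ?_
  refine Finset.sum_nonpos fun I _ => ?_
  refine (norm_dirDeriv_dirDeriv_le hP.1 J I x).trans (le_of_eq ?_)
  rw [show j + 1 + m = m + j + 1 by ring, hP.2, norm_zero]

lemma smallO_of_ae_le {g : Euc n → V} {x₀ : Euc n} {j : ℕ}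
    (h : ∀ ε > 0, ∃ δ > 0, ∀ r, 0 < r → r < δ → ∀ᵐ y ∂volume.restrict (ball x₀ r),
      ‖g y‖ ≤ ε * r ^ j) :
    SmallO (fun r => essSup (fun y => (‖g y‖₊ : ℝ≥0∞)) (volume.restrict (ball x₀ r))) (j : ℝ) := by
  refine ENNReal.tendsto_nhds_zero.2 fun ε hε => ?_
  obtain ⟨η, hη0, hη⟩ := ENNReal.lt_iff_exists_nnreal_btwn.1 hε
  obtain ⟨δ, hδ, h1⟩ := h η (by exact_mod_cast hη0)
  filter_upwards [Ioo_mem_nhdsGT hδ] with r hr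
  refine ENNReal.div_le_of_le_mul (le_trans (b := (η : ℝ≥0∞) * ENNReal.ofReal (r ^ (j : ℝ))) ?_ ?_)
  · refine essSup_le_of_ae_le _ ?_
    filter_upwards [h1 r hr.1 hr.2] with y hy
    rw [← ENNReal.ofReal_coe_nnreal (p := η), ← ENNReal.ofReal_mul η.coe_nonneg, Real.rpow_natCast,
      ← enorm_eq_nnnorm, ← ofReal_norm]
    exact ENNReal.ofReal_le_ofReal hy
  · gcongr

lemma norm_sub_le_sum (b : OrthonormalBasis (Fin (Module.finrank ℝ V)) ℝ V)
    (c : Fin (Module.finrank ℝ V) → ℝ) (q : V) :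
    ‖∑ a, c a • b a - q‖ ≤ ∑ a, |c a - ⟪q, b a⟫| := by
  have h3 : ∑ a, c a • b a - q = ∑ a, (c a - ⟪q, b a⟫) • b a := by
    conv_lhs => rw [← b.sum_repr' q]
    rw [← Finset.sum_sub_distrib]
    refine Finset.sum_congr rfl fun a _ => ?_
    rw [sub_smul, real_inner_comm]
  rw [h3]
  refine (norm_sum_le _ _).trans (Finset.sum_le_sum fun a _ => ?_)
  rw [norm_smul, b.norm_eq_one, mul_one, Real.norm_eq_abs]

lemma integral_test_sub_smooth {u P : Euc n → V} (hu : LocallyIntegrable u volume)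
    (hP : ContDiff ℝ (⊤ : ℕ∞) P) {m : ℕ} {J : Fin m → Fin n} {e : V} {w : Euc n → ℝ}
    (hw : LocallyIntegrable w volume) {φ : Euc n → ℝ} (hφ : IsTestFun n φ)
    (h : ∫ x, φ x * w x = (-1 : ℝ) ^ m * ∫ y, ⟪u y, e⟫ * dirDeriv n m J φ y) :
    ∫ x, φ x * (w x - ⟪dirDeriv n m J P x, e⟫) =
      (-1 : ℝ) ^ m * ∫ y, ⟪u y - P y, e⟫ * dirDeriv n m J φ y := by
  have hi : ∀ {g ψ : Euc n → ℝ}, LocallyIntegrable g volume → IsTestFun n ψ →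
      Integrable (fun x => ψ x * g x) := fun hg hψ =>
    hg.integrable_smul_left_of_hasCompactSupport hψ.1.continuous hψ.2
  have hPe : ContDiff ℝ (⊤ : ℕ∞) (fun y => ⟪P y, e⟫) := hP.inner ℝ contDiff_const
  have hd : ∀ x, dirDeriv n m J (fun y => ⟪P y, e⟫) x = ⟪dirDeriv n m J P x, e⟫ := fun x =>
    dirDeriv_clm ((innerB V).flip e) hP J x
  have h1 := integral_dirDeriv_right (ContinuousLinearMap.mul ℝ ℝ) hPe hφ.1 (Or.inr hφ.2) J
  simp only [hd, ContinuousLinearMap.mul_apply', smul_eq_mul] at h1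
  have hsm : Continuous fun x => ⟪dirDeriv n m J P x, e⟫ :=
    (smooth_dirDeriv hP J).continuous.inner continuous_const
  simp only [mul_sub, inner_sub_left, sub_mul]
  rw [integral_sub (hi hw hφ) (hi hsm.locallyIntegrable hφ), integral_sub
    (by simpa only [mul_comm] using hi (locInt_inner hu e) (hφ.dirDeriv J))
    (by simpa only [mul_comm] using hi hPe.continuous.locallyIntegrable (hφ.dirDeriv J)), h, h1,
    mul_sub, ← mul_assoc _ _ (∫ x, ⟪dirDeriv n m J P x, e⟫ * φ x), ← mul_pow]
  simp [mul_comm]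

/-- Differentiability of order `n` of the weak derivatives of order `k - n`, given the kernels. -/
theorem exists_weakDeriv_memTInf (hn : 1 ≤ n) (hnk : n ≤ k) {A : CoeffOp n k V W}
    (hE : IsElliptic n k A) {J₀ : Fin 0 → Fin n} (K₀ : ∀ e : V, KernelSys A J₀ e)
    (K : ∀ (J : Fin (k - n) → Fin n) (e : V), KernelSys A J e) {u : Euc n → V}
    (hu : MemBVAloc n k A u) : ∃ v, IsWeakDerivFamily n (k - n) u v ∧
      ∀ᵐ x : Euc n, ∀ I, MemTInf n n (v I) x := by
  obtain ⟨hu, σ, f, hσ, hf, hf1, h⟩ := hu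
  set b := stdOrthonormalBasis ℝ V
  choose w _ hw hwt using fun (J : Fin (k - n) → Fin n) a =>
    (K J (b a)).exists_limit (Nat.sub_le _ _) hu hf h one_pos
  choose C hC0 hC using fun (J : Fin (k - n) → Fin n) a =>
    (K J (b a)).exists_ae_bound (Nat.sub_le _ _)
  have hvi : ∀ J : Fin (k - n) → Fin n, ∀ a, LocallyIntegrable (fun x => w J a x • b a) volume :=
    fun J a x => by
      obtain ⟨s, hs, h⟩ := hw J a x
      exact ⟨s, hs, h.smul_const _⟩
  refine ⟨fun J x => ∑ a, w J a x • b a, ⟨fun J => ?_, fun J φ hφ => ?_⟩, ?_⟩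
  · exact locallyIntegrable_finsetSum _ fun a _ => hvi J a
  · have e1 : ∀ x, dirDeriv n (k - n) J φ x • u x =
        ∑ a, (⟪u x, b a⟫ * dirDeriv n (k - n) J φ x) • b a := fun x => by
      conv_lhs => rw [← b.sum_repr' (u x)]
      rw [Finset.smul_sum]
      refine Finset.sum_congr rfl fun a _ => ?_
      rw [smul_smul, real_inner_comm, mul_comm]
    simp only [e1, Finset.smul_sum, smul_smul]
    have i1 : ∀ a, Integrable fun x => (⟪u x, b a⟫ * dirDeriv n (k - n) J φ x) := fun a => by
      have := (locInt_inner hu (b a)).integrable_smul_left_of_hasCompactSupport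
        (hφ.dirDeriv J).1.continuous (hφ.dirDeriv J).2
      simpa only [smul_eq_mul, mul_comm] using this
    have i2 : ∀ a, Integrable fun x => φ x * w J a x := fun a =>
      (hw J a).integrable_smul_left_of_hasCompactSupport hφ.1.continuous hφ.2
    rw [integral_finsetSum _ fun a _ => (i1 a).smul_const _,
      integral_finsetSum _ fun a _ => (i2 a).smul_const _, Finset.smul_sum]
    refine Finset.sum_congr rfl fun a _ => ?_
    rw [integral_smul_const, integral_smul_const, hwt J a φ hφ, smul_smul, ← mul_assoc, ← mul_pow]
    simp
  · filter_upwards [ae_exists_poly hn (hn.trans hnk) hE K₀ hu hf hf1 h,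
      ae_exists_shifted hu hf hf1 h] with x₀ ⟨F, hF, P, hP, hFP⟩ hsh J
    obtain ⟨τ, f', c, hf', hd, hc⟩ := hsh P hP.1
    have hup : LocallyIntegrable (fun x => u x - P x) volume :=
      hu.sub hP.1.continuous.locallyIntegrable
    have hX := integral_norm_small K₀ hup hf' hd hc hF hFP
    have hc0 := hc.eq_zero hup hd hX
    refine ⟨dirDeriv n (k - n) J P, IsPolyDeg.dirDeriv (by rwa [Nat.sub_add_cancel hnk]) J,
      smallO_of_ae_le fun ε hε => ?_⟩
    set D := (∑ a, C J a) * (2 ^ (n + k) + 2 ^ n) + 1 with hD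
    have hS0 : 0 ≤ ∑ a, C J a := Finset.sum_nonneg fun a _ => hC0 J a
    have hD0 : 0 < D := by positivity
    obtain ⟨δ₁, hδ₁, h1⟩ := hX (ε / D) (by positivity)
    obtain ⟨δ₂, hδ₂, h2⟩ := hc (ε / D) (by positivity)
    refine ⟨min δ₁ δ₂ / 2, by positivity, fun r hr hrδ => ?_⟩
    have hr2 : 2 * r < min δ₁ δ₂ := by linarith
    have hXr := h1 (2 * r) (by positivity) (hr2.trans_le (min_le_left _ _))
    have hYr := (h2 (2 * r) (by positivity) (hr2.trans_le (min_le_right _ _))).1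
    rw [hc0, norm_zero, zero_mul, zero_add] at hYr
    have h3 : ∀ᵐ x, ∀ a, |w J a x - ⟪dirDeriv n (k - n) J P x, b a⟫| ≤
        C J a * ((r⁻¹) ^ (n + (k - n)) * ((∫ y in ball x r, ‖u y - P y‖) +
          r ^ k * ∫ y in ball x r, ‖f' y‖ ∂τ)) :=
      ae_all_iff.2 fun a => hC J a _ τ f' _ hup hf' hd
        ((hw J a).sub (((smooth_dirDeriv hP.1 J).continuous.inner
          continuous_const).locallyIntegrable))
        (fun φ hφ => integral_test_sub_smooth hu hP.1 (hw J a) hφ (hwt J a φ hφ)) r hr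
    filter_upwards [ae_restrict_of_ae h3, ae_restrict_mem measurableSet_ball] with x hx hxb
    refine (norm_sub_le_sum b _ _).trans ((Finset.sum_le_sum fun a _ => hx a).trans ?_)
    rw [← Finset.sum_mul, Nat.add_sub_cancel' hnk]
    have hsub := ball_subset_ball_two hxb
    have e1 : ∫ y in ball x r, ‖u y - P y‖ ≤ ε / D * (2 * r) ^ (n + k) :=
      (setIntegral_norm_mono hup hsub (exists_subset_closedBall_zero _ _)).trans hXr
    have e2 : ∫ y in ball x r, ‖f' y‖ ∂τ ≤ ε / D * (2 * r) ^ n :=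
      (setIntegral_norm_mono hf' hsub (exists_subset_closedBall_zero _ _)).trans hYr
    calc _ ≤ (∑ a, C J a) * (r⁻¹ ^ k * (ε / D * (2 * r) ^ (n + k) +
          r ^ k * (ε / D * (2 * r) ^ n))) := by gcongr
      _ = (∑ a, C J a) * (2 ^ (n + k) + 2 ^ n) * (ε / D) * r ^ n := by
          rw [mul_pow, mul_pow, pow_add r, inv_pow]
          field_simp
      _ ≤ D * (ε / D) * r ^ n := by
          gcongr
          rw [hD]
          linarith
      _ = ε * r ^ n := by field_simp

end Sufficiency

section UniformMeasure

variable {X E : Type*} [MetricSpace X] [MeasurableSpace X] [BorelSpace X]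
  [SecondCountableTopology X] [NormedAddCommGroup E] [NormedSpace ℝ E] [CompleteSpace E]

theorem ContinuousOn.integrable_of_ae_mem {S : Set X} (hS : IsCompact S) {μ : Measure X}
    [IsFiniteMeasure μ] (hμ : ∀ᵐ x ∂μ, x ∈ S) {f : X → E} (hf : ContinuousOn f S) :
    Integrable f μ := by
  have h := hf.integrableOn_compact (μ := μ) hS
  rwa [IntegrableOn, Measure.restrict_eq_self_of_ae_mem hμ] at h

theorem measurableSet_dist_lt (r : ℝ) : MeasurableSet {p : X × X | dist p.1 p.2 < r} :=
  measurableSet_lt (by fun_prop) measurable_const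

theorem setIntegral_dist_lt_fst {S : Set X} {μ ν : Measure X} [IsFiniteMeasure μ]
    [IsFiniteMeasure ν] (hμ : ∀ᵐ x ∂μ, x ∈ S) {r c : ℝ}
    (hc : ∀ x ∈ S, ν.real (ball x r) = c) {f : X → E} (hf : Integrable f μ) :
    ∫ p in {p : X × X | dist p.1 p.2 < r}, f p.1 ∂(μ.prod ν) = c • ∫ x, f x ∂μ := by
  rw [← integral_indicator (measurableSet_dist_lt r),
    integral_prod _ ((hf.comp_fst ν).indicator (measurableSet_dist_lt r)), ← integral_smul]
  refine integral_congr_ae ?_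
  filter_upwards [hμ] with x hx
  have : (fun y => ({p : X × X | dist p.1 p.2 < r}).indicator (fun p => f p.1) (x, y)) =
      (ball x r).indicator fun _ => f x := by
    ext y
    simp [Set.indicator, dist_comm]
  rw [this, integral_indicator measurableSet_ball, setIntegral_const, hc x hx]

theorem setIntegral_dist_lt_snd {S : Set X} {μ ν : Measure X} [IsFiniteMeasure μ]
    [IsFiniteMeasure ν] (hν : ∀ᵐ x ∂ν, x ∈ S) {r c : ℝ}
    (hc : ∀ x ∈ S, μ.real (ball x r) = c) {f : X → E} (hf : Integrable f ν) :
    ∫ p in {p : X × X | dist p.1 p.2 < r}, f p.2 ∂(μ.prod ν) = c • ∫ x, f x ∂ν := by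
  rw [← integral_indicator (measurableSet_dist_lt r),
    integral_prod_symm _ ((hf.comp_snd μ).indicator (measurableSet_dist_lt r)), ← integral_smul]
  refine integral_congr_ae ?_
  filter_upwards [hν] with y hy
  have : (fun x => ({p : X × X | dist p.1 p.2 < r}).indicator (fun p => f p.2) (x, y)) =
      (ball y r).indicator fun _ => f y := by
    ext x
    simp [Set.indicator]
  rw [this, integral_indicator measurableSet_ball, setIntegral_const, hc y hy]

/-- Two uniformly distributed measures on a compact set are proportional. -/
theorem integral_smul_eq_of_uniform {S : Set X} (hS : IsCompact S) {μ ν : Measure X}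
    [IsFiniteMeasure μ] [IsFiniteMeasure ν] (hμ : ∀ᵐ x ∂μ, x ∈ S) (hν : ∀ᵐ x ∂ν, x ∈ S)
    (φ ψ : ℝ → ℝ) (hφ : ∀ r, ∀ x ∈ S, μ.real (ball x r) = φ r)
    (hψ : ∀ r, ∀ x ∈ S, ν.real (ball x r) = ψ r) {f : X → E} (hf : ContinuousOn f S) :
    ν.real Set.univ • ∫ x, f x ∂μ = μ.real Set.univ • ∫ x, f x ∂ν := by
  have hfμ := hf.integrable_of_ae_mem hS hμ
  have hfν := hf.integrable_of_ae_mem hS hν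
  rcases eq_or_ne ν 0 with rfl | hν0
  · simp
  have hψpos : ∀ r, 0 < r → 0 < ψ r := by
    intro r hr
    by_contra hcon
    obtain ⟨t, htS, hcov⟩ := hS.elim_nhds_subcover (fun x => ball x r) fun x _ => ball_mem_nhds x hr
    refine hν0 (Measure.measure_univ_eq_zero.1 (le_antisymm ?_ bot_le))
    calc ν Set.univ ≤ ν (⋃ x ∈ t, ball x r) := measure_mono_ae (by
          filter_upwards [hν] with x hx _ using hcov hx)
      _ ≤ ∑ x ∈ t, ν (ball x r) := measure_biUnion_finset_le _ _
      _ = 0 := Finset.sum_eq_zero fun x hx => by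
          have h1 := hψ r x (htS x hx)
          have h2 : ν.real (ball x r) = 0 :=
            le_antisymm (h1.le.trans (not_lt.1 hcon)) measureReal_nonneg
          rwa [measureReal_eq_zero_iff] at h2
  have huc := hS.uniformContinuousOn_of_continuous hf
  have key : ∀ ε > 0, ‖ν.real Set.univ • ∫ x, f x ∂μ - μ.real Set.univ • ∫ x, f x ∂ν‖ ≤
      ε * (μ.real Set.univ * ν.real Set.univ) := by
    intro ε hε
    obtain ⟨r, hr, hfr⟩ := Metric.uniformContinuousOn_iff.1 huc ε hε
    set K := {p : X × X | dist p.1 p.2 < r} with hK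
    have hsym : ψ r * μ.real Set.univ = φ r * ν.real Set.univ := by
      have h1 := setIntegral_dist_lt_fst (ν := ν) hμ (hψ r) (integrable_const (1 : ℝ) (μ := μ))
      have h2 := setIntegral_dist_lt_snd (μ := μ) hν (hφ r) (integrable_const (1 : ℝ) (μ := ν))
      simp only [integral_const, smul_eq_mul, mul_one] at h1 h2
      exact h1.symm.trans h2
    have hKreal : (μ.prod ν).real K = ψ r * μ.real Set.univ := by
      have h1 := setIntegral_dist_lt_fst (ν := ν) hμ (hψ r) (integrable_const (1 : ℝ) (μ := μ))
      simpa using h1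
    have hmain : ‖∫ p in K, (f p.1 - f p.2) ∂(μ.prod ν)‖ ≤ ε * (μ.prod ν).real K := by
      refine norm_setIntegral_le_of_norm_le_const_ae' (measure_lt_top _ _) ?_
      have a1 : ∀ᵐ p ∂(μ.prod ν), p.1 ∈ S := Measure.quasiMeasurePreserving_fst.ae hμ
      have a2 : ∀ᵐ p ∂(μ.prod ν), p.2 ∈ S := Measure.quasiMeasurePreserving_snd.ae hν
      filter_upwards [a1, a2] with p h1 h2 hp
      rw [← dist_eq_norm]
      exact (hfr _ h1 _ h2 hp).le
    rw [integral_sub (hfμ.comp_fst ν).integrableOn (hfν.comp_snd μ).integrableOn,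
      setIntegral_dist_lt_fst hμ (hψ r) hfμ, setIntegral_dist_lt_snd hν (hφ r) hfν, hKreal] at hmain
    have h3 : ν.real Set.univ • (ψ r • ∫ x, f x ∂μ - φ r • ∫ x, f x ∂ν) =
        ψ r • (ν.real Set.univ • ∫ x, f x ∂μ - μ.real Set.univ • ∫ x, f x ∂ν) := by
      rw [smul_sub, smul_sub, smul_smul, smul_smul, smul_smul, smul_smul, hsym, mul_comm (φ r),
        mul_comm (ψ r)]
    have h4 := congrArg norm h3
    rw [norm_smul, norm_smul, Real.norm_of_nonneg measureReal_nonneg,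
      Real.norm_of_nonneg (hψpos r hr).le] at h4
    have h5 := mul_le_mul_of_nonneg_left hmain (measureReal_nonneg (μ := ν) (s := Set.univ))
    rw [h4] at h5
    refine le_of_mul_le_mul_left (h5.trans (le_of_eq ?_)) (hψpos r hr)
    ring
  rw [← sub_eq_zero, ← norm_le_zero_iff]
  refine le_of_forall_pos_le_add fun ε hε => ?_
  have hP : 0 ≤ μ.real Set.univ * ν.real Set.univ := by positivity
  refine (key (ε / (μ.real Set.univ * ν.real Set.univ + 1)) (by positivity)).trans ?_
  rw [zero_add, div_mul_eq_mul_div, div_le_iff₀ (by positivity)]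
  nlinarith

end UniformMeasure

section SphereMeasure

variable {n : ℕ}

lemma norm_normalize_sub_le {E : Type*} [NormedAddCommGroup E] [NormedSpace ℝ E] {z w : E}
    (hz : 1 ≤ ‖z‖) (hw : 1 ≤ ‖w‖) : ‖‖z‖⁻¹ • z - ‖w‖⁻¹ • w‖ ≤ 2 * ‖z - w‖ := by
  have hz0 : 0 < ‖z‖ := by linarith
  have hw0 : 0 < ‖w‖ := by linarith
  have e : ‖z‖⁻¹ • z - ‖w‖⁻¹ • w = ‖z‖⁻¹ • (z - w) + ((‖w‖ - ‖z‖) * ‖z‖⁻¹ * ‖w‖⁻¹) • w := by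
    have : (‖w‖ - ‖z‖) * ‖z‖⁻¹ * ‖w‖⁻¹ = ‖z‖⁻¹ - ‖w‖⁻¹ := by field_simp
    rw [this, sub_smul, smul_sub]; abel
  have h2 : |‖w‖ - ‖z‖| ≤ ‖z - w‖ := by rw [norm_sub_rev]; exact abs_norm_sub_norm_le w z
  have hi : ‖z‖⁻¹ ≤ 1 := inv_le_one_of_one_le₀ hz
  rw [e]
  refine (norm_add_le _ _).trans ?_
  rw [norm_smul, norm_smul, norm_mul, norm_mul, norm_inv, norm_inv, norm_norm, norm_norm,
    mul_assoc (‖‖w‖ - ‖z‖‖ * ‖z‖⁻¹), inv_mul_cancel₀ hw0.ne', mul_one, Real.norm_eq_abs]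
  calc _ ≤ 1 * ‖z - w‖ + ‖z - w‖ * 1 := by gcongr
    _ = _ := by ring

/-- The `i`-th face (`s = ±1`) of the cube, projected radially to the unit sphere. -/
noncomputable def cubeFace (N : ℕ) (i : Fin (N + 1)) (s : ℝ) (y : Fin N → ℝ) : Euc (N + 1) :=
  ‖(WithLp.toLp 2 (i.insertNth s y) : Euc (N + 1))‖⁻¹ • WithLp.toLp 2 (i.insertNth s y)

lemma norm_toLp_insertNth_zero_le {N : ℕ} (i : Fin (N + 1)) (y : Fin N → ℝ) :
    ‖(WithLp.toLp 2 (i.insertNth (0 : ℝ) y) : Euc (N + 1))‖ ≤ N * ‖y‖ := by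
  refine (norm_le_sum_coord _).trans ?_
  rw [Fin.sum_univ_succAbove _ i]
  simp only [Fin.insertNth_apply_same, abs_zero, zero_add, Fin.insertNth_apply_succAbove]
  refine (Finset.sum_le_sum fun j _ => norm_le_pi_norm y j).trans ?_
  simp

lemma lipschitzWith_cubeFace {N : ℕ} (i : Fin (N + 1)) {s : ℝ} (hs : |s| = 1) :
    LipschitzWith (2 * N) (cubeFace N i s) := by
  refine LipschitzWith.of_dist_le_mul fun y y' => ?_
  have h1 : ∀ y : Fin N → ℝ, 1 ≤ ‖(WithLp.toLp 2 (i.insertNth s y) : Euc (N + 1))‖ := fun y => by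
    have := abs_coord_le (WithLp.toLp 2 (i.insertNth s y) : Euc (N + 1)) i
    simpa [hs] using this
  rw [dist_eq_norm, dist_eq_norm]
  refine (norm_normalize_sub_le (h1 y) (h1 y')).trans ?_
  rw [← WithLp.toLp_sub, ← Fin.insertNth_sub, sub_self]
  have := norm_toLp_insertNth_zero_le i (y - y')
  push_cast
  linarith

lemma sphere_subset_cubeFace (N : ℕ) : sphere (0 : Euc (N + 1)) 1 ⊆
    ⋃ i : Fin (N + 1), cubeFace N i 1 '' closedBall 0 1 ∪ cubeFace N i (-1) '' closedBall 0 1 := by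
  intro x hx
  have hx1 : ‖x‖ = 1 := by simpa using hx
  obtain ⟨i, -, hi⟩ := Finset.exists_max_image Finset.univ (fun j => |x j|) Finset.univ_nonempty
  have hpos : 0 < |x i| := by
    by_contra hcon
    have h0 : ∀ j, |x j| ≤ 0 := fun j => (hi j (Finset.mem_univ j)).trans (not_lt.1 hcon)
    have := (norm_le_sum_coord x).trans (Finset.sum_nonpos fun j _ => h0 j)
    linarith
  have hxi : x i ≠ 0 := abs_pos.1 hpos
  have key : cubeFace N i (x i / |x i|) (fun j => x (i.succAbove j) / |x i|) = x := by
    have e : (WithLp.toLp 2 (i.insertNth (x i / |x i|) fun j => x (i.succAbove j) / |x i|) :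
        Euc (N + 1)) = |x i|⁻¹ • x := by
      ext j
      refine Fin.succAboveCases i ?_ (fun j => ?_) j
      · simp [div_eq_inv_mul]
      · simp [div_eq_inv_mul]
    rw [cubeFace, e, norm_smul, norm_inv, Real.norm_eq_abs, abs_abs, hx1, mul_one, inv_inv,
      smul_smul, mul_inv_cancel₀ hpos.ne', one_smul]
  have hy : (fun j => x (i.succAbove j) / |x i|) ∈ closedBall (0 : Fin N → ℝ) 1 := by
    rw [mem_closedBall_zero_iff, pi_norm_le_iff_of_nonneg zero_le_one]
    intro j
    rw [norm_div, Real.norm_eq_abs, Real.norm_eq_abs, abs_abs, div_le_one hpos]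
    exact hi _ (Finset.mem_univ _)
  refine Set.mem_iUnion.2 ⟨i, ?_⟩
  rcases lt_or_gt_of_ne hxi with h | h
  · right
    refine ⟨_, hy, ?_⟩
    rwa [abs_of_neg h, div_neg, div_self hxi, ← abs_of_neg h] at key
  · left
    refine ⟨_, hy, ?_⟩
    rwa [abs_of_pos h, div_self hxi, ← abs_of_pos h] at key

lemma hausdorffMeasure_sphere_lt_top (N : ℕ) :
    μH[(N : ℝ)] (sphere (0 : Euc (N + 1)) 1) < ⊤ := by
  have hface : ∀ (i : Fin (N + 1)) (s : ℝ), |s| = 1 →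
      μH[(N : ℝ)] (cubeFace N i s '' closedBall 0 1) < ⊤ := by
    intro i s hs
    refine ((lipschitzWith_cubeFace i hs).hausdorffMeasure_image_le N.cast_nonneg _).trans_lt ?_
    have h := hausdorffMeasure_pi_real (ι := Fin N)
    rw [Fintype.card_fin] at h
    rw [h]
    refine ENNReal.mul_lt_top ?_ measure_closedBall_lt_top
    simp only [ENNReal.rpow_natCast]
    exact ENNReal.pow_lt_top ENNReal.coe_lt_top
  refine (measure_mono (sphere_subset_cubeFace N)).trans_lt ?_
  refine (measure_iUnion_fintype_le _ _).trans_lt (ENNReal.sum_lt_top.2 fun i _ => ?_)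
  exact (measure_union_le _ _).trans_lt
    (ENNReal.add_lt_top.2 ⟨hface i 1 (by simp), hface i (-1) (by simp)⟩)

lemma hausdorffMeasure_sphere_pos (N : ℕ) :
    0 < μH[(N : ℝ)] (sphere (0 : Euc (N + 1)) 1) := by
  set P : Euc (N + 1) → (Fin N → ℝ) := fun x i => x i.succ with hP
  have hLip : LipschitzWith 1 P := by
    refine LipschitzWith.of_dist_le_mul fun x y => ?_
    rw [dist_pi_le_iff (by positivity)]
    intro i
    rw [NNReal.coe_one, one_mul, Real.dist_eq, dist_eq_norm]
    exact abs_coord_le (x - y) i.succ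
  have hsub : ball (0 : Fin N → ℝ) (1 / (N + 1)) ⊆ P '' sphere 0 1 := by
    intro y hy
    have hsum : ∑ j, y j ^ 2 ≤ 1 := by
      have hyj : ∀ j, y j ^ 2 ≤ 1 / (N + 1) := by
        intro j
        have h1 : |y j| ≤ 1 / (N + 1) := (norm_le_pi_norm y j).trans (mem_ball_zero_iff.1 hy).le
        have h2 : (1 : ℝ) / (N + 1) ≤ 1 := by
          rw [div_le_one (by positivity)]
          linarith [(Nat.cast_nonneg N : (0 : ℝ) ≤ N)]
        rw [← sq_abs]
        nlinarith [abs_nonneg (y j)]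
      refine (Finset.sum_le_sum fun j _ => hyj j).trans ?_
      rw [Finset.sum_const, Finset.card_univ, Fintype.card_fin, nsmul_eq_mul, mul_one_div,
        div_le_one (by positivity)]
      linarith
    refine ⟨WithLp.toLp 2 (Fin.cons (Real.sqrt (1 - ∑ j, y j ^ 2)) y), ?_, ?_⟩
    · rw [mem_sphere_zero_iff_norm, EuclideanSpace.norm_eq, Fin.sum_univ_succ]
      simp only [Fin.cons_zero, Fin.cons_succ, Real.norm_eq_abs, sq_abs]
      rw [Real.sq_sqrt (by linarith), sub_add_cancel, Real.sqrt_one]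
    · ext i
      simp [hP]
  have h := hausdorffMeasure_pi_real (ι := Fin N)
  rw [Fintype.card_fin] at h
  calc (0 : ℝ≥0∞) < volume (ball (0 : Fin N → ℝ) (1 / (N + 1))) :=
        measure_ball_pos _ _ (by positivity)
    _ ≤ μH[(N : ℝ)] (P '' sphere 0 1) := by rw [h]; exact measure_mono hsub
    _ ≤ _ := by
        have := hLip.hausdorffMeasure_image_le (N.cast_nonneg (α := ℝ)) (sphere 0 1)
        simpa using this

lemma exists_linearIsometryEquiv_of_norm_eq {x y : Euc n} (h : ‖x‖ = ‖y‖) :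
    ∃ R : Euc n ≃ₗᵢ[ℝ] Euc n, R x = y :=
  ⟨_, Submodule.reflection_sub h⟩

/-- The density `ψ(x) |x|⁻ⁿ`. -/
noncomputable def radDens (n : ℕ) (x : Euc n) : ℝ := psi n x * (‖x‖ ^ n)⁻¹

/-- The radial projection to the sphere of the measure with density `ψ(x) |x|⁻ⁿ`. -/
noncomputable def radMeas (n : ℕ) : Measure (Euc n) :=
  (volume.withDensity fun x => ENNReal.ofReal (radDens n x)).map fun x => ‖x‖⁻¹ • x

lemma one_lt_norm_of_psi_ne {x : Euc n} (h : psi n x ≠ 0) : 1 < ‖x‖ := by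
  by_contra hcon
  exact h (psi_of_norm_le (not_lt.1 hcon))

lemma measurable_radDens : Measurable (radDens n) := by
  have := (smooth_psi (n := n)).continuous.measurable
  unfold radDens
  fun_prop

lemma radDens_nonneg (x : Euc n) : 0 ≤ radDens n x :=
  mul_nonneg (psi_nonneg x) (by positivity)

lemma measurable_normalize : Measurable fun x : Euc n => ‖x‖⁻¹ • x := by fun_prop

lemma integrable_radDens : Integrable (radDens n) volume := by
  refine (isTestFun_psi.integrable volume).mono' measurable_radDens.aestronglyMeasurable
    (ae_of_all _ fun x => ?_)
  rw [Real.norm_of_nonneg (radDens_nonneg x), radDens]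
  by_cases h : psi n x = 0
  · simp [h]
  · exact mul_le_of_le_one_right (psi_nonneg x)
      (inv_le_one_of_one_le₀ (one_le_pow₀ (one_lt_norm_of_psi_ne h).le))

instance : IsFiniteMeasure (radMeas n) := by
  have : IsFiniteMeasure (volume.withDensity fun x => ENNReal.ofReal (radDens n x)) :=
    isFiniteMeasure_withDensity_ofReal integrable_radDens.2
  rw [radMeas]
  infer_instance

lemma radMeas_ae_mem : ∀ᵐ x ∂(radMeas n), x ∈ sphere (0 : Euc n) 1 := by
  rw [radMeas]
  refine (ae_map_iff measurable_normalize.aemeasurable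
    (isClosed_sphere (x := (0 : Euc n)) (ε := 1)).measurableSet).2 ?_
  rw [ae_withDensity_iff measurable_radDens.ennreal_ofReal]
  refine ae_of_all _ fun x hx => ?_
  have h0 : psi n x ≠ 0 := by
    rintro h
    simp [radDens, h] at hx
  have := one_lt_norm_of_psi_ne h0
  rw [dist_zero_right, norm_smul, norm_inv, norm_norm, inv_mul_cancel₀ (by linarith)]

lemma radMeas_apply {s : Set (Euc n)} (hs : MeasurableSet s) :
    radMeas n s = ∫⁻ x, ((fun x => ‖x‖⁻¹ • x) ⁻¹' s).indicator
      (fun x => ENNReal.ofReal (radDens n x)) x := by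
  rw [radMeas, Measure.map_apply measurable_normalize hs,
    withDensity_apply _ (measurable_normalize hs), lintegral_indicator (measurable_normalize hs)]

lemma radMeas_ball_congr {x y : Euc n} (h : ‖x‖ = ‖y‖) (r : ℝ) :
    radMeas n (ball x r) = radMeas n (ball y r) := by
  obtain ⟨R, rfl⟩ := exists_linearIsometryEquiv_of_norm_eq h
  symm
  rw [radMeas_apply measurableSet_ball, radMeas_apply measurableSet_ball,
    ← R.measurePreserving.lintegral_comp_emb R.toHomeomorph.measurableEmbedding]
  refine lintegral_congr fun z => ?_
  have e1 : radDens n (R z) = radDens n z := by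
    rw [radDens, radDens, psi_congr (R.norm_map z), R.norm_map]
  have e2 : ‖z‖⁻¹ • R z = R (‖z‖⁻¹ • z) := by simp
  simp only [Set.indicator, Set.mem_preimage, R.norm_map, e1, e2, mem_ball, R.dist_map]

lemma sphere_ball_congr {x y : Euc n} (h : ‖x‖ = ‖y‖) (d r : ℝ) :
    (μH[d].restrict (sphere (0 : Euc n) 1)) (ball x r) =
      (μH[d].restrict (sphere (0 : Euc n) 1)) (ball y r) := by
  obtain ⟨R, rfl⟩ := exists_linearIsometryEquiv_of_norm_eq h
  symm
  rw [Measure.restrict_apply measurableSet_ball, Measure.restrict_apply measurableSet_ball,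
    ← R.toIsometryEquiv.hausdorffMeasure_preimage]
  congr 1
  ext z
  simp

lemma integral_radMeas {F : Type*} [NormedAddCommGroup F] [NormedSpace ℝ F] [CompleteSpace F]
    {g : Euc n → F} (hg : ContinuousOn g (sphere 0 1))
    (hom : ∀ t : ℝ, 0 < t → ∀ ξ : Euc n, ξ ≠ 0 → g (t • ξ) = (t ^ n)⁻¹ • g ξ) :
    ∫ x, g x ∂(radMeas n) = ∫ x, psi n x • g x := by
  have hm := (hg.integrable_of_ae_mem (isCompact_sphere 0 1) radMeas_ae_mem).aestronglyMeasurable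
  rw [radMeas] at hm ⊢
  rw [integral_map measurable_normalize.aemeasurable hm,
    integral_withDensity_eq_integral_toReal_smul measurable_radDens.ennreal_ofReal
      (ae_of_all _ fun _ => ENNReal.ofReal_lt_top)]
  refine integral_congr_ae (ae_of_all _ fun x => ?_)
  simp only [ENNReal.toReal_ofReal (radDens_nonneg x)]
  by_cases h : psi n x = 0
  · simp [radDens, h]
  · have hx : 0 < ‖x‖ := zero_lt_one.trans (one_lt_norm_of_psi_ne h)
    rw [hom _ (inv_pos.2 hx) x (norm_pos_iff.1 hx), radDens, smul_smul, inv_pow, inv_inv,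
      inv_mul_cancel_right₀ (pow_pos hx n).ne']

lemma radMeas_univ_pos (hn : 1 ≤ n) : 0 < (radMeas n).real Set.univ := by
  refine ENNReal.toReal_pos (fun h => ?_) (measure_ne_top _ _)
  rw [radMeas_apply MeasurableSet.univ, Set.preimage_univ, Set.indicator_univ,
    lintegral_eq_zero_iff measurable_radDens.ennreal_ofReal] at h
  have h2 : psi n =ᵐ[volume] 0 := by
    filter_upwards [h] with x hx
    by_contra hcon
    have hx1 := one_lt_norm_of_psi_ne hcon
    have hpos : 0 < psi n x := lt_of_le_of_ne (psi_nonneg x) (Ne.symm hcon)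
    have : 0 < radDens n x := mul_pos hpos (by positivity)
    simp only [Pi.zero_apply, ENNReal.ofReal_eq_zero] at hx
    linarith
  have h3 := (smooth_psi (n := n)).continuous.ae_eq_iff_eq volume continuous_zero |>.1 h2
  have h4 := psi_of_norm_eq (n := n) (ξ := (2 : ℝ) • stdVec n ⟨0, hn⟩)
    (by rw [norm_smul, norm_stdVec]; norm_num)
  rw [h3] at h4
  exact zero_ne_one h4

/-- Vanishing of the spherical mean of a `(-n)`-homogeneous function via a radial cutoff. -/
theorem setIntegral_sphere_eq_zero_iff (hn : 1 ≤ n) {F : Type*} [NormedAddCommGroup F]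
    [NormedSpace ℝ F] [CompleteSpace F] {g : Euc n → F} (hg : ContinuousOn g (sphere 0 1))
    (hom : ∀ t : ℝ, 0 < t → ∀ ξ : Euc n, ξ ≠ 0 → g (t • ξ) = (t ^ n)⁻¹ • g ξ) :
    ∫ ξ in sphere (0 : Euc n) 1, g ξ ∂(μH[(n : ℝ) - 1]) = 0 ↔ ∫ ξ, psi n ξ • g ξ = 0 := by
  obtain ⟨N, rfl⟩ : ∃ N, n = N + 1 := ⟨n - 1, by omega⟩
  have hd : (((N + 1 : ℕ) : ℝ) - 1) = N := by push_cast; ring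
  rw [hd]
  set μ := (μH[(N : ℝ)] : Measure (Euc (N + 1))).restrict (sphere 0 1) with hμ
  have hfin : IsFiniteMeasure μ := ⟨by
    rw [hμ, Measure.restrict_apply_univ]; exact hausdorffMeasure_sphere_lt_top N⟩
  have hpos : 0 < μ.real Set.univ := by
    refine ENNReal.toReal_pos (ne_of_gt ?_) (measure_ne_top _ _)
    rw [hμ, Measure.restrict_apply_univ]
    exact hausdorffMeasure_sphere_pos N
  have hS : ∀ x ∈ sphere (0 : Euc (N + 1)) 1, ‖x‖ = ‖stdVec (N + 1) 0‖ := fun x hx => by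
    rw [norm_stdVec]; simpa using hx
  have key := integral_smul_eq_of_uniform (isCompact_sphere (0 : Euc (N + 1)) 1) (μ := μ)
    (ν := radMeas (N + 1)) (ae_restrict_mem isClosed_sphere.measurableSet) radMeas_ae_mem
    (fun r => μ.real (ball (stdVec (N + 1) 0) r))
    (fun r => (radMeas (N + 1)).real (ball (stdVec (N + 1) 0) r))
    (fun r x hx => congrArg ENNReal.toReal (sphere_ball_congr (hS x hx) _ r))
    (fun r x hx => congrArg ENNReal.toReal (radMeas_ball_congr (hS x hx) r)) hg
  rw [integral_radMeas hg hom] at key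
  constructor
  · intro h
    rw [h, smul_zero] at key
    exact (smul_eq_zero.1 key.symm).resolve_left hpos.ne'
  · intro h
    rw [h, smul_zero] at key
    exact (smul_eq_zero.1 key).resolve_left (radMeas_univ_pos hn).ne'

end SphereMeasure

section WeakCancellation

variable {n k : ℕ} {V W : Type*}
  [NormedAddCommGroup V] [InnerProductSpace ℝ V] [FiniteDimensional ℝ V]
  [NormedAddCommGroup W] [InnerProductSpace ℝ W] [FiniteDimensional ℝ W] {A : CoeffOp n k V W}

lemma IsElliptic.range_sphere_iff (hE : IsElliptic n k A) (w : W) :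
    (∀ ξ ∈ sphere (0 : Euc n) 1, w ∈ LinearMap.range (symbolMap n k A ξ)) ↔
      ∀ ξ ≠ 0, projK A w ξ = 0 := by
  constructor
  · intro h ξ hξ
    have hξ' : 0 < ‖ξ‖ := norm_pos_iff.2 hξ
    have hs : ‖ξ‖⁻¹ • ξ ∈ sphere (0 : Euc n) 1 := by
      rw [mem_sphere_zero_iff_norm, norm_smul, norm_inv, norm_norm, inv_mul_cancel₀ hξ'.ne']
    have := (hE.mem_range_iff w (ne_zero_of_mem_unit_sphere ⟨_, hs⟩)).1 (h _ hs)
    rwa [hE.projK_comp_smul w hξ (inv_pos.2 hξ').ne'] at this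
  · intro h ξ hξ
    have h0 := ne_zero_of_mem_unit_sphere ⟨ξ, hξ⟩
    exact (hE.mem_range_iff w h0).2 (h ξ h0)

lemma IsElliptic.weakCancel_iff (hn : 1 ≤ n) (hE : IsElliptic n k A) {m : ℕ} (hm : m + n = k)
    (w : W) (J : Fin m → Fin n) :
    ∫ ξ in sphere (0 : Euc n) 1, (∏ i, ξ (J i)) • (Adagger n k A ξ w) ∂(μH[(n : ℝ) - 1]) = 0 ↔
      ∫ ξ, (∏ i, ξ (J i)) • psi n ξ • dagK A w ξ = 0 := by
  have h1 : ∫ ξ in sphere (0 : Euc n) 1, (∏ i, ξ (J i)) • (Adagger n k A ξ w) ∂(μH[(n : ℝ) - 1]) =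
      ∫ ξ in sphere (0 : Euc n) 1, (∏ i, ξ (J i)) • dagK A w ξ ∂(μH[(n : ℝ) - 1]) :=
    setIntegral_congr_fun isClosed_sphere.measurableSet fun ξ hξ => by
      simp only [hE.adagger_eq w (ne_zero_of_mem_unit_sphere ⟨ξ, hξ⟩)]
  rw [h1, setIntegral_sphere_eq_zero_iff hn]
  · simp only [smul_smul, mul_comm]
  · refine ContinuousOn.smul (by fun_prop) fun ξ hξ => ?_
    exact (hE.contDiffAt_dagK w (ne_zero_of_mem_unit_sphere ⟨ξ, hξ⟩)).continuousAt.continuousWithinAt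
  · intro t ht ξ hξ
    rw [prod_coord_smul, hE.dagK_smul w hξ ht.ne', smul_smul, smul_smul]
    have : t ^ k = t ^ m * t ^ n := by rw [← hm, pow_add]
    rw [this]
    congr 1
    field_simp

end WeakCancellation

section Series

variable {n k m : ℕ} {ι : Type*} {E F G : Type*}
  [NormedAddCommGroup E] [NormedSpace ℝ E] [CompleteSpace E]
  [NormedAddCommGroup F] [NormedSpace ℝ F]
  [NormedAddCommGroup G] [NormedSpace ℝ G] [CompleteSpace G]

/-- A series of continuous functions converging absolutely in `L¹_loc`. -/
def LocSummable (u : ι → Euc n → E) : Prop :=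
  (∀ i, Continuous (u i)) ∧ ∀ R : ℝ, Summable fun i => ∫ x in closedBall 0 R, ‖u i x‖

lemma LocSummable.integrableOn {u : ι → Euc n → E} (hu : LocSummable u) (i : ι) (R : ℝ) :
    IntegrableOn (u i) (closedBall 0 R) volume :=
  (hu.1 i).continuousOn.integrableOn_compact (isCompact_closedBall 0 R)

lemma LocSummable.tsum_lintegral_ne_top {u : ι → Euc n → E} (hu : LocSummable u) (R : ℝ) :
    ∑' i, ∫⁻ x in closedBall 0 R, ‖u i x‖ₑ ≠ ⊤ := by
  have : ∀ i, ∫⁻ x in closedBall 0 R, ‖u i x‖ₑ =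
      ENNReal.ofReal (∫ x in closedBall 0 R, ‖u i x‖) := fun i =>
    (ofReal_integral_norm_eq_lintegral_enorm (hu.integrableOn i R)).symm
  simp only [this]
  exact (hu.2 R).tsum_ofReal_ne_top

variable [Countable ι]

lemma LocSummable.lintegral_tsum_ne_top {u : ι → Euc n → E} (hu : LocSummable u) (R : ℝ) :
    ∫⁻ x in closedBall 0 R, ∑' i, ‖u i x‖ₑ ≠ ⊤ := by
  rw [lintegral_tsum fun i => (hu.1 i).enorm.measurable.aemeasurable]
  exact hu.tsum_lintegral_ne_top R

lemma LocSummable.ae_summable {u : ι → Euc n → E} (hu : LocSummable u) :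
    ∀ᵐ x ∂(volume : Measure (Euc n)), Summable fun i => u i x := by
  have h : ∀ N : ℕ, ∀ᵐ x ∂(volume : Measure (Euc n)), x ∈ closedBall (0 : Euc n) N →
      Summable fun i => u i x := by
    intro N
    rw [← ae_restrict_iff' measurableSet_closedBall]
    filter_upwards [ae_lt_top' (AEMeasurable.tsum fun i =>
      (hu.1 i).enorm.measurable.aemeasurable) (hu.lintegral_tsum_ne_top N)] with x hx
    have h2 : Summable fun i => ‖u i x‖₊ := by
      rw [← ENNReal.tsum_coe_ne_top_iff_summable]; exact hx.ne
    exact Summable.of_norm (NNReal.summable_coe.2 h2)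
  filter_upwards [ae_all_iff.2 h] with x hx
  obtain ⟨N, hN⟩ := exists_nat_ge ‖x‖
  exact hx N (by simpa using hN)

lemma LocSummable.locallyIntegrable {u : ι → Euc n → E} (hu : LocSummable u) :
    LocallyIntegrable (fun x => ∑' i, u i x) volume := by
  have hm : AEStronglyMeasurable (fun x => ∑' i, u i x) volume := by
    refine aestronglyMeasurable_of_tendsto_ae (atTop : Filter (Finset ι))
      (f := fun s x => ∑ i ∈ s, u i x)
      (fun s => (continuous_finsetSum s fun i _ => hu.1 i).aestronglyMeasurable) ?_
    filter_upwards [hu.ae_summable] with x hx using hx.hasSum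
  intro x
  obtain ⟨R, hR⟩ := exists_subset_closedBall_zero x 1
  refine ⟨ball x 1, ball_mem_nhds x one_pos, IntegrableOn.mono_set ⟨hm.restrict, ?_⟩ hR⟩
  exact (lintegral_mono fun x => enorm_tsum_le_tsum_enorm).trans_lt
    (hu.lintegral_tsum_ne_top R).lt_top

omit [Countable ι] in
lemma LocSummable.integrable_test {u : ι → Euc n → E} (hu : LocSummable u)
    (B : E →L[ℝ] F →L[ℝ] G) {φ : Euc n → F} (hφ : IsTestFun n φ) (i : ι) :
    Integrable (fun x => B (u i x) (φ x)) volume := by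
  refine Continuous.integrable_of_hasCompactSupport ?_ ?_
  · exact B.isBoundedBilinearMap.continuous.comp ((hu.1 i).prodMk hφ.1.continuous)
  · refine hφ.2.mono fun x hx => ?_
    contrapose! hx
    simp only [Function.mem_support, not_not] at hx ⊢
    rw [hx, map_zero]

lemma LocSummable.hasSum_integral {u : ι → Euc n → E} (hu : LocSummable u)
    (B : E →L[ℝ] F →L[ℝ] G) {φ : Euc n → F} (hφ : IsTestFun n φ) :
    HasSum (fun i => ∫ x, B (u i x) (φ x)) (∫ x, B (∑' i, u i x) (φ x)) := by
  obtain ⟨R, hR⟩ := hφ.2.isCompact.isBounded.subset_closedBall (0 : Euc n)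
  obtain ⟨C, hC0, hC⟩ := hφ.exists_bound 0
  have hC' : ∀ x, ‖φ x‖ ≤ C := fun x => by simpa using hC x
  have hout : ∀ x ∉ closedBall (0 : Euc n) R, φ x = 0 := fun x hx =>
    image_eq_zero_of_notMem_tsupport fun h => hx (hR h)
  have hle : ∀ i, ∫ x, ‖B (u i x) (φ x)‖ ≤ ‖B‖ * C * ∫ x in closedBall 0 R, ‖u i x‖ := by
    intro i
    rw [← setIntegral_eq_integral_of_forall_compl_eq_zero (s := closedBall 0 R)
      fun x hx => by rw [hout x hx, map_zero, norm_zero], ← integral_const_mul]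
    refine integral_mono (hu.integrable_test B hφ i).norm.integrableOn
      ((hu.integrableOn i R).norm.const_mul _) fun x => ?_
    calc ‖B (u i x) (φ x)‖ ≤ ‖B‖ * ‖u i x‖ * ‖φ x‖ := B.le_opNorm₂ _ _
      _ ≤ ‖B‖ * ‖u i x‖ * C := by gcongr; exact hC' x
      _ = _ := by ring
  have h := hasSum_integral_of_summable_integral_norm (fun i => hu.integrable_test B hφ i)
    (Summable.of_nonneg_of_le (fun i => integral_nonneg fun x => norm_nonneg _) hle
      ((hu.2 R).mul_left _))
  have e : ∫ x, ∑' i, B (u i x) (φ x) = ∫ x, B (∑' i, u i x) (φ x) := by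
    refine integral_congr_ae ?_
    filter_upwards [hu.ae_summable] with x hx
    exact (B.flip (φ x)).map_tsum hx |>.symm
  rwa [e] at h

omit [CompleteSpace E] [Countable ι] in
lemma locSummable_of_bound {u : ι → Euc n → E} (hc : ∀ i, Continuous (u i)) {c : ι → ℝ}
    (hs : Summable c) (hb : ∀ i x, ‖u i x‖ ≤ c i) : LocSummable u := by
  refine ⟨hc, fun R => Summable.of_nonneg_of_le (fun i => integral_nonneg fun x => norm_nonneg _)
    (fun i => ?_) (hs.mul_right (volume.real (closedBall (0 : Euc n) R)))⟩
  have := norm_setIntegral_le_of_norm_le_const (μ := (volume : Measure (Euc n)))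
    (s := closedBall 0 R) (f := fun x => ‖u i x‖) (C := c i)
    measure_closedBall_lt_top (fun x _ => by rw [norm_norm]; exact hb i x)
  exact (le_abs_self _).trans this

omit [CompleteSpace E] [Countable ι] in
lemma locSummable_of_integral {u : ι → Euc n → E} (hc : ∀ i, Continuous (u i))
    (hi : ∀ i, Integrable (u i) volume) (hs : Summable fun i => ∫ x, ‖u i x‖) :
    LocSummable u :=
  ⟨hc, fun _ => Summable.of_nonneg_of_le (fun _ => integral_nonneg fun _ => norm_nonneg _)
    (fun i => setIntegral_le_integral (hi i).norm (ae_of_all _ fun _ => norm_nonneg _)) hs⟩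

/-- Weak differentiation of a locally summable series of smooth functions. -/
lemma LocSummable.integral_dirDeriv {u : ι → Euc n → E} (hu : LocSummable u)
    (hs : ∀ i, ContDiff ℝ (⊤ : ℕ∞) (u i)) {J : Fin m → Fin n}
    (hd : LocSummable fun i => dirDeriv n m J (u i)) {φ : Euc n → ℝ} (hφ : IsTestFun n φ) :
    ∫ x, dirDeriv n m J φ x • ∑' i, u i x =
      (-1 : ℝ) ^ m • ∫ x, φ x • ∑' i, dirDeriv n m J (u i) x := by
  have h1 := hu.hasSum_integral ((ContinuousLinearMap.lsmul ℝ ℝ).flip : E →L[ℝ] ℝ →L[ℝ] E)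
    (hφ.dirDeriv J)
  have h2 := hd.hasSum_integral ((ContinuousLinearMap.lsmul ℝ ℝ).flip : E →L[ℝ] ℝ →L[ℝ] E) hφ
  have h3 : ∀ i, _ = _ := fun i => integral_dirDeriv_right
    ((ContinuousLinearMap.lsmul ℝ ℝ).flip : E →L[ℝ] ℝ →L[ℝ] E) (hs i) hφ.1 (Or.inr hφ.2) J
  simp only [h3] at h1
  exact h1.unique (h2.const_smul _)

end Series

section SeriesDistrib

variable {n k : ℕ} {ι : Type*} [Countable ι] {V W : Type*}
  [NormedAddCommGroup V] [InnerProductSpace ℝ V] [FiniteDimensional ℝ V]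
  [NormedAddCommGroup W] [InnerProductSpace ℝ W] [FiniteDimensional ℝ W]

lemma LocSummable.hasSum_distrib (A : CoeffOp n k V W) {u : ι → Euc n → V} (hu : LocSummable u)
    (hs : ∀ i, ContDiff ℝ (⊤ : ℕ∞) (u i)) {φ : Euc n → W} (hφ : IsTestFun n φ) :
    HasSum (fun i => ∫ x, ⟪Aapply n k A (u i) x, φ x⟫)
      ((-1 : ℝ) ^ k * ∑ I : Fin k → Fin n,
        ∫ x, ⟪∑' i, u i x, LinearMap.adjoint (A I) (dirDeriv n k I φ x)⟫) := by
  have ht : ∀ I : Fin k → Fin n,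
      IsTestFun n (fun x => LinearMap.adjoint (A I) (dirDeriv n k I φ x)) := fun I =>
    (hφ.dirDeriv I).clm (LinearMap.toContinuousLinearMap (LinearMap.adjoint (A I)))
  have h := (hasSum_sum fun I (_ : I ∈ Finset.univ) =>
    hu.hasSum_integral (innerB V) (ht I)).mul_left ((-1 : ℝ) ^ k)
  have e : ∀ i, ∫ x, ⟪Aapply n k A (u i) x, φ x⟫ = _ := fun i =>
    (hasDistribA_smooth A (hs i) φ hφ).symm
  simp only [e]
  exact h

end SeriesDistrib

section LocalBound

variable {n m : ℕ} {F : Type*} [NormedAddCommGroup F] [NormedSpace ℝ F]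

lemma IsWeakDerivFamily.ae_eq {V : Type*} [NormedAddCommGroup V] [InnerProductSpace ℝ V]
    [FiniteDimensional ℝ V] {u : Euc n → V} {v : (Fin m → Fin n) → Euc n → V}
    (h : IsWeakDerivFamily n m u v) {J : Fin m → Fin n} {g : Euc n → V}
    (hg : LocallyIntegrable g volume)
    (hug : ∀ φ : Euc n → ℝ, IsTestFun n φ →
      ∫ x, dirDeriv n m J φ x • u x = ((-1 : ℝ) ^ m) • ∫ x, φ x • g x) :
    v J =ᵐ[volume] g := by
  refine ae_eq_of_integral_contDiff_smul_eq (h.1 J) hg fun φ hφ hc => ?_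
  have := (h.2 J φ ⟨hφ, hc⟩).symm.trans (hug φ ⟨hφ, hc⟩)
  exact smul_right_injective V (pow_ne_zero m (by norm_num : (-1 : ℝ) ≠ 0)) this

/-- Order-`n` approximability in `L^∞` at `x` implies a pointwise Lipschitz bound at `x`. -/
lemma MemTInf.exists_bound (hn : 1 ≤ n) {f : Euc n → F} {x : Euc n} (h : MemTInf n n f x) :
    ∃ (c : F) (C r₀ : ℝ), 0 < r₀ ∧ ∀ r, 0 < r → r < r₀ →
      ∀ᵐ y ∂(volume : Measure (Euc n)).restrict (ball x r), ‖f y - c‖ ≤ C * r := by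
  obtain ⟨P, hP, hS⟩ := h
  obtain ⟨K, t, ht, hK⟩ := (hP.1.contDiffAt (x := x)).of_le (m := 1)
    (by exact_mod_cast le_top) |>.exists_lipschitzOnWith
  obtain ⟨r₁, hr₁, hrt⟩ := Metric.mem_nhds_iff.1 ht
  have h1 : ∀ᶠ r : ℝ in 𝓝[>] 0, essSup (fun y => (‖f y - P y‖₊ : ℝ≥0∞))
      (volume.restrict (ball x r)) / ENNReal.ofReal (r ^ (n : ℝ)) < 1 :=
    hS.eventually_lt_const zero_lt_one
  obtain ⟨r₂, hr₂, h2⟩ := mem_nhdsGT_iff_exists_Ioo_subset.1 h1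
  refine ⟨P x, 1 + K, min (min r₁ r₂) 1, lt_min (lt_min hr₁ hr₂) one_pos, fun r hr hr' => ?_⟩
  have ha : r < r₁ := hr'.trans_le ((min_le_left _ _).trans (min_le_left _ _))
  have hb : r < r₂ := hr'.trans_le ((min_le_left _ _).trans (min_le_right _ _))
  have h3 := h2 ⟨hr, hb⟩
  have hrn : 0 < r ^ (n : ℝ) := Real.rpow_pos_of_pos hr _
  have hrr : r ^ (n : ℝ) ≤ r := by
    calc r ^ (n : ℝ) ≤ r ^ (1 : ℝ) := Real.rpow_le_rpow_of_exponent_ge hr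
          (hr'.le.trans (min_le_right _ _)) (by exact_mod_cast hn)
      _ = r := Real.rpow_one r
  have h4 : essSup (fun y => (‖f y - P y‖₊ : ℝ≥0∞)) (volume.restrict (ball x r)) ≤
      ENNReal.ofReal r := by
    have : essSup (fun y => (‖f y - P y‖₊ : ℝ≥0∞)) (volume.restrict (ball x r)) <
        1 * ENNReal.ofReal (r ^ (n : ℝ)) :=
      (ENNReal.div_lt_iff (Or.inl (ENNReal.ofReal_pos.2 hrn).ne')
        (Or.inl ENNReal.ofReal_ne_top)).1 h3
    rw [one_mul] at this
    exact this.le.trans (ENNReal.ofReal_le_ofReal hrr)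
  filter_upwards [ENNReal.ae_le_essSup (μ := volume.restrict (ball x r))
    (fun y => (‖f y - P y‖₊ : ℝ≥0∞)), ae_restrict_mem measurableSet_ball] with y hy hyb
  have h5 : ‖f y - P y‖ ≤ r := by
    have := hy.trans h4
    rw [ENNReal.ofReal, ENNReal.coe_le_coe] at this
    have h6 := NNReal.coe_le_coe.2 this
    rwa [coe_nnnorm, Real.coe_toNNReal _ hr.le] at h6
  have h7 : ‖P y - P x‖ ≤ K * r := by
    have h8 := hK.dist_le_mul y (hrt (ball_subset_ball ha.le hyb)) x (hrt (mem_ball_self hr₁))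
    rw [dist_eq_norm] at h8
    exact h8.trans (by gcongr; exact (mem_ball.1 hyb).le)
  calc ‖f y - P x‖ = ‖(f y - P y) + (P y - P x)‖ := by congr 1; abel
    _ ≤ ‖f y - P y‖ + ‖P y - P x‖ := norm_add_le _ _
    _ ≤ (1 + K) * r := by linarith

lemma Continuous.forall_mem_of_ae_restrict {g : Euc n → F} (hg : Continuous g) {U : Set (Euc n)}
    (hU : IsOpen U) {c : F} {C : ℝ}
    (h : ∀ᵐ y ∂(volume : Measure (Euc n)).restrict U, ‖g y - c‖ ≤ C) :
    ∀ y ∈ U, ‖g y - c‖ ≤ C := by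
  rw [ae_restrict_iff' hU.measurableSet] at h
  have ho : IsOpen (U ∩ {y | C < ‖g y - c‖}) :=
    hU.inter (isOpen_lt continuous_const (by fun_prop))
  have h0 : volume (U ∩ {y | C < ‖g y - c‖}) = 0 := by
    refine measure_mono_null ?_ (ae_iff.1 h)
    rintro y ⟨hy, hy'⟩
    simpa [hy] using hy'
  have he := ho.eq_empty_of_measure_zero h0
  intro y hy
  by_contra hlt
  exact Set.notMem_empty y (he ▸ ⟨hy, not_le.1 hlt⟩)

end LocalBound

section Weierstrass

/-- A Weierstrass function, nowhere pointwise Lipschitz. -/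
noncomputable def weier (s : ℝ) : ℝ := ∑' j : ℕ, (1 / 2 : ℝ) ^ j * Real.cos (16 ^ j * s)

lemma norm_weier_term_le (s : ℝ) (j : ℕ) :
    ‖(1 / 2 : ℝ) ^ j * Real.cos (16 ^ j * s)‖ ≤ (1 / 2) ^ j := by
  rw [norm_mul, Real.norm_of_nonneg (by positivity)]
  exact mul_le_of_le_one_right (by positivity) (Real.abs_cos_le_one _)

lemma summable_half_pow : Summable fun j : ℕ => (1 / 2 : ℝ) ^ j :=
  summable_geometric_of_lt_one (by norm_num) (by norm_num)

lemma summable_weier (s : ℝ) : Summable fun j : ℕ => (1 / 2 : ℝ) ^ j * Real.cos (16 ^ j * s) :=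
  Summable.of_norm_bounded summable_half_pow (norm_weier_term_le s)

lemma continuous_weier : Continuous weier :=
  continuous_tsum (fun j => by fun_prop) summable_half_pow fun j s => norm_weier_term_le s j

lemma exists_weier_osc (s : ℝ) (j : ℕ) : ∃ a b : ℝ, |a - s| ≤ Real.pi / 16 ^ j ∧
    |b - s| ≤ Real.pi / 16 ^ j ∧ (1 / 2 : ℝ) ^ j ≤ |weier a - weier b| := by
  have hpi := Real.pi_pos
  have h16 : (0 : ℝ) < 16 ^ j := by positivity
  set p : ℤ := ⌊16 ^ j * s / Real.pi⌋ with hp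
  have hp1 : (p : ℝ) * Real.pi ≤ 16 ^ j * s := by
    rw [← le_div_iff₀ hpi]; exact Int.floor_le _
  have hp2 : 16 ^ j * s ≤ (p + 1) * Real.pi := by
    rw [← div_le_iff₀ hpi]; exact (Int.lt_floor_add_one _).le
  set a : ℝ := p * Real.pi / 16 ^ j with ha
  set b : ℝ := (p + 1) * Real.pi / 16 ^ j with hb
  have hab : a - b = -(Real.pi / 16 ^ j) := by rw [ha, hb]; ring
  have has : a ≤ s := by rw [ha, div_le_iff₀ h16]; linarith
  have hsb : s ≤ b := by rw [hb, le_div_iff₀ h16]; linarith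
  refine ⟨a, b, by rw [abs_le]; constructor <;> linarith,
    by rw [abs_le]; constructor <;> linarith, ?_⟩
  have ha' : 16 ^ j * a = p * Real.pi := by rw [ha]; field_simp
  have hb' : 16 ^ j * b = (p + 1 : ℤ) * Real.pi := by rw [hb]; push_cast; field_simp
  set d : ℕ → ℝ := fun i => (1 / 2 : ℝ) ^ i * Real.cos (16 ^ i * a) -
    (1 / 2 : ℝ) ^ i * Real.cos (16 ^ i * b) with hd
  have hsum : weier a - weier b = ∑' i, d i :=
    ((summable_weier a).tsum_sub (summable_weier b)).symm
  have htail : ∀ i ∉ Finset.range (j + 1), d i = 0 := by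
    intro i hi
    obtain ⟨l, rfl⟩ : ∃ l, i = j + 1 + l := Nat.exists_eq_add_of_le (by simpa using hi)
    have key : ∀ q : ℤ, ∀ c : ℝ, 16 ^ j * c = q * Real.pi →
        Real.cos (16 ^ (j + 1 + l) * c) = 1 := by
      intro q c hc
      have : (16 : ℝ) ^ (j + 1 + l) * c = ((q * 8 * 16 ^ l : ℤ) : ℝ) * (2 * Real.pi) := by
        rw [show (16 : ℝ) ^ (j + 1 + l) * c = 16 ^ (l + 1) * (16 ^ j * c) by ring, hc]
        push_cast; ring
      rw [this, Real.cos_int_mul_two_pi]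
    simp only [hd, key p a ha', key (p + 1) b hb', sub_self]
  have hdj : |d j| = 2 * (1 / 2) ^ j := by
    have : d j = 2 * (1 / 2) ^ j * (-1) ^ p := by
      simp only [hd]
      rw [ha', hb', Real.cos_int_mul_pi, Real.cos_int_mul_pi, zpow_add₀ (by norm_num)]
      simp only [zpow_one]; ring
    rw [this, abs_mul, abs_zpow, abs_neg, abs_one, one_zpow, mul_one, abs_of_pos (by positivity)]
  have hlow : ∀ i, |d i| ≤ 8 ^ i * (Real.pi / 16 ^ j) := by
    intro i
    have h1 := Real.abs_cos_sub_cos_le (16 ^ i * a) (16 ^ i * b)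
    have h2 : |(16 : ℝ) ^ i * a - 16 ^ i * b| = 16 ^ i * (Real.pi / 16 ^ j) := by
      rw [← mul_sub, hab, abs_mul, abs_neg, abs_of_pos (by positivity), abs_of_pos (by positivity)]
    calc |d i| = (1 / 2) ^ i * |Real.cos (16 ^ i * a) - Real.cos (16 ^ i * b)| := by
          simp only [hd]
          rw [← mul_sub, abs_mul, abs_of_pos (by positivity)]
      _ ≤ (1 / 2) ^ i * (16 ^ i * (Real.pi / 16 ^ j)) := by gcongr; rwa [h2] at h1
      _ = ((1 / 2) ^ i * 16 ^ i) * (Real.pi / 16 ^ j) := by ring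
      _ = 8 ^ i * (Real.pi / 16 ^ j) := by rw [← mul_pow]; norm_num
  have hhead : |∑ i ∈ Finset.range j, d i| ≤ (1 / 2) ^ j := by
    have hg : (∑ i ∈ Finset.range j, (8 : ℝ) ^ i) ≤ 8 ^ j / 7 := by
      rw [geom_sum_eq (by norm_num)]
      norm_num
      gcongr
      linarith
    calc |∑ i ∈ Finset.range j, d i| ≤ ∑ i ∈ Finset.range j, |d i| := Finset.abs_sum_le_sum_abs _ _
      _ ≤ ∑ i ∈ Finset.range j, 8 ^ i * (Real.pi / 16 ^ j) := Finset.sum_le_sum fun i _ => hlow i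
      _ = (∑ i ∈ Finset.range j, (8 : ℝ) ^ i) * (Real.pi / 16 ^ j) := by rw [Finset.sum_mul]
      _ ≤ (8 ^ j / 7) * (7 / 16 ^ j) := by
          gcongr
          linarith [Real.pi_lt_four]
      _ = (8 / 16) ^ j := by rw [div_pow]; field_simp
      _ = (1 / 2) ^ j := by norm_num
  rw [hsum, tsum_eq_sum htail, Finset.sum_range_succ]
  have h3 := abs_sub_abs_le_abs_sub (d j) (-∑ i ∈ Finset.range j, d i)
  rw [abs_neg, sub_neg_eq_add, add_comm (d j)] at h3
  linarith

end Weierstrass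

section PlaneWave

variable {n k m : ℕ} {V W : Type*}
  [NormedAddCommGroup V] [InnerProductSpace ℝ V] [FiniteDimensional ℝ V]
  [NormedAddCommGroup W] [InnerProductSpace ℝ W] [FiniteDimensional ℝ W]

lemma not_memTInf_weier (hn : 1 ≤ n) {ξ : Euc n} (hξ : ξ ≠ 0) {e : V} (he : e ≠ 0)
    {f : Euc n → V} (hf : f =ᵐ[volume] fun x => weier ⟪x, ξ⟫ • e) (x : Euc n) :
    ¬ MemTInf n n f x := by
  intro h
  obtain ⟨c, C, r₀, hr₀, hb⟩ := h.exists_bound hn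
  have hξ' : 0 < ‖ξ‖ := norm_pos_iff.2 hξ
  have he' : 0 < ‖e‖ := norm_pos_iff.2 he
  have hcont : Continuous fun x : Euc n => weier ⟪x, ξ⟫ • e :=
    (continuous_weier.comp (by fun_prop)).smul continuous_const
  have hball : ∀ r, 0 < r → r < r₀ → ∀ y ∈ ball x r, ‖weier ⟪y, ξ⟫ • e - c‖ ≤ C * r := by
    intro r hr hr'
    refine hcont.forall_mem_of_ae_restrict isOpen_ball ?_
    filter_upwards [hb r hr hr', ae_restrict_of_ae hf] with y hy hy'
    rwa [← hy']
  obtain ⟨j, hj⟩ := pow_unbounded_of_one_lt (max (4 / (r₀ * ‖ξ‖)) (8 * C / (‖ξ‖ * ‖e‖)))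
    (by norm_num : (1 : ℝ) < 8)
  have h16 : (0 : ℝ) < 16 ^ j := by positivity
  have h8 : (8 : ℝ) ^ j ≤ 16 ^ j := by gcongr; norm_num
  set r : ℝ := 4 / (16 ^ j * ‖ξ‖) with hr
  have hr0 : 0 < r := by positivity
  have hrr : r < r₀ := by
    have h1 := (le_max_left _ _).trans_lt (hj.trans_le h8)
    rw [div_lt_iff₀ (by positivity)] at h1
    rw [hr, div_lt_iff₀ (by positivity)]
    linarith
  obtain ⟨a, b, ha, hb', hab⟩ := exists_weier_osc ⟪x, ξ⟫ j
  have hpt : ∀ t : ℝ, |t - ⟪x, ξ⟫| ≤ Real.pi / 16 ^ j → ‖weier t • e - c‖ ≤ C * r := by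
    intro t ht
    have h1 : ⟪x + ((t - ⟪x, ξ⟫) / ‖ξ‖ ^ 2) • ξ, ξ⟫ = t := by
      rw [inner_add_left, real_inner_smul_left, real_inner_self_eq_norm_sq]
      field_simp; ring
    have h2 := hball r hr0 hrr (x + ((t - ⟪x, ξ⟫) / ‖ξ‖ ^ 2) • ξ) (by
      rw [mem_ball, dist_eq_norm, add_sub_cancel_left, norm_smul, Real.norm_eq_abs, abs_div,
        abs_of_pos (by positivity : (0 : ℝ) < ‖ξ‖ ^ 2)]
      calc |t - ⟪x, ξ⟫| / ‖ξ‖ ^ 2 * ‖ξ‖ = |t - ⟪x, ξ⟫| / ‖ξ‖ := by field_simp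
        _ ≤ (Real.pi / 16 ^ j) / ‖ξ‖ := by gcongr
        _ = Real.pi / (16 ^ j * ‖ξ‖) := by rw [div_div]
        _ < r := by rw [hr]; gcongr; exact Real.pi_lt_four)
    rwa [h1] at h2
  have h3 : |weier a - weier b| * ‖e‖ ≤ 2 * (C * r) := by
    calc |weier a - weier b| * ‖e‖ = ‖(weier a • e - c) - (weier b • e - c)‖ := by
          rw [sub_sub_sub_cancel_right, ← sub_smul, norm_smul, Real.norm_eq_abs]
      _ ≤ ‖weier a • e - c‖ + ‖weier b • e - c‖ := norm_sub_le _ _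
      _ ≤ 2 * (C * r) := by linarith [hpt a ha, hpt b hb']
  have h4 : (1 / 2 : ℝ) ^ j * ‖e‖ ≤ 2 * (C * r) := (by gcongr : _ ≤ _).trans h3
  have h5 := (le_max_right _ _).trans_lt hj
  rw [div_lt_iff₀ (by positivity)] at h5
  have h6 : (1 / 2 : ℝ) ^ j * 16 ^ j = 8 ^ j := by rw [← mul_pow]; norm_num
  have h7 : 2 * (C * r) * (16 ^ j * ‖ξ‖) = 8 * C := by rw [hr]; field_simp; ring
  have h8 : (1 / 2 : ℝ) ^ j * ‖e‖ * (16 ^ j * ‖ξ‖) ≤ 8 * C := by rw [← h7]; gcongr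
  have h9 : (1 / 2 : ℝ) ^ j * ‖e‖ * (16 ^ j * ‖ξ‖) = 8 ^ j * (‖ξ‖ * ‖e‖) := by
    rw [← h6]; ring
  linarith

lemma smooth_cos_inner (a β : ℝ) (ξ : Euc n) :
    ContDiff ℝ (⊤ : ℕ∞) fun x : Euc n => Real.cos (a * ⟪x, ξ⟫ + β) :=
  Real.contDiff_cos.comp
    ((contDiff_const.mul (contDiff_id.inner ℝ contDiff_const)).add contDiff_const)

lemma smooth_cos_inner_smul (a β : ℝ) (ξ : Euc n) (v : V) :
    ContDiff ℝ (⊤ : ℕ∞) fun x : Euc n => Real.cos (a * ⟪x, ξ⟫ + β) • v :=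
  (smooth_cos_inner a β ξ).smul contDiff_const

lemma dirDeriv_cos_inner (a β : ℝ) (ξ : Euc n) (J : Fin m → Fin n) (x : Euc n) :
    dirDeriv n m J (fun x => Real.cos (a * ⟪x, ξ⟫ + β)) x =
      a ^ m * (∏ i, ξ (J i)) * Real.cos (a * ⟪x, ξ⟫ + β + m * (Real.pi / 2)) := by
  induction m generalizing x with
  | zero => simp [dirDeriv_zero]
  | succ m ih =>
    rw [dirDeriv_succ (smooth_cos_inner a β ξ), funext (ih (Fin.tail J))]
    have h1 : HasFDerivAt (fun y : Euc n => a * ⟪y, ξ⟫ + β + m * (Real.pi / 2))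
        (a • innerSL ℝ ξ) x := by
      have := ((innerSL ℝ ξ).hasFDerivAt (x := x)).const_smul a
      refine ((this.add_const β).add_const (m * (Real.pi / 2))).congr_of_eventuallyEq
        (Eventually.of_forall fun y => ?_)
      simp [real_inner_comm]
    have h2 := (h1.cos.const_mul (a ^ m * ∏ i, ξ (Fin.tail J i))).fderiv
    rw [h2]
    have h3 : Real.cos (a * ⟪x, ξ⟫ + β + (m + 1 : ℕ) * (Real.pi / 2)) =
        -Real.sin (a * ⟪x, ξ⟫ + β + m * (Real.pi / 2)) := by
      rw [← Real.cos_add_pi_div_two]; congr 1; push_cast; ring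
    rw [h3, Fin.prod_univ_succ]
    simp [inner_stdVec, Fin.tail]
    ring

lemma Aapply_cos_inner (A : CoeffOp n k V W) (a β c : ℝ) (ξ : Euc n) (v : V) (x : Euc n) :
    Aapply n k A (fun x => c • Real.cos (a * ⟪x, ξ⟫ + β) • v) x =
      (c * (a ^ k * Real.cos (a * ⟪x, ξ⟫ + β + k * (Real.pi / 2)))) • symbolMap n k A ξ v := by
  unfold Aapply symbolMap
  rw [LinearMap.sum_apply, Finset.smul_sum]
  refine Finset.sum_congr rfl fun I _ => ?_
  rw [dirDeriv_const_smul c (smooth_cos_inner_smul a β ξ v),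
    dirDeriv_smul_const v (smooth_cos_inner a β ξ), dirDeriv_cos_inner]
  simp only [map_smul, LinearMap.smul_apply, smul_smul]
  congr 1; ring

/-- Plane waves along a characteristic direction give `𝒜`-free maps with rough derivatives. -/
lemma isElliptic_of_forall_memTInf (hn : 1 ≤ n) (A : CoeffOp n k V W)
    (h : ∀ u : Euc n → V, MemBVAloc n k A u → ∃ v, IsWeakDerivFamily n m u v ∧
      ∀ᵐ x ∂(volume : Measure (Euc n)), ∀ I, MemTInf n n (v I) x) : IsElliptic n k A := by
  by_contra hE
  unfold IsElliptic at hE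
  push Not at hE
  obtain ⟨ξ, hξ, hinj⟩ := hE
  obtain ⟨e, hse, he⟩ : ∃ e, symbolMap n k A ξ e = 0 ∧ e ≠ 0 := by
    rw [injective_iff_map_eq_zero] at hinj
    push Not at hinj
    exact hinj
  obtain ⟨i₀, hi₀⟩ : ∃ i, ξ i ≠ 0 := by
    by_contra hc
    push Not at hc
    exact hξ (by ext i; simpa using hc i)
  set β : ℝ := -(m * (Real.pi / 2)) with hβ
  set c : ℕ → ℝ := fun j => (1 / 2) ^ j * ((16 ^ j) ^ m)⁻¹ with hc
  set u : ℕ → Euc n → V := fun j x => c j • Real.cos (16 ^ j * ⟪x, ξ⟫ + β) • e with hu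
  set J : Fin m → Fin n := fun _ => i₀ with hJ
  set p : ℝ := ∏ i, ξ (J i) with hp
  have hp0 : p ≠ 0 := Finset.prod_ne_zero_iff.2 fun _ _ => hi₀
  have hs : ∀ j, ContDiff ℝ (⊤ : ℕ∞) (u j) := fun j =>
    (smooth_cos_inner_smul _ β ξ e).const_smul (c j)
  have hd : ∀ j x, dirDeriv n m J (u j) x =
      ((1 / 2 : ℝ) ^ j * Real.cos (16 ^ j * ⟪x, ξ⟫)) • p • e := by
    intro j x
    simp only [hu]
    rw [dirDeriv_const_smul (c j) (smooth_cos_inner_smul _ β ξ e),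
      dirDeriv_smul_const e (smooth_cos_inner _ β ξ), dirDeriv_cos_inner]
    simp only [smul_smul, hβ, neg_add_cancel_right, hc]
    congr 1
    have : (16 : ℝ) ^ j ≠ 0 := by positivity
    field_simp
    exact mul_comm _ _
  have hsu : LocSummable u := by
    refine locSummable_of_bound (fun j => (hs j).continuous)
      (c := fun j => (1 / 2) ^ j * ‖e‖) (summable_half_pow.mul_right _) fun j x => ?_
    simp only [hu, norm_smul, Real.norm_eq_abs]
    have h1 : |c j| ≤ (1 / 2) ^ j := by
      rw [abs_of_nonneg (by simp only [hc]; positivity)]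
      refine mul_le_of_le_one_right (by positivity) (inv_le_one_of_one_le₀ ?_)
      exact one_le_pow₀ (one_le_pow₀ (by norm_num))
    calc |c j| * (|Real.cos (16 ^ j * ⟪x, ξ⟫ + β)| * ‖e‖) ≤ (1 / 2) ^ j * (1 * ‖e‖) := by
          gcongr; exact Real.abs_cos_le_one _
      _ = _ := by rw [one_mul]
  have hsd : LocSummable fun j => dirDeriv n m J (u j) := by
    refine locSummable_of_bound (fun j => (smooth_dirDeriv (hs j) J).continuous)
      (c := fun j => (1 / 2) ^ j * ‖p • e‖) (summable_half_pow.mul_right _) fun j x => ?_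
    rw [hd, norm_smul]
    gcongr
    exact norm_weier_term_le _ j
  have hsum : ∀ x, ∑' j, dirDeriv n m J (u j) x = weier ⟪x, ξ⟫ • p • e := by
    intro x
    simp only [hd]
    exact (summable_weier _).tsum_smul_const _
  have hBV : MemBVAloc n k A (fun x => ∑' j, u j x) := by
    refine ⟨hsu.locallyIntegrable, 0, 0, inferInstance, locallyIntegrable_zero, by simp, ?_⟩
    intro φ hφ
    have h1 := hsu.hasSum_distrib A hs hφ
    have h2 : ∀ j x, Aapply n k A (u j) x = 0 := fun j x => by
      simp only [hu]; rw [Aapply_cos_inner, hse, smul_zero]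
    simp only [h2, inner_zero_left, integral_zero] at h1
    exact (h1.unique hasSum_zero).trans (by simp)
  obtain ⟨v, hv, hT⟩ := h _ hBV
  have hae := hv.ae_eq (J := J) hsd.locallyIntegrable fun φ hφ => hsu.integral_dirDeriv hs hsd hφ
  simp only [hsum] at hae
  obtain ⟨x, hx⟩ := hT.exists
  exact not_memTInf_weier hn hξ (smul_ne_zero hp0 he) hae x (hx J)

lemma locallyIntegrable_of_bounded {F : Type*} [NormedAddCommGroup F] {σ : Measure (Euc n)}
    [IsLocallyFiniteMeasure σ] {f : Euc n → F} (hf : AEStronglyMeasurable f σ) {M : ℝ}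
    (hM : ∀ x, ‖f x‖ ≤ M) : LocallyIntegrable f σ := by
  intro x
  obtain ⟨U, hU, hfin⟩ := σ.finiteAt_nhds x
  exact ⟨U, hU, IntegrableOn.of_bound hfin hf.restrict M (ae_of_all _ hM)⟩

/-- Polar normalisation of a bounded density. -/
lemma MemBVAloc.of_bounded_density {A : CoeffOp n k V W} {u : Euc n → V}
    (hu : LocallyIntegrable u volume) {σ : Measure (Euc n)} [IsLocallyFiniteMeasure σ]
    {f : Euc n → W} (hf : StronglyMeasurable f) {M : ℝ} (hM : ∀ x, ‖f x‖ ≤ M)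
    (h : HasDistribA n k A u σ f) : MemBVAloc n k A u := by
  have hm : Measurable fun x => ‖f x‖₊ := hf.nnnorm.measurable
  have hlf : IsLocallyFiniteMeasure (σ.withDensity fun x => (‖f x‖₊ : ℝ≥0∞)) := by
    refine ⟨fun x => ?_⟩
    obtain ⟨U, hU, hfin⟩ := σ.finiteAt_nhds x
    obtain ⟨t, htU, hto, hxt⟩ := _root_.mem_nhds_iff.1 hU
    refine ⟨t, hto.mem_nhds hxt, ?_⟩
    rw [withDensity_apply _ hto.measurableSet]
    refine setLIntegral_lt_top_of_le_nnreal ((measure_mono htU).trans_lt hfin).ne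
      ⟨M.toNNReal, fun y _ => ?_⟩
    rw [ENNReal.coe_le_coe, ← NNReal.coe_le_coe, coe_nnnorm]
    exact (hM y).trans (Real.le_coe_toNNReal M)
  have hf' : StronglyMeasurable fun x => ‖f x‖⁻¹ • f x := hf.norm.inv₀.smul hf
  refine ⟨hu, σ.withDensity fun x => (‖f x‖₊ : ℝ≥0∞), fun x => ‖f x‖⁻¹ • f x, hlf,
    locallyIntegrable_of_bounded hf'.aestronglyMeasurable (M := 1) fun x => ?_, ?_, fun φ hφ => ?_⟩
  · rw [norm_smul, norm_inv, norm_norm]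
    exact inv_mul_le_one
  · rw [ae_withDensity_iff hm.coe_nnreal_ennreal]
    refine ae_of_all _ fun x hx => ?_
    have : ‖f x‖ ≠ 0 := by simpa using hx
    rw [norm_smul, norm_inv, norm_norm, inv_mul_cancel₀ this]
  · rw [integral_withDensity_eq_integral_smul hm, h φ hφ]
    refine integral_congr_ae (ae_of_all _ fun x => ?_)
    rcases eq_or_ne (f x) 0 with h0 | h0
    · simp [h0]
    · simp only [NNReal.smul_def, coe_nnnorm, inner_smul_left, smul_eq_mul]
      simp [h0]

variable (d : ℕ → Euc n)

/-- Geometrically weighted point masses at `d q`. -/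
noncomputable def pointMeas : Measure (Euc n) :=
  Measure.sum fun q => ENNReal.ofReal ((1 / 2) ^ q) • Measure.dirac (d q)

instance : IsFiniteMeasure (pointMeas d) := by
  refine ⟨?_⟩
  rw [pointMeas, Measure.sum_apply _ MeasurableSet.univ]
  simp only [Measure.smul_apply, measure_univ, smul_eq_mul, mul_one]
  exact summable_half_pow.tsum_ofReal_lt_top

instance : IsLocallyFiniteMeasure (pointMeas d + volume) := by
  refine ⟨fun x => ⟨ball x 1, ball_mem_nhds x one_pos, ?_⟩⟩
  rw [Measure.add_apply]
  exact ENNReal.add_lt_top.2 ⟨measure_lt_top _ _, measure_ball_lt_top⟩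

/-- Density of `∑ 2^{-q} δ_{d q} - ∑ 2^{-q} ρ(· - d q)` with respect to `pointMeas d + volume`. -/
noncomputable def pointDens (x : Euc n) : ℝ :=
  (Set.range d).indicator (fun _ => 1) x +
    (Set.range d)ᶜ.indicator (fun x => -∑' q : ℕ, (1 / 2 : ℝ) ^ q * rho n (x - d q)) x

variable {d}

lemma exists_rho_bound : ∃ M, 0 ≤ M ∧ ∀ x : Euc n, |rho n x| ≤ M := by
  obtain ⟨C, h0, h⟩ := (isRapid_rho (n := n)).2 0 0
  exact ⟨C, h0, fun x => by simpa using h x⟩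

lemma locSummable_rho : LocSummable fun (q : ℕ) (x : Euc n) => (1 / 2 : ℝ) ^ q * rho n (x - d q) := by
  obtain ⟨M, -, hM⟩ := exists_rho_bound (n := n)
  have hc := (isRapid_rho (n := n)).1.continuous
  refine locSummable_of_bound (fun q => by fun_prop) (summable_half_pow.mul_right M) fun q x => ?_
  rw [norm_mul, Real.norm_of_nonneg (by positivity)]
  gcongr
  exact hM _

lemma exists_pointDens_bound : ∃ M, ∀ x, |pointDens d x| ≤ M := by
  obtain ⟨M, hM0, hM⟩ := exists_rho_bound (n := n)
  have h1 : ∀ x, |∑' q : ℕ, (1 / 2 : ℝ) ^ q * rho n (x - d q)| ≤ 2 * M := fun x => by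
    refine tsum_of_norm_bounded (f := fun q : ℕ => (1 / 2 : ℝ) ^ q * rho n (x - d q))
      (hasSum_geometric_two.mul_right M) fun q => ?_
    · rw [norm_mul, Real.norm_of_nonneg (by positivity)]
      gcongr
      exact hM _
  refine ⟨1 + 2 * M, fun x => ?_⟩
  by_cases hx : x ∈ Set.range d
  · simp [pointDens, hx, -Set.mem_range]; exact hM0
  · simp only [pointDens, Set.indicator_of_notMem hx, Set.indicator_of_mem (Set.mem_compl hx),
      zero_add, abs_neg]
    linarith [h1 x]

lemma measurable_pointDens : Measurable (pointDens d) := by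
  obtain ⟨M, -, hM⟩ := exists_rho_bound (n := n)
  have hr : MeasurableSet (Set.range d) := (Set.countable_range d).measurableSet
  have hc := (isRapid_rho (n := n)).1.continuous
  have hcont : Continuous fun x => ∑' q : ℕ, (1 / 2 : ℝ) ^ q * rho n (x - d q) :=
    continuous_tsum (fun q => by fun_prop) (summable_half_pow.mul_right M) fun q x => by
      rw [norm_mul, Real.norm_of_nonneg (by positivity)]
      gcongr
      exact hM _
  exact (measurable_const.indicator hr).add (hcont.neg.measurable.indicator hr.compl)

lemma hasSum_pointDens (hn : 1 ≤ n) (w : W) {φ : Euc n → W} (hφ : IsTestFun n φ) :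
    HasSum (fun q : ℕ => (1 / 2 : ℝ) ^ q * (⟪w, φ (d q)⟫ - ∫ x, rho n (x - d q) * ⟪w, φ x⟫))
      (∫ x, ⟪pointDens d x • w, φ x⟫ ∂(pointMeas d + volume)) := by
  have : Nonempty (Fin n) := ⟨⟨0, hn⟩⟩
  obtain ⟨M, hM⟩ := exists_pointDens_bound (d := d)
  have hφw : IsTestFun n fun x => ⟪w, φ x⟫ := hφ.clm (innerSL ℝ w)
  have hint : Integrable (fun x => ⟪pointDens d x • w, φ x⟫) (pointMeas d + volume) := by
    simp only [real_inner_smul_left]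
    exact (hφw.integrable _).bdd_mul measurable_pointDens.aestronglyMeasurable
      (ae_of_all _ hM)
  have hint1 := hint.mono_measure (Measure.le_add_right le_rfl : pointMeas d ≤ _)
  have hint2 := hint.mono_measure (Measure.le_add_left le_rfl : (volume : Measure (Euc n)) ≤ _)
  rw [integral_add_measure hint1 hint2]
  have h1 := hasSum_integral_measure hint1
  have h2 := (locSummable_rho (d := d)).hasSum_integral (ContinuousLinearMap.mul ℝ ℝ) hφw
  have h3 : ∫ x, ⟪pointDens d x • w, φ x⟫ =
      -∫ x, (∑' q : ℕ, (1 / 2 : ℝ) ^ q * rho n (x - d q)) * ⟪w, φ x⟫ := by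
    rw [← integral_neg]
    refine integral_congr_ae ?_
    filter_upwards [(Set.countable_range d).ae_notMem volume] with x hx
    simp only [pointDens, Set.indicator_of_notMem hx, Set.indicator_of_mem (Set.mem_compl hx),
      zero_add, real_inner_smul_left, neg_mul]
  rw [h3, ← sub_eq_add_neg]
  have h5 : ∀ q : ℕ, (1 / 2 : ℝ) ^ q * (⟪w, φ (d q)⟫ - ∫ x, rho n (x - d q) * ⟪w, φ x⟫) =
      ∫ x, ⟪pointDens d x • w, φ x⟫ ∂(ENNReal.ofReal ((1 / 2) ^ q) • Measure.dirac (d q)) -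
        ∫ x, (1 / 2 : ℝ) ^ q * rho n (x - d q) * ⟪w, φ x⟫ := fun q => by
    have h4 : pointDens d (d q) = 1 := by simp [pointDens]
    rw [integral_smul_measure, integral_dirac, h4, one_smul, ENNReal.toReal_ofReal (by positivity),
      smul_eq_mul, mul_sub, ← integral_const_mul]
    simp only [mul_assoc]
  simp only [h5]
  exact h1.sub h2

lemma tendsto_integral_rho_mul {φ : Euc n → ℝ} (hφ : Continuous φ) {M : ℝ}
    (hM : ∀ x, |φ x| ≤ M) (y : Euc n) :
    Tendsto (fun N : ℕ => ∫ x, ((2 : ℝ) ^ N) ^ n * rho n ((2 : ℝ) ^ N • (x - y)) * φ x) atTop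
      (𝓝 (φ y)) := by
  have hc := (isRapid_rho (n := n)).1.continuous
  have key : ∀ N : ℕ, ∫ x, ((2 : ℝ) ^ N) ^ n * rho n ((2 : ℝ) ^ N • (x - y)) * φ x =
      ∫ ζ, rho n ζ * φ (((2 : ℝ) ^ N)⁻¹ • ζ + y) := by
    intro N
    have h1 := integral_add_right_eq_self (μ := (volume : Measure (Euc n)))
      (fun x => ((2 : ℝ) ^ N) ^ n * rho n ((2 : ℝ) ^ N • (x - y)) * φ x) y
    have h2 := Measure.integral_comp_smul (volume : Measure (Euc n))
      (fun ζ => rho n ζ * φ (((2 : ℝ) ^ N)⁻¹ • ζ + y)) ((2 : ℝ) ^ N)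
    rw [finrank_euclideanSpace_fin, abs_of_pos (by positivity), smul_eq_mul,
      eq_inv_mul_iff_mul_eq₀ (by positivity), ← integral_const_mul] at h2
    rw [← h1, ← h2]
    refine integral_congr_ae (ae_of_all _ fun x => ?_)
    simp only [add_sub_cancel_right, smul_smul]
    rw [inv_mul_cancel₀ (by positivity), one_smul, mul_assoc]
  simp only [key]
  have h0 : Tendsto (fun N : ℕ => ((2 : ℝ) ^ N)⁻¹) atTop (𝓝 0) :=
    (tendsto_pow_atTop_atTop_of_one_lt one_lt_two).inv_tendsto_atTop
  have h1 : φ y = ∫ ζ, rho n ζ * φ y := by rw [integral_mul_const, integral_rho, one_mul]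
  rw [h1]
  refine tendsto_integral_of_dominated_convergence (fun ζ => |rho n ζ| * M) (fun N => ?_)
    (integrable_rho.abs.mul_const M) (fun N => ae_of_all _ fun ζ => ?_) (ae_of_all _ fun ζ => ?_)
  · exact (by fun_prop : Continuous _).aestronglyMeasurable
  · rw [Real.norm_eq_abs, abs_mul]
    gcongr
    exact hM _
  · refine tendsto_const_nhds.mul ((hφ.tendsto y).comp ?_)
    simpa using (h0.smul_const ζ).add_const y

end PlaneWave

section ScaledSeries

variable {n k m : ℕ} {V W F : Type*}
  [NormedAddCommGroup V] [InnerProductSpace ℝ V] [FiniteDimensional ℝ V]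
  [NormedAddCommGroup W] [InnerProductSpace ℝ W] [FiniteDimensional ℝ W]
  [NormedAddCommGroup F] [NormedSpace ℝ F]

/-- The dyadic rescalings of `g` around the points `d q`, with weights `c`. -/
def scaled (d : ℕ → Euc n) (c : ℕ × ℕ → ℝ) (g : Euc n → F) (p : ℕ × ℕ) (x : Euc n) : F :=
  c p • g ((2 : ℝ) ^ p.2 • (x - d p.1))

variable {d : ℕ → Euc n} {c : ℕ × ℕ → ℝ}

lemma smooth_scaled {g : Euc n → F} (hg : ContDiff ℝ (⊤ : ℕ∞) g) (p : ℕ × ℕ) :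
    ContDiff ℝ (⊤ : ℕ∞) (scaled d c g p) := by
  have h : ContDiff ℝ (⊤ : ℕ∞) fun x : Euc n => (2 : ℝ) ^ p.2 • (x - d p.1) := by fun_prop
  exact (hg.comp h).const_smul (c p)

lemma dirDeriv_scaled {g : Euc n → F} (hg : ContDiff ℝ (⊤ : ℕ∞) g) (J : Fin m → Fin n)
    (p : ℕ × ℕ) (x : Euc n) :
    dirDeriv n m J (scaled d c g p) x =
      (c p * ((2 : ℝ) ^ p.2) ^ m) • dirDeriv n m J g ((2 : ℝ) ^ p.2 • (x - d p.1)) := by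
  have h1 : ContDiff ℝ (⊤ : ℕ∞) fun y : Euc n => g ((2 : ℝ) ^ p.2 • y) :=
    hg.comp (by fun_prop : ContDiff ℝ (⊤ : ℕ∞) fun y : Euc n => (2 : ℝ) ^ p.2 • y)
  have h2 : ContDiff ℝ (⊤ : ℕ∞) fun y : Euc n => g ((2 : ℝ) ^ p.2 • (y - d p.1)) :=
    h1.comp (contDiff_id.sub contDiff_const)
  unfold scaled
  rw [dirDeriv_const_smul (c p) h2,
    dirDeriv_comp_sub (fun y => g ((2 : ℝ) ^ p.2 • y)), dirDeriv_comp_smul _ hg, smul_smul]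

lemma Aapply_scaled (A : CoeffOp n k V W) {g : Euc n → V} (hg : ContDiff ℝ (⊤ : ℕ∞) g)
    (p : ℕ × ℕ) (x : Euc n) :
    Aapply n k A (scaled d c g p) x =
      (c p * ((2 : ℝ) ^ p.2) ^ k) • Aapply n k A g ((2 : ℝ) ^ p.2 • (x - d p.1)) := by
  simp only [Aapply, dirDeriv_scaled hg, map_smul, Finset.smul_sum]

lemma IsRapid.integrable {g : Euc n → F} (hg : IsRapid g) : Integrable g volume := by
  obtain ⟨C, -, h⟩ := hg.2 (n + 1) 0
  exact integrable_of_decay hg.1.continuous.aestronglyMeasurable (C := C) fun x => by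
    simpa using h x

lemma locSummable_scaled (hn : 1 ≤ n) {g : Euc n → F} (hg : IsRapid g)
    (hc : ∀ p, |c p| ≤ (1 / 2) ^ p.1) : LocSummable (scaled d c g) := by
  have hi : ∀ p : ℕ × ℕ, Integrable fun x => g ((2 : ℝ) ^ p.2 • (x - d p.1)) := fun p =>
    (hg.integrable.comp_smul (by positivity : (2 : ℝ) ^ p.2 ≠ 0)).comp_sub_right (d p.1)
  refine locSummable_of_integral (fun p => (smooth_scaled hg.1 p).continuous)
    (fun p => (hi p).smul (c p)) ?_
  refine Summable.of_nonneg_of_le (fun p => integral_nonneg fun x => norm_nonneg _) (fun p => ?_)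
    ((summable_half_pow.mul_of_nonneg summable_half_pow (fun _ => by positivity)
      (fun _ => by positivity)).mul_right (∫ x, ‖g x‖))
  have h1 : ∫ x, ‖g ((2 : ℝ) ^ p.2 • (x - d p.1))‖ = (((2 : ℝ) ^ p.2) ^ n)⁻¹ * ∫ x, ‖g x‖ := by
    rw [integral_sub_right_eq_self (fun x => ‖g ((2 : ℝ) ^ p.2 • x)‖) (d p.1),
      Measure.integral_comp_smul volume (fun x => ‖g x‖), finrank_euclideanSpace_fin,
      abs_of_pos (by positivity), smul_eq_mul]
  have h2 : (((2 : ℝ) ^ p.2) ^ n)⁻¹ ≤ (1 / 2) ^ p.2 := by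
    rw [one_div, inv_pow]
    refine inv_anti₀ (by positivity) (le_self_pow₀ (one_le_pow₀ one_le_two) (by lia))
  have h0 : 0 ≤ ∫ x, ‖g x‖ := integral_nonneg fun x => norm_nonneg _
  simp only [scaled, norm_smul]
  rw [integral_const_mul, h1, ← mul_assoc]
  gcongr
  exact hc p

/-- Weights making the derivatives of order `m` of the rescaled series converge in `L¹`. -/
noncomputable def weight (m : ℕ) (p : ℕ × ℕ) : ℝ := (1 / 2) ^ p.1 * (((2 : ℝ) ^ p.2) ^ m)⁻¹

lemma abs_weight_le (p : ℕ × ℕ) : |weight m p| ≤ (1 / 2) ^ p.1 := by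
  rw [weight, abs_of_nonneg (by positivity)]
  exact mul_le_of_le_one_right (by positivity)
    (inv_le_one_of_one_le₀ (one_le_pow₀ (one_le_pow₀ one_le_two)))

lemma weight_mul (m : ℕ) (p : ℕ × ℕ) : weight m p * ((2 : ℝ) ^ p.2) ^ m = (1 / 2) ^ p.1 := by
  rw [weight, inv_mul_cancel_right₀ (by positivity)]

lemma dirDeriv_scaled_weight {g : Euc n → F} (hg : ContDiff ℝ (⊤ : ℕ∞) g) (J : Fin m → Fin n)
    (p : ℕ × ℕ) : dirDeriv n m J (scaled d (weight m) g p) =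
      scaled d (fun p => (1 / 2) ^ p.1) (dirDeriv n m J g) p := by
  funext x
  rw [dirDeriv_scaled hg, weight_mul]
  rfl

/-- Superposing rescalings of a kernel whose image under `𝒜` is a band-limited bump produces
point masses. -/
lemma memBVAloc_scaled (hn : 1 ≤ n) (hm : m + n = k) {A : CoeffOp n k V W} {g : Euc n → V}
    (hg : IsRapid g) {w : W} (hA : ∀ x, Aapply n k A g x = osc 0 (psi n) x • w) :
    MemBVAloc n k A fun x => ∑' p, scaled d (weight m) g p x := by
  have hs := locSummable_scaled (d := d) hn hg (abs_weight_le (m := m))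
  obtain ⟨M, hM⟩ := exists_pointDens_bound (d := d)
  refine MemBVAloc.of_bounded_density hs.locallyIntegrable (σ := pointMeas d + volume)
    (f := fun x => pointDens d x • w)
    (measurable_pointDens.stronglyMeasurable.smul stronglyMeasurable_const)
    (M := M * ‖w‖) (fun x => by rw [norm_smul]; gcongr; exact hM x) fun φ hφ => ?_
  have h := hs.hasSum_distrib A (smooth_scaled hg.1) hφ
  have hφw : IsTestFun n fun x => ⟪w, φ x⟫ := hφ.clm (innerSL ℝ w)
  obtain ⟨K, -, hK⟩ := hφw.exists_bound 0
  have hc := (isRapid_rho (n := n)).1.continuous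
  set a : ℕ → ℕ → ℝ := fun q N =>
    ∫ x, ((2 : ℝ) ^ N) ^ n * rho n ((2 : ℝ) ^ N • (x - d q)) * ⟪w, φ x⟫ with ha
  have hai : ∀ q N, Integrable
      fun x => ((2 : ℝ) ^ N) ^ n * rho n ((2 : ℝ) ^ N • (x - d q)) * ⟪w, φ x⟫ := fun q N =>
    Continuous.integrable_of_hasCompactSupport (by have := hφw.1.continuous; fun_prop)
      hφw.2.mul_left
  have hterm : ∀ p : ℕ × ℕ, ∫ x, ⟪Aapply n k A (scaled d (weight m) g p) x, φ x⟫ =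
      (1 / 2) ^ p.1 * (a p.1 (p.2 + 1) - a p.1 p.2) := by
    intro p
    simp only [ha]
    rw [← integral_sub (hai _ _) (hai _ _), ← integral_const_mul]
    refine integral_congr_ae (ae_of_all _ fun x => ?_)
    simp only
    have hk : ((2 : ℝ) ^ p.2) ^ k = ((2 : ℝ) ^ p.2) ^ m * ((2 : ℝ) ^ p.2) ^ n := by
      rw [← hm, pow_add]
    rw [Aapply_scaled A hg.1, hA, osc_psi, smul_smul, hk, ← mul_assoc, weight_mul,
      real_inner_smul_left, smul_smul, pow_succ' (2 : ℝ) p.2, mul_pow]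
    ring
  simp only [hterm] at h
  have hfib : ∀ q, HasSum (fun i => (1 / 2 : ℝ) ^ q * (a q (i + 1) - a q i))
      ((1 / 2 : ℝ) ^ q * (⟪w, φ (d q)⟫ - ∫ x, rho n (x - d q) * ⟪w, φ x⟫)) := by
    intro q
    have h1 : Summable fun i => (1 / 2 : ℝ) ^ q * (a q (i + 1) - a q i) := h.summable.prod_factor q
    have h2 := h1.hasSum.tendsto_sum_nat
    simp only [← Finset.mul_sum, Finset.sum_range_sub] at h2
    have h3 := ((tendsto_integral_rho_mul hφw.1.continuous
      (fun x => by simpa using hK x) (d q)).sub_const (a q 0)).const_mul ((1 / 2 : ℝ) ^ q)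
    have h4 : a q 0 = ∫ x, rho n (x - d q) * ⟪w, φ x⟫ := by simp [ha]
    rw [← h4, ← tendsto_nhds_unique h2 h3]
    exact h1.hasSum
  exact (h.prod_fiberwise hfib).unique (hasSum_pointDens hn w hφ)

end ScaledSeries

section Necessity

variable {n k m : ℕ} {V W : Type*}
  [NormedAddCommGroup V] [InnerProductSpace ℝ V] [FiniteDimensional ℝ V]
  [NormedAddCommGroup W] [InnerProductSpace ℝ W] [FiniteDimensional ℝ W]

lemma sum_dyadic_le_one {s : ℝ} (hs : 0 ≤ s) (N : ℕ) :
    ∑ i ∈ Finset.range N, 2 ^ i * s / ((1 + 2 ^ i * s) * (1 + 2 * (2 ^ i * s))) ≤ 1 := by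
  have h : ∀ i : ℕ, 2 ^ i * s / ((1 + 2 ^ i * s) * (1 + 2 * (2 ^ i * s))) =
      2 ^ (i + 1) * s / (1 + 2 ^ (i + 1) * s) - 2 ^ i * s / (1 + 2 ^ i * s) := fun i => by
    rw [pow_succ]
    field_simp
    ring
  simp only [h]
  rw [Finset.sum_range_sub (fun i => 2 ^ i * s / (1 + 2 ^ i * s))]
  have h1 : 2 ^ N * s / (1 + 2 ^ N * s) ≤ 1 := div_le_one_of_le₀ (by linarith) (by positivity)
  have h2 : 0 ≤ 2 ^ 0 * s / (1 + 2 ^ 0 * s) := by positivity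
  linarith

lemma IsRapid.exists_inner_lower_bound {h : Euc n → V} (hh : IsRapid h) :
    ∃ K, 0 ≤ K ∧ ∀ (y : Euc n) (N₀ M : ℕ), (∀ i < N₀, 2 ^ i * ‖y‖ ≤ 1) →
      ‖h 0‖ ^ 2 * N₀ - K ≤ ∑ i ∈ Finset.range (N₀ + M), ⟪h ((2 : ℝ) ^ i • y), h 0⟫ := by
  obtain ⟨L, hL0, hL⟩ := hh.2 0 1
  obtain ⟨C, hC0, hC⟩ := hh.2 1 0
  have hlip : ∀ z, ‖h z - h 0‖ ≤ L * ‖z‖ := fun z => by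
    have := convex_univ.norm_image_sub_le_of_norm_fderiv_le (𝕜 := ℝ) (f := h) (C := L)
      (fun x _ => hh.1.differentiable (by simp) x)
      (fun x _ => by simpa [norm_iteratedFDeriv_one] using hL x) (Set.mem_univ 0) (Set.mem_univ z)
    simpa using this
  set K := ‖h 0‖ * (6 * (L + C)) with hK
  have hK0 : 0 ≤ K := by positivity
  have near : ∀ z : Euc n, ‖z‖ ≤ 1 →
      ‖h 0‖ ^ 2 - K * (‖z‖ / ((1 + ‖z‖) * (1 + 2 * ‖z‖))) ≤ ⟪h z, h 0⟫ := fun z hz => by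
    have h1 : -(‖h z - h 0‖ * ‖h 0‖) ≤ ⟪h z - h 0, h 0⟫ :=
      (abs_le.1 (abs_real_inner_le_norm _ _)).1
    rw [inner_sub_left, real_inner_self_eq_norm_sq] at h1
    have h2 : ‖z‖ / 6 ≤ ‖z‖ / ((1 + ‖z‖) * (1 + 2 * ‖z‖)) := by
      gcongr
      nlinarith [norm_nonneg z]
    have h3 := mul_le_mul_of_nonneg_left h2 hK0
    have h4 := mul_le_mul_of_nonneg_right (hlip z) (norm_nonneg (h 0))
    have h5 : 0 ≤ ‖h 0‖ * C * ‖z‖ := by positivity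
    rw [hK] at h3 ⊢
    linarith
  have far : ∀ z : Euc n, -(K * (‖z‖ / ((1 + ‖z‖) * (1 + 2 * ‖z‖)))) ≤ ⟪h z, h 0⟫ := fun z => by
    rcases le_total ‖z‖ 1 with hz | hz
    · linarith [near z hz, sq_nonneg ‖h 0‖]
    have h1 : -(‖h z‖ * ‖h 0‖) ≤ ⟪h z, h 0⟫ := (abs_le.1 (abs_real_inner_le_norm _ _)).1
    have h2 : (1 + ‖z‖) * ‖h z‖ ≤ C := by simpa using hC z
    have h3 : ‖h z‖ ≤ 6 * C * (‖z‖ / ((1 + ‖z‖) * (1 + 2 * ‖z‖))) := by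
      rw [← mul_div_assoc, le_div_iff₀ (by positivity)]
      nlinarith [norm_nonneg (h z), mul_le_mul_of_nonneg_left h2 (norm_nonneg z)]
    have h4 := mul_le_mul_of_nonneg_right h3 (norm_nonneg (h 0))
    have h5 : 0 ≤ ‖h 0‖ * L * (‖z‖ / ((1 + ‖z‖) * (1 + 2 * ‖z‖))) := by positivity
    rw [hK]
    linarith
  refine ⟨K, hK0, fun y N₀ M hy => ?_⟩
  have h1 := mul_le_mul_of_nonneg_left (sum_dyadic_le_one (norm_nonneg y) (N₀ + M)) hK0
  have hn : ∀ i : ℕ, ‖(2 : ℝ) ^ i • y‖ = 2 ^ i * ‖y‖ := fun i => by simp [norm_smul]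
  have h2 := Finset.sum_le_sum fun i (hi : i ∈ Finset.range N₀) => near ((2 : ℝ) ^ i • y)
    ((hn i).trans_le (hy i (Finset.mem_range.1 hi)))
  have h3 := Finset.sum_le_sum fun i (_ : i ∈ Finset.range M) => far ((2 : ℝ) ^ (N₀ + i) • y)
  simp only [hn, Finset.sum_sub_distrib, Finset.sum_neg_distrib, ← Finset.mul_sum,
    Finset.sum_const, Finset.card_range, nsmul_eq_mul] at h2 h3
  rw [Finset.sum_range_add] at h1 ⊢
  linarith

lemma exists_tsum_scaled_lower_bound {h : Euc n → V} (hh : IsRapid h) (d : ℕ → Euc n) :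
    ∃ K, ∀ x, Summable (fun p => scaled d (fun p => (1 / 2) ^ p.1) h p x) → ∀ q N : ℕ,
      2 ^ N * ‖x - d q‖ ≤ 1 → (1 / 2) ^ q * (‖h 0‖ ^ 2 * N) - K ≤
        ⟪∑' p, scaled d (fun p => (1 / 2) ^ p.1) h p x, h 0⟫ := by
  obtain ⟨K, hK0, hK⟩ := hh.exists_inner_lower_bound
  refine ⟨2 * K, fun x hx q N hq => ?_⟩
  have hs := hx.hasSum.mapL (innerSL ℝ (h 0))
  simp only [innerSL_apply_apply, scaled, real_inner_smul_right] at hs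
  simp only [real_inner_comm _ (h 0)] at hs
  have hfac := hs.summable.prod_factor
  have hlow : ∀ (p N₀ : ℕ), (∀ i < N₀, 2 ^ i * ‖x - d p‖ ≤ 1) →
      (1 / 2) ^ p * (‖h 0‖ ^ 2 * N₀ - K) ≤
        ∑' i : ℕ, (1 / 2) ^ p * ⟪h ((2 : ℝ) ^ i • (x - d p)), h 0⟫ := fun p N₀ hp => by
    refine ge_of_tendsto (hfac p).hasSum.tendsto_sum_nat ?_
    filter_upwards [eventually_ge_atTop N₀] with j hj
    obtain ⟨M, rfl⟩ := exists_add_of_le hj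
    rw [← Finset.mul_sum]
    gcongr
    exact hK _ _ _ hp
  have h1 := hs.prod_fiberwise fun p => (hfac p).hasSum
  have h2 : HasSum (fun p : ℕ => (if p = q then (1 / 2) ^ q * (‖h 0‖ ^ 2 * N) else 0) -
      (1 / 2 : ℝ) ^ p * K) ((1 / 2) ^ q * (‖h 0‖ ^ 2 * N) - 2 * K) :=
    (hasSum_ite_eq q _).sub (hasSum_geometric_two.mul_right K)
  refine hasSum_le (fun p => ?_) h2 h1
  split_ifs with hpq
  · subst hpq
    rw [← mul_sub]
    refine hlow p N fun i hi => le_trans ?_ hq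
    gcongr
    exact one_le_two
  · have := hlow p 0 (by simp)
    simpa using this

/-- Superposed kernels with nonvanishing derivative of order `k - n` at the origin have unbounded
derivatives of this order near every point. -/
lemma exists_not_memTInf (hn : 1 ≤ n) (hm : m + n = k) {A : CoeffOp n k V W} {g : Euc n → V}
    (hg : IsRapid g) {w : W} (hA : ∀ x, Aapply n k A g x = osc 0 (psi n) x • w)
    {J : Fin m → Fin n} (hJ : IsRapid (dirDeriv n m J g)) (h0 : dirDeriv n m J g 0 ≠ 0) :
    ∃ u, MemBVAloc n k A u ∧ ∀ v, IsWeakDerivFamily n m u v → ∀ x, ¬ MemTInf n n (v J) x := by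
  set d := TopologicalSpace.denseSeq (Euc n)
  have hs := locSummable_scaled (d := d) hn hg (abs_weight_le (m := m))
  have hS := locSummable_scaled (d := d) hn hJ (c := fun p => (1 / 2) ^ p.1)
    fun p => (abs_of_nonneg (by positivity)).le
  refine ⟨_, memBVAloc_scaled (d := d) hn hm hg hA, fun v hv x hT => ?_⟩
  have hae := hv.ae_eq (J := J) hS.locallyIntegrable fun φ hφ => by
    simpa only [dirDeriv_scaled_weight hg.1] using hs.integral_dirDeriv
      (fun p => smooth_scaled hg.1 p) (J := J) (by simpa only [dirDeriv_scaled_weight hg.1]) hφ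
  obtain ⟨K, hK⟩ := exists_tsum_scaled_lower_bound hJ d
  obtain ⟨e, C, r₀, hr₀, hr⟩ := hT.exists_bound hn
  set r := r₀ / 2 with hrdef
  have hr0 : 0 < r := by positivity
  have hb := (ae_restrict_iff' measurableSet_ball).1 (hr r hr0 (by linarith))
  obtain ⟨q, hq⟩ := (TopologicalSpace.denseRange_denseSeq (Euc n)).exists_mem_open isOpen_ball
    ⟨x, mem_ball_self hr0⟩
  set c := dirDeriv n m J g 0
  have hγ : 0 < (1 / 2 : ℝ) ^ q * ‖c‖ ^ 2 := by have := norm_pos_iff.2 h0; positivity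
  obtain ⟨N, hN⟩ := exists_nat_gt ((K + (C * r + ‖e‖) * ‖c‖) / ((1 / 2 : ℝ) ^ q * ‖c‖ ^ 2))
  rw [div_lt_iff₀ hγ] at hN
  have hpos : 0 < volume (ball x r ∩ ball (d q) ((2 ^ N)⁻¹)) :=
    (isOpen_ball.inter isOpen_ball).measure_pos volume ⟨d q, hq, mem_ball_self (by positivity)⟩
  have hex : ∃ᵐ y ∂(volume : Measure (Euc n)), y ∈ ball x r ∩ ball (d q) ((2 ^ N)⁻¹) :=
    frequently_ae_mem_iff.2 hpos.ne'
  obtain ⟨y, ⟨hy1, hy2⟩, hy3, hy4, hy5⟩ := (hex.and_eventually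
    (hb.and (hS.ae_summable.and hae))).exists
  have h1 := hK y hy4 q N (by
    rw [mem_ball_iff_norm] at hy2
    calc (2 : ℝ) ^ N * ‖y - d q‖ ≤ 2 ^ N * (2 ^ N)⁻¹ := by gcongr
      _ = 1 := mul_inv_cancel₀ (by positivity))
  beta_reduce at hy5
  rw [← hy5] at h1
  have h2 : ‖v J y‖ ≤ C * r + ‖e‖ := by
    linarith [hy3 hy1, norm_le_norm_sub_add (v J y) e]
  have h3 := (real_inner_le_norm (v J y) c).trans
    (mul_le_mul_of_nonneg_right h2 (norm_nonneg c))
  linarith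

theorem isWeaklyCanceling_of_forall_memTInf (hn : 1 ≤ n) (hnk : n ≤ k) {A : CoeffOp n k V W}
    (hE : IsElliptic n k A) (h : ∀ u, MemBVAloc n k A u → ∃ v, IsWeakDerivFamily n (k - n) u v ∧
      ∀ᵐ x ∂(volume : Measure (Euc n)), ∀ I, MemTInf n n (v I) x) : IsWeaklyCanceling n k A := by
  intro w hw J
  have hm := Nat.sub_add_cancel hnk
  have hb : ∀ ξ ≠ 0, ContDiffAt ℝ (⊤ : ℕ∞) (dagK A w) ξ := fun ξ hξ => hE.contDiffAt_dagK w hξ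
  rw [hE.range_sphere_iff] at hw
  rw [hE.weakCancel_iff hn hm]
  by_contra hI
  have hsign : ((-1 : ℝ) ^ (k - n) * ((-1 : ℝ) ^ k)⁻¹) = 1 := by
    have h1 := integral_neg_eq_self
      (fun ξ : Euc n => (∏ i, ξ (J i)) • psi n ξ • dagK A w ξ) volume
    have h2 : ∀ᵐ ξ : Euc n, (∏ i, (-ξ) (J i)) • psi n (-ξ) • dagK A w (-ξ) =
        ((-1 : ℝ) ^ (k - n) * ((-1 : ℝ) ^ k)⁻¹) • (∏ i, ξ (J i)) • psi n ξ • dagK A w ξ := by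
      have : Nonempty (Fin n) := ⟨⟨0, hn⟩⟩
      filter_upwards [Measure.ae_ne volume (0 : Euc n)] with ξ hξ
      rw [psi_congr (norm_neg ξ), ← neg_one_smul ℝ ξ, prod_coord_smul,
        hE.dagK_smul w hξ (by norm_num)]
      simp only [smul_smul]
      congr 1
      ring
    rw [integral_congr_ae h2, integral_smul] at h1
    exact smul_left_injective ℝ hI (h1.trans (one_smul ℝ _).symm)
  have heven : Even n := by
    rw [← div_eq_mul_inv, div_eq_one_iff_eq (by positivity)] at hsign
    by_contra ho
    rw [Nat.not_even_iff_odd] at ho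
    rw [← hm, pow_add, Nat.add_sub_cancel, ho.neg_one_pow] at hsign
    have : (-1 : ℝ) ^ (k - n) ≠ 0 := pow_ne_zero _ (by norm_num)
    apply this; linarith
  have hne : dirDeriv n (k - n) J (bandK k (dagK A w)) 0 ≠ 0 := by
    rw [dirDeriv_bandK_zero hb]
    refine smul_ne_zero (by positivity) (smul_ne_zero (by positivity) (smul_ne_zero ?_ hI))
    obtain ⟨j, rfl⟩ := heven
    rw [Nat.cast_sub hnk, show -((k : ℝ) * (Real.pi / 2)) + ((k : ℝ) - ((j + j : ℕ) : ℝ)) *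
      (Real.pi / 2) = -(j * Real.pi) by push_cast; ring, Real.cos_neg, Real.cos_nat_mul_pi]
    exact pow_ne_zero _ (by norm_num)
  have hJ : IsRapid (dirDeriv n (k - n) J (bandK k (dagK A w))) := by
    rw [funext (dirDeriv_bandK hb J)]
    exact ((isRapid_osc _ ((isTestFun_psi_smul hb).smul_left (smooth_prod_coord J))).const_smul
      _).const_smul _
  obtain ⟨u, hu, hnot⟩ := exists_not_memTInf hn hm (isRapid_bandK hb)
    (Aapply_bandK hb fun ξ hξ => (sub_eq_zero.1 (hw ξ hξ)).symm) hJ hne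
  obtain ⟨v, hv, hT⟩ := h u hu
  obtain ⟨x, hx⟩ := hT.exists
  exact hnot v hv x (hx J)

end Necessity

/-- Theorem 1.3(2): for `k ≥ n`, the a.e. `t^{n,∞}`-regularity of
`D^{k-n} u` for all `u ∈ BV^𝒜_loc` is equivalent to `𝒜` being elliptic and
satisfying condition (WC). -/
theorem statement4 (n k : ℕ) (hn : 1 ≤ n) (hnk : n ≤ k) {V W : Type*}
    [NormedAddCommGroup V] [InnerProductSpace ℝ V] [FiniteDimensional ℝ V]
    [NormedAddCommGroup W] [InnerProductSpace ℝ W] [FiniteDimensional ℝ W]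
    (A : CoeffOp n k V W) (hA : IsSymmetricOp n k A) :
    (∀ u : Euc n → V, MemBVAloc n k A u →
        ∃ v : (Fin (k - n) → Fin n) → Euc n → V, IsWeakDerivFamily n (k - n) u v ∧
          ∀ᵐ x ∂(volume : Measure (Euc n)), ∀ I, MemTInf n n (v I) x) ↔
      (IsElliptic n k A ∧ IsWeaklyCanceling n k A) := by
  constructor
  · intro h
    have hE := isElliptic_of_forall_memTInf hn A h
    exact ⟨hE, isWeaklyCanceling_of_forall_memTInf hn hnk hE h⟩
  · rintro ⟨hE, hW⟩ u hu
    have key : ∀ (m : ℕ) (J : Fin m → Fin n), m + n = k → ∀ w : W, (∀ ξ ≠ 0, projK A w ξ = 0) →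
        ∫ ξ, (∏ i, ξ (J i)) • psi n ξ • dagK A w ξ = 0 := by
      intro m J hm w hw
      obtain rfl : m = k - n := by lia
      exact (hE.weakCancel_iff hn hm w J).1 (hW w ((hE.range_sphere_iff w).2 hw) J)
    exact exists_weakDeriv_memTInf hn hnk hE (J₀ := Fin.elim0)
      (fun e => Classical.choice (hE.exists_kernel _ (by lia) (key 0 _) e))
      (fun J e => Classical.choice (hE.exists_kernel J (by lia) (key _ J) e)) hu
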